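/- Let d ≥ 2 and d/(d−1) < p < ∞. Then there exist δ = δ(d,p) > 0 and a constant C such that for all integers j > k ≥ 0 and all f, ‖χ_{−k}(|·|) M_j f‖_{L^p(|x|^{1−d})} ≤ C 2^{−δ(j−k)} ‖P_j f‖_{L^p(ℝ^d)}. -/

import Mathlib

open MeasureTheory Metric Complex Set Pointwise
open scoped FourierTransform ENNReal NNReal

noncomputable section

/-- The (unnormalized) surface measure on the unit sphere `S^{d-1} ⊆ ℝ^d`. -/
def sphereMeasure (d : ℕ) : Measure (Metric.sphere (0 : EuclideanSpace ℝ (Fin d)) 1) :=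
  (volume : Measure (EuclideanSpace ℝ (Fin d))).toSphere

/-- Spherical average `A_t f(x) = ∫_{S^{d-1}} f(x - ty) dσ(y)`, where `dσ` is the
normalized surface measure on the unit sphere. -/
def sphAvg (d : ℕ) (f : EuclideanSpace ℝ (Fin d) → ℂ) (t : ℝ)
    (x : EuclideanSpace ℝ (Fin d)) : ℂ :=
  ⨍ y, f (x - t • (y : EuclideanSpace ℝ (Fin d))) ∂(sphereMeasure d)

/-- Global spherical maximal function `Mf(x) = sup_{t>0} |A_t f(x)|`. -/
def sphMax (d : ℕ) (f : EuclideanSpace ℝ (Fin d) → ℂ)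
    (x : EuclideanSpace ℝ (Fin d)) : ℝ≥0∞ :=
  ⨆ (t : ℝ) (_ : 0 < t), (‖sphAvg d f t x‖₊ : ℝ≥0∞)

/-- Local spherical maximal function `M_c f(x) = sup_{1<t<2} |A_t f(x)|`. -/
def sphMaxLoc (d : ℕ) (f : EuclideanSpace ℝ (Fin d) → ℂ)
    (x : EuclideanSpace ℝ (Fin d)) : ℝ≥0∞ :=
  ⨆ (t : ℝ) (_ : t ∈ Ioo (1:ℝ) 2), (‖sphAvg d f t x‖₊ : ℝ≥0∞)

/-- Littlewood–Paley projection `P_j`, determined by `(P_j f)^(ξ) = χ(|ξ|/2^j) f̂(ξ)`. -/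
def proj (d : ℕ) (χ : ℝ → ℝ) (j : ℤ) (f : EuclideanSpace ℝ (Fin d) → ℂ) :
    EuclideanSpace ℝ (Fin d) → ℂ :=
  𝓕⁻ (fun ξ => (χ (‖ξ‖ / 2 ^ j) : ℂ) * 𝓕 f ξ)

/-- Projection `P_{<n}`, determined by `(P_{<n} f)^(ξ) = (Σ_{j<n} χ(|ξ|/2^j)) f̂(ξ)`. -/
def projLT (d : ℕ) (χ : ℝ → ℝ) (n : ℤ) (f : EuclideanSpace ℝ (Fin d) → ℂ) :
    EuclideanSpace ℝ (Fin d) → ℂ :=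
  𝓕⁻ (fun ξ => ((∑' j : ℤ, if j < n then χ (‖ξ‖ / 2 ^ j) else 0 : ℝ) : ℂ) * 𝓕 f ξ)

/-- The weight `|x|^{1-d}`, as an `ℝ≥0∞`-valued function. -/
def wt (d : ℕ) (x : EuclideanSpace ℝ (Fin d)) : ℝ≥0∞ :=
  ENNReal.ofReal (‖x‖ ^ ((1:ℝ) - d))

noncomputable section

open Function (uncurry)
open Real renaming pi → rpi, pi_pos → rpi_pos, cos → rcos, sin → rsin, exp → rexp, norm_eq_abs → norm_abs
open Filter.Eventually (of_forall)
open ENNReal renaming ofReal → eR, ofReal_mul → eR_mul, ofReal_le_ofReal → eR_le, measurable_ofReal → meas_eR,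
  ofReal_ne_top → eR_ne_top, ofReal_pow → eR_pow, ofReal_add → eR_add

/-- Euclidean space. -/
abbrev EE (d : ℕ) := EuclideanSpace ℝ (Fin d)

/-- normalized surface measure as a measure on the ambient space -/
def sig (d : ℕ) : Measure (EE d) :=
  ((sphereMeasure d univ)⁻¹ • sphereMeasure d).map Subtype.val

lemma sphAvg_eq (d : ℕ) (f : EE d → ℂ) (t : ℝ) (x : EE d) :
    sphAvg d f t x = ∫ y, f (x - t • y) ∂(sig d) := by
  unfold sphAvg sig average
  rw [(MeasurableEmbedding.subtype_coe (isClosed_sphere.measurableSet)).integral_map]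

lemma sphereMeasure_pos {d : ℕ} (hd : 1 ≤ d) : sphereMeasure d univ ≠ 0 := by
  haveI : Nonempty (Fin d) := ⟨⟨0, hd⟩⟩
  unfold sphereMeasure
  rw [Measure.measure_univ_ne_zero]
  exact Measure.toSphere_ne_zero _

instance sphereMeasure_fin (d : ℕ) : IsFiniteMeasure (sphereMeasure d) := by
  unfold sphereMeasure; infer_instance

lemma sig_prob {d : ℕ} (hd : 1 ≤ d) : IsProbabilityMeasure (sig d) := by
  constructor
  unfold sig
  rw [Measure.map_apply measurable_subtype_coe MeasurableSet.univ]
  simp only [preimage_univ, Measure.smul_apply, smul_eq_mul]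
  exact ENNReal.inv_mul_cancel (sphereMeasure_pos hd) (measure_ne_top _ _)

lemma sig_norm (d : ℕ) : ∀ᵐ y ∂(sig d), ‖y‖ = 1 := by
  unfold sig
  rw [ae_map_iff measurable_subtype_coe.aemeasurable
    (measurableSet_eq_fun (by fun_prop) (by fun_prop))]
  filter_upwards with y
  simpa using y.2

lemma polar_lintegral {d : ℕ} (hd : 1 ≤ d) (G : EE d → ℝ≥0∞) (hG : Measurable G) :
    ∫⁻ y, G y = sphereMeasure d univ *
      ∫⁻ s in Ioi (0:ℝ), eR (s ^ (d-1)) * ∫⁻ w, G (s • w) ∂(sig d) := by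
  haveI : Nonempty (Fin d) := ⟨⟨0, hd⟩⟩
  have key := (volume : Measure (EE d)).measurePreserving_homeomorphUnitSphereProd
  have e1 : ∫⁻ y, G y = ∫⁻ y : ({0}ᶜ : Set (EE d)), G y.1 ∂((volume : Measure (EE d)).comap (↑)) := by
    rw [lintegral_subtype_comap (measurableSet_singleton _).compl,
      restrict_compl_singleton]
  have e2 : ∫⁻ y : ({0}ᶜ : Set (EE d)), G y.1 ∂((volume : Measure (EE d)).comap (↑))
      = ∫⁻ z : sphere (0 : EE d) 1 × Ioi (0:ℝ), G (z.2.1 • z.1.1)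
        ∂((volume : Measure (EE d)).toSphere.prod (Measure.volumeIoiPow (Module.finrank ℝ (EE d) - 1))) := by
    rw [← key.lintegral_comp]
    · refine lintegral_congr fun y => ?_
      congr 1
      have h0 : ‖(y : EE d)‖ ≠ 0 := norm_ne_zero_iff.2 y.2
      simp [smul_smul, h0]
    · fun_prop
  rw [e1, e2, lintegral_prod_symm' _ (by fun_prop)]
  have hfr : Module.finrank ℝ (EE d) = d := by simp
  rw [hfr]
  unfold Measure.volumeIoiPow
  rw [lintegral_withDensity_eq_lintegral_mul]
  · have : ∀ s : Ioi (0:ℝ), ((fun r : Ioi (0:ℝ) => eR (r.1 ^ (d-1))) * fun y : Ioi (0:ℝ) =>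
        ∫⁻ (x : sphere (0 : EE d) 1), G (y.1 • x.1) ∂(volume : Measure (EE d)).toSphere) s
       = (fun s : ℝ => eR (s ^ (d-1)) *
          (sphereMeasure d univ * ∫⁻ w, G (s • w) ∂(sig d))) s.1 := by
      intro s
      simp only [Pi.mul_apply]
      congr 1
      unfold sig
      rw [lintegral_map (by fun_prop) measurable_subtype_coe, lintegral_smul_measure, smul_eq_mul,
        ← mul_assoc, ENNReal.mul_inv_cancel (sphereMeasure_pos hd) (measure_ne_top _ _), one_mul]
      rfl
    rw [lintegral_congr this, lintegral_subtype_comap measurableSet_Ioi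
      (fun s : ℝ => eR (s ^ (d-1)) * (sphereMeasure d univ * ∫⁻ w, G (s • w) ∂(sig d)))]
    rw [← lintegral_const_mul' _ _ (measure_ne_top _ _)]
    refine lintegral_congr fun s => ?_
    ring
  · fun_prop
  · haveI : IsFiniteMeasure (volume : Measure (EE d)).toSphere := inferInstance
    apply Measurable.lintegral_prod_left'
      (f := fun z : sphere (0 : EE d) 1 × Ioi (0:ℝ) => G (z.2.1 • z.1.1))
    fun_prop

lemma smear {d : ℕ} (hd : 1 ≤ d) (G G' : EE d → ℝ≥0∞) (hG' : Measurable G') (δ ρ : ℝ)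
    (hδ : 0 < δ) (hρ : 0 < ρ) (h : ∀ y y', dist y y' ≤ δ → G y ≤ G' y') :
    sphereMeasure d univ * (eR (δ * ρ ^ (d-1)) * ∫⁻ w, G (ρ • w) ∂(sig d)) ≤ ∫⁻ y, G' y := by
  rw [polar_lintegral hd G' hG']
  gcongr
  calc eR (δ * ρ ^ (d-1)) * ∫⁻ w, G (ρ • w) ∂(sig d)
      = ∫⁻ s in Ioo ρ (ρ+δ), eR (ρ ^ (d-1)) * ∫⁻ w, G (ρ • w) ∂(sig d) := by
        rw [lintegral_const, Measure.restrict_apply MeasurableSet.univ, univ_inter, Real.volume_Ioo,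
          eR_mul hδ.le]
        simp only [add_sub_cancel_left]; ring
    _ ≤ ∫⁻ s in Ioo ρ (ρ+δ), eR (s ^ (d-1)) * ∫⁻ w, G' (s • w) ∂(sig d) := by
        refine setLIntegral_mono' measurableSet_Ioo fun s hs => ?_
        gcongr ?_ * ?_
        · apply eR_le
          gcongr; exact hs.1.le
        · apply lintegral_mono_ae
          filter_upwards [sig_norm d] with w hw
          apply h
          rw [dist_eq_norm, ← sub_smul, norm_smul, hw, mul_one, norm_abs, abs_le]
          constructor <;> linarith [hs.1, hs.2]
    _ ≤ _ := by
        apply lintegral_mono_set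
        intro s hs
        exact hρ.trans hs.1

lemma sig_isom {d : ℕ} (L : EE d ≃ₗᵢ[ℝ] EE d) : (sig d).map L = sig d := by
  have hL : Measurable (L : EE d → EE d) := L.continuous.measurable
  have key : ∀ A : Set (EE d), MeasurableSet A →
      sphereMeasure d (Subtype.val ⁻¹' A) = (Module.finrank ℝ (EE d)) *
        volume (Ioo (0:ℝ) 1 • (A ∩ sphere (0 : EE d) 1)) := by
    intro A hA
    unfold sphereMeasure
    rw [Measure.toSphere_apply' _ (measurable_subtype_coe hA), Subtype.image_preimage_coe,
      inter_comm]
  ext A hA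
  unfold sig
  rw [Measure.map_apply hL hA, Measure.map_apply measurable_subtype_coe (hL hA),
    Measure.map_apply measurable_subtype_coe hA]
  simp only [Measure.smul_apply]
  rw [key _ (hL hA), key _ hA]
  congr 2
  have : Ioo (0:ℝ) 1 • ((L ⁻¹' A) ∩ sphere (0 : EE d) 1) = L ⁻¹' (Ioo (0:ℝ) 1 • (A ∩ sphere (0 : EE d) 1)) := by
    ext x
    simp only [mem_smul, mem_inter_iff, mem_preimage, mem_sphere_iff_norm, sub_zero]
    constructor
    · rintro ⟨c, hc, y, ⟨hy, hy1⟩, rfl⟩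
      exact ⟨c, hc, L y, ⟨hy, by simpa using hy1⟩, by simp⟩
    · rintro ⟨c, hc, y, ⟨hy, hy1⟩, e⟩
      refine ⟨c, hc, L.symm y, ⟨by simpa using hy, by simpa using hy1⟩, ?_⟩
      apply L.injective
      simp [e]
  rw [this]
  exact (L.measurePreserving).measure_preimage_equiv (f := L.toMeasurableEquiv) _

/-- Fourier transform of the normalized surface measure. -/
def Phi (d : ℕ) (ξ : EE d) : ℂ := ∫ y, cexp (2 * rpi * I * (inner ℝ y ξ : ℝ)) ∂(sig d)

lemma Phi_radial {d : ℕ} (ξ η : EE d) (h : ‖ξ‖ = ‖η‖) : Phi d ξ = Phi d η := by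
  set L : EE d ≃ₗᵢ[ℝ] EE d := (Submodule.span ℝ {ξ - η})ᗮ.reflection with hL
  have hLξ : L ξ = η := Submodule.reflection_sub h
  unfold Phi
  conv_rhs => rw [← sig_isom L]
  rw [integral_map L.continuous.measurable.aemeasurable (by
    apply Continuous.aestronglyMeasurable; fun_prop)]
  simp_rw [← hLξ, LinearIsometryEquiv.inner_map_map]

lemma osc_deriv {d : ℕ} (hd : 1 ≤ d) (g : EE d → ℂ) (a b : EE d → ℝ) (hg : Continuous g)
    (ha : Continuous a) (hb : Continuous b) (ha1 : ∀ y, ‖y‖ = 1 → |a y| ≤ 1)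
    (C : ℝ) (hgC : ∀ y, ‖y‖ = 1 → ‖g y‖ ≤ C) (s : ℝ) :
    HasDerivAt (fun s : ℝ => ∫ y, g y * cexp (2 * rpi * I * ((s * a y + b y : ℝ) : ℂ)) ∂(sig d))
      (∫ y, (2 * rpi * I * a y * g y) * cexp (2 * rpi * I * ((s * a y + b y : ℝ) : ℂ)) ∂(sig d)) s := by
  have := sig_prob hd
  have hexp : ∀ r : ℝ, ‖cexp (2 * rpi * I * (r : ℂ))‖ = 1 := by
    intro r
    rw [show (2 * rpi * I * (r : ℂ)) = ((2 * rpi * r : ℝ) : ℂ) * I by push_cast; ring]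
    exact norm_exp_ofReal_mul_I _
  refine (hasDerivAt_integral_of_dominated_loc_of_deriv_le
    (F := fun (s : ℝ) y => g y * cexp (2 * rpi * I * ((s * a y + b y : ℝ) : ℂ)))
    (F' := fun (s : ℝ) y => (2 * rpi * I * a y * g y) * cexp (2 * rpi * I * ((s * a y + b y : ℝ) : ℂ)))
    (bound := fun _ => 2 * rpi * C)
    (s := univ) Filter.univ_mem ?_ ?_ ?_ ?_ ?_ ?_).2
  · filter_upwards with s
    apply Continuous.aestronglyMeasurable; fun_prop
  · refine Integrable.mono' (integrable_const C) ?_ ?_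
    · apply Continuous.aestronglyMeasurable; fun_prop
    · filter_upwards [sig_norm d] with y hy
      rw [norm_mul, hexp, mul_one]; exact hgC y hy
  · apply Continuous.aestronglyMeasurable; fun_prop
  · filter_upwards [sig_norm d] with y hy
    intro s _
    rw [norm_mul, hexp, mul_one]
    simp only [norm_mul, Complex.norm_real, norm_I, Complex.norm_ofNat, norm_abs,
      abs_of_pos rpi_pos, mul_one]
    have h1 := ha1 y hy
    have h2 := hgC y hy
    have h3 : |a y| * ‖g y‖ ≤ 1 * C := by gcongr
    nlinarith [rpi_pos, abs_nonneg (a y), norm_nonneg (g y)]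
  · exact integrable_const _
  · filter_upwards with y
    intro s _
    have h1 : HasDerivAt (fun s : ℝ => ((s * a y + b y : ℝ) : ℂ)) ((a y : ℝ) : ℂ) s := by
      have : HasDerivAt (fun s : ℝ => (s * a y + b y : ℝ)) (a y) s := by
        simpa using ((hasDerivAt_id s).mul_const (a y)).add_const (b y)
      exact this.ofReal_comp
    have h2 := ((h1.const_mul (2 * rpi * I : ℂ)).cexp).const_mul (g y)
    refine h2.congr_deriv ?_
    ring

lemma coord_le {d : ℕ} (y : EE d) (hy : ‖y‖ = 1) (i : Fin d) : |y i| ≤ 1 := by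
  rw [← hy]; exact PiLp.norm_apply_le y i

/-- radial profile -/
def mm (d : ℕ) (i0 : Fin d) (s : ℝ) : ℂ := ∫ y, cexp (2 * rpi * I * ((s * y i0 : ℝ) : ℂ)) ∂(sig d)
def mm' (d : ℕ) (i0 : Fin d) (s : ℝ) : ℂ :=
  ∫ y, (2 * rpi * I * (y i0 : ℝ)) * cexp (2 * rpi * I * ((s * y i0 : ℝ) : ℂ)) ∂(sig d)
def mm2 (d : ℕ) (i0 i : Fin d) (s : ℝ) : ℂ :=
  ∫ y, (2 * rpi * I * (y i : ℝ)) ^ 2 * cexp (2 * rpi * I * ((s * y i0 : ℝ) : ℂ)) ∂(sig d)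

lemma Phi_eq_mm {d : ℕ} (i0 : Fin d) (ξ : EE d) : Phi d ξ = mm d i0 ‖ξ‖ := by
  rw [Phi_radial ξ (EuclideanSpace.single i0 ‖ξ‖) (by simp)]
  unfold Phi mm
  refine integral_congr_ae (of_forall fun y => ?_)
  simp [EuclideanSpace.inner_single_right]

lemma mm_deriv {d : ℕ} (i0 : Fin d) (s : ℝ) : HasDerivAt (mm d i0) (mm' d i0 s) s := by
  have := osc_deriv (d := d) (Nat.one_le_iff_ne_zero.2 (Fin.pos i0).ne') (fun _ => 1) (fun y => y i0)
    (fun _ => 0) (by fun_prop) (by fun_prop) (by fun_prop) (fun y hy => coord_le y hy i0) 1 (by simp) s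
  unfold mm mm'
  simpa using this

lemma mm'_deriv {d : ℕ} (i0 : Fin d) (s : ℝ) : HasDerivAt (mm' d i0) (mm2 d i0 i0 s) s := by
  have := osc_deriv (d := d) (Nat.one_le_iff_ne_zero.2 (Fin.pos i0).ne')
    (fun y => 2 * rpi * I * (y i0 : ℝ)) (fun y => y i0)
    (fun _ => 0) (by fun_prop) (by fun_prop) (by fun_prop) (fun y hy => coord_le y hy i0) (2 * rpi)
      (by
        intro y hy
        simp only [norm_mul, Complex.norm_real, norm_I, Complex.norm_ofNat, norm_abs,
          abs_of_pos rpi_pos, mul_one]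
        have := coord_le y hy i0
        nlinarith [rpi_pos]) s
  unfold mm' mm2
  simp only [sq]
  simpa using this

lemma mm2_off {d : ℕ} (i0 i : Fin d) (hi : i ≠ i0) (s : ℝ) (hs : 0 < s) :
    mm2 d i0 i s = mm' d i0 s / s := by
  have hd : 1 ≤ d := Nat.one_le_iff_ne_zero.2 (Fin.pos i0).ne'
  set q : ℝ → ℂ := fun τ => ∫ y, (1:ℂ) * cexp (2 * rpi * I * ((τ * y i + s * y i0 : ℝ) : ℂ)) ∂(sig d)
  set q' : ℝ → ℂ := fun τ => ∫ y, (2 * rpi * I * (y i : ℝ) * 1) *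
    cexp (2 * rpi * I * ((τ * y i + s * y i0 : ℝ) : ℂ)) ∂(sig d)
  have hq : ∀ τ, HasDerivAt q (q' τ) τ := fun τ =>
    osc_deriv hd (fun _ => 1) (fun y => y i) (fun y => s * y i0) (by fun_prop) (by fun_prop) (by fun_prop)
      (fun y hy => coord_le y hy i) 1 (by simp) τ
  have hq2 : HasDerivAt q' (mm2 d i0 i s) 0 := by
    have := osc_deriv hd (fun y => 2 * rpi * I * (y i : ℝ) * 1) (fun y => y i) (fun y => s * y i0)
      (by fun_prop) (by fun_prop) (by fun_prop)
      (fun y hy => coord_le y hy i) (2 * rpi) (by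
        intro y hy
        simp only [norm_mul, Complex.norm_real, norm_I, Complex.norm_ofNat, norm_abs,
          abs_of_pos rpi_pos, mul_one, norm_one]
        have := coord_le y hy i
        nlinarith [rpi_pos]) 0
    convert this using 1
    unfold mm2
    refine integral_congr_ae (of_forall fun y => ?_)
    simp only [zero_mul, zero_add, mul_one]; ring
  have hqm : ∀ τ, q τ = mm d i0 (Real.sqrt (τ ^ 2 + s ^ 2)) := by
    intro τ
    have : q τ = Phi d (EuclideanSpace.single i τ + EuclideanSpace.single i0 s) := by
      unfold Phi
      refine integral_congr_ae (of_forall fun y => ?_)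
      simp [EuclideanSpace.inner_single_right, inner_add_right]
    rw [this, Phi_eq_mm i0]
    congr 1
    rw [EuclideanSpace.norm_eq]
    congr 1
    rw [Finset.sum_eq_add i i0 hi]
    · simp [hi, hi.symm]
    · intro c _ hc; simp [hc.1, hc.2]
    · simp
    · simp
  have hpos : ∀ τ : ℝ, 0 < τ ^ 2 + s ^ 2 := fun τ => by positivity
  have hsq : ∀ τ : ℝ, HasDerivAt (fun τ : ℝ => Real.sqrt (τ ^ 2 + s ^ 2)) (τ / Real.sqrt (τ ^ 2 + s ^ 2)) τ := by
    intro τ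
    have h1 : HasDerivAt (fun τ : ℝ => τ ^ 2 + s ^ 2) (2 * τ) τ := by
      simpa using ((hasDerivAt_id τ).pow 2).add_const (s ^ 2)
    have := h1.sqrt (hpos τ).ne'
    convert this using 1
    have := (Real.sqrt_pos.2 (hpos τ)).ne'
    field_simp
  have hq'2 : ∀ τ, q' τ = (τ / Real.sqrt (τ ^ 2 + s ^ 2)) • mm' d i0 (Real.sqrt (τ ^ 2 + s ^ 2)) := by
    intro τ
    have h1 : HasDerivAt q ((τ / Real.sqrt (τ ^ 2 + s ^ 2)) • mm' d i0 (Real.sqrt (τ ^ 2 + s ^ 2))) τ := by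
      have h2 : q = (mm d i0) ∘ (fun τ : ℝ => Real.sqrt (τ ^ 2 + s ^ 2)) := by ext τ; exact hqm τ
      rw [h2]
      exact (mm_deriv i0 _).scomp τ (hsq τ)
    exact (hq τ).unique h1
  have hs0 : Real.sqrt ((0:ℝ) ^ 2 + s ^ 2) = s := by
    rw [zero_pow two_ne_zero, zero_add, Real.sqrt_sq hs.le]
  have h3 : HasDerivAt q' ((1 / s : ℝ) • mm' d i0 s) 0 := by
    have hc : HasDerivAt (fun τ : ℝ => τ / Real.sqrt (τ ^ 2 + s ^ 2)) (1 / s) 0 := by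
      have := (hasDerivAt_id (0:ℝ)).div (hsq 0) (by rw [hs0]; exact hs.ne')
      refine HasDerivAt.congr_deriv this ?_
      rw [hs0]; simp; field_simp
    have hm : HasDerivAt (fun τ : ℝ => mm' d i0 (Real.sqrt (τ ^ 2 + s ^ 2)))
        (((0:ℝ) / Real.sqrt ((0:ℝ) ^ 2 + s ^ 2)) • mm2 d i0 i0 (Real.sqrt ((0:ℝ) ^ 2 + s ^ 2))) 0 :=
      (mm'_deriv i0 _).scomp 0 (hsq 0)
    have := hc.smul hm
    have e : q' = fun τ => (τ / Real.sqrt (τ ^ 2 + s ^ 2)) • mm' d i0 (Real.sqrt (τ ^ 2 + s ^ 2)) := by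
      ext τ; exact hq'2 τ
    rw [e]
    refine HasDerivAt.congr_deriv this ?_
    simp [Real.sqrt_sq hs.le]
  rw [hq2.unique h3]
  simp [div_eq_inv_mul]

lemma mm_ode {d : ℕ} (i0 : Fin d) (s : ℝ) (hs : 0 < s) :
    mm2 d i0 i0 s + ((d:ℝ) - 1) / s * mm' d i0 s + 4 * rpi ^ 2 * mm d i0 s = 0 := by
  have hd : 1 ≤ d := Nat.one_le_iff_ne_zero.2 (Fin.pos i0).ne'
  have := sig_prob hd
  have h1 : ∑ i, mm2 d i0 i s = -(4 * rpi ^ 2) * mm d i0 s := by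
    unfold mm2 mm
    rw [← integral_finsetSum, ← integral_const_mul]
    · apply integral_congr_ae
      filter_upwards [sig_norm d] with y hy
      rw [← Finset.sum_mul]
      congr 1
      have : ∑ i, (y i) ^ 2 = 1 := by
        have := EuclideanSpace.norm_sq_eq y
        rw [hy] at this
        simpa using this.symm
      have h2 : ∑ i, ((y i : ℝ) : ℂ) ^ 2 = 1 := by exact_mod_cast this
      simp_rw [mul_pow]
      rw [← Finset.mul_sum, h2]
      simp; ring
    · intro i _
      refine Integrable.mono' (integrable_const ((2 * rpi) ^ 2)) ?_ ?_
      · apply Continuous.aestronglyMeasurable; fun_prop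
      · filter_upwards [sig_norm d] with y hy
        rw [norm_mul, show (2 * rpi * I * ((s * y i0 : ℝ) : ℂ)) = ((2 * rpi * (s * y i0) : ℝ) : ℂ) * I by
          push_cast; ring, norm_exp_ofReal_mul_I, mul_one, norm_pow]
        simp only [norm_mul, Complex.norm_real, norm_I, Complex.norm_ofNat, norm_abs,
          abs_of_pos rpi_pos, mul_one]
        have := coord_le y hy i
        refine pow_le_pow_left₀ (by positivity) ?_ 2
        nlinarith [rpi_pos]
  have h2 : ∑ i, mm2 d i0 i s = mm2 d i0 i0 s + ((d:ℝ) - 1) / s * mm' d i0 s := by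
    rw [← Finset.add_sum_erase _ _ (Finset.mem_univ i0)]
    congr 1
    rw [Finset.sum_congr rfl (fun i hi => mm2_off i0 i (Finset.ne_of_mem_erase hi) s hs)]
    rw [Finset.sum_const, Finset.card_erase_of_mem (Finset.mem_univ _), Finset.card_univ, Fintype.card_fin]
    rw [nsmul_eq_mul, Nat.cast_sub hd]
    push_cast; ring
  rw [← h2, h1]; ring

/-- the exponential `e^{2π i s}` -/
def ee (s : ℝ) : ℂ := cexp (2 * rpi * I * (s : ℂ))

lemma ee_norm (s : ℝ) : ‖ee s‖ = 1 := by
  unfold ee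
  rw [show (2 * rpi * I * (s : ℂ)) = ((2 * rpi * s : ℝ) : ℂ) * I by push_cast; ring]
  exact norm_exp_ofReal_mul_I _

lemma ee_add (a b : ℝ) : ee (a + b) = ee a * ee b := by
  unfold ee; rw [← Complex.exp_add]; push_cast; ring_nf

lemma ee_zero : ee 0 = 1 := by simp [ee]

lemma ee_mul_neg (a : ℝ) : ee a * ee (-a) = 1 := by rw [← ee_add]; simp [ee]

lemma ee_conj (a : ℝ) : (starRingEnd ℂ) (ee a) = ee (-a) := by
  unfold ee
  rw [← Complex.exp_conj]; congr 1; simp [Complex.conj_ofNat]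

@[fun_prop]
lemma ee_cont : Continuous ee := by unfold ee; fun_prop

lemma ee_deriv (s : ℝ) : HasDerivAt ee (2 * rpi * I * ee s) s := by
  unfold ee
  have h1 : HasDerivAt (fun s : ℝ => (s : ℂ)) 1 s := (hasDerivAt_id s).ofReal_comp
  have h2 := (h1.const_mul (2 * rpi * I : ℂ)).cexp
  refine h2.congr_deriv ?_
  ring

lemma ee_neg_deriv (s : ℝ) : HasDerivAt (fun s => ee (-s)) (-(2 * rpi * I) * ee (-s)) s := by
  have := (ee_deriv (-s)).scomp s (hasDerivAt_neg s)
  refine this.congr_deriv ?_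
  simp

/-- tail of a function with `O(s^{-2})` derivative -/
lemma tail_limit (z z' : ℝ → ℂ) (K : ℝ) (hz : ∀ s > 0, HasDerivAt z (z' s) s)
    (hz'c : ContinuousOn z' (Ioi 0)) (hK : ∀ s ≥ 1, ‖z' s‖ ≤ K / s ^ 2) :
    ∃ L : ℂ, ∀ s ≥ 1, ‖z s - L‖ ≤ K / s := by
  have hint : ∀ s ≥ (1:ℝ), IntegrableOn (fun x : ℝ => K / x ^ 2) (Ioi s) := by
    intro s hs
    have := (integrableOn_Ioi_rpow_of_lt (a := -2) (by norm_num) (show (0:ℝ) < s by linarith)).const_mul K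
    refine IntegrableOn.congr_fun this (fun x hx => ?_) measurableSet_Ioi
    have hx0 : (0:ℝ) < x := by have : s < x := hx; linarith
    rw [Real.rpow_neg hx0.le, div_eq_mul_inv]; norm_cast
  have hz'i : ∀ s ≥ (1:ℝ), IntegrableOn z' (Ioi s) := by
    intro s hs
    refine Integrable.mono' (hint s hs) ?_ ?_
    · apply ContinuousOn.aestronglyMeasurable _ measurableSet_Ioi
      exact hz'c.mono (fun x hx => by have : s < x := hx; show 0 < x; linarith)
    · filter_upwards [ae_restrict_mem measurableSet_Ioi] with x hx
      have : s < x := hx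
      exact hK x (by linarith)
  have ht := tendsto_limUnder_of_hasDerivAt_of_integrableOn_Ioi (a := 1) (f := z) (f' := z')
    (fun x hx => hz x (by have : (1:ℝ) < x := hx; linarith)) (hz'i 1 le_rfl)
  refine ⟨Filter.atTop.limUnder z, fun s hs => ?_⟩
  have h1 := integral_Ioi_of_hasDerivAt_of_tendsto' (a := s) (f := z) (f' := z')
    (fun x hx => hz x (by have : s ≤ x := hx; linarith)) (hz'i s hs) ht
  rw [norm_sub_rev, ← h1]
  have hval : ∫ x in Ioi s, K / x ^ 2 = K / s := by
    have h2 := integral_Ioi_rpow_of_lt (a := -2) (by norm_num) (show (0:ℝ) < s by linarith)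
    have h3 : ∫ x in Ioi s, K / x ^ 2 = ∫ x in Ioi s, K * x ^ (-2:ℝ) := by
      refine setIntegral_congr_fun measurableSet_Ioi (fun x hx => ?_)
      have hx0 : (0:ℝ) < x := by have : s < x := hx; linarith
      rw [Real.rpow_neg hx0.le, div_eq_mul_inv]; norm_cast
    rw [h3, integral_const_mul, h2]
    norm_num
    rw [Real.rpow_neg_one]; rfl
  rw [← hval]
  refine norm_integral_le_of_norm_le (hint s hs) ?_
  filter_upwards [ae_restrict_mem measurableSet_Ioi] with x hx
  have : s < x := hx
  exact hK x (by linarith)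

lemma ode_asymp (u u' : ℝ → ℂ) (c : ℝ) (hu : ∀ s > 0, HasDerivAt u (u' s) s)
    (hu' : ∀ s > 0, HasDerivAt u' (((c / s ^ 2 - 4 * rpi ^ 2 : ℝ) : ℂ) * u s) s) :
    ∃ (ap am : ℂ) (C : ℝ) (er er' : ℝ → ℂ), 0 < C ∧ ∀ s ≥ 1, HasDerivAt er (er' s) s ∧
      ‖er s‖ ≤ C / s ∧ ‖er' s‖ ≤ C / s ∧ u s = ap * ee s + am * ee (-s) + er s := by
  have hpi := rpi_pos
  set w : ℂ := 2 * rpi * I with hw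
  have hw2 : w * w = -(4 * rpi ^ 2 : ℝ) := by
    rw [hw]; push_cast
    have := I_mul_I
    linear_combination (4 * (rpi : ℂ) ^ 2) * this
  have hw0 : w ≠ 0 := by rw [hw]; simp [Real.pi_ne_zero]
  have hwn : ‖w‖ = 2 * rpi := by rw [hw]; simp [abs_of_pos hpi]
  set z : ℝ → ℂ := fun s => (u' s + w * u s) * ee (-s) with hzdef
  set y : ℝ → ℂ := fun s => (u' s - w * u s) * ee s with hydef
  set z' : ℝ → ℂ := fun s => ((c / s ^ 2 : ℝ) : ℂ) * u s * ee (-s) with hz'def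
  set y' : ℝ → ℂ := fun s => ((c / s ^ 2 : ℝ) : ℂ) * u s * ee s with hy'def
  have hz : ∀ s > 0, HasDerivAt z (z' s) s := by
    intro s hs
    have := ((hu' s hs).add ((hu s hs).const_mul w)).mul (ee_neg_deriv s)
    refine this.congr_deriv ?_
    simp only [hz'def, ← hw, Pi.add_apply]
    push_cast
    push_cast at hw2
    linear_combination (-u s * ee (-s)) * hw2
  have hy : ∀ s > 0, HasDerivAt y (y' s) s := by
    intro s hs
    have := ((hu' s hs).sub ((hu s hs).const_mul w)).mul (ee_deriv s)
    refine this.congr_deriv ?_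
    simp only [hy'def, ← hw, Pi.sub_apply]
    push_cast
    push_cast at hw2
    linear_combination (-u s * ee s) * hw2
  have huz : ∀ s, 2 * w * u s = z s * ee s - y s * ee (-s) := by
    intro s
    simp only [hzdef, hydef]
    linear_combination (-2 * w * u s) * ee_mul_neg s
  have huz' : ∀ s, 2 * u' s = z s * ee s + y s * ee (-s) := by
    intro s
    simp only [hzdef, hydef]
    linear_combination (-2 * u' s) * ee_mul_neg s
  have hucont : ContinuousOn u (Ioi 0) := fun s hs => (hu s hs).continuousAt.continuousWithinAt
  have hz'c : ContinuousOn z' (Ioi 0) := by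
    simp only [hz'def]
    refine ContinuousOn.mul (ContinuousOn.mul ?_ hucont) (by fun_prop)
    refine Complex.continuous_ofReal.comp_continuousOn ?_
    refine ContinuousOn.div (by fun_prop) (by fun_prop) (fun s hs => ?_)
    have : (0:ℝ) < s := hs
    positivity
  have hy'c : ContinuousOn y' (Ioi 0) := by
    simp only [hy'def]
    refine ContinuousOn.mul (ContinuousOn.mul ?_ hucont) (by fun_prop)
    refine Complex.continuous_ofReal.comp_continuousOn ?_
    refine ContinuousOn.div (by fun_prop) (by fun_prop) (fun s hs => ?_)
    have : (0:ℝ) < s := hs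
    positivity
  have hub : ∀ s, ‖u s‖ ≤ ‖z s‖ + ‖y s‖ := by
    intro s
    have h1 : ‖2 * w * u s‖ ≤ ‖z s‖ + ‖y s‖ := by
      rw [huz]
      refine (norm_sub_le _ _).trans ?_
      rw [norm_mul (z s), norm_mul (y s), ee_norm, ee_norm, mul_one, mul_one]
    rw [norm_mul, norm_mul, hwn] at h1
    simp only [Complex.norm_ofNat] at h1
    have := Real.pi_gt_three
    nlinarith [norm_nonneg (u s)]
  -- energy
  set Q : ℝ → ℝ := fun s => (‖z s‖ ^ 2 + ‖y s‖ ^ 2) * rexp (4 * |c| / s) with hQ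
  have hz'b : ∀ s > 0, ‖z' s‖ ≤ |c| / s ^ 2 * ‖u s‖ := by
    intro s hs
    simp only [hz'def, norm_mul, ee_norm, mul_one, Complex.norm_real, norm_abs, abs_div]
    rw [abs_of_pos (by positivity : (0:ℝ) < s ^ 2)]
  have hy'b : ∀ s > 0, ‖y' s‖ ≤ |c| / s ^ 2 * ‖u s‖ := by
    intro s hs
    simp only [hy'def, norm_mul, ee_norm, mul_one, Complex.norm_real, norm_abs, abs_div]
    rw [abs_of_pos (by positivity : (0:ℝ) < s ^ 2)]
  have hQd : ∀ s > 0, ∃ q, q ≤ 0 ∧ HasDerivAt Q q s := by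
    intro s hs
    have h1 := ((hz s hs).norm_sq.add (hy s hs).norm_sq)
    have h2 : HasDerivAt (fun s : ℝ => rexp (4 * |c| / s)) (rexp (4 * |c| / s) * (-(4 * |c|) / s ^ 2)) s := by
      have := ((hasDerivAt_inv hs.ne').const_mul (4 * |c|)).exp
      simp only [← div_eq_mul_inv] at this
      refine this.congr_deriv ?_
      field_simp
    refine ⟨_, ?_, h1.mul h2⟩
    have i1 : inner ℝ (z s) (z' s) ≤ ‖z s‖ * (|c| / s ^ 2 * (‖z s‖ + ‖y s‖)) := by
      refine (real_inner_le_norm _ _).trans ?_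
      gcongr
      exact (hz'b s hs).trans (by gcongr; exact hub s)
    have i2 : inner ℝ (y s) (y' s) ≤ ‖y s‖ * (|c| / s ^ 2 * (‖z s‖ + ‖y s‖)) := by
      refine (real_inner_le_norm _ _).trans ?_
      gcongr
      exact (hy'b s hs).trans (by gcongr; exact hub s)
    set A := ‖z s‖
    set B := ‖y s‖
    set k := |c| / s ^ 2 with hk
    have hk0 : 0 ≤ k := by positivity
    have e1 : (-(4 * |c|) / s ^ 2) = -(4 * k) := by rw [hk]; ring
    rw [e1]
    simp only [Pi.add_apply]
    have : 2 * inner ℝ (z s) (z' s) + 2 * inner ℝ (y s) (y' s) - 4 * k * (A ^ 2 + B ^ 2) ≤ 0 := by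
      nlinarith [mul_nonneg hk0 (sq_nonneg (A - B))]
    have := mul_nonpos_of_nonneg_of_nonpos (Real.exp_pos (4 * |c| / s)).le this
    nlinarith
  have hQm : ∀ s ≥ 1, Q s ≤ Q 1 := by
    intro s hs
    have : AntitoneOn Q (Ici 1) := by
      refine antitoneOn_of_deriv_nonpos (convex_Ici 1) ?_ ?_ ?_
      · intro x hx
        obtain ⟨q, _, hq⟩ := hQd x (by have : (1:ℝ) ≤ x := hx; linarith)
        exact hq.continuousAt.continuousWithinAt
      · intro x hx
        rw [interior_Ici] at hx
        obtain ⟨q, _, hq⟩ := hQd x (by have : (1:ℝ) < x := hx; linarith)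
        exact hq.differentiableAt.differentiableWithinAt
      · intro x hx
        rw [interior_Ici] at hx
        obtain ⟨q, h0, hq⟩ := hQd x (by have : (1:ℝ) < x := hx; linarith)
        rw [hq.deriv]; exact h0
    exact this (by simp) hs hs
  set M : ℝ := Q 1 + 2 with hM
  have hQ1 : 0 ≤ Q 1 := by simp only [hQ]; positivity
  have huM : ∀ s ≥ 1, ‖u s‖ ≤ M := by
    intro s hs
    have h1 := hQm s hs
    have h2 : ‖z s‖ ^ 2 + ‖y s‖ ^ 2 ≤ Q s := by
      simp only [hQ]
      have : 1 ≤ rexp (4 * |c| / s) := Real.one_le_exp (by positivity)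
      nlinarith [sq_nonneg ‖z s‖, sq_nonneg ‖y s‖]
    have h3 := hub s
    nlinarith [sq_nonneg (‖z s‖ - 1), sq_nonneg (‖y s‖ - 1), norm_nonneg (z s), norm_nonneg (y s)]
  set K := |c| * M with hKdef
  have hM0 : 0 ≤ M := by linarith
  obtain ⟨Lz, hLz⟩ := tail_limit z z' K hz hz'c (fun s hs => by
    refine (hz'b s (by linarith)).trans ?_
    rw [hKdef, mul_div_right_comm]
    gcongr; exact huM s hs)
  obtain ⟨Ly, hLy⟩ := tail_limit y y' K hy hy'c (fun s hs => by
    refine (hy'b s (by linarith)).trans ?_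
    rw [hKdef, mul_div_right_comm]
    gcongr; exact huM s hs)
  have hK0 : 0 ≤ K := by positivity
  refine ⟨Lz / (2 * w), -Ly / (2 * w), K + 1,
    fun s => u s - (Lz / (2 * w) * ee s + -Ly / (2 * w) * ee (-s)),
    fun s => u' s - (Lz / 2 * ee s + Ly / 2 * ee (-s)), by positivity, fun s hs => ?_⟩
  have hs0 : 0 < s := by linarith
  refine ⟨?_, ?_, ?_, by ring⟩
  · have := (hu s hs0).sub (((ee_deriv s).const_mul (Lz / (2 * w))).add ((ee_neg_deriv s).const_mul (-Ly / (2 * w))))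
    refine this.congr_deriv ?_
    rw [← hw]; field_simp
  · have e1 : u s - (Lz / (2 * w) * ee s + -Ly / (2 * w) * ee (-s)) =
        ((z s - Lz) * ee s - (y s - Ly) * ee (-s)) / (2 * w) := by
      have := huz s
      field_simp
      linear_combination this
    beta_reduce
    rw [e1, norm_div]
    have h1 : ‖(z s - Lz) * ee s - (y s - Ly) * ee (-s)‖ ≤ K / s + K / s := by
      refine (norm_sub_le _ _).trans ?_
      rw [norm_mul, norm_mul, ee_norm, ee_norm, mul_one, mul_one]
      exact add_le_add (hLz s hs) (hLy s hs)
    rw [norm_mul, hwn, Complex.norm_ofNat]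
    have hp3 := Real.pi_gt_three
    rw [div_le_iff₀ (by positivity)]
    have : 0 ≤ K / s := by positivity
    have h2 : (K + 1) / s = K / s + 1 / s := by ring
    have : 0 ≤ 1 / s := by positivity
    rw [h2]
    nlinarith
  · have e1 : u' s - (Lz / 2 * ee s + Ly / 2 * ee (-s)) =
        ((z s - Lz) * ee s + (y s - Ly) * ee (-s)) / 2 := by
      have := huz' s
      linear_combination this / 2
    beta_reduce
    rw [e1, norm_div]
    have h1 : ‖(z s - Lz) * ee s + (y s - Ly) * ee (-s)‖ ≤ K / s + K / s := by
      refine (norm_add_le _ _).trans ?_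
      rw [norm_mul, norm_mul, ee_norm, ee_norm, mul_one, mul_one]
      exact add_le_add (hLz s hs) (hLy s hs)
    rw [Complex.norm_ofNat]
    have h2 : (K + 1) / s = K / s + 1 / s := by ring
    have : 0 ≤ 1 / s := by positivity
    rw [h2]; linarith

/-- asymptotics of `Phi` -/
lemma Phi_asymp {d : ℕ} (hd : 1 ≤ d) :
    ∃ (ap am : ℂ) (C : ℝ) (er er' : ℝ → ℂ), 0 < C ∧ ∀ s ≥ 1, HasDerivAt er (er' s) s ∧
      ‖er s‖ ≤ C / s ∧ ‖er' s‖ ≤ C / s ∧ ∀ ξ : EE d, ‖ξ‖ = s →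
        Phi d ξ = ((s ^ (-(((d:ℝ) - 1) / 2)) : ℝ) : ℂ) * (ap * ee s + am * ee (-s) + er s) := by
  set i0 : Fin d := ⟨0, hd⟩
  set a : ℝ := ((d:ℝ) - 1) / 2 with ha
  set u : ℝ → ℂ := fun s => ((s ^ a : ℝ) : ℂ) * mm d i0 s
  set u' : ℝ → ℂ := fun s => ((a * s ^ (a-1) : ℝ) : ℂ) * mm d i0 s + ((s ^ a : ℝ) : ℂ) * mm' d i0 s
  have hpow : ∀ (b : ℝ) (s : ℝ), 0 < s → HasDerivAt (fun s : ℝ => ((s ^ b : ℝ) : ℂ)) ((b * s ^ (b-1) : ℝ) : ℂ) s := by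
    intro b s hs
    exact (Real.hasDerivAt_rpow_const (Or.inl hs.ne')).ofReal_comp
  have hu : ∀ s > 0, HasDerivAt u (u' s) s := fun s hs => (hpow a s hs).mul (mm_deriv i0 s)
  have hu' : ∀ s > 0, HasDerivAt u' (((a * (a-1) / s ^ 2 - 4 * rpi ^ 2 : ℝ) : ℂ) * u s) s := by
    intro s hs
    have h1 : HasDerivAt (fun s : ℝ => ((a * s ^ (a-1) : ℝ) : ℂ)) ((a * ((a-1) * s ^ (a-1-1)) : ℝ) : ℂ) s := by
      have := ((Real.hasDerivAt_rpow_const (p := a-1) (Or.inl hs.ne')).const_mul a).ofReal_comp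
      exact this
    have h2 := (h1.mul (mm_deriv i0 s)).add ((hpow a s hs).mul (mm'_deriv i0 s))
    refine h2.congr_deriv ?_
    have ode := mm_ode i0 s hs
    have r1 : s ^ (a-1) = s ^ a / s := by rw [Real.rpow_sub_one hs.ne']
    have r2 : s ^ (a-1-1) = s ^ a / s ^ 2 := by
      rw [Real.rpow_sub_one hs.ne', Real.rpow_sub_one hs.ne']; field_simp
    have r3 : (d:ℝ) - 1 = 2 * a := by rw [ha]; ring
    have r3' : (((d:ℝ) : ℂ) - 1) = 2 * (a : ℂ) := by exact_mod_cast congrArg (fun x : ℝ => (x : ℂ)) r3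
    rw [r1, r2]
    rw [r3'] at ode
    have hs' : (s : ℂ) ≠ 0 := by exact_mod_cast hs.ne'
    simp only [u]
    push_cast
    field_simp at ode ⊢
    linear_combination ((s ^ a : ℝ) : ℂ) * s * ode
  obtain ⟨ap, am, C, er, er', hC, h⟩ := ode_asymp u u' _ hu hu'
  refine ⟨ap, am, C, er, er', hC, fun s hs => ?_⟩
  obtain ⟨h1, h2, h3, h4⟩ := h s hs
  refine ⟨h1, h2, h3, fun ξ hξ => ?_⟩
  rw [Phi_eq_mm i0, hξ, ← h4]
  simp only [u]
  rw [← mul_assoc, ← Complex.ofReal_mul, ← Real.rpow_add (by linarith)]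
  simp

lemma ttstar {X Y : Type*} [MeasurableSpace X] [MeasurableSpace Y] (μ : Measure X) (ν : Measure Y)
    [SFinite μ] [SFinite ν] (w : X → ℝ) (hw0 : ∀ x, 0 ≤ w x) (hw : Integrable w μ)
    (e : X → Y → ℂ) (he : Measurable (uncurry e)) (he1 : ∀ x y, ‖e x y‖ ≤ 1)
    (G : Y → ℂ) (hG : Integrable G ν) :
    ∫⁻ x, eR (w x * ‖∫ y, e x y * G y ∂ν‖ ^ 2) ∂μ ≤
      ∫⁻ y, ∫⁻ y', ‖G y‖ₑ * ‖G y'‖ₑ *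
        ‖∫ x, (w x : ℂ) * (e x y * (starRingEnd ℂ) (e x y')) ∂μ‖ₑ ∂ν ∂ν := by
  set F : X → ℂ := fun x => ∫ y, e x y * G y ∂ν with hF
  -- the triple integrand
  set T : X × (Y × Y) → ℂ := fun z => (w z.1 : ℂ) * (e z.1 z.2.1 * G z.2.1 *
    ((starRingEnd ℂ) (e z.1 z.2.2 * G z.2.2))) with hT
  have hGG : Integrable (fun z : Y × Y => ‖G z.1‖ * ‖G z.2‖) (ν.prod ν) := hG.norm.mul_prod hG.norm
  have hTi : Integrable T (μ.prod (ν.prod ν)) := by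
    refine Integrable.mono' (hw.mul_prod hGG) ?_ ?_
    · have m1 : AEStronglyMeasurable (fun z : X × (Y × Y) => (w z.1 : ℂ)) (μ.prod (ν.prod ν)) :=
        (Complex.continuous_ofReal.comp_aestronglyMeasurable hw.aestronglyMeasurable).comp_fst
      have mG : AEStronglyMeasurable G ν := hG.aestronglyMeasurable
      have m2 : AEStronglyMeasurable (fun z : X × (Y × Y) => G z.2.1) (μ.prod (ν.prod ν)) :=
        (mG.comp_fst (ν := ν)).comp_snd (μ := μ)
      have m3 : AEStronglyMeasurable (fun z : X × (Y × Y) => G z.2.2) (μ.prod (ν.prod ν)) :=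
        (mG.comp_snd (μ := ν)).comp_snd (μ := μ)
      have m4 : AEStronglyMeasurable (fun z : X × (Y × Y) => e z.1 z.2.1) (μ.prod (ν.prod ν)) :=
        (he.comp (measurable_fst.prodMk (measurable_fst.comp measurable_snd))).aestronglyMeasurable
      have m5 : AEStronglyMeasurable (fun z : X × (Y × Y) => e z.1 z.2.2) (μ.prod (ν.prod ν)) :=
        (he.comp (measurable_fst.prodMk (measurable_snd.comp measurable_snd))).aestronglyMeasurable
      exact m1.mul ((m4.mul m2).mul (Complex.continuous_conj.comp_aestronglyMeasurable (m5.mul m3)))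
    · filter_upwards with z
      simp only [hT, norm_mul, Complex.norm_real, RCLike.norm_conj, norm_abs, abs_of_nonneg (hw0 _)]
      have h1 := he1 z.1 z.2.1
      have h2 := he1 z.1 z.2.2
      have h3 : ‖e z.1 z.2.1‖ * ‖G z.2.1‖ * (‖e z.1 z.2.2‖ * ‖G z.2.2‖) ≤ 1 * ‖G z.2.1‖ * (1 * ‖G z.2.2‖) := by
        gcongr
      have h4 := mul_le_mul_of_nonneg_left h3 (hw0 z.1)
      simpa using h4
  have hsq : ∀ x, ((w x * ‖F x‖ ^ 2 : ℝ) : ℂ) = ∫ z, T (x, z) ∂(ν.prod ν) := by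
    intro x
    simp only [hT]
    rw [integral_const_mul, integral_prod_mul (fun y => e x y * G y) (fun y => (starRingEnd ℂ) (e x y * G y)),
      integral_conj]
    push_cast
    rw [Complex.mul_conj, Complex.normSq_eq_norm_sq]
    push_cast; rfl
  have hint : Integrable (fun x => w x * ‖F x‖ ^ 2) μ := by
    have := hTi.integral_prod_left
    have h2 : Integrable (fun x => ((w x * ‖F x‖ ^ 2 : ℝ) : ℂ)) μ := by
      simp_rw [hsq]; exact this
    exact h2.re
  rw [← ofReal_integral_eq_lintegral_ofReal hint (of_forall fun x => by
    have := hw0 x; positivity)]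
  have e1 : ((∫ x, w x * ‖F x‖ ^ 2 ∂μ : ℝ) : ℂ) = ∫ z, (∫ x, T (x, z) ∂μ) ∂(ν.prod ν) := by
    rw [← integral_complex_ofReal]
    simp_rw [hsq]
    exact integral_integral_swap hTi
  have e2 : ∫ x, w x * ‖F x‖ ^ 2 ∂μ ≤ ‖∫ z, (∫ x, T (x, z) ∂μ) ∂(ν.prod ν)‖ := by
    rw [← e1, Complex.norm_real]; exact le_abs_self _
  calc eR (∫ x, w x * ‖F x‖ ^ 2 ∂μ)
      ≤ ‖∫ z, (∫ x, T (x, z) ∂μ) ∂(ν.prod ν)‖ₑ := by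
        rw [← ofReal_norm_eq_enorm]; exact eR_le e2
    _ ≤ ∫⁻ z, ‖∫ x, T (x, z) ∂μ‖ₑ ∂(ν.prod ν) := enorm_integral_le_lintegral_enorm _
    _ = ∫⁻ y, ∫⁻ y', ‖∫ x, T (x, (y, y')) ∂μ‖ₑ ∂ν ∂ν := by
        rw [lintegral_prod]
        exact hTi.integral_prod_right.aestronglyMeasurable.enorm
    _ = _ := by
        refine lintegral_congr fun y => lintegral_congr fun y' => ?_
        have hc : ‖G y'‖ₑ = ‖(starRingEnd ℂ) (G y')‖ₑ := by
          rw [← ofReal_norm_eq_enorm, ← ofReal_norm_eq_enorm, RCLike.norm_conj]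
        rw [hc, ← enorm_mul, ← enorm_mul, ← integral_const_mul]
        congr 2
        ext x
        simp only [hT, map_mul]; ring

lemma schur_sym {Y : Type*} [MeasurableSpace Y] (ν : Measure Y) [SFinite ν]
    (k : Y → Y → ℝ≥0∞) (hk : Measurable (uncurry k))
    (hsym : ∀ y y', k y y' = k y' y)
    (B : ℝ≥0∞) (hB : ∀ᵐ y ∂ν, ∫⁻ y', k y y' ∂ν ≤ B) (g : Y → ℝ≥0∞) (hg : AEMeasurable g ν) :
    ∫⁻ y, ∫⁻ y', g y * g y' * k y y' ∂ν ∂ν ≤ B * ∫⁻ y, g y ^ 2 ∂ν := by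
  have hm1 : AEMeasurable (fun z : Y × Y => g z.1 ^ 2 * k z.1 z.2) (ν.prod ν) :=
    ((hg.comp_fst).pow_const 2).mul hk.aemeasurable
  have hm2 : AEMeasurable (fun z : Y × Y => g z.2 ^ 2 * k z.1 z.2) (ν.prod ν) :=
    ((hg.comp_snd).pow_const 2).mul hk.aemeasurable
  have hmm : AEMeasurable (fun z : Y × Y => g z.1 * g z.2 * k z.1 z.2) (ν.prod ν) :=
    ((hg.comp_fst).mul hg.comp_snd).mul hk.aemeasurable
  have hkae : ∀ᵐ y ∂ν, AEMeasurable (fun y' => k y y') ν := of_forall fun y => (hk.comp measurable_prodMk_left).aemeasurable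
  have b1 : ∫⁻ z, g z.1 ^ 2 * k z.1 z.2 ∂(ν.prod ν) ≤ B * ∫⁻ y, g y ^ 2 ∂ν := by
    rw [lintegral_prod _ hm1]
    calc ∫⁻ y, ∫⁻ y', g y ^ 2 * k y y' ∂ν ∂ν ≤ ∫⁻ y, B * g y ^ 2 ∂ν := by
          apply lintegral_mono_ae
          filter_upwards [hB, hkae] with y hy hky
          rw [lintegral_const_mul'' _ hky, mul_comm]
          gcongr
      _ = _ := by rw [lintegral_const_mul'' _ (hg.pow_const 2)]
  have b2 : ∫⁻ z, g z.2 ^ 2 * k z.1 z.2 ∂(ν.prod ν) ≤ B * ∫⁻ y, g y ^ 2 ∂ν := by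
    refine le_trans (le_of_eq ?_) b1
    rw [← lintegral_prod_swap]
    refine lintegral_congr fun z => ?_
    simp only [Prod.fst_swap, Prod.snd_swap]
    rw [hsym]
  calc ∫⁻ y, ∫⁻ y', g y * g y' * k y y' ∂ν ∂ν = ∫⁻ z, g z.1 * g z.2 * k z.1 z.2 ∂(ν.prod ν) := by
        rw [lintegral_prod _ hmm]
    _ ≤ ∫⁻ z, 2⁻¹ * (g z.1 ^ 2 * k z.1 z.2 + g z.2 ^ 2 * k z.1 z.2) ∂(ν.prod ν) := by
        refine lintegral_mono fun z => ?_
        have : g z.1 * g z.2 ≤ 2⁻¹ * (g z.1 ^ 2 + g z.2 ^ 2) := by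
          generalize g z.1 = a
          generalize g z.2 = b
          have h2 : 2 * (a * b) ≤ a ^ 2 + b ^ 2 := by
            rcases eq_or_ne a ⊤ with ha | ha
            · simp [ha]
            rcases eq_or_ne b ⊤ with hb | hb
            · simp [hb]
            lift a to ℝ≥0 using ha
            lift b to ℝ≥0 using hb
            norm_cast
            have := two_mul_le_add_sq (a : ℝ) b
            rw [← NNReal.coe_le_coe]
            push_cast
            linarith
          calc a * b = 2⁻¹ * (2 * (a * b)) := by
                rw [← mul_assoc, ENNReal.inv_mul_cancel two_ne_zero ENNReal.ofNat_ne_top, one_mul]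
            _ ≤ _ := by gcongr
        calc g z.1 * g z.2 * k z.1 z.2 ≤ 2⁻¹ * (g z.1 ^ 2 + g z.2 ^ 2) * k z.1 z.2 := by gcongr
          _ = _ := by ring
    _ = 2⁻¹ * (∫⁻ z, g z.1 ^ 2 * k z.1 z.2 ∂(ν.prod ν) + ∫⁻ z, g z.2 ^ 2 * k z.1 z.2 ∂(ν.prod ν)) := by
        have hm12 : AEMeasurable (fun z : Y × Y => g z.1 ^ 2 * k z.1 z.2 + g z.2 ^ 2 * k z.1 z.2) (ν.prod ν) := hm1.add hm2
        rw [lintegral_const_mul'' _ hm12, lintegral_add_left' hm1]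
    _ ≤ 2⁻¹ * (B * ∫⁻ y, g y ^ 2 ∂ν + B * ∫⁻ y, g y ^ 2 ∂ν) := by gcongr
    _ = _ := by
        rw [← two_mul, ← mul_assoc, ENNReal.inv_mul_cancel two_ne_zero ENNReal.ofNat_ne_top, one_mul]

/-- the two previous lemmas combined -/
lemma ttstar_schur {X Y : Type*} [MeasurableSpace X] [MeasurableSpace Y] (μ : Measure X) (ν : Measure Y)
    [SFinite μ] [SFinite ν] (w : X → ℝ) (hw0 : ∀ x, 0 ≤ w x) (hw : Integrable w μ)
    (e : X → Y → ℂ) (he : Measurable (uncurry e)) (he1 : ∀ x y, ‖e x y‖ ≤ 1)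
    (k : Y → Y → ℝ≥0∞) (hk : Measurable (uncurry k)) (hks : ∀ y y', k y y' = k y' y)
    (hkk : ∀ y y', ‖∫ x, (w x : ℂ) * (e x y * (starRingEnd ℂ) (e x y')) ∂μ‖ₑ ≤ k y y')
    (B : ℝ≥0∞) (hB : ∀ᵐ y ∂ν, ∫⁻ y', k y y' ∂ν ≤ B)
    (G : Y → ℂ) (hG : Integrable G ν) :
    ∫⁻ x, eR (w x * ‖∫ y, e x y * G y ∂ν‖ ^ 2) ∂μ ≤ B * ∫⁻ y, ‖G y‖ₑ ^ 2 ∂ν := by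
  refine (ttstar μ ν w hw0 hw e he he1 G hG).trans ?_
  refine le_trans ?_ (schur_sym ν k hk hks B hB (fun y => ‖G y‖ₑ) hG.aestronglyMeasurable.enorm)
  gcongr with y y'
  exact hkk y y'

section gauss
variable {V : Type*} [NormedAddCommGroup V] [InnerProductSpace ℝ V] [FiniteDimensional ℝ V]
  [MeasurableSpace V] [BorelSpace V]

lemma gauss_fourier (r : ℝ) (hr : 0 < r) (w : V) :
    ∫ v : V, ((rexp (-(rpi / r ^ 2) * ‖v‖ ^ 2) : ℝ) : ℂ) * ee (inner ℝ v w)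
      = ((r ^ (Module.finrank ℝ V) * rexp (-(rpi * r ^ 2) * ‖w‖ ^ 2) : ℝ) : ℂ) := by
  have hb : 0 < ((rpi / r ^ 2 : ℝ) : ℂ).re := by
    rw [ofReal_re]; positivity
  have h := GaussianFourier.integral_cexp_neg_mul_sq_norm_add (V := V) hb (2 * rpi * I) w
  have h1 : (fun v : V => ((rexp (-(rpi / r ^ 2) * ‖v‖ ^ 2) : ℝ) : ℂ) * ee (inner ℝ v w))
      = fun v : V => cexp (-((rpi / r ^ 2 : ℝ) : ℂ) * ‖v‖ ^ 2 + 2 * rpi * I * (inner ℝ w v : ℝ)) := by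
    funext v
    rw [ee, ofReal_exp, ← Complex.exp_add, real_inner_comm]
    push_cast; rfl
  rw [h1, h]
  have hπ : (rpi : ℂ) ≠ 0 := by exact_mod_cast Real.pi_ne_zero
  have hr' : (r : ℂ) ≠ 0 := by exact_mod_cast hr.ne'
  have h2 : (rpi : ℂ) / ((rpi / r ^ 2 : ℝ) : ℂ) = ((r ^ 2 : ℝ) : ℂ) := by
    push_cast; field_simp
  have h3 : (Module.finrank ℝ V / 2 : ℂ) = ((Module.finrank ℝ V / 2 : ℝ) : ℂ) := by push_cast; rfl
  rw [h2, h3, ← ofReal_cpow (by positivity), ofReal_mul, ofReal_exp]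
  congr 1
  · congr 1
    rw [← Real.rpow_natCast r 2, ← Real.rpow_mul hr.le, ← Real.rpow_natCast]
    congr 1; push_cast; ring
  · congr 1
    push_cast
    field_simp
    rw [Complex.I_sq]; ring

lemma gauss_int (b : ℝ) (hb : 0 < b) : Integrable (fun v : V => rexp (-b * ‖v‖ ^ 2)) := by
  have h := (GaussianFourier.integrable_cexp_neg_mul_sq_norm_add (V := V) (b := (b:ℂ)) (by simpa using hb) 0 0).norm
  refine h.congr (of_forall fun v => ?_)
  simp only [zero_mul, add_zero, Complex.norm_exp]
  congr 1
  rw [← ofReal_neg, ← ofReal_pow, ← ofReal_mul, ofReal_re]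

/-- Gaussian mass -/
lemma gauss_mass (r : ℝ) (hr : 0 < r) :
    ∫⁻ v : V, eR (r ^ (Module.finrank ℝ V) * rexp (-(rpi * r ^ 2) * ‖v‖ ^ 2)) = 1 := by
  have hb : 0 < rpi * r ^ 2 := by positivity
  rw [← ofReal_integral_eq_lintegral_ofReal ((gauss_int _ hb).const_mul _)
    (of_forall fun v => by positivity), integral_const_mul,
    GaussianFourier.integral_rexp_neg_mul_sq_norm hb]
  have : rpi / (rpi * r ^ 2) = (r⁻¹) ^ 2 := by
    have := Real.pi_ne_zero; field_simp
  rw [this, ← Real.rpow_natCast (r⁻¹) 2, ← Real.rpow_mul (by positivity), ← ENNReal.ofReal_one]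
  congr 1
  rw [show ((2:ℕ):ℝ) * ((Module.finrank ℝ V : ℝ) / 2) = (Module.finrank ℝ V : ℝ) by push_cast; ring,
    Real.rpow_natCast, ← mul_pow, mul_inv_cancel₀ hr.ne', one_pow]

lemma fourier_ee (h : V → ℂ) (ξ : V) : 𝓕 h ξ = ∫ y, ee (-(inner ℝ y ξ)) * h y := by
  rw [Real.fourier_eq']
  congr 1; funext y
  rw [ee, smul_eq_mul]; congr 2; push_cast; ring

lemma fourierInv_ee (h : V → ℂ) (ξ : V) : 𝓕⁻ h ξ = ∫ y, ee (inner ℝ y ξ) * h y := by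
  rw [Real.fourierInv_eq']
  congr 1; funext y
  rw [ee, smul_eq_mul]; congr 2; push_cast; ring

lemma fourier_bdd (h : V → ℂ) (ξ : V) : ‖𝓕 h ξ‖ ≤ ∫ y, ‖h y‖ := by
  rw [fourier_ee]
  refine (norm_integral_le_integral_norm _).trans (le_of_eq ?_)
  simp [ee_norm]

lemma fourier_cont (h : V → ℂ) (hh : Integrable h) : Continuous (𝓕 h) := by
  have : 𝓕 h = fun ξ => ∫ y, ee (-(inner ℝ y ξ)) * h y := by funext ξ; exact fourier_ee h ξ
  rw [this]
  refine continuous_of_dominated (bound := fun y => ‖h y‖) (fun ξ => ?_) (fun ξ => ?_) hh.norm ?_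
  · exact (Continuous.aestronglyMeasurable (ee_cont.comp (by fun_prop))).mul hh.1
  · exact of_forall fun y => by simp [ee_norm]
  · refine of_forall fun y => ?_
    exact (ee_cont.comp (by fun_prop)).mul continuous_const

/-- Bessel inequality for integrable functions. -/
lemma bessel (h : V → ℂ) (hh : Integrable h) : ∫⁻ ξ, ‖𝓕 h ξ‖ₑ ^ 2 ≤ ∫⁻ y, ‖h y‖ₑ ^ 2 := by
  have key : ∀ n : ℕ, ∫⁻ ξ : V, eR (rexp (-(rpi / ((n:ℝ) + 1) ^ 2) * ‖ξ‖ ^ 2) *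
      ‖∫ y, ee (-(inner ℝ y ξ)) * h y‖ ^ 2) ≤ 1 * ∫⁻ y, ‖h y‖ₑ ^ 2 := by
    intro n
    have hn : (0:ℝ) < (n:ℝ) + 1 := by positivity
    refine ttstar_schur volume volume _ (fun _ => by positivity) (gauss_int _ (by positivity))
      (fun ξ y => ee (-(inner ℝ y ξ))) ?_ (fun x y => (ee_norm _).le)
      (fun y y' => eR (((n:ℝ)+1) ^ (Module.finrank ℝ V) *
        rexp (-(rpi * ((n:ℝ)+1) ^ 2) * ‖y' - y‖ ^ 2))) ?_ ?_ ?_ 1 ?_ h hh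
    · exact (ee_cont.comp (by fun_prop)).measurable
    · unfold uncurry; exact meas_eR.comp (Continuous.measurable (by fun_prop))
    · intro y y'; rw [norm_sub_rev]
    · intro y y'
      have := gauss_fourier (V := V) ((n:ℝ)+1) hn (y' - y)
      have h2 : ∀ x : V, ee (-(inner ℝ y x)) * (starRingEnd ℂ) (ee (-(inner ℝ y' x))) = ee (inner ℝ x (y' - y)) := by
        intro x
        rw [ee_conj, ← ee_add, inner_sub_right, real_inner_comm, real_inner_comm y' x]; congr 1; ring
      simp_rw [h2]
      rw [this, ← ofReal_norm_eq_enorm, Complex.norm_real, Real.norm_of_nonneg (by positivity)]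
    · refine of_forall fun y => ?_
      have := lintegral_sub_right_eq_self (μ := (volume : Measure V)) (fun v => eR (((n:ℝ)+1) ^ (Module.finrank ℝ V) *
        rexp (-(rpi * ((n:ℝ)+1) ^ 2) * ‖v‖ ^ 2))) y
      rw [this, gauss_mass _ hn]
  have hF : Measurable (fun ξ : V => ‖𝓕 h ξ‖ₑ ^ 2) := by
    have : Continuous (𝓕 h) := fourier_cont h hh
    fun_prop
  have hmono : ∫⁻ ξ, ‖𝓕 h ξ‖ₑ ^ 2 ≤ Filter.liminf (fun n : ℕ => ∫⁻ ξ : V, eR (rexp (-(rpi / ((n:ℝ) + 1) ^ 2) * ‖ξ‖ ^ 2) *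
      ‖∫ y, ee (-(inner ℝ y ξ)) * h y‖ ^ 2)) Filter.atTop := by
    refine le_trans (lintegral_mono fun ξ => ?_) (lintegral_liminf_le' fun n => ?_)
    · refine le_of_eq ((Filter.Tendsto.liminf_eq ?_).symm)
      rw [← fourier_ee]
      have : ‖𝓕 h ξ‖ₑ ^ 2 = eR (rexp (-0 * ‖ξ‖ ^ 2) * ‖𝓕 h ξ‖ ^ 2) := by
        rw [← ofReal_norm_eq_enorm, ← eR_pow (norm_nonneg _)]; simp
      rw [this]
      refine (ENNReal.continuous_ofReal.tendsto _).comp ?_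
      refine Filter.Tendsto.mul_const _ ((Real.continuous_exp.tendsto _).comp ?_)
      refine Filter.Tendsto.mul_const _ (Filter.Tendsto.neg ?_)
      refine Filter.Tendsto.div_atTop tendsto_const_nhds ?_
      refine (Filter.tendsto_pow_atTop two_ne_zero).comp ?_
      exact Filter.tendsto_atTop_add_const_right _ _ tendsto_natCast_atTop_atTop
    · have : Continuous (𝓕 h) := fourier_cont h hh
      simp_rw [← fourier_ee]
      apply Measurable.aemeasurable
      fun_prop
  refine hmono.trans ?_
  refine (Filter.liminf_le_liminf (of_forall key)).trans ?_
  simp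
end gauss

def Ker {d : ℕ} (m : EE d → ℂ) (z : EE d) : ℂ := ∫ ξ, ee (inner ℝ ξ z) * m ξ
def Tm {d : ℕ} (m : EE d → ℂ) (h : EE d → ℂ) (x : EE d) : ℂ := ∫ ξ, ee (inner ℝ ξ x) * (m ξ * 𝓕 h ξ)

lemma Ker_eq {d : ℕ} (m : EE d → ℂ) : Ker m = 𝓕⁻ m := by
  funext z; rw [fourierInv_ee]; rfl

lemma Ker_bdd {d : ℕ} (m : EE d → ℂ) (z : EE d) : ‖Ker m z‖ ≤ ∫ ξ, ‖m ξ‖ := by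
  refine (norm_integral_le_integral_norm _).trans (le_of_eq ?_)
  simp [ee_norm]

lemma Ker_cont {d : ℕ} (m : EE d → ℂ) (hm : Integrable m) : Continuous (Ker m) := by
  unfold Ker
  refine continuous_of_dominated (bound := fun y => ‖m y‖) (fun ξ => ?_) (fun ξ => ?_) hm.norm ?_
  · exact (Continuous.aestronglyMeasurable (ee_cont.comp (by fun_prop))).mul hm.1
  · exact of_forall fun y => by simp [ee_norm]
  · refine of_forall fun y => ?_
    exact (ee_cont.comp (by fun_prop)).mul continuous_const

lemma Tm_ker {d : ℕ} (m h : EE d → ℂ) (hm : Integrable m) (hh : Integrable h) (x : EE d) :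
    Tm m h x = ∫ y, Ker m (x - y) * h y := by
  unfold Tm Ker
  have hint : Integrable (uncurry fun ξ y : EE d => ee (inner ℝ ξ (x - y)) * m ξ * h y) (volume.prod volume) := by
    have h1 := hm.mul_prod hh
    refine h1.norm.mono' ?_ (of_forall fun q => ?_)
    · have hc : Continuous (fun q : EE d × EE d => ee (inner ℝ q.1 (x - q.2))) := ee_cont.comp (by fun_prop)
      refine (hc.aestronglyMeasurable.mul h1.1).congr (of_forall fun q => ?_)
      simp [uncurry, mul_assoc]
    · simp [uncurry, ee_norm]
  have h2 : ∀ ξ, ee (inner ℝ ξ x) * (m ξ * 𝓕 h ξ) = ∫ y, ee (inner ℝ ξ (x - y)) * m ξ * h y := by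
    intro ξ
    rw [fourier_ee, ← mul_assoc, ← integral_const_mul]
    congr 1; funext y
    rw [inner_sub_right, sub_eq_add_neg, ee_add, real_inner_comm y ξ]; ring
  simp_rw [h2]
  rw [integral_integral_swap hint]
  congr 1; funext y
  rw [← integral_mul_const]

lemma Ker_scale {d : ℕ} (m : EE d → ℂ) (N : ℝ) (hN : 0 < N) (z : EE d) :
    Ker (fun ξ => m (N⁻¹ • ξ)) z = ((N ^ d : ℝ) : ℂ) * Ker m (N • z) := by
  unfold Ker
  have := Measure.integral_comp_smul (volume : Measure (EE d)) (fun ξ => ee (inner ℝ ξ (N • z)) * m ξ) (N⁻¹)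
  simp only [finrank_euclideanSpace, Fintype.card_fin] at this
  have h2 : ∀ ξ : EE d, inner ℝ (N⁻¹ • ξ) (N • z) = inner ℝ ξ z := by
    intro ξ
    rw [inner_smul_left, inner_smul_right]; simp; field_simp
  simp_rw [h2] at this
  rw [this, inv_pow, inv_inv, abs_of_pos (by positivity), real_smul]

lemma Ker_decay {d : ℕ} (m : EE d → ℂ) (hm : ContDiff ℝ (⊤ : ℕ∞) m) (hs : HasCompactSupport m) (A : ℕ) :
    ∃ C : ℝ, 0 < C ∧ ∀ z, (1 + ‖z‖) ^ A * ‖Ker m z‖ ≤ C := by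
  let S : SchwartzMap (EE d) ℂ := hs.toSchwartzMap hm
  have hS : Ker m = (FourierTransform.fourierInv S : SchwartzMap (EE d) ℂ) := by
    rw [Ker_eq, SchwartzMap.fourierInv_coe]; rfl
  have h := SchwartzMap.one_add_le_sup_seminorm_apply (𝕜 := ℂ) (m := (A, 0)) (k := A) (n := 0) le_rfl le_rfl
     (FourierTransform.fourierInv S : SchwartzMap (EE d) ℂ)
  refine ⟨_, lt_add_of_le_of_pos (le_trans (by positivity) (h 0)) one_pos, fun z => ?_⟩
  refine le_trans ?_ (le_add_of_nonneg_right zero_le_one)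
  have := h z
  rw [norm_iteratedFDeriv_zero, ← hS] at this
  exact this

/-- integrability from decay -/
lemma Ker_integrable {d : ℕ} (m : EE d → ℂ) (hm : ContDiff ℝ (⊤ : ℕ∞) m) (hs : HasCompactSupport m) :
    Integrable (Ker m) := by
  let S : SchwartzMap (EE d) ℂ := hs.toSchwartzMap hm
  have hS : Ker m = (FourierTransform.fourierInv S : SchwartzMap (EE d) ℂ) := by
    rw [Ker_eq, SchwartzMap.fourierInv_coe]; rfl
  rw [hS]
  exact SchwartzMap.integrable _

/-- the cutoff -/
def bbump : ContDiffBump (5/2 : ℝ) := ⟨8/5, 11/5, by norm_num, by norm_num⟩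
def bb (s : ℝ) : ℝ := bbump s
lemma bb_smooth : ContDiff ℝ (⊤ : ℕ∞) bb := bbump.contDiff
lemma bb_nonneg (s : ℝ) : 0 ≤ bb s := bbump.nonneg
lemma bb_le_one (s : ℝ) : bb s ≤ 1 := bbump.le_one
lemma bb_one (s : ℝ) (h1 : 9/10 ≤ s) (h2 : s ≤ 41/10) : bb s = 1 := by
  refine bbump.one_of_mem_closedBall ?_
  rw [mem_closedBall, Real.dist_eq, abs_le]
  constructor <;> norm_num [bbump] <;> linarith
lemma bb_zero (s : ℝ) (h : s ≤ 3/10 ∨ 47/10 ≤ s) : bb s = 0 := by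
  refine bbump.zero_of_le_dist ?_
  rw [Real.dist_eq, le_abs]
  rcases h with h | h
  · right; norm_num [bbump]; linarith
  · left; norm_num [bbump]; linarith

def bN (d : ℕ) (N : ℝ) (ξ : EE d) : ℝ := bb (‖N⁻¹ • ξ‖ ^ 2)

lemma bN_cont (d : ℕ) (N : ℝ) : Continuous (bN d N) := by
  unfold bN; exact bb_smooth.continuous.comp (by fun_prop)

lemma bN_range (d : ℕ) (N : ℝ) (hN : 0 < N) (ξ : EE d) (h : bN d N ξ ≠ 0) :
    N / 2 ≤ ‖ξ‖ ∧ ‖ξ‖ ≤ 5 / 2 * N := by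
  have h1 : ¬ (‖N⁻¹ • ξ‖ ^ 2 ≤ 3/10 ∨ 47/10 ≤ ‖N⁻¹ • ξ‖ ^ 2) := fun h' => h (bb_zero _ h')
  rw [not_or, not_le, not_le] at h1
  rw [norm_smul, norm_inv, Real.norm_of_nonneg hN.le] at h1
  have hq : 0 ≤ N⁻¹ * ‖ξ‖ := by positivity
  have e : ‖ξ‖ = N * (N⁻¹ * ‖ξ‖) := by field_simp
  constructor
  · have : 1/2 ≤ N⁻¹ * ‖ξ‖ := by nlinarith [h1.1]
    nlinarith
  · have : N⁻¹ * ‖ξ‖ ≤ 5/2 := by nlinarith [h1.2]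
    nlinarith

lemma bN_one_smooth (d : ℕ) : ContDiff ℝ (⊤ : ℕ∞) (fun ξ : EE d => ((bb (‖ξ‖ ^ 2) : ℝ) : ℂ)) := by
  exact Complex.ofRealCLM.contDiff.comp (bb_smooth.comp (contDiff_norm_sq ℝ))

lemma bN_one_supp (d : ℕ) : HasCompactSupport (fun ξ : EE d => ((bb (‖ξ‖ ^ 2) : ℝ) : ℂ)) := by
  refine HasCompactSupport.intro (isCompact_closedBall (0 : EE d) 3) fun x hx => ?_
  rw [mem_closedBall_zero_iff, not_le] at hx
  rw [bb_zero _ (Or.inr (by nlinarith)), ofReal_zero]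

lemma integrable_of_supp {d : ℕ} (m : EE d → ℂ) (hm : Continuous m) (ρ : ℝ) (h : ∀ ξ, ρ < ‖ξ‖ → m ξ = 0) :
    Integrable m := by
  refine hm.integrable_of_hasCompactSupport (HasCompactSupport.intro (isCompact_closedBall (0 : EE d) ρ) fun x hx => ?_)
  rw [mem_closedBall_zero_iff, not_le] at hx
  exact h x hx

lemma bN_supp_zero (d : ℕ) (N : ℝ) (hN : 0 < N) (ξ : EE d) (h : 5/2 * N < ‖ξ‖) : bN d N ξ = 0 := by
  by_contra h'
  exact absurd (bN_range d N hN ξ h').2 (not_le.mpr h)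

lemma bN_int (d : ℕ) (N : ℝ) (hN : 0 < N) : Integrable (fun ξ => ((bN d N ξ : ℝ) : ℂ)) := by
  refine integrable_of_supp _ (by have := bN_cont d N; fun_prop) (5/2*N) fun ξ h => ?_
  rw [bN_supp_zero d N hN ξ h, ofReal_zero]

/-- K_N -/
def KN (d : ℕ) (N : ℝ) : EE d → ℂ := Ker (fun ξ => ((bN d N ξ : ℝ) : ℂ))

lemma KN_cont (d : ℕ) (N : ℝ) (hN : 0 < N) : Continuous (KN d N) := Ker_cont _ (bN_int d N hN)

lemma KN_scale (d : ℕ) (N : ℝ) (hN : 0 < N) (z : EE d) :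
    KN d N z = ((N ^ d : ℝ) : ℂ) * Ker (fun ξ : EE d => ((bb (‖ξ‖ ^ 2) : ℝ) : ℂ)) (N • z) := by
  exact Ker_scale (fun ξ : EE d => ((bb (‖ξ‖ ^ 2) : ℝ) : ℂ)) N hN z

lemma KN_decay (d : ℕ) (A : ℕ) : ∃ C : ℝ, 0 < C ∧ ∀ N > 0, ∀ z, ‖KN d N z‖ ≤ C * N ^ d * ((1 + N * ‖z‖) ^ A)⁻¹ := by
  obtain ⟨C, hC, h⟩ := Ker_decay _ (bN_one_smooth d) (bN_one_supp d) A
  refine ⟨C, hC, fun N hN z => ?_⟩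
  rw [KN_scale d N hN z, norm_mul, Complex.norm_real, Real.norm_of_nonneg (by positivity)]
  have := h (N • z)
  rw [norm_smul, Real.norm_of_nonneg hN.le] at this
  have hp : 0 < (1 + N * ‖z‖) ^ A := by positivity
  rw [← div_eq_mul_inv, le_div_iff₀ hp]
  calc N ^ d * _ * (1 + N * ‖z‖) ^ A = N ^ d * ((1 + N * ‖z‖) ^ A * ‖Ker (fun ξ : EE d => ((bb (‖ξ‖ ^ 2) : ℝ) : ℂ)) (N • z)‖) := by ring
    _ ≤ N ^ d * C := by gcongr
    _ = _ := by ring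

lemma Phi_cont (d : ℕ) (hd : 1 ≤ d) : Continuous (Phi d) := by
  have := sig_prob hd
  unfold Phi
  refine continuous_of_dominated (bound := fun _ => 1) (fun ξ => ?_) (fun ξ => ?_) (integrable_const _) ?_
  · exact Continuous.aestronglyMeasurable (by fun_prop)
  · refine of_forall fun y => ?_
    exact (ee_norm _).le
  · exact of_forall fun y => by fun_prop

lemma Phi_bdd (d : ℕ) (hd : 1 ≤ d) (ξ : EE d) : ‖Phi d ξ‖ ≤ 1 := by
  have := sig_prob hd
  refine (norm_integral_le_integral_norm _).trans ?_
  have : ∀ y : EE d, ‖cexp (2 * rpi * I * (inner ℝ y ξ : ℝ))‖ = 1 := fun y => ee_norm _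
  simp [this]

/-- averaging multiplier localized -/
def mavg (d : ℕ) (N t : ℝ) (ξ : EE d) : ℂ := Phi d (t • ξ) * (bN d N ξ : ℝ)

lemma mavg_cont (d : ℕ) (hd : 1 ≤ d) (N t : ℝ) : Continuous (mavg d N t) := by
  have h1 := bN_cont d N
  have h2 := Phi_cont d hd
  unfold mavg; fun_prop

lemma mavg_int (d : ℕ) (hd : 1 ≤ d) (N t : ℝ) (hN : 0 < N) : Integrable (mavg d N t) := by
  refine integrable_of_supp _ (mavg_cont d hd N t) (5/2*N) fun ξ h => ?_
  rw [mavg, bN_supp_zero d N hN ξ h, ofReal_zero, mul_zero]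

/-- Fubini for averaging. -/
lemma avg_fourier (d : ℕ) (hd : 1 ≤ d) (m : EE d → ℂ) (hm : Integrable m) (t : ℝ) (x : EE d) :
    ∫ ξ, ee (inner ℝ ξ x) * (Phi d (t • ξ) * m ξ) = ∫ y, Ker m (x + t • y) ∂sig d := by
  have := sig_prob hd
  unfold Ker
  have hint : Integrable (uncurry fun y ξ : EE d => ee (inner ℝ ξ (x + t • y)) * m ξ) ((sig d).prod volume) := by
    have h1 : Integrable (fun q : EE d × EE d => (1:ℂ) * m q.2) ((sig d).prod volume) :=
      (integrable_const (1:ℂ)).mul_prod hm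
    have hc : Continuous (fun q : EE d × EE d => ee (inner ℝ q.2 (x + t • q.1))) := ee_cont.comp (by fun_prop)
    refine h1.norm.mono' ?_ (of_forall fun q => ?_)
    · refine (hc.aestronglyMeasurable.mul h1.1).congr (of_forall fun q => ?_)
      simp [uncurry]
    · simp [uncurry, ee_norm]
  rw [integral_integral_swap hint]
  congr 1; funext ξ
  have : Phi d (t • ξ) = ∫ y, ee (inner ℝ ξ (t • y)) ∂sig d := by
    unfold Phi ee
    congr 1; funext y
    rw [inner_smul_right, inner_smul_right, real_inner_comm]
  rw [this, integral_mul_const]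
  simp_rw [inner_add_right, ee_add]
  rw [integral_const_mul]; ring

lemma Kt_eq (d : ℕ) (hd : 1 ≤ d) (N t : ℝ) (hN : 0 < N) (z : EE d) :
    Ker (mavg d N t) z = ∫ y, KN d N (z + t • y) ∂sig d := avg_fourier d hd _ (bN_int d N hN) t z

lemma lint_scale {d : ℕ} (F : EE d → ℝ≥0∞) (hF : Measurable F) (N : ℝ) (hN : 0 < N) :
    eR (N ^ d) * ∫⁻ z, F (N • z) = ∫⁻ z, F z := by
  have h := Measure.map_addHaar_smul (volume : Measure (EE d)) hN.ne'
  have h2 : ∫⁻ z, F (N • z) = ∫⁻ z, F z ∂(Measure.map (fun z : EE d => N • z) volume) :=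
    (lintegral_map hF (by fun_prop)).symm
  rw [h2, h, lintegral_smul_measure, smul_eq_mul, ← mul_assoc, ← eR_mul (by positivity)]
  simp only [finrank_euclideanSpace, Fintype.card_fin]
  rw [abs_of_pos (by positivity), mul_inv_cancel₀ (by positivity)]; simp

lemma KN_L1 (d : ℕ) (N : ℝ) (hN : 0 < N) :
    ∫⁻ z, ‖KN d N z‖ₑ = ∫⁻ z, ‖KN d 1 z‖ₑ := by
  have h1 : ∀ z, ‖KN d N z‖ₑ = eR (N ^ d) * ‖KN d 1 (N • z)‖ₑ := by
    intro z
    rw [KN_scale d N hN, KN_scale d 1 one_pos, enorm_mul]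
    simp only [one_smul, one_pow, ofReal_one, one_mul]
    rw [← ofReal_norm_eq_enorm, Complex.norm_real, Real.norm_of_nonneg (by positivity)]
  simp_rw [h1]
  rw [lintegral_const_mul' _ _ eR_ne_top]
  exact lint_scale (fun z => ‖KN d 1 z‖ₑ) (KN_cont d 1 one_pos).enorm.measurable N hN

lemma KN_L1_fin (d : ℕ) : ∫⁻ z, ‖KN d 1 z‖ₑ < ⊤ := by
  have h := Ker_integrable _ (bN_one_smooth d) (bN_one_supp d)
  refine lt_of_le_of_lt (lintegral_mono fun z => ?_) h.2
  rw [KN_scale d 1 one_pos]; simp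

lemma Kt_L1 (d : ℕ) (hd : 1 ≤ d) (N t : ℝ) (hN : 0 < N) :
    ∫⁻ z, ‖Ker (mavg d N t) z‖ₑ ≤ ∫⁻ z, ‖KN d 1 z‖ₑ := by
  have := sig_prob hd
  have hK := KN_cont d N hN
  calc ∫⁻ z, ‖Ker (mavg d N t) z‖ₑ ≤ ∫⁻ z, ∫⁻ y, ‖KN d N (z + t • y)‖ₑ ∂sig d := by
        refine lintegral_mono fun z => ?_
        rw [Kt_eq d hd N t hN]
        exact enorm_integral_le_lintegral_enorm _
    _ = ∫⁻ y, (∫⁻ z, ‖KN d N (z + t • y)‖ₑ) ∂sig d := by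
        refine lintegral_lintegral_swap ?_
        apply Continuous.aemeasurable
        unfold uncurry; fun_prop
    _ = ∫⁻ y, (∫⁻ z, ‖KN d 1 z‖ₑ) ∂sig d := by
        refine lintegral_congr fun y => ?_
        rw [lintegral_add_right_eq_self (fun z => ‖KN d N z‖ₑ) (t • y), KN_L1 d N hN]
    _ = _ := by simp

/-- (∞) bound -/
lemma Tt_sup (d : ℕ) (hd : 1 ≤ d) (N t : ℝ) (hN : 0 < N) (h : EE d → ℂ) (hh : Integrable h)
    (B : ℝ≥0∞) (hB : ∀ y, ‖h y‖ₑ ≤ B) (x : EE d) :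
    ‖Tm (mavg d N t) h x‖ₑ ≤ (∫⁻ z, ‖KN d 1 z‖ₑ) * B := by
  rw [Tm_ker _ _ (mavg_int d hd N t hN) hh]
  have hKc := Ker_cont _ (mavg_int d hd N t hN)
  calc _ ≤ ∫⁻ y, ‖Ker (mavg d N t) (x - y) * h y‖ₑ := enorm_integral_le_lintegral_enorm _
    _ ≤ ∫⁻ y, ‖Ker (mavg d N t) (x - y)‖ₑ * B := by
        refine lintegral_mono fun y => ?_
        rw [enorm_mul]; exact mul_le_mul_right (hB y) _
    _ = (∫⁻ y, ‖Ker (mavg d N t) (x - y)‖ₑ) * B :=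
        lintegral_mul_const'' _ (by apply Continuous.aemeasurable; fun_prop)
    _ = (∫⁻ y, ‖Ker (mavg d N t) y‖ₑ) * B := by
        rw [lintegral_sub_left_eq_self (fun z => ‖Ker (mavg d N t) z‖ₑ) x]
    _ ≤ _ := mul_le_mul_left (Kt_L1 d hd N t hN) _

lemma sph_decay (d : ℕ) (hd : 1 ≤ d) (A : ℕ) (hA : d < A) : ∃ C : ℝ≥0, ∀ N > (0:ℝ), ∀ t ≥ (1:ℝ), ∀ z : EE d,
    ∫⁻ y, eR (N ^ d * ((1 + N * ‖z + t • y‖) ^ A)⁻¹) ∂sig d ≤ C * eR N := by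
  have hfin : ∫⁻ y : EE d, eR ((2:ℝ) ^ A * ((1 + ‖y‖) ^ A)⁻¹) < ⊤ := by
    have := (integrable_one_add_norm (E := EE d) (μ := volume) (r := A) (by simpa using hA)).const_mul ((2:ℝ)^A)
    refine lt_of_le_of_lt (le_of_eq ?_) this.2
    refine lintegral_congr fun y => ?_
    beta_reduce
    rw [Real.rpow_neg (by positivity), Real.rpow_natCast, ← ofReal_norm_eq_enorm, Real.norm_of_nonneg (by positivity)]
  set J := ∫⁻ y : EE d, eR ((2:ℝ) ^ A * ((1 + ‖y‖) ^ A)⁻¹) with hJ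
  have hs0 := sphereMeasure_pos hd
  have hs1 : sphereMeasure d univ ≠ ⊤ := measure_ne_top _ _
  refine ⟨((sphereMeasure d univ)⁻¹ * J).toNNReal, fun N hN t ht z => ?_⟩
  rw [ENNReal.coe_toNNReal (ENNReal.mul_ne_top (ENNReal.inv_ne_top.2 hs0) hfin.ne)]
  have hsm := smear hd (fun y => eR (N ^ d * ((1 + N * ‖z + y‖) ^ A)⁻¹))
    (fun y => eR (N ^ d) * eR ((2:ℝ) ^ A * ((1 + ‖N • (z + y)‖) ^ A)⁻¹))
    (by apply Measurable.const_mul; apply meas_eR.comp; fun_prop) (1/N) t (by positivity) (by linarith)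
    (by
      intro y y' hy
      rw [← eR_mul (by positivity)]
      refine eR_le ?_
      refine mul_le_mul_of_nonneg_left ?_ (by positivity)
      rw [norm_smul, Real.norm_of_nonneg hN.le]
      have h1 : ‖z + y'‖ ≤ ‖z + y‖ + 1/N := by
        rw [dist_eq_norm] at hy
        calc ‖z + y'‖ = ‖(z + y) - (y - y')‖ := by congr 1; abel
          _ ≤ _ := (norm_sub_le _ _).trans (by linarith)
      have h2 : 1 + N * ‖z + y'‖ ≤ 2 * (1 + N * ‖z + y‖) := by
        have : N * ‖z + y'‖ ≤ N * (‖z + y‖ + 1/N) := by gcongr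
        have e : N * (‖z + y‖ + 1/N) = N * ‖z + y‖ + 1 := by field_simp
        have : 0 ≤ N * ‖z + y‖ := by positivity
        linarith
      rw [inv_eq_one_div, inv_eq_one_div, mul_one_div, div_le_div_iff₀ (by positivity) (by positivity), one_mul, ← mul_pow]
      exact pow_le_pow_left₀ (by positivity) h2 A)
  rw [lintegral_const_mul' _ _ eR_ne_top] at hsm
  have e3 := lint_scale (d := d) (fun y => eR ((2:ℝ) ^ A * ((1 + ‖y‖) ^ A)⁻¹)) (by
    apply meas_eR.comp; fun_prop) N hN
  have e4 := lintegral_add_left_eq_self (μ := (volume : Measure (EE d))) (fun y => eR ((2:ℝ) ^ A * ((1 + ‖N • y‖) ^ A)⁻¹)) z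
  rw [e4, e3, ← hJ] at hsm
  set Q := ∫⁻ y, eR (N ^ d * ((1 + N * ‖z + t • y‖) ^ A)⁻¹) ∂sig d
  have h5 : eR (1 / N * t ^ (d-1)) ≥ (eR N)⁻¹ := by
    rw [← ENNReal.ofReal_inv_of_pos hN]
    refine eR_le ?_
    rw [one_div]
    exact le_mul_of_one_le_right (by positivity) (one_le_pow₀ ht)
  have h6 : sphereMeasure d univ * ((eR N)⁻¹ * Q) ≤ J := le_trans (by gcongr) hsm
  have hN0 : eR N ≠ 0 := by simpa using hN
  calc Q = (sphereMeasure d univ)⁻¹ * (sphereMeasure d univ * ((eR N)⁻¹ * Q)) * eR N := by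
        rw [← mul_assoc, ENNReal.inv_mul_cancel hs0 hs1, one_mul, mul_comm, ← mul_assoc,
          ENNReal.mul_inv_cancel hN0 eR_ne_top, one_mul]
    _ ≤ _ := by gcongr

lemma Kt_bdd (d : ℕ) (hd : 1 ≤ d) : ∃ C : ℝ≥0, ∀ N > (0:ℝ), ∀ t ≥ (1:ℝ), ∀ z : EE d,
    ‖Ker (mavg d N t) z‖ₑ ≤ C * eR N := by
  obtain ⟨C1, hC1, h1⟩ := KN_decay d (d+1)
  obtain ⟨C2, h2⟩ := sph_decay d hd (d+1) (by omega)
  refine ⟨C1.toNNReal * C2, fun N hN t ht z => ?_⟩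
  rw [Kt_eq d hd N t hN]
  calc _ ≤ ∫⁻ y, ‖KN d N (z + t • y)‖ₑ ∂sig d := enorm_integral_le_lintegral_enorm _
    _ ≤ ∫⁻ y, eR C1 * eR (N ^ d * ((1 + N * ‖z + t • y‖) ^ (d+1))⁻¹) ∂sig d := by
        refine lintegral_mono fun y => ?_
        rw [← ofReal_norm_eq_enorm, ← eR_mul hC1.le, ← mul_assoc]
        exact eR_le (h1 N hN _)
    _ = eR C1 * ∫⁻ y, eR (N ^ d * ((1 + N * ‖z + t • y‖) ^ (d+1))⁻¹) ∂sig d :=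
        lintegral_const_mul' _ _ eR_ne_top
    _ ≤ eR C1 * (C2 * eR N) := by gcongr; exact h2 N hN t ht z
    _ = _ := by rw [ENNReal.coe_mul, mul_assoc]; rfl

/-- (1) bound -/
lemma Tt_one (d : ℕ) (hd : 1 ≤ d) : ∃ C : ℝ≥0, ∀ N > (0:ℝ), ∀ t ≥ (1:ℝ), ∀ h : EE d → ℂ, Integrable h → ∀ x,
    ‖Tm (mavg d N t) h x‖ₑ ≤ C * eR N * ∫⁻ y, ‖h y‖ₑ := by
  obtain ⟨C, hC⟩ := Kt_bdd d hd
  refine ⟨C, fun N hN t ht h hh x => ?_⟩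
  rw [Tm_ker _ _ (mavg_int d hd N t hN) hh]
  calc _ ≤ ∫⁻ y, ‖Ker (mavg d N t) (x - y) * h y‖ₑ := enorm_integral_le_lintegral_enorm _
    _ ≤ ∫⁻ y, C * eR N * ‖h y‖ₑ := by
        refine lintegral_mono fun y => ?_
        rw [enorm_mul]; exact mul_le_mul_left (hC N hN t ht _) _
    _ = _ := lintegral_const_mul' _ _ (ENNReal.mul_ne_top ENNReal.coe_ne_top eR_ne_top)

lemma bessel_inv {d : ℕ} (h : EE d → ℂ) (hh : Integrable h) :
    ∫⁻ x, ‖∫ ξ, ee (inner ℝ ξ x) * h ξ‖ₑ ^ 2 ≤ ∫⁻ y, ‖h y‖ₑ ^ 2 := by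
  refine le_trans (le_of_eq ?_) (bessel h hh)
  rw [← lintegral_neg_eq_self (μ := (volume : Measure (EE d))) (fun x => ‖𝓕 h x‖ₑ ^ 2)]
  refine lintegral_congr fun x => ?_
  rw [fourier_ee]; simp

/-- one-dimensional Sobolev bound -/
lemma sobolev_one (u u' : ℝ → ℂ) (B : ℝ) (hu : ∀ t ∈ Ioo (1:ℝ) 2, HasDerivAt u (u' t) t)
    (hm : Measurable u') (hB : ∀ t ∈ Ioo (1:ℝ) 2, ‖u t‖ ≤ B ∧ ‖u' t‖ ≤ B) (N : ℝ) (hN : 0 < N)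
    (t : ℝ) (ht : t ∈ Ioo (1:ℝ) 2) :
    ‖u t‖ₑ ^ 2 ≤ eR (1 + N) * (∫⁻ s in Ioo (1:ℝ) 2, ‖u s‖ₑ ^ 2) +
      eR (N⁻¹) * ∫⁻ s in Ioo (1:ℝ) 2, ‖u' s‖ₑ ^ 2 := by
  have hcont : ContinuousOn u (Ioo 1 2) := fun s hs => (hu s hs).continuousAt.continuousWithinAt
  have hvol : volume (Ioo (1:ℝ) 2) = 1 := by rw [Real.volume_Ioo]; norm_num
  have hum : AEStronglyMeasurable u (volume.restrict (Ioo (1:ℝ) 2)) := hcont.aestronglyMeasurable measurableSet_Ioo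
  have hi1 : IntegrableOn (fun s => ‖u s‖ ^ 2) (Ioo 1 2) := by
    refine Integrable.of_bound (hum.norm.pow 2) (B ^ 2) ?_
    refine (ae_restrict_iff' measurableSet_Ioo).2 (of_forall fun s hs => ?_)
    rw [norm_pow, norm_norm]; exact pow_le_pow_left₀ (norm_nonneg _) (hB s hs).1 2
  have hi2 : IntegrableOn (fun s => ‖u' s‖ ^ 2) (Ioo 1 2) := by
    refine Measure.integrableOn_of_bounded (M := B ^ 2) (by rw [hvol]; simp) ((hm.norm.pow_const 2).aestronglyMeasurable) ?_
    refine (ae_restrict_iff' measurableSet_Ioo).2 (of_forall fun s hs => ?_)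
    rw [norm_pow, norm_norm]; exact pow_le_pow_left₀ (norm_nonneg _) (hB s hs).2 2
  set J1 := ∫ s in Ioo (1:ℝ) 2, ‖u s‖ ^ 2
  set J2 := ∫ s in Ioo (1:ℝ) 2, ‖u' s‖ ^ 2
  have hder : ∀ s ∈ Ioo (1:ℝ) 2, HasDerivAt (fun s => ‖u s‖ ^ 2) (2 * inner ℝ (u s) (u' s)) s :=
    fun s hs => (hu s hs).norm_sq
  have hle : ∀ s ∈ Ioo (1:ℝ) 2, ‖2 * inner ℝ (u s) (u' s)‖ ≤ N * ‖u s‖ ^ 2 + N⁻¹ * ‖u' s‖ ^ 2 := by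
    intro s hs
    rw [norm_mul, Real.norm_of_nonneg (by norm_num : (0:ℝ) ≤ 2)]
    have h1 : ‖inner ℝ (u s) (u' s)‖ ≤ ‖u s‖ * ‖u' s‖ := norm_inner_le_norm _ _
    have h2 : 0 ≤ N⁻¹ * (N * ‖u s‖ - ‖u' s‖) ^ 2 := by positivity
    have h3 : N⁻¹ * (N * ‖u s‖ - ‖u' s‖) ^ 2 = N * ‖u s‖ ^ 2 + N⁻¹ * ‖u' s‖ ^ 2 - 2 * (‖u s‖ * ‖u' s‖) := by
      field_simp; ring
    linarith
  have hi3 : IntegrableOn (fun s => N * ‖u s‖ ^ 2 + N⁻¹ * ‖u' s‖ ^ 2) (Ioo 1 2) := (hi1.const_mul _).add (hi2.const_mul _)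
  have hi4 : IntegrableOn (fun s => (2 * inner ℝ (u s) (u' s) : ℝ)) (Ioo 1 2) := by
    refine Integrable.mono' hi3 ?_ ((ae_restrict_iff' measurableSet_Ioo).2 (of_forall hle))
    exact (hum.inner hm.aestronglyMeasurable).const_mul 2
  have hpt : ∀ s ∈ Ioo (1:ℝ) 2, ‖u t‖ ^ 2 ≤ ‖u s‖ ^ 2 + (N * J1 + N⁻¹ * J2) := by
    intro s hs
    have hsub : uIcc s t ⊆ Ioo 1 2 := by
      intro y hy
      rw [mem_uIcc] at hy
      rcases hy with hy | hy
      · exact ⟨lt_of_lt_of_le hs.1 hy.1, lt_of_le_of_lt hy.2 ht.2⟩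
      · exact ⟨lt_of_lt_of_le ht.1 hy.1, lt_of_le_of_lt hy.2 hs.2⟩
    have hsub2 : uIoc s t ⊆ Ioo 1 2 := uIoc_subset_uIcc.trans hsub
    have h1 := intervalIntegral.integral_eq_sub_of_hasDerivAt (a := s) (b := t) (fun y hy => hder y (hsub hy))
      (by rw [intervalIntegrable_iff]; exact hi4.mono_set hsub2)
    have h2 : ‖∫ y in s..t, 2 * inner ℝ (u y) (u' y)‖ ≤ ∫ y in Ioo (1:ℝ) 2, N * ‖u y‖ ^ 2 + N⁻¹ * ‖u' y‖ ^ 2 := by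
      refine intervalIntegral.norm_integral_le_integral_norm_uIoc.trans ?_
      calc _ ≤ ∫ y in uIoc s t, N * ‖u y‖ ^ 2 + N⁻¹ * ‖u' y‖ ^ 2 := by
            refine setIntegral_mono_on (hi4.mono_set hsub2).norm (hi3.mono_set hsub2) measurableSet_uIoc fun y hy => hle y (hsub2 hy)
        _ ≤ _ := setIntegral_mono_set hi3 (of_forall fun y => by positivity) (hsub2.eventuallyLE)
    rw [integral_add (hi1.const_mul _) (hi2.const_mul _), integral_const_mul, integral_const_mul, h1] at h2
    have := le_trans (le_abs_self _) h2
    linarith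
  have hreal : ‖u t‖ ^ 2 ≤ (1 + N) * J1 + N⁻¹ * J2 := by
    have h1 : ∫ s in Ioo (1:ℝ) 2, ‖u t‖ ^ 2 ≤ ∫ s in Ioo (1:ℝ) 2, (‖u s‖ ^ 2 + (N * J1 + N⁻¹ * J2)) :=
      setIntegral_mono_on (integrableOn_const (by rw [hvol]; simp)) (hi1.add (integrableOn_const (by rw [hvol]; simp))) measurableSet_Ioo hpt
    rw [integral_add hi1 (integrableOn_const (by rw [hvol]; simp)), setIntegral_const, setIntegral_const] at h1
    simp only [measureReal_def, hvol] at h1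
    simp at h1
    linarith
  have e : ∀ (v : ℝ → ℂ), IntegrableOn (fun s => ‖v s‖ ^ 2) (Ioo 1 2) →
      ∫⁻ s in Ioo (1:ℝ) 2, ‖v s‖ₑ ^ 2 = eR (∫ s in Ioo (1:ℝ) 2, ‖v s‖ ^ 2) := by
    intro v hv
    rw [ofReal_integral_eq_lintegral_ofReal hv (of_forall fun s => by positivity)]
    refine lintegral_congr fun s => ?_
    rw [eR_pow (norm_nonneg _), ofReal_norm_eq_enorm]
  rw [e u hi1, e u' hi2, ← eR_mul (by positivity), ← eR_mul (by positivity),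
    ← eR_add, ← ofReal_norm_eq_enorm, ← eR_pow (norm_nonneg _)]
  · exact eR_le hreal
  · have : 0 ≤ J1 := integral_nonneg fun _ => by positivity
    positivity
  · have : 0 ≤ J2 := integral_nonneg fun _ => by positivity
    positivity

def UU {d : ℕ} (q : ℝ → EE d → ℂ) (G : EE d → ℂ) (t : ℝ) (x : EE d) : ℂ := ∫ ξ, ee (inner ℝ ξ x) * (q t ξ * G ξ)

lemma UU_meas {d : ℕ} (q : ℝ → EE d → ℂ) (G : EE d → ℂ) (hq : Measurable (uncurry q)) (hG : Measurable G) :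
    Measurable (uncurry (UU q G)) := by
  have : StronglyMeasurable (uncurry fun (z : ℝ × EE d) (ξ : EE d) => ee (inner ℝ ξ z.2) * (q z.1 ξ * G ξ)) := by
    apply Measurable.stronglyMeasurable
    have h1 : Measurable fun a : (ℝ × EE d) × EE d => q a.1.1 a.2 := hq.comp (measurable_fst.fst.prodMk measurable_snd)
    have h2 : Measurable fun a : (ℝ × EE d) × EE d => ee (inner ℝ a.2 a.1.2) := ee_cont.measurable.comp (by fun_prop)
    exact h2.mul (h1.mul (hG.comp measurable_snd))
  exact this.integral_prod_right.measurable

lemma UU_pt {d : ℕ} (q : ℝ → EE d → ℂ) (G : EE d → ℂ) (x : EE d) (B t : ℝ)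
    (hb : ∀ ξ, G ξ ≠ 0 → ‖q t ξ‖ ≤ B) (ξ : EE d) : ‖ee (inner ℝ ξ x) * (q t ξ * G ξ)‖ ≤ B * ‖G ξ‖ := by
  rw [norm_mul, ee_norm, one_mul, norm_mul]
  by_cases h0 : G ξ = 0
  · simp [h0]
  · exact mul_le_mul_of_nonneg_right (hb ξ h0) (norm_nonneg _)

lemma UU_bd {d : ℕ} (q : ℝ → EE d → ℂ) (G : EE d → ℂ) (hG : Integrable G) (x : EE d) (B t : ℝ)
    (hb : ∀ ξ, G ξ ≠ 0 → ‖q t ξ‖ ≤ B) : ‖UU q G t x‖ ≤ B * ∫ ξ, ‖G ξ‖ := by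
  rw [← integral_const_mul]
  exact norm_integral_le_of_norm_le (hG.norm.const_mul B) (of_forall (UU_pt q G x B t hb))

lemma UU_ms {d : ℕ} (q : ℝ → EE d → ℂ) (G : EE d → ℂ) (hGm : Measurable G) (hq : Measurable (uncurry q)) (x : EE d) (t : ℝ) :
    AEStronglyMeasurable (fun ξ => ee (inner ℝ ξ x) * (q t ξ * G ξ)) volume := by
  apply Measurable.aestronglyMeasurable
  have h1 : Measurable fun ξ : EE d => ee (inner ℝ ξ x) := ee_cont.measurable.comp (by fun_prop)
  have h2 : Measurable fun ξ : EE d => q t ξ := hq.comp measurable_prodMk_left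
  exact h1.mul (h2.mul hGm)

lemma UU_der {d : ℕ} (q q' : ℝ → EE d → ℂ) (G : EE d → ℂ) (hG : Integrable G) (hGm : Measurable G)
    (hq : Measurable (uncurry q)) (hq' : Measurable (uncurry q')) (B : ℝ)
    (h : ∀ t ∈ Ioo (1:ℝ) 2, ∀ ξ, G ξ ≠ 0 → HasDerivAt (fun t => q t ξ) (q' t ξ) t ∧ ‖q t ξ‖ ≤ B ∧ ‖q' t ξ‖ ≤ B)
    (x : EE d) (t : ℝ) (ht : t ∈ Ioo (1:ℝ) 2) :
    HasDerivAt (fun t => UU q G t x) (UU q' G t x) t := by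
  have hbi : Integrable (fun ξ => B * ‖G ξ‖) := hG.norm.const_mul B
  have h1 : Integrable (fun ξ => ee (inner ℝ ξ x) * (q t ξ * G ξ)) :=
    hbi.mono' (UU_ms q G hGm hq x t) (of_forall (UU_pt q G x B t fun ξ h0 => (h t ht ξ h0).2.1))
  have h2 : ∀ᵐ ξ : EE d, ∀ s ∈ Ioo (1:ℝ) 2, ‖ee (inner ℝ ξ x) * (q' s ξ * G ξ)‖ ≤ B * ‖G ξ‖ :=
    of_forall fun ξ s hs => UU_pt q' G x B s (fun ξ h0 => (h s hs ξ h0).2.2) ξ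
  have h3 : ∀ᵐ ξ : EE d, ∀ s ∈ Ioo (1:ℝ) 2, HasDerivAt (fun s => ee (inner ℝ ξ x) * (q s ξ * G ξ)) (ee (inner ℝ ξ x) * (q' s ξ * G ξ)) s := by
    refine of_forall fun ξ s hs => ?_
    by_cases h0 : G ξ = 0
    · simp only [h0, mul_zero]; exact hasDerivAt_const _ _
    · exact (((h s hs ξ h0).1).mul_const _).const_mul _
  exact (hasDerivAt_integral_of_dominated_loc_of_deriv_le (F := fun t ξ => ee (inner ℝ ξ x) * (q t ξ * G ξ))
      (F' := fun t ξ => ee (inner ℝ ξ x) * (q' t ξ * G ξ)) (s := Ioo 1 2) (bound := fun ξ => B * ‖G ξ‖)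
      (isOpen_Ioo.mem_nhds ht) (of_forall fun t => UU_ms q G hGm hq x t) h1 (UU_ms q' G hGm hq' x t) h2 hbi h3).2

lemma sup_family {d : ℕ} (q q' : ℝ → EE d → ℂ) (G : EE d → ℂ) (hG : Integrable G) (hGm : Measurable G)
    (hq : Measurable (uncurry q)) (hq' : Measurable (uncurry q')) (B : ℝ)
    (h : ∀ t ∈ Ioo (1:ℝ) 2, ∀ ξ, G ξ ≠ 0 → HasDerivAt (fun t => q t ξ) (q' t ξ) t ∧ ‖q t ξ‖ ≤ B ∧ ‖q' t ξ‖ ≤ B)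
    (N : ℝ) (hN : 0 < N) (x : EE d) (t : ℝ) (ht : t ∈ Ioo (1:ℝ) 2) :
    ‖UU q G t x‖ₑ ^ 2 ≤ eR (1 + N) * (∫⁻ s in Ioo (1:ℝ) 2, ‖UU q G s x‖ₑ ^ 2) +
      eR (N⁻¹) * ∫⁻ s in Ioo (1:ℝ) 2, ‖UU q' G s x‖ₑ ^ 2 := by
  have hm : Measurable fun t => UU q' G t x := (UU_meas q' G hq' hGm).of_uncurry_right
  refine sobolev_one (fun t => UU q G t x) (fun t => UU q' G t x) (B * ∫ ξ, ‖G ξ‖)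
    (fun t ht => UU_der q q' G hG hGm hq hq' B h x t ht) hm ?_ N hN t ht
  intro t ht
  exact ⟨UU_bd q G hG x B t fun ξ h0 => (h t ht ξ h0).2.1, UU_bd q' G hG x B t fun ξ h0 => (h t ht ξ h0).2.2⟩

lemma wave_schur (d : ℕ) (hd : 1 ≤ d) : ∃ C : ℝ≥0, ∀ r > (0:ℝ), ∀ ξ : EE d,
    ∫⁻ ξ', eR (r ^ d * rexp (-(rpi * r ^ 2) * ‖ξ' - ξ‖ ^ 2) *
      rexp (-(rpi * 1 ^ 2) * ‖(‖ξ'‖ - ‖ξ‖)‖ ^ 2)) ≤ C * eR r := by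
  have hfin : ∫⁻ y : EE d, eR (rexp rpi * rexp (-(rpi / 2) * ‖y‖ ^ 2)) < ⊤ :=
    ((gauss_int (V := EE d) (rpi / 2) (by positivity)).const_mul (rexp rpi)).lintegral_lt_top
  set J := ∫⁻ y : EE d, eR (rexp rpi * rexp (-(rpi / 2) * ‖y‖ ^ 2)) with hJ
  refine ⟨J.toNNReal, fun r hr ξ => ?_⟩
  rw [ENNReal.coe_toNNReal hfin.ne, polar_lintegral hd _ (by apply meas_eR.comp; fun_prop)]
  have hsm : ∀ s ∈ Ioi (0:ℝ), sphereMeasure d univ * (eR (1/r * s^(d-1)) *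
      ∫⁻ w, eR (r ^ d * rexp (-(rpi * r ^ 2) * ‖s • w - ξ‖ ^ 2)) ∂sig d) ≤ J := by
    intro s hs
    have h1 := smear hd (fun y => eR (r ^ d * rexp (-(rpi * r ^ 2) * ‖y - ξ‖ ^ 2)))
      (fun y => eR (r ^ d) * eR (rexp rpi * rexp (-(rpi / 2) * ‖r • (y - ξ)‖ ^ 2)))
      (by apply Measurable.const_mul; apply meas_eR.comp; fun_prop) (1/r) s (by positivity) hs
      (by
        intro y y' hy
        rw [← eR_mul (by positivity), ← Real.exp_add]
        refine eR_le (mul_le_mul_of_nonneg_left (Real.exp_le_exp.2 ?_) (by positivity))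
        rw [norm_smul, Real.norm_of_nonneg hr.le]
        have h1 : ‖y' - ξ‖ ≤ ‖y - ξ‖ + 1/r := by
          rw [dist_eq_norm] at hy
          calc ‖y' - ξ‖ = ‖(y - ξ) - (y - y')‖ := by congr 1; abel
            _ ≤ _ := (norm_sub_le _ _).trans (by linarith)
        have h2 : r * ‖y' - ξ‖ ≤ r * ‖y - ξ‖ + 1 := by
          have : r * ‖y' - ξ‖ ≤ r * (‖y - ξ‖ + 1/r) := by gcongr
          have e : r * (‖y - ξ‖ + 1/r) = r * ‖y - ξ‖ + 1 := by field_simp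
          linarith
        have h3 : (r * ‖y' - ξ‖) ^ 2 ≤ (r * ‖y - ξ‖ + 1) ^ 2 := pow_le_pow_left₀ (by positivity) h2 2
        have h4 : (r * ‖y' - ξ‖) ^ 2 ≤ 2 * (r * ‖y - ξ‖) ^ 2 + 2 := by nlinarith [sq_nonneg (r * ‖y - ξ‖ - 1)]
        have := rpi_pos
        nlinarith)
    refine h1.trans (le_of_eq ?_)
    rw [lintegral_const_mul' _ _ eR_ne_top]
    rw [lintegral_sub_right_eq_self (μ := (volume : Measure (EE d))) (fun y => eR (rexp rpi * rexp (-(rpi / 2) * ‖r • y‖ ^ 2))) ξ]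
    exact lint_scale (d := d) (fun y => eR (rexp rpi * rexp (-(rpi / 2) * ‖y‖ ^ 2))) (by
      apply meas_eR.comp; fun_prop) r hr
  have hpt : ∀ s ∈ Ioi (0:ℝ), sphereMeasure d univ * (eR (s^(d-1)) * ∫⁻ w, eR (r ^ d * rexp (-(rpi * r ^ 2) * ‖s • w - ξ‖ ^ 2) *
      rexp (-(rpi * 1 ^ 2) * ‖(‖s • w‖ - ‖ξ‖)‖ ^ 2)) ∂sig d) ≤ (J * eR r) *
        eR (1 ^ 1 * rexp (-(rpi * 1 ^ 2) * ‖s - ‖ξ‖‖ ^ 2)) := by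
    intro s hs
    have e1 : ∫⁻ w, eR (r ^ d * rexp (-(rpi * r ^ 2) * ‖s • w - ξ‖ ^ 2) *
      rexp (-(rpi * 1 ^ 2) * ‖(‖s • w‖ - ‖ξ‖)‖ ^ 2)) ∂sig d = (∫⁻ w, eR (r ^ d * rexp (-(rpi * r ^ 2) * ‖s • w - ξ‖ ^ 2)) ∂sig d) *
        eR (1 ^ 1 * rexp (-(rpi * 1 ^ 2) * ‖s - ‖ξ‖‖ ^ 2)) := by
      rw [← lintegral_mul_const' _ _ eR_ne_top]
      refine lintegral_congr_ae ?_
      filter_upwards [sig_norm d] with w hw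
      rw [norm_smul, hw, mul_one, Real.norm_of_nonneg (le_of_lt hs), eR_mul (by positivity)]
      simp
    rw [e1, ← mul_assoc, ← mul_assoc]
    refine mul_le_mul_left ?_ _
    have h2 := hsm s hs
    have hs' : (0:ℝ) < s := hs
    have e2 : eR (s^(d-1)) = eR (1/r * s^(d-1)) * eR r := by
      rw [← eR_mul (by positivity)]; congr 1; field_simp
    rw [e2]
    refine le_trans (le_of_eq ?_) (mul_le_mul_left h2 _)
    ring
  rw [← lintegral_const_mul' _ _ (measure_ne_top _ _)]
  refine (setLIntegral_mono' measurableSet_Ioi hpt).trans ?_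
  rw [lintegral_const_mul' _ _ (ENNReal.mul_ne_top hfin.ne eR_ne_top)]
  refine (mul_le_mul_right ((setLIntegral_le_lintegral _ _)) _).trans ?_
  have h1 := gauss_mass (V := ℝ) 1 one_pos
  rw [Module.finrank_self] at h1
  rw [lintegral_sub_right_eq_self (μ := (volume : Measure ℝ)) (fun s => eR (1 ^ 1 * rexp (-(rpi * 1 ^ 2) * ‖s‖ ^ 2))) ‖ξ‖, h1, mul_one]

lemma meas_swap2 {α β γ : Type*} [MeasurableSpace α] [MeasurableSpace β] [MeasurableSpace γ] {f : α → β → γ}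
    (hf : Measurable (uncurry f)) : Measurable fun z : β × α => f z.2 z.1 := hf.comp measurable_swap

set_option maxHeartbeats 600000 in
lemma wave_L2 (d : ℕ) (hd : 1 ≤ d) : ∃ C : ℝ≥0, ∀ r > (0:ℝ), ∀ ε : ℝ, |ε| = 1 → ∀ G : EE d → ℂ, Integrable G → Measurable G →
    ∫⁻ x in ball (0 : EE d) (3*r), ∫⁻ t in Ioo (1:ℝ) 2, ‖UU (fun t ξ => ee (ε * (t * ‖ξ‖))) G t x‖ₑ ^ 2 ≤ C * eR r * ∫⁻ ξ, ‖G ξ‖ₑ ^ 2 := by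
  obtain ⟨C, hC⟩ := wave_schur d hd
  refine ⟨(rexp (13 * rpi)).toNNReal * C, fun r hr ε hε G hG hGm => ?_⟩
  set U := UU (d := d) (fun t ξ => ee (ε * (t * ‖ξ‖))) G with hU
  have hqm : Measurable (uncurry fun (t : ℝ) (ξ : EE d) => ee (ε * (t * ‖ξ‖))) :=
    ee_cont.measurable.comp (by fun_prop)
  have hUm : Measurable (uncurry U) := UU_meas _ G hqm hGm
  let w : EE d × ℝ → ℝ := fun z => rexp (-(rpi / r ^ 2) * ‖z.1‖ ^ 2) * rexp (-(rpi / 1 ^ 2) * ‖z.2‖ ^ 2)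
  have hwi : Integrable w (volume.prod volume) :=
    (gauss_int (V := EE d) (rpi / r ^ 2) (by positivity)).mul_prod (gauss_int (V := ℝ) (rpi / 1 ^ 2) (by positivity))
  have hw0 : ∀ z, 0 ≤ w z := fun z => by positivity
  have main := ttstar_schur (volume.prod volume) (volume : Measure (EE d)) w hw0 hwi
    (fun z ξ => ee (inner ℝ ξ z.1) * ee (ε * (z.2 * ‖ξ‖))) ?_ ?_
    (fun ξ ξ' => eR (r ^ d * rexp (-(rpi * r ^ 2) * ‖ξ' - ξ‖ ^ 2) *
      rexp (-(rpi * 1 ^ 2) * ‖(‖ξ'‖ - ‖ξ‖)‖ ^ 2))) ?_ ?_ ?_ (C * eR r) (of_forall (hC r hr)) G hG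
  · have hUeq : ∀ z : EE d × ℝ, ∫ ξ, ee (inner ℝ ξ z.1) * ee (ε * (z.2 * ‖ξ‖)) * G ξ = U z.2 z.1 := by
      intro z
      rw [hU, UU]
      simp only [mul_assoc]
    simp_rw [hUeq] at main
    have hUm2 : Measurable (fun z : EE d × ℝ => ‖U z.2 z.1‖ₑ ^ 2) := by
      have : Measurable (fun z : EE d × ℝ => U z.2 z.1) := meas_swap2 hUm
      fun_prop
    calc ∫⁻ x in ball (0 : EE d) (3*r), ∫⁻ t in Ioo (1:ℝ) 2, ‖U t x‖ₑ ^ 2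
        = ∫⁻ z in ball (0 : EE d) (3*r) ×ˢ Ioo (1:ℝ) 2, ‖U z.2 z.1‖ₑ ^ 2 ∂(volume.prod volume) := by
          rw [← Measure.prod_restrict, lintegral_prod _ hUm2.aemeasurable]
      _ ≤ ∫⁻ z in ball (0 : EE d) (3*r) ×ˢ Ioo (1:ℝ) 2, eR (rexp (13 * rpi)) * eR (w z * ‖U z.2 z.1‖ ^ 2) ∂(volume.prod volume) := by
          refine setLIntegral_mono' (measurableSet_ball.prod measurableSet_Ioo) fun z hz => ?_
          rw [← eR_mul (by positivity), ← ofReal_norm_eq_enorm, ← eR_pow (norm_nonneg _)]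
          refine eR_le ?_
          rw [← mul_assoc]
          refine le_mul_of_one_le_left (by positivity) ?_
          simp only [w]
          rw [← Real.exp_add, ← Real.exp_add, Real.one_le_exp_iff]
          have h1 : ‖z.1‖ < 3 * r := by simpa using hz.1
          have h2 : ‖z.1‖ ^ 2 ≤ 9 * r ^ 2 := by nlinarith [norm_nonneg z.1]
          have h3 : rpi / r ^ 2 * ‖z.1‖ ^ 2 ≤ rpi / r ^ 2 * (9 * r ^ 2) := by gcongr
          have h4 : rpi / r ^ 2 * (9 * r ^ 2) = 9 * rpi := by field_simp
          have h5 : ‖z.2‖ ^ 2 ≤ 4 := by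
            rw [norm_abs, sq_abs]; nlinarith [hz.2.1, hz.2.2]
          have := rpi_pos
          nlinarith
      _ ≤ ∫⁻ z, eR (rexp (13 * rpi)) * eR (w z * ‖U z.2 z.1‖ ^ 2) ∂(volume.prod volume) := setLIntegral_le_lintegral _ _
      _ = eR (rexp (13 * rpi)) * ∫⁻ z, eR (w z * ‖U z.2 z.1‖ ^ 2) ∂(volume.prod volume) := lintegral_const_mul' _ _ eR_ne_top
      _ ≤ eR (rexp (13 * rpi)) * (C * eR r * ∫⁻ ξ, ‖G ξ‖ₑ ^ 2) := by gcongr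
      _ = _ := by rw [ENNReal.coe_mul, eR]; ring
  · have h1 : Continuous (fun a : (EE d × ℝ) × EE d => ee (inner ℝ a.2 a.1.1) * ee (ε * (a.1.2 * ‖a.2‖))) := by
      have := ee_cont
      fun_prop
    exact h1.measurable
  · intro z ξ; rw [norm_mul, ee_norm, ee_norm, one_mul]
  · unfold uncurry; apply meas_eR.comp; fun_prop
  · intro ξ ξ'; rw [norm_sub_rev ξ' ξ, norm_sub_rev ‖ξ'‖ ‖ξ‖]
  · intro ξ ξ'
    have e1 : ∀ z : EE d × ℝ, (w z : ℂ) * (ee (inner ℝ ξ z.1) * ee (ε * (z.2 * ‖ξ‖)) * (starRingEnd ℂ) (ee (inner ℝ ξ' z.1) * ee (ε * (z.2 * ‖ξ'‖)))) =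
       (((rexp (-(rpi / r ^ 2) * ‖z.1‖ ^ 2) : ℝ) : ℂ) * ee (inner ℝ z.1 (ξ - ξ'))) *
       (((rexp (-(rpi / 1 ^ 2) * ‖z.2‖ ^ 2) : ℝ) : ℂ) * ee (inner ℝ z.2 (ε * (‖ξ‖ - ‖ξ'‖)))) := by
      intro z
      rw [map_mul, ee_conj, ee_conj, inner_sub_right, real_inner_comm ξ z.1, real_inner_comm ξ' z.1]
      have : inner ℝ z.2 (ε * (‖ξ‖ - ‖ξ'‖)) = ε * (z.2 * ‖ξ‖) + - (ε * (z.2 * ‖ξ'‖)) := by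
        simp; ring
      rw [this, sub_eq_add_neg, ee_add, ee_add]
      simp only [w, ofReal_mul]
      ring
    simp_rw [e1]
    rw [integral_prod_mul (fun x : EE d => ((rexp (-(rpi / r ^ 2) * ‖x‖ ^ 2) : ℝ) : ℂ) * ee (inner ℝ x (ξ - ξ')))
      (fun t : ℝ => ((rexp (-(rpi / 1 ^ 2) * ‖t‖ ^ 2) : ℝ) : ℂ) * ee (inner ℝ t (ε * (‖ξ‖ - ‖ξ'‖))))]
    rw [gauss_fourier r hr, gauss_fourier 1 one_pos, ← ofReal_mul, ← ofReal_norm_eq_enorm, Complex.norm_real, Real.norm_of_nonneg (by positivity)]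
    refine le_of_eq ?_
    congr 1
    rw [norm_sub_rev ξ ξ', norm_mul, norm_abs ε, hε, one_mul, norm_sub_rev ‖ξ‖ ‖ξ'‖]
    simp

def ZZ {d : ℕ} (q q' : ℝ → EE d → ℂ) (G : EE d → ℂ) (N : ℝ) (x : EE d) : ℝ≥0∞ :=
  eR (1 + N) * (∫⁻ s in Ioo (1:ℝ) 2, ‖UU q G s x‖ₑ ^ 2) +
      eR (N⁻¹) * ∫⁻ s in Ioo (1:ℝ) 2, ‖UU q' G s x‖ₑ ^ 2

lemma UUsq_meas {d : ℕ} (q : ℝ → EE d → ℂ) (G : EE d → ℂ) (hGm : Measurable G)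
    (hq : Measurable (uncurry q)) : Measurable (uncurry fun (x : EE d) (s : ℝ) => ‖UU q G s x‖ₑ ^ 2) := by
  have h := meas_swap2 (UU_meas q G hq hGm)
  exact (h.enorm.pow_const 2)

lemma ZZ_meas {d : ℕ} (q q' : ℝ → EE d → ℂ) (G : EE d → ℂ) (hGm : Measurable G)
    (hq : Measurable (uncurry q)) (hq' : Measurable (uncurry q')) (N : ℝ) : Measurable (ZZ q q' G N) := by
  have h1 := (UUsq_meas q G hGm hq).lintegral_prod_right' (ν := volume.restrict (Ioo (1:ℝ) 2))
  have h2 := (UUsq_meas q' G hGm hq').lintegral_prod_right' (ν := volume.restrict (Ioo (1:ℝ) 2))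
  exact (h1.const_mul _).add (h2.const_mul _)

lemma ZZ_int {d : ℕ} (q q' : ℝ → EE d → ℂ) (G : EE d → ℂ) (hGm : Measurable G)
    (hq : Measurable (uncurry q)) (hq' : Measurable (uncurry q')) (N : ℝ) (S : Set (EE d)) (A A' : ℝ≥0∞)
    (h1 : ∫⁻ x in S, ∫⁻ t in Ioo (1:ℝ) 2, ‖UU q G t x‖ₑ ^ 2 ≤ A)
    (h2 : ∫⁻ x in S, ∫⁻ t in Ioo (1:ℝ) 2, ‖UU q' G t x‖ₑ ^ 2 ≤ A') :
    ∫⁻ x in S, ZZ q q' G N x ≤ eR (1 + N) * A + eR (N⁻¹) * A' := by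
  have m1 := (UUsq_meas q G hGm hq).lintegral_prod_right' (ν := volume.restrict (Ioo (1:ℝ) 2))
  have e : ∫⁻ x in S, ZZ q q' G N x = eR (1 + N) * (∫⁻ x in S, ∫⁻ t in Ioo (1:ℝ) 2, ‖UU q G t x‖ₑ ^ 2) +
      eR (N⁻¹) * ∫⁻ x in S, ∫⁻ t in Ioo (1:ℝ) 2, ‖UU q' G t x‖ₑ ^ 2 := by
    rw [← lintegral_const_mul' _ _ eR_ne_top, ← lintegral_const_mul' _ _ eR_ne_top]
    exact lintegral_add_left (m1.const_mul _) _
  rw [e]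
  gcongr

lemma wave_piece (d : ℕ) (hd : 1 ≤ d) : ∃ C : ℝ≥0, ∀ N ≥ (1:ℝ), ∀ r > (0:ℝ), ∀ ε : ℝ, |ε| = 1 → ∀ G : EE d → ℂ,
    Integrable G → Measurable G → (∀ ξ, G ξ ≠ 0 → ‖ξ‖ ≤ 5/2 * N) →
    ∃ Z : EE d → ℝ≥0∞, Measurable Z ∧ (∀ x, ∀ t ∈ Ioo (1:ℝ) 2, ‖UU (fun t ξ => ee (ε * (t * ‖ξ‖))) G t x‖ₑ ^ 2 ≤ Z x) ∧
      ∫⁻ x in ball 0 (3*r), Z x ≤ C * eR (r * N) * ∫⁻ ξ, ‖G ξ‖ₑ ^ 2 := by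
  obtain ⟨C, hC⟩ := wave_L2 d hd
  refine ⟨C * (2 + (5 * rpi) ^ 2).toNNReal, fun N hN r hr ε hε G hG hGm hs => ?_⟩
  set q : ℝ → EE d → ℂ := fun t ξ => ee (ε * (t * ‖ξ‖)) with hqdef
  set q' : ℝ → EE d → ℂ := fun t ξ => (2 * rpi * I * (ε * ‖ξ‖ : ℝ)) * ee (ε * (t * ‖ξ‖)) with hqdef'
  have hqm : Measurable (uncurry q) := ee_cont.measurable.comp (by fun_prop)
  have hqm' : Measurable (uncurry q') := by
    have h1 : Measurable (fun a : ℝ × EE d => ee (ε * (a.1 * ‖a.2‖))) := hqm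
    have h2 : Measurable (fun a : ℝ × EE d => (2 * rpi * I * (ε * ‖a.2‖ : ℝ) : ℂ)) := by fun_prop
    exact h2.mul h1
  set G' : EE d → ℂ := fun ξ => (2 * rpi * I * (ε * ‖ξ‖ : ℝ)) * G ξ with hG'
  have hfac : ∀ ξ, G ξ ≠ 0 → ‖(2 * rpi * I * (ε * ‖ξ‖ : ℝ) : ℂ)‖ ≤ 5 * rpi * N := by
    intro ξ h0
    have := hs ξ h0
    simp only [norm_mul, Complex.norm_real, norm_norm, norm_abs, abs_mul, abs_norm, hε, Complex.norm_I, one_mul, mul_one, abs_of_pos rpi_pos]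
    rw [Complex.norm_ofNat]
    nlinarith [rpi_pos]
  have hGle : ∀ ξ, ‖G' ξ‖ ≤ 5 * rpi * N * ‖G ξ‖ := by
    intro ξ
    by_cases h0 : G ξ = 0
    · simp [hG', h0]
    · rw [hG', norm_mul]; exact mul_le_mul_of_nonneg_right (hfac ξ h0) (norm_nonneg _)
  have hGm' : Measurable G' := by
    have h2 : Measurable (fun ξ : EE d => (2 * rpi * I * (ε * ‖ξ‖ : ℝ) : ℂ)) := by fun_prop
    exact h2.mul hGm
  have hGi' : Integrable G' := (hG.norm.const_mul _).mono' hGm'.aestronglyMeasurable (of_forall hGle)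
  have hUU : ∀ t x, UU q' G t x = UU q G' t x := by
    intro t x
    unfold UU
    congr 1; funext ξ
    rw [hqdef', hG']; ring
  have h2 := hC r hr ε hε G' hGi' hGm'
  rw [← hqdef] at h2
  simp_rw [← hUU] at h2
  have hGsq : ∫⁻ ξ, ‖G' ξ‖ₑ ^ 2 ≤ eR ((5 * rpi * N) ^ 2) * ∫⁻ ξ, ‖G ξ‖ₑ ^ 2 := by
    rw [← lintegral_const_mul' _ _ eR_ne_top]
    refine lintegral_mono fun ξ => ?_
    rw [← ofReal_norm_eq_enorm, ← ofReal_norm_eq_enorm, ← eR_pow (norm_nonneg _), ← eR_pow (norm_nonneg _),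
      ← eR_mul (by positivity), ← mul_pow]
    exact eR_le (pow_le_pow_left₀ (norm_nonneg _) (hGle ξ) 2)
  refine ⟨ZZ q q' G N, ZZ_meas q q' G hGm hqm hqm' N, fun x t ht => ?_, ?_⟩
  · refine sup_family q q' G hG hGm hqm hqm' (1 + 5 * rpi * N) ?_ N (by linarith) x t ht
    intro t ht ξ h0
    refine ⟨?_, ?_, ?_⟩
    · have h1 : HasDerivAt (fun t : ℝ => ε * (t * ‖ξ‖)) (ε * ‖ξ‖) t := by
        simpa using ((hasDerivAt_id t).mul_const ‖ξ‖).const_mul ε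
      have h3 := (ee_deriv (ε * (t * ‖ξ‖))).scomp t h1
      refine h3.congr_deriv ?_
      rw [hqdef', real_smul]; push_cast; ring
    · rw [hqdef]; beta_reduce; rw [ee_norm]
      have : 0 ≤ 5 * rpi * N := by positivity
      linarith
    · rw [hqdef']; beta_reduce; rw [norm_mul, ee_norm, mul_one]
      linarith [hfac ξ h0]
  · refine (ZZ_int q q' G hGm hqm hqm' N _ _ _ (hC r hr ε hε G hG hGm) h2).trans ?_
    set S := ∫⁻ ξ, ‖G ξ‖ₑ ^ 2
    calc _ ≤ eR (1 + N) * (C * eR r * S) + eR N⁻¹ * (C * eR r * (eR ((5 * rpi * N) ^ 2) * S)) := by gcongr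
      _ = C * S * (eR (1 + N) * eR r + eR N⁻¹ * eR r * eR ((5 * rpi * N) ^ 2)) := by ring
      _ ≤ C * S * eR ((2 + (5 * rpi) ^ 2) * (r * N)) := by
        gcongr
        have hN0 : 0 < N := by linarith
        rw [← eR_mul (by positivity), ← eR_mul (by positivity), ← eR_mul (by positivity), ← eR_add (by positivity) (by positivity)]
        refine eR_le ?_
        have : N⁻¹ * r * (5 * rpi * N) ^ 2 = (5 * rpi) ^ 2 * (r * N) := by field_simp
        rw [this]
        nlinarith
      _ = _ := by
        rw [eR_mul (by positivity), ENNReal.coe_mul]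
        rw [show eR (2 + (5 * rpi) ^ 2) = ((2 + (5 * rpi) ^ 2).toNNReal : ℝ≥0∞) from rfl]; ring

lemma bessel_piece (d : ℕ) (q : ℝ → EE d → ℂ) (G : EE d → ℂ) (hG : Integrable G) (hGm : Measurable G)
    (hq : Measurable (uncurry q)) (B : ℝ)
    (h : ∀ t ∈ Ioo (1:ℝ) 2, ∀ ξ, G ξ ≠ 0 → ‖q t ξ‖ ≤ B) (S : Set (EE d)) :
    ∫⁻ x in S, ∫⁻ t in Ioo (1:ℝ) 2, ‖UU q G t x‖ₑ ^ 2 ≤ eR (B ^ 2) * ∫⁻ ξ, ‖G ξ‖ₑ ^ 2 := by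
  calc _ ≤ ∫⁻ x, ∫⁻ t in Ioo (1:ℝ) 2, ‖UU q G t x‖ₑ ^ 2 := setLIntegral_le_lintegral _ _
    _ = ∫⁻ t in Ioo (1:ℝ) 2, ∫⁻ x, ‖UU q G t x‖ₑ ^ 2 := lintegral_lintegral_swap (UUsq_meas q G hGm hq).aemeasurable
    _ ≤ ∫⁻ t in Ioo (1:ℝ) 2, eR (B ^ 2) * ∫⁻ ξ, ‖G ξ‖ₑ ^ 2 := by
        refine setLIntegral_mono' measurableSet_Ioo fun t ht => ?_
        have hle : ∀ ξ, ‖q t ξ * G ξ‖ ≤ B * ‖G ξ‖ := by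
          intro ξ
          by_cases h0 : G ξ = 0
          · simp [h0]
          · rw [norm_mul]; exact mul_le_mul_of_nonneg_right (h t ht ξ h0) (norm_nonneg _)
        have hqt : Measurable fun ξ => q t ξ := hq.of_uncurry_left
        have hint : Integrable fun ξ => q t ξ * G ξ := (hG.norm.const_mul B).mono' (hqt.mul hGm).aestronglyMeasurable (of_forall hle)
        refine (bessel_inv _ hint).trans ?_
        rw [← lintegral_const_mul' _ _ eR_ne_top]
        refine lintegral_mono fun ξ => ?_
        rw [← ofReal_norm_eq_enorm, ← ofReal_norm_eq_enorm, ← eR_pow (norm_nonneg _), ← eR_pow (norm_nonneg _),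
          ← eR_mul (by positivity), ← mul_pow]
        exact eR_le (pow_le_pow_left₀ (norm_nonneg _) (hle ξ) 2)
    _ = _ := by
        rw [setLIntegral_const, Real.volume_Ioo]; norm_num

lemma err_piece (d : ℕ) (er er' : ℝ → ℂ) (C : ℝ) (hC : 0 < C)
    (her : ∀ s ≥ (1:ℝ), HasDerivAt er (er' s) s ∧ ‖er s‖ ≤ C / s ∧ ‖er' s‖ ≤ C / s) (N : ℝ) (hN : 2 ≤ N) (r : ℝ)
    (hr : 1 ≤ N * r) (G : EE d → ℂ)
    (hG : Integrable G) (hGm : Measurable G) (hs : ∀ ξ, G ξ ≠ 0 → N / 2 ≤ ‖ξ‖) :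
    ∃ Z : EE d → ℝ≥0∞, Measurable Z ∧ (∀ x, ∀ t ∈ Ioo (1:ℝ) 2, ‖UU (fun t ξ => er (max 1 (t * ‖ξ‖))) G t x‖ₑ ^ 2 ≤ Z x) ∧
      ∫⁻ x in ball 0 (3*r), Z x ≤ eR (9 * C ^ 2 * (r * N)) * ∫⁻ ξ, ‖G ξ‖ₑ ^ 2 := by
  set er1 : ℝ → ℂ := fun s => er (max 1 s) with her1
  have hN0 : 0 < N := by linarith
  have hcont : Continuous er1 := by
    rw [continuous_iff_continuousAt]
    intro s
    exact ContinuousAt.comp (f := fun s : ℝ => max 1 s) (her (max 1 s) (le_max_left _ _)).1.continuousAt (by fun_prop)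
  set q : ℝ → EE d → ℂ := fun t ξ => er1 (t * ‖ξ‖) with hqdef
  set q' : ℝ → EE d → ℂ := fun t ξ => (‖ξ‖ : ℂ) * deriv er1 (t * ‖ξ‖) with hqdef'
  have hqm : Measurable (uncurry q) := hcont.measurable.comp (by fun_prop)
  have hqm' : Measurable (uncurry q') := by
    have h1 : Measurable (fun a : ℝ × EE d => deriv er1 (a.1 * ‖a.2‖)) := (measurable_deriv er1).comp (by fun_prop)
    have h2 : Measurable (fun a : ℝ × EE d => (‖a.2‖ : ℂ)) := by fun_prop
    exact h2.mul h1
  have hgt : ∀ t ∈ Ioo (1:ℝ) 2, ∀ ξ, G ξ ≠ 0 → 1 < t * ‖ξ‖ := by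
    intro t ht ξ h0
    have := hs ξ h0
    nlinarith [ht.1]
  have hder1 : ∀ s > 1, HasDerivAt er1 (er' s) s := by
    intro s hs1
    refine (her s hs1.le).1.congr_of_eventuallyEq ?_
    filter_upwards [lt_mem_nhds hs1] with y hy
    rw [her1]; beta_reduce; rw [max_eq_right hy.le]
  have hb1 : ∀ t ∈ Ioo (1:ℝ) 2, ∀ ξ, G ξ ≠ 0 → ‖q t ξ‖ ≤ 2 * C / N := by
    intro t ht ξ h0
    have hg := hgt t ht ξ h0
    have hx := hs ξ h0
    rw [hqdef, her1]; beta_reduce; rw [max_eq_right hg.le]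
    refine (her _ hg.le).2.1.trans ?_
    rw [div_le_div_iff₀ (by linarith) hN0]
    have h5 : N / 2 ≤ t * ‖ξ‖ := by nlinarith [ht.1]
    nlinarith
  have hb2 : ∀ t ∈ Ioo (1:ℝ) 2, ∀ ξ, G ξ ≠ 0 → ‖q' t ξ‖ ≤ C := by
    intro t ht ξ h0
    have hg := hgt t ht ξ h0
    have hx := hs ξ h0
    rw [hqdef']; beta_reduce
    rw [(hder1 _ hg).deriv, norm_mul, Complex.norm_real, norm_norm]
    have h1 := (her _ hg.le).2.2
    have hpos : 0 < ‖ξ‖ := by linarith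
    calc ‖ξ‖ * ‖er' (t * ‖ξ‖)‖ ≤ ‖ξ‖ * (C / (t * ‖ξ‖)) := by gcongr
      _ = C / t := by have := ht.1; field_simp
      _ ≤ C := div_le_self hC.le ht.1.le
  refine ⟨ZZ q q' G N, ZZ_meas q q' G hGm hqm hqm' N, fun x t ht => ?_, ?_⟩
  · refine sup_family q q' G hG hGm hqm hqm' (2 * C / N + C) ?_ N (by linarith) x t ht
    intro t ht ξ h0
    refine ⟨?_, (hb1 t ht ξ h0).trans (by linarith), (hb2 t ht ξ h0).trans ?_⟩
    · have hg := hgt t ht ξ h0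
      have h1 : HasDerivAt (fun t : ℝ => t * ‖ξ‖) ‖ξ‖ t := by
        simpa using (hasDerivAt_id t).mul_const ‖ξ‖
      have h3 := (hder1 _ hg).scomp t h1
      refine h3.congr_deriv ?_
      rw [hqdef', real_smul]; beta_reduce; rw [(hder1 _ hg).deriv]
    · have : 0 ≤ 2 * C / N := by positivity
      linarith
  · refine (ZZ_int q q' G hGm hqm hqm' N _ _ _ (bessel_piece d q G hG hGm hqm _ hb1 _) (bessel_piece d q' G hG hGm hqm' _ hb2 _)).trans ?_
    rw [← mul_assoc, ← mul_assoc, ← add_mul]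
    gcongr
    rw [← eR_mul (by positivity), ← eR_mul (by positivity), ← eR_add (by positivity) (by positivity)]
    refine eR_le ?_
    have h1 : (1 + N) * (2 * C / N) ^ 2 + N⁻¹ * C ^ 2 ≤ 9 * C ^ 2 * N⁻¹ := by
      have : (1 + N) * (2 * C / N) ^ 2 + N⁻¹ * C ^ 2 = C ^ 2 * N⁻¹ * (4 * (1 + N) / N + 1) := by field_simp; ring
      rw [this]
      have h2 : 4 * (1 + N) / N ≤ 8 := by rw [div_le_iff₀ hN0]; linarith
      have : 0 ≤ C ^ 2 * N⁻¹ := by positivity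
      nlinarith
    refine h1.trans ?_
    have h2 : N⁻¹ ≤ r * N := by
      rw [inv_le_iff_one_le_mul₀ hN0]; nlinarith
    gcongr

lemma enorm_sq3 (a b c : ℂ) : ‖a + b + c‖ₑ ^ 2 ≤ 3 * (‖a‖ₑ ^ 2 + ‖b‖ₑ ^ 2 + ‖c‖ₑ ^ 2) := by
  have h : ∀ z : ℂ, ‖z‖ₑ ^ 2 = eR (‖z‖ ^ 2) := fun z => by
    rw [← ofReal_norm_eq_enorm, eR_pow (norm_nonneg _)]
  rw [h, h, h, h, ← eR_add (by positivity) (by positivity), ← eR_add (by positivity) (by positivity),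
    show (3:ℝ≥0∞) = eR 3 by simp, ← eR_mul (by norm_num)]
  refine eR_le ?_
  have h1 := norm_add_le (a + b) c
  have h2 := norm_add_le a b
  have h3 : ‖a+b+c‖ ≤ ‖a‖ + ‖b‖ + ‖c‖ := by linarith
  have h4 := pow_le_pow_left₀ (norm_nonneg _) h3 2
  nlinarith [sq_nonneg (‖a‖-‖b‖), sq_nonneg (‖a‖-‖c‖), sq_nonneg (‖b‖-‖c‖)]

lemma L2max (d : ℕ) (hd : 1 ≤ d) : ∃ C : ℝ≥0, ∀ N ≥ (2:ℝ), ∀ r > (0:ℝ), 1 ≤ N * r → ∀ h : EE d → ℂ, Integrable h →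
    ∃ Z : EE d → ℝ≥0∞, Measurable Z ∧ (∀ x, ∀ t ∈ Ioo (1:ℝ) 2, ‖Tm (mavg d N t) h x‖ₑ ^ 2 ≤ Z x) ∧
      ∫⁻ x in ball 0 (3*r), Z x ≤ C * eR (r * N * N ^ (1 - (d:ℝ))) * ∫⁻ y, ‖h y‖ₑ ^ 2 := by
  obtain ⟨ap, am, C, er, er', hC, hasy⟩ := Phi_asymp (d := d) hd
  obtain ⟨C1, hC1⟩ := wave_piece d hd
  set a : ℝ := ((d:ℝ) - 1) / 2 with ha
  have ha0 : 0 ≤ a := by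
    have : (1:ℝ) ≤ d := by exact_mod_cast hd
    rw [ha]; linarith
  refine ⟨3 * (‖ap‖₊ ^ 2 * C1 + ‖am‖₊ ^ 2 * C1 + (9 * C ^ 2).toNNReal) * (((1/2:ℝ) ^ (1 - (d:ℝ))).toNNReal), fun N hN r hr hNr h hh => ?_⟩
  have hN0 : 0 < N := by linarith
  set G : EE d → ℂ := fun ξ => ((‖ξ‖ ^ (-a) : ℝ) : ℂ) * (((bN d N ξ : ℝ) : ℂ) * 𝓕 h ξ) with hG
  have hGm : Measurable G := by
    have h1 := (fourier_cont h hh).measurable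
    have h2 := (bN_cont d N).measurable
    have h3 : Measurable fun ξ : EE d => ((‖ξ‖ ^ (-a) : ℝ) : ℂ) :=
      Complex.measurable_ofReal.comp (measurable_norm.pow_const _)
    exact h3.mul ((Complex.measurable_ofReal.comp h2).mul h1)
  have hGs : ∀ ξ, G ξ ≠ 0 → N / 2 ≤ ‖ξ‖ ∧ ‖ξ‖ ≤ 5/2 * N := by
    intro ξ h0
    refine bN_range d N hN0 ξ fun h' => h0 ?_
    simp [hG, h']
  have hpw : ∀ ξ : EE d, G ξ ≠ 0 → ‖ξ‖ ^ (-a) ≤ (N/2) ^ (-a) := fun ξ h0 =>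
    Real.rpow_le_rpow_of_nonpos (by positivity) (hGs ξ h0).1 (by linarith)
  have hGle : ∀ ξ, ‖G ξ‖ ≤ (N/2) ^ (-a) * (‖((bN d N ξ : ℝ) : ℂ)‖ * ‖𝓕 h ξ‖) := by
    intro ξ
    by_cases h0 : G ξ = 0
    · rw [h0, norm_zero]; positivity
    · rw [hG]; beta_reduce
      rw [norm_mul, norm_mul, Complex.norm_real, Real.norm_of_nonneg (by positivity)]
      exact mul_le_mul_of_nonneg_right (hpw ξ h0) (by positivity)
  have hGi : Integrable G := by
    refine Integrable.mono' (g := fun ξ => (N/2) ^ (-a) * (‖((bN d N ξ : ℝ) : ℂ)‖ * ∫ y, ‖h y‖)) ?_ hGm.aestronglyMeasurable ?_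
    · exact (((bN_int d N hN0).norm).mul_const _).const_mul _
    · refine of_forall fun ξ => (hGle ξ).trans ?_
      gcongr
      exact fourier_bdd h ξ
  have hG2 : ∫⁻ ξ, ‖G ξ‖ₑ ^ 2 ≤ eR ((N/2) ^ (1 - (d:ℝ))) * ∫⁻ y, ‖h y‖ₑ ^ 2 := by
    refine le_trans ?_ (mul_le_mul_right (bessel h hh) _)
    rw [← lintegral_const_mul' _ _ eR_ne_top]
    refine lintegral_mono fun ξ => ?_
    have e1 : (N/2) ^ (1 - (d:ℝ)) = ((N/2) ^ (-a)) ^ 2 := by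
      rw [← Real.rpow_natCast, ← Real.rpow_mul (by positivity)]; congr 1; rw [ha]; push_cast; ring
    rw [← ofReal_norm_eq_enorm, ← ofReal_norm_eq_enorm, ← eR_pow (norm_nonneg _), ← eR_pow (norm_nonneg _),
      ← eR_mul (by positivity), e1, ← mul_pow]
    refine eR_le (pow_le_pow_left₀ (norm_nonneg _) ((hGle ξ).trans ?_) 2)
    have hb : ‖((bN d N ξ : ℝ) : ℂ)‖ ≤ 1 := by
      rw [Complex.norm_real, norm_abs, bN, abs_of_nonneg (bb_nonneg _)]; exact bb_le_one _
    gcongr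
    nlinarith [norm_nonneg (𝓕 h ξ)]
  obtain ⟨Z1, hZ1m, hZ1, hZ1i⟩ := hC1 N (by linarith) r hr 1 (by simp) G hGi hGm (fun ξ h0 => (hGs ξ h0).2)
  obtain ⟨Z2, hZ2m, hZ2, hZ2i⟩ := hC1 N (by linarith) r hr (-1) (by simp) G hGi hGm (fun ξ h0 => (hGs ξ h0).2)
  obtain ⟨Z3, hZ3m, hZ3, hZ3i⟩ := err_piece d er er' C hC (fun s hs => ⟨(hasy s hs).1, (hasy s hs).2.1, (hasy s hs).2.2.1⟩) N hN r hNr G hGi hGm (fun ξ h0 => (hGs ξ h0).1)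
  have hrep : ∀ x, ∀ t ∈ Ioo (1:ℝ) 2, Tm (mavg d N t) h x = ((t ^ (-a) : ℝ) : ℂ) *
      (ap * UU (fun t ξ => ee (1 * (t * ‖ξ‖))) G t x + am * UU (fun t ξ => ee (-1 * (t * ‖ξ‖))) G t x +
        UU (fun t ξ => er (max 1 (t * ‖ξ‖))) G t x) := by
    intro x t ht
    have ht0 : 0 < t := by linarith [ht.1]
    unfold UU Tm
    have hint : ∀ q : EE d → ℂ, Measurable q → (∃ B : ℝ, ∀ ξ, G ξ ≠ 0 → ‖q ξ‖ ≤ B) → Integrable (fun ξ => ee (inner ℝ ξ x) * (q ξ * G ξ)) := by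
      intro q hq ⟨B, hB⟩
      refine Integrable.mono' (hGi.norm.const_mul B) ?_ (of_forall fun ξ => ?_)
      · have : Measurable fun ξ : EE d => ee (inner ℝ ξ x) := ee_cont.measurable.comp (by fun_prop)
        exact (this.mul (hq.mul hGm)).aestronglyMeasurable
      · rw [norm_mul, ee_norm, one_mul, norm_mul]
        by_cases h0 : G ξ = 0
        · simp [h0]
        · exact mul_le_mul_of_nonneg_right (hB ξ h0) (norm_nonneg _)
    have hcont : Measurable fun s => er (max 1 s) := by
      apply Continuous.measurable
      rw [continuous_iff_continuousAt]
      intro s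
      exact ContinuousAt.comp (f := fun s : ℝ => max 1 s) (g := er) ((hasy _ (le_max_left 1 s)).1.continuousAt) (by fun_prop)
    have i1 := hint (fun ξ => ee (1 * (t * ‖ξ‖))) (ee_cont.measurable.comp (by fun_prop)) ⟨1, fun ξ _ => (ee_norm _).le⟩
    have i2 := hint (fun ξ => ee (-1 * (t * ‖ξ‖))) (ee_cont.measurable.comp (by fun_prop)) ⟨1, fun ξ _ => (ee_norm _).le⟩
    have i3 := hint (fun ξ => er (max 1 (t * ‖ξ‖))) (hcont.comp (by fun_prop)) ⟨C, fun ξ _ =>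
      ((hasy _ (le_max_left 1 _)).2.1).trans (div_le_self hC.le (le_max_left 1 _))⟩
    rw [← integral_const_mul, ← integral_const_mul, ← integral_add (i1.const_mul _) (i2.const_mul _),
      ← integral_add (f := fun ξ => ap * (ee (inner ℝ ξ x) * (ee (1 * (t * ‖ξ‖)) * G ξ)) + am * (ee (inner ℝ ξ x) * (ee (-1 * (t * ‖ξ‖)) * G ξ)))
        ((i1.const_mul _).add (i2.const_mul _)) i3, ← integral_const_mul]
    congr 1; funext ξ
    beta_reduce
    by_cases hb : bN d N ξ = 0
    · simp [mavg, hG, hb]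
    have hr := (bN_range d N hN0 ξ hb).1
    have hge : 1 ≤ t * ‖ξ‖ := by nlinarith [ht.1]
    have hx0 : 0 < ‖ξ‖ := by linarith
    have hphi := (hasy _ hge).2.2.2 (t • ξ) (by rw [norm_smul, Real.norm_of_nonneg ht0.le])
    rw [mavg, hphi, Real.mul_rpow ht0.le hx0.le, max_eq_right hge, hG]
    beta_reduce
    rw [one_mul, neg_one_mul]
    push_cast
    ring
  refine ⟨fun x => 3 * (‖ap‖ₑ ^ 2 * Z1 x + ‖am‖ₑ ^ 2 * Z2 x + Z3 x), by fun_prop, fun x t ht => ?_, ?_⟩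
  · rw [hrep x t ht, enorm_mul, mul_pow]
    have h1 : ‖((t ^ (-a) : ℝ) : ℂ)‖ₑ ≤ 1 := by
      rw [← ofReal_norm_eq_enorm, Complex.norm_real, Real.norm_of_nonneg (by have := ht.1; positivity), ENNReal.ofReal_le_one]
      exact Real.rpow_le_one_of_one_le_of_nonpos ht.1.le (by linarith)
    refine (mul_le_of_le_one_left zero_le (pow_le_one₀ zero_le h1)).trans ((enorm_sq3 _ _ _).trans ?_)
    rw [enorm_mul, enorm_mul, mul_pow, mul_pow]
    beta_reduce
    gcongr
    · exact hZ1 x t ht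
    · exact hZ2 x t ht
    · exact hZ3 x t ht
  · rw [lintegral_const_mul _ (by fun_prop), lintegral_add_left (by fun_prop), lintegral_add_left (by fun_prop),
      lintegral_const_mul _ hZ1m, lintegral_const_mul _ hZ2m]
    set W := ∫⁻ ξ, ‖G ξ‖ₑ ^ 2 with hW
    calc _ ≤ 3 * (‖ap‖ₑ ^ 2 * (C1 * eR (r * N) * W) + ‖am‖ₑ ^ 2 * (C1 * eR (r * N) * W) + eR (9 * C ^ 2 * (r * N)) * W) := by gcongr
      _ = 3 * (‖ap‖ₑ ^ 2 * C1 + ‖am‖ₑ ^ 2 * C1 + eR (9 * C ^ 2)) * eR (r * N) * W := by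
        rw [eR_mul (p := 9 * C ^ 2) (by positivity)]; ring
      _ ≤ 3 * (‖ap‖ₑ ^ 2 * C1 + ‖am‖ₑ ^ 2 * C1 + eR (9 * C ^ 2)) * eR (r * N) * (eR ((N/2) ^ (1 - (d:ℝ))) * ∫⁻ y, ‖h y‖ₑ ^ 2) := by gcongr
      _ = _ := by
        rw [div_eq_mul_one_div N 2, Real.mul_rpow hN0.le (by norm_num), eR_mul (p := N ^ (1 - (d:ℝ))) (by positivity), eR_mul (p := r * N) (by positivity)]
        push_cast
        rw [← ENNReal.ofReal.eq_1, ← ENNReal.ofReal.eq_1, enorm_eq_nnnorm, enorm_eq_nnnorm]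
        ring

/-- unit vector with angle u -/
def om (u : ℝ) : EE 2 := !₂[rcos u, rsin u]

lemma om_cont : Continuous om := by
  unfold om
  refine (PiLp.continuous_toLp 2 _).comp ?_
  refine continuous_pi fun i => ?_
  fin_cases i <;> simp <;> fun_prop

lemma om_inner (u v : ℝ) : inner ℝ (om u) (om v) = rcos (u - v) := by
  simp [om, PiLp.inner_apply, Real.cos_sub]; ring

lemma om_norm (u : ℝ) : ‖om u‖ = 1 := by
  have h := om_inner u u
  rw [real_inner_self_eq_norm_sq] at h
  simp at h
  rcases h with h | h
  · exact h
  · linarith [norm_nonneg (om u)]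

lemma om_surj (z : EE 2) : ∃ u, z = ‖z‖ • om u := by
  have hn : ‖z‖^2 = (z 0)^2 + (z 1)^2 := by
    rw [EuclideanSpace.norm_sq_eq]; simp
  refine ⟨Complex.arg (⟨z 0, z 1⟩ : ℂ), ?_⟩
  have h1 : ‖(⟨z 0, z 1⟩ : ℂ)‖ = ‖z‖ := by
    have : ‖(⟨z 0, z 1⟩ : ℂ)‖^2 = ‖z‖^2 := by
      rw [hn, ← Complex.normSq_eq_norm_sq, Complex.normSq_apply]; simp; ring
    exact (sq_eq_sq₀ (norm_nonneg _) (norm_nonneg _)).1 this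
  ext i
  fin_cases i
  · have := Complex.norm_mul_cos_arg (⟨z 0, z 1⟩ : ℂ)
    rw [h1] at this
    simp [om, this]
  · have := Complex.norm_mul_sin_arg (⟨z 0, z 1⟩ : ℂ)
    rw [h1] at this
    simp [om, this]

/-- measurable equivalence between the plane models -/
def plE : (ℝ × ℝ) ≃ᵐ EE 2 :=
  (MeasurableEquiv.finTwoArrow (α := ℝ)).symm.trans (MeasurableEquiv.toLp 2 (Fin 2 → ℝ))

lemma plE_mp : MeasurePreserving plE volume volume := by
  unfold plE
  have h1 := (volume_preserving_finTwoArrow ℝ).symm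
  have h2 := PiLp.volume_preserving_toLp (Fin 2)
  exact h2.comp h1

lemma plE_polar (p : ℝ × ℝ) : plE (polarCoord.symm p) = p.1 • om p.2 := by
  ext i
  fin_cases i <;> simp [plE, om, polarCoord_symm_apply, MeasurableEquiv.finTwoArrow]

lemma polar2_lint (G : EE 2 → ℝ≥0∞) :
    ∫⁻ y, G y = ∫⁻ p in Ioi (0:ℝ) ×ˢ Ioo (-rpi) rpi, eR p.1 * G (p.1 • om p.2) := by
  rw [← plE_mp.lintegral_comp_emb plE.measurableEmbedding, ← lintegral_comp_polarCoord_symm]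
  simp only [plE_polar, smul_eq_mul]
  rfl

lemma polar2_int (G : EE 2 → ℂ) :
    ∫ y, G y = ∫ p in Ioi (0:ℝ) ×ˢ Ioo (-rpi) rpi, (p.1:ℂ) * G (p.1 • om p.2) := by
  rw [← plE_mp.integral_comp plE.measurableEmbedding, ← integral_comp_polarCoord_symm]
  simp only [plE_polar, Complex.real_smul]
  rfl

lemma sig2_lint (g : EE 2 → ℝ≥0∞) (hg : Measurable g) :
    ∫⁻ y, g y ∂(sig 2) = eR (1 / (2 * rpi)) *
      ∫⁻ u in Ioo (-rpi) rpi, g (om u) := by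
  have hom : Measurable om := om_cont.measurable
  set A : ℝ≥0∞ := ∫⁻ s in Ioo (0:ℝ) 1, eR s with hA
  have hA0 : A ≠ 0 := by
    rw [hA, ← lintegral_indicator measurableSet_Ioo]
    intro h
    rw [lintegral_eq_zero_iff (by apply Measurable.indicator _ measurableSet_Ioo; exact meas_eR)] at h
    have h2 : ∀ᵐ s : ℝ, s ∉ Ioo (0:ℝ) 1 := by
      filter_upwards [h] with s hs hs2
      rw [indicator_of_mem hs2] at hs
      simp at hs
      linarith [hs2.1]
    have h3 : volume (Ioo (0:ℝ) 1) = 0 := by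
      rw [← compl_compl (Ioo (0:ℝ) 1)]
      exact h2
    simp at h3
  have hA1 : A ≠ ⊤ := by
    have : A ≤ ∫⁻ s in Ioo (0:ℝ) 1, 1 := by
      apply setLIntegral_mono (by fun_prop)
      intro s hs
      rw [ENNReal.ofReal_le_one]; exact hs.2.le
    refine ne_top_of_le_ne_top ?_ this
    simp
  have key : ∀ g : EE 2 → ℝ≥0∞, Measurable g →
      sphereMeasure 2 univ * (A * ∫⁻ y, g y ∂(sig 2)) = A * ∫⁻ u in Ioo (-rpi) rpi, g (om u) := by
    intro g hg
    set G : EE 2 → ℝ≥0∞ := fun x => (ball (0:EE 2) 1).indicator (fun x => g (‖x‖⁻¹ • x)) x with hGd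
    have hG : Measurable G := by
      apply Measurable.indicator _ measurableSet_ball
      exact hg.comp (by fun_prop)
    have hval : ∀ s > (0:ℝ), ∀ w : EE 2, ‖w‖ = 1 → G (s • w) = (Ioo (0:ℝ) 1).indicator (fun _ => g w) s := by
      intro s hs w hw
      have hn : ‖s • w‖ = s := by rw [norm_smul, hw, norm_abs, abs_of_pos hs, mul_one]
      simp only [hGd]
      by_cases h1 : s < 1
      · rw [indicator_of_mem, indicator_of_mem]
        · rw [hn, smul_smul, inv_mul_cancel₀ hs.ne', one_smul]
        · exact ⟨hs, h1⟩
        · rw [mem_ball_zero_iff, hn]; exact h1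
      · rw [indicator_of_notMem, indicator_of_notMem]
        · intro h; exact h1 h.2
        · rw [mem_ball_zero_iff, hn]; exact h1
    have e1 := polar_lintegral (d := 2) (by norm_num) G hG
    have e2 := polar2_lint G
    rw [e1] at e2
    have e3 : ∫⁻ s in Ioi (0:ℝ), eR (s ^ (2-1)) * ∫⁻ w, G (s • w) ∂(sig 2)
        = A * ∫⁻ y, g y ∂(sig 2) := by
      rw [hA, ← lintegral_mul_const _ meas_eR, ← lintegral_indicator measurableSet_Ioo,
        ← lintegral_indicator measurableSet_Ioi]
      refine lintegral_congr fun s => ?_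
      by_cases hs : 0 < s
      · rw [indicator_of_mem (show s ∈ Ioi (0:ℝ) from hs)]
        have : ∫⁻ w, G (s • w) ∂(sig 2) = ∫⁻ w, (Ioo (0:ℝ) 1).indicator (fun _ => g w) s ∂(sig 2) := by
          apply lintegral_congr_ae
          filter_upwards [sig_norm 2] with w hw
          exact hval s hs w hw
        rw [this]
        by_cases h1 : s ∈ Ioo (0:ℝ) 1
        · simp [h1]
        · simp [h1]
      · rw [indicator_of_notMem (by simpa using hs), indicator_of_notMem (fun h => hs h.1)]
    have e4 : ∫⁻ p in Ioi (0:ℝ) ×ˢ Ioo (-rpi) rpi, eR p.1 * G (p.1 • om p.2)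
        = A * ∫⁻ u in Ioo (-rpi) rpi, g (om u) := by
      rw [Measure.volume_eq_prod, ← Measure.prod_restrict, lintegral_prod _ (by
        apply Measurable.aemeasurable
        apply Measurable.mul
        · exact meas_eR.comp measurable_fst
        · apply hG.comp
          exact measurable_fst.smul (hom.comp measurable_snd))]
      rw [hA, ← lintegral_mul_const _ meas_eR, ← lintegral_indicator measurableSet_Ioo,
        ← lintegral_indicator measurableSet_Ioi]
      refine lintegral_congr fun s => ?_
      by_cases hs : 0 < s
      · rw [indicator_of_mem (show s ∈ Ioi (0:ℝ) from hs)]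
        simp only [hval s hs _ (om_norm _)]
        by_cases h1 : s ∈ Ioo (0:ℝ) 1
        · simp only [h1, indicator_of_mem]
          exact lintegral_const_mul' _ _ eR_ne_top
        · simp [h1]
      · rw [indicator_of_notMem (by simpa using hs), indicator_of_notMem (fun h => hs h.1)]
    rw [e3, e4] at e2
    exact e2
  have k1 := key (fun _ => 1) measurable_const
  have k2 := key g hg
  haveI := sig_prob (d := 2) (by norm_num)
  simp only [lintegral_const, measure_univ, mul_one] at k1
  rw [Measure.restrict_apply MeasurableSet.univ, univ_inter, Real.volume_Ioo, one_mul] at k1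
  have k3 : sphereMeasure 2 univ = eR (2 * rpi) := by
    rw [mul_comm] at k1
    have := (ENNReal.mul_right_inj hA0 hA1).1 k1
    rw [this]; congr 1; ring
  rw [k3, ← mul_assoc, mul_comm (eR _), mul_assoc] at k2
  have k4 := (ENNReal.mul_right_inj hA0 hA1).1 k2
  rw [← k4, ← mul_assoc, ← eR_mul (by positivity)]
  have : 1 / (2 * rpi) * (2 * rpi) = 1 := by
    field_simp
  rw [this]; simp

lemma sig2_eq : sig 2 = (eR (1 / (2 * rpi))) •
    (volume.restrict (Ioo (-rpi) rpi)).map om := by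
  ext s hs
  have := sig2_lint (s.indicator 1) (measurable_one.indicator hs)
  rw [lintegral_indicator_one hs] at this
  rw [this, Measure.smul_apply, smul_eq_mul, Measure.map_apply om_cont.measurable hs]
  congr 1
  have h2 : (fun u => s.indicator (1 : EE 2 → ℝ≥0∞) (om u)) = (om ⁻¹' s).indicator 1 := by
    ext u; simp [indicator]; rfl
  rw [h2, lintegral_indicator_one (om_cont.measurable hs)]

lemma sig2_int (g : EE 2 → ℂ) (hg : Continuous g) :
    ∫ y, g y ∂(sig 2) = ((1 / (2 * rpi) : ℝ) : ℂ) * ∫ u in (-rpi)..Real.pi, g (om u) := by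
  rw [sig2_eq, integral_smul_measure, integral_map om_cont.measurable.aemeasurable
    hg.aestronglyMeasurable, ENNReal.toReal_ofReal (by positivity),
    intervalIntegral.integral_of_le (by linarith [rpi_pos]), integral_Ioc_eq_integral_Ioo,
    Complex.real_smul]

/-- complex exponential of an integer multiple -/
def ex (k : ℤ) (u : ℝ) : ℂ := cexp (I * k * u)

lemma ex_cont (k : ℤ) : Continuous (ex k) := by unfold ex; fun_prop

lemma ex_norm (k : ℤ) (u : ℝ) : ‖ex k u‖ = 1 := by
  unfold ex
  rw [show (I * k * u : ℂ) = ((k * u : ℝ) : ℂ) * I by push_cast; ring]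
  exact norm_exp_ofReal_mul_I _

lemma ex_add (k l : ℤ) (u : ℝ) : ex (k + l) u = ex k u * ex l u := by
  unfold ex; rw [← Complex.exp_add]; push_cast; ring_nf

lemma ex_add' (k : ℤ) (u v : ℝ) : ex k (u + v) = ex k u * ex k v := by
  unfold ex; rw [← Complex.exp_add]; push_cast; ring_nf

lemma ex_zero (u : ℝ) : ex 0 u = 1 := by simp [ex]

lemma ex_conj (k : ℤ) (u : ℝ) : (starRingEnd ℂ) (ex k u) = ex (-k) u := by
  unfold ex
  rw [← Complex.exp_conj]; congr 1; simp

lemma ex_deriv (k : ℤ) (u : ℝ) : HasDerivAt (ex k) (I * k * ex k u) u := by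
  unfold ex
  have h1 : HasDerivAt (fun s : ℝ => (s : ℂ)) 1 u := (hasDerivAt_id u).ofReal_comp
  have h2 := (h1.const_mul (I * k : ℂ)).cexp
  refine h2.congr_deriv ?_
  ring

lemma ex_periodic (k : ℤ) (u : ℝ) : ex k (u + 2 * rpi) = ex k u := by
  unfold ex
  rw [Complex.exp_eq_exp_iff_exists_int]
  refine ⟨k, ?_⟩
  push_cast; ring

/-- circular harmonics of plane waves -/
def Ek (k : ℤ) (s : ℝ) : ℂ := ∫ u in (-rpi)..Real.pi, ex k u * ee (s * rcos u)

lemma Ek_ii (k : ℤ) (s a b : ℝ) :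
    IntervalIntegrable (fun u => ex k u * ee (s * rcos u)) volume a b := by
  apply Continuous.intervalIntegrable
  have := ex_cont k
  fun_prop

lemma Ek_bdd (k : ℤ) (s : ℝ) : ‖Ek k s‖ ≤ 2 * rpi := by
  unfold Ek
  have := intervalIntegral.norm_integral_le_of_norm_le_const (a := -rpi) (b := rpi)
    (f := fun u => ex k u * ee (s * rcos u)) (C := 1) (fun u _ => by
      rw [norm_mul, ex_norm, ee_norm, one_mul])
  refine this.trans (le_of_eq ?_)
  rw [abs_of_pos (by linarith [rpi_pos])]; ring

lemma Ek_neg (k : ℤ) (s : ℝ) : Ek (-k) s = Ek k s := by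
  unfold Ek
  have := intervalIntegral.integral_comp_neg (a := -rpi) (b := rpi)
    (fun u => ex k u * ee (s * rcos u))
  rw [neg_neg] at this
  rw [← this]
  refine intervalIntegral.integral_congr fun u _ => ?_
  simp only [Real.cos_neg]
  congr 1
  unfold ex; push_cast; ring_nf

lemma ex_diff (k : ℤ) (u : ℝ) : ex (k+1) u - ex (k-1) u = 2 * I * (rsin u * ex k u) := by
  rw [sub_eq_add_neg k 1, ex_add, ex_add]
  have : ex 1 u - ex (-1) u = 2 * I * rsin u := by
    unfold ex
    rw [Complex.ofReal_sin, Complex.sin]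
    have h1 : (I * ((1:ℤ):ℂ) * (u:ℂ)) = u * I := by push_cast; ring
    have h2 : (I * ((-1:ℤ):ℂ) * (u:ℂ)) = -u * I := by push_cast; ring
    rw [h1, h2]
    linear_combination (-(cexp (-u * I) - cexp (u * I))) * Complex.I_sq
  linear_combination (ex k u) * this

lemma Ek_rec (k : ℤ) (s : ℝ) :
    (rpi * s : ℂ) * (Ek (k+1) s - Ek (k-1) s) = I * k * Ek k s := by
  have hc := ex_cont k
  have h1 : Ek (k+1) s - Ek (k-1) s
      = 2 * I * ∫ u in (-rpi)..Real.pi, rsin u * (ex k u * ee (s * rcos u)) := by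
    unfold Ek
    rw [← intervalIntegral.integral_sub (Ek_ii _ _ _ _) (Ek_ii _ _ _ _),
      ← intervalIntegral.integral_const_mul]
    refine intervalIntegral.integral_congr fun u _ => ?_
    beta_reduce
    linear_combination (ee (s * rcos u)) * ex_diff k u
  have hd : ∀ u : ℝ, HasDerivAt (fun u => ex k u * ee (s * rcos u))
      (I * k * (ex k u * ee (s * rcos u)) -
        2 * rpi * I * s * (rsin u * (ex k u * ee (s * rcos u)))) u := by
    intro u
    have a1 : HasDerivAt (fun u => s * rcos u) (s * (-rsin u)) u :=
      (Real.hasDerivAt_cos u).const_mul s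
    have a2 := (ee_deriv (s * rcos u)).scomp u a1
    refine ((ex_deriv k u).mul a2).congr_deriv ?_
    simp only [Function.comp, Complex.real_smul]
    push_cast; ring
  have h2 := intervalIntegral.integral_eq_sub_of_hasDerivAt (a := -rpi) (b := rpi)
    (fun u _ => hd u) (by
      apply Continuous.intervalIntegrable
      fun_prop)
  have h3 : ex k rpi = ex k (-rpi) := by
    have := ex_periodic k (-rpi)
    rw [← this]; congr 1; ring
  rw [h3, Real.cos_neg, sub_self, intervalIntegral.integral_sub
    (by apply Continuous.intervalIntegrable; fun_prop) (by apply Continuous.intervalIntegrable; fun_prop),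
    intervalIntegral.integral_const_mul, intervalIntegral.integral_const_mul] at h2
  rw [h1]
  change I * k * Ek k s - _ = 0 at h2
  linear_combination (-1:ℂ) * h2

lemma mm_Ek (s : ℝ) : Ek 0 s = (2 * rpi : ℂ) * mm 2 0 s := by
  unfold mm
  rw [sig2_int _ (by fun_prop)]
  unfold Ek
  have : (rpi : ℂ) ≠ 0 := by exact_mod_cast Real.pi_ne_zero
  push_cast
  rw [← mul_assoc, mul_one_div_cancel (by simp [this]), one_mul]
  refine intervalIntegral.integral_congr fun u _ => ?_
  simp [ex_zero, ee, om]

lemma mm'_Ek (s : ℝ) : Ek 1 s = - I * mm' 2 0 s := by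
  have h1 : Ek 1 s = (Ek (1) s + Ek (-1) s) / 2 := by rw [Ek_neg]; ring
  have hc := ex_cont 1
  have hc2 := ex_cont (-1)
  rw [h1]
  unfold mm'
  rw [sig2_int _ (by fun_prop)]
  have : (rpi : ℂ) ≠ 0 := by exact_mod_cast Real.pi_ne_zero
  unfold Ek
  rw [← intervalIntegral.integral_add (Ek_ii _ _ _ _) (Ek_ii _ _ _ _), ← mul_assoc,
    ← intervalIntegral.integral_const_mul, ← intervalIntegral.integral_div]
  refine intervalIntegral.integral_congr fun u _ => ?_
  beta_reduce
  have h3 : ex 1 u + ex (-1) u = 2 * rcos u := by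
    unfold ex
    rw [Complex.ofReal_cos, Complex.cos]
    have h1 : (I * ((1:ℤ):ℂ) * (u:ℂ)) = u * I := by push_cast; ring
    have h2 : (I * ((-1:ℤ):ℂ) * (u:ℂ)) = -u * I := by push_cast; ring
    rw [h1, h2]; ring
  rw [← add_mul, h3]
  simp only [om, ee]
  simp
  field_simp
  rw [Complex.I_sq]; ring

lemma Phi_Ek (ξ : EE 2) : (2 * rpi : ℂ) * Phi 2 ξ = Ek 0 ‖ξ‖ := by
  rw [Phi_eq_mm 0, mm_Ek]

lemma E01_bound : ∃ C > (0:ℝ), ∀ s > (0:ℝ), ‖Ek 0 s‖ ≤ C * s^(-(1/2):ℝ) ∧ ‖Ek 1 s‖ ≤ C * s^(-(1/2):ℝ) := by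
  obtain ⟨ap, am, C, er, er', hC, h⟩ := Phi_asymp (d := 2) (by norm_num)
  have hpi := rpi_pos
  set K : ℝ := 100 * (‖ap‖ + ‖am‖ + C + 1) with hK
  have hK0 : 100 ≤ K := by rw [hK]; nlinarith [norm_nonneg ap, norm_nonneg am]
  refine ⟨K, by linarith, fun s hs => ?_⟩
  rcases le_or_gt s 1 with h1 | h1
  · have h2 : 1 ≤ s^(-(1/2):ℝ) := Real.one_le_rpow_of_pos_of_le_one_of_nonpos hs h1 (by norm_num)
    have h3 : 2 * rpi ≤ K * s^(-(1/2):ℝ) := by nlinarith [Real.pi_le_four]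
    exact ⟨(Ek_bdd _ _).trans h3, (Ek_bdd _ _).trans h3⟩
  · obtain ⟨a1, a2, a3, a4⟩ := h s h1.le
    have hform : ∀ s ≥ (1:ℝ), mm 2 0 s = ((s^(-(1/2):ℝ):ℝ):ℂ) * (ap * ee s + am * ee (-s) + er s) := by
      intro s hs
      have := (h s hs).2.2.2 (s • om 0) (by rw [norm_smul, om_norm]; simp; linarith)
      rw [Phi_eq_mm 0, norm_smul, om_norm] at this
      simp only [norm_abs, abs_of_pos (by linarith : 0 < s), mul_one] at this
      rw [this]; norm_num
    set g := ap * ee s + am * ee (-s) + er s with hg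
    have hCs : C / s ≤ C := div_le_self hC.le h1.le
    have hgb : ‖g‖ ≤ ‖ap‖ + ‖am‖ + C := by
      refine (norm_add_le _ _).trans (add_le_add ((norm_add_le _ _).trans ?_) (a2.trans hCs))
      rw [norm_mul, norm_mul, ee_norm, ee_norm, mul_one, mul_one]
    have hsp : 0 < s^(-(1/2):ℝ) := Real.rpow_pos_of_pos hs _
    have hnn : ‖((s^(-(1/2):ℝ):ℝ):ℂ)‖ = s^(-(1/2):ℝ) := by
      rw [Complex.norm_real, norm_abs, abs_of_pos hsp]
    have hn2 : ‖(2 * rpi : ℂ)‖ = 2 * rpi := by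
      rw [norm_mul, Complex.norm_real, norm_abs, abs_of_pos hpi]; simp
    constructor
    · rw [mm_Ek, hform s h1.le, norm_mul, hn2, norm_mul, hnn]
      have : 2 * rpi * ‖g‖ ≤ K := by
        rw [hK]
        nlinarith [Real.pi_le_four, norm_nonneg g, norm_nonneg ap, norm_nonneg am]
      nlinarith
    · have hder : HasDerivAt (mm 2 0) (((-(1/2) * s^(-(1/2)-1:ℝ):ℝ):ℂ) * g +
          ((s^(-(1/2):ℝ):ℝ):ℂ) * (ap * (2 * rpi * I * ee s) + am * (-(2 * rpi * I) * ee (-s)) + er' s)) s := by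
        have b1 : HasDerivAt (fun s : ℝ => ((s^(-(1/2):ℝ):ℝ):ℂ)) ((-(1/2) * s^(-(1/2)-1:ℝ):ℝ):ℂ) s :=
          (Real.hasDerivAt_rpow_const (Or.inl hs.ne')).ofReal_comp
        have b2 := (((ee_deriv s).const_mul ap).add ((ee_neg_deriv s).const_mul am)).add a1
        have b3 := b1.mul b2
        refine b3.congr_of_eventuallyEq ?_
        filter_upwards [Ioi_mem_nhds h1] with y hy
        rw [hform y (le_of_lt hy)]; rfl
      have hu := hder.unique (mm_deriv 0 s)
      rw [mm'_Ek, ← hu, norm_mul, norm_neg, Complex.norm_I, one_mul]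
      refine (norm_add_le _ _).trans ?_
      rw [norm_mul, norm_mul, hnn, Complex.norm_real, norm_abs, abs_mul,
        abs_of_pos (Real.rpow_pos_of_pos hs _)]
      have c1 : s^(-(1/2)-1:ℝ) ≤ s^(-(1/2):ℝ) := Real.rpow_le_rpow_of_exponent_le h1.le (by norm_num)
      have c2 : ‖ap * (2 * rpi * I * ee s) + am * (-(2 * rpi * I) * ee (-s)) + er' s‖
          ≤ ‖ap‖ * (2 * rpi) + ‖am‖ * (2 * rpi) + C := by
        refine (norm_add_le _ _).trans (add_le_add ((norm_add_le _ _).trans ?_) (a3.trans hCs))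
        rw [norm_mul, norm_mul, norm_mul am, norm_mul _ (ee (-s)), ee_norm, ee_norm, norm_neg, norm_mul, hn2]
        simp
      have c3 : |(-(1/2):ℝ)| = 1/2 := by rw [abs_neg, abs_of_pos]; norm_num
      rw [c3]
      have c0 : 0 ≤ s^(-(1/2)-1:ℝ) := (Real.rpow_pos_of_pos hs _).le
      have d1 : 1/2 * s^(-(1/2)-1:ℝ) * ‖g‖ ≤ s^(-(1/2):ℝ) * (‖ap‖ + ‖am‖ + C) := by
        apply mul_le_mul _ hgb (norm_nonneg _) hsp.le
        linarith
      have d2 := mul_le_mul_of_nonneg_left c2 hsp.le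
      refine (add_le_add d1 d2).trans ?_
      rw [← mul_add, mul_comm]
      apply mul_le_mul_of_nonneg_right _ hsp.le
      rw [hK]
      nlinarith [Real.pi_le_four, norm_nonneg ap, norm_nonneg am]

lemma Ek_step (k : ℤ) (s : ℝ) (hs : 0 < s) :
    ‖Ek (k+1) s - Ek (k-1) s‖ ≤ |(k:ℝ)| * ‖Ek k s‖ * (3 * s)⁻¹ := by
  have h := congrArg norm (Ek_rec k s)
  rw [norm_mul, norm_mul, norm_mul, norm_mul, Complex.norm_I, Complex.norm_real, Complex.norm_real,
    norm_abs, norm_abs, abs_of_pos hs, abs_of_pos rpi_pos, one_mul] at h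
  have hk : ‖(k:ℂ)‖ = |(k:ℝ)| := by
    rw [← Complex.ofReal_intCast, Complex.norm_real, norm_abs]
  rw [hk] at h
  rw [← div_eq_mul_inv, le_div_iff₀ (by positivity), ← h]
  nlinarith [Real.pi_gt_three, norm_nonneg (Ek (k+1) s - Ek (k-1) s),
    mul_nonneg hs.le (norm_nonneg (Ek (k+1) s - Ek (k-1) s))]

lemma Ek_all : ∃ C > (0:ℝ), ∀ k : ℤ, ∀ s > (0:ℝ), ‖Ek k s‖ ≤ C * (1 + (k:ℝ)^2) * s^(-(1/2):ℝ) := by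
  obtain ⟨C, hC, h⟩ := E01_bound
  refine ⟨C + 20, by linarith, ?_⟩
  have hnat : ∀ n : ℕ, ∀ s ≥ (1:ℝ), ‖Ek n s‖ ≤ (C + 2 * (n:ℝ)^2) * s^(-(1/2):ℝ) ∧
      ‖Ek (n+1) s‖ ≤ (C + 2 * (n+1:ℝ)^2) * s^(-(1/2):ℝ) := by
    intro n s hs
    have hs0 : 0 < s := by linarith
    have hsp : 0 < s^(-(1/2):ℝ) := Real.rpow_pos_of_pos hs0 _
    have hinv : s⁻¹ ≤ s^(-(1/2):ℝ) := by
      rw [← Real.rpow_neg_one]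
      exact Real.rpow_le_rpow_of_exponent_le hs (by norm_num)
    induction n with
    | zero =>
      have := h s hs0
      refine ⟨?_, ?_⟩
      · simpa using this.1
      · simp only [Nat.cast_zero, zero_add]
        nlinarith [this.2]
    | succ n ih =>
      refine ⟨by exact_mod_cast ih.2, ?_⟩
      have h1 := Ek_step (n+1) s hs0
      have e1 : ((n:ℤ)+1+1) = ((n+1:ℕ):ℤ) + 1 := by push_cast; ring
      have e2 : ((n:ℤ)+1-1) = (n:ℤ) := by ring
      rw [e1, e2] at h1
      have h2 : ‖Ek (((n+1:ℕ):ℤ) + 1) s‖ ≤ ‖Ek n s‖ + ‖Ek (((n+1:ℕ):ℤ) + 1) s - Ek n s‖ := by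
        have := norm_add_le (Ek n s) (Ek (((n+1:ℕ):ℤ) + 1) s - Ek n s)
        simpa using this
      have h3 := Ek_bdd (n+1) s
      have h4 : |(((n:ℤ)+1:ℤ):ℝ)| = (n:ℝ)+1 := by
        push_cast; rw [abs_of_nonneg (by positivity)]
      rw [h4] at h1
      have h5 : ((n:ℝ)+1) * ‖Ek (n+1) s‖ * (3 * s)⁻¹ ≤ (n+1) * 3 * s^(-(1/2):ℝ) := by
        have : ‖Ek (n+1) s‖ * (3 * s)⁻¹ ≤ 3 * s^(-(1/2):ℝ) := by
          have h6 : (3 * s)⁻¹ = s⁻¹ / 3 := by rw [mul_inv]; ring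
          rw [h6]
          have h7 : ‖Ek (n+1) s‖ ≤ 8 := by linarith [Real.pi_le_four]
          have : 0 ≤ s⁻¹ := by positivity
          nlinarith [norm_nonneg (Ek (n+1) s)]
        calc ((n:ℝ)+1) * ‖Ek (n+1) s‖ * (3 * s)⁻¹ = ((n:ℝ)+1) * (‖Ek (n+1) s‖ * (3 * s)⁻¹) := by ring
          _ ≤ ((n:ℝ)+1) * (3 * s^(-(1/2):ℝ)) := by gcongr
          _ = _ := by ring
      have h8 : (C + 2 * (n:ℝ)^2) + (n+1) * 3 ≤ C + 2 * (((n+1:ℕ):ℝ)+1)^2 := by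
        push_cast; nlinarith [(Nat.cast_nonneg n : (0:ℝ) ≤ n)]
      have h9 := mul_le_mul_of_nonneg_right h8 hsp.le
      nlinarith [ih.1]
  have hint : ∀ n : ℕ, ∀ s > (0:ℝ), ‖Ek n s‖ ≤ (C+20) * (1 + (n:ℝ)^2) * s^(-(1/2):ℝ) := by
    intro n s hs
    have hsp : 0 < s^(-(1/2):ℝ) := Real.rpow_pos_of_pos hs _
    rcases le_or_gt s 1 with h1 | h1
    · have h2 : 1 ≤ s^(-(1/2):ℝ) := Real.one_le_rpow_of_pos_of_le_one_of_nonpos hs h1 (by norm_num)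
      have h3 := Ek_bdd n s
      have h4 : 20 ≤ (C+20) * (1 + (n:ℝ)^2) := by nlinarith [sq_nonneg (n:ℝ)]
      nlinarith [Real.pi_le_four]
    · refine (hnat n s h1.le).1.trans ?_
      apply mul_le_mul_of_nonneg_right _ hsp.le
      nlinarith [sq_nonneg (n:ℝ), mul_nonneg hC.le (sq_nonneg (n:ℝ))]
  intro k s hs
  rcases Int.eq_nat_or_neg k with ⟨n, rfl | rfl⟩
  · exact_mod_cast hint n s hs
  · rw [Ek_neg]
    have := hint n s hs
    push_cast
    rw [neg_sq]
    exact this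

lemma Ek_even : ∃ C > (0:ℝ), ∀ k : ℤ, Even k → ∀ s > (0:ℝ),
    ‖Ek k s - Ek 0 s‖ ≤ C * (1 + |(k:ℝ)|)^4 * s^(-(3/2):ℝ) := by
  obtain ⟨C, hC, h⟩ := Ek_all
  refine ⟨C, hC, ?_⟩
  have hnat : ∀ i : ℕ, ∀ s > (0:ℝ), ‖Ek ((2*i:ℕ):ℤ) s - Ek 0 s‖ ≤ C * (1 + 2 * (i:ℝ))^4 * s^(-(3/2):ℝ) := by
    intro i s hs
    have hsp : 0 < s^(-(3/2):ℝ) := Real.rpow_pos_of_pos hs _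
    have hmul : s^(-(1/2):ℝ) * s⁻¹ = s^(-(3/2):ℝ) := by
      rw [← Real.rpow_neg_one, ← Real.rpow_add hs]; norm_num
    induction i with
    | zero => simp; positivity
    | succ i ih =>
      have h1 := Ek_step (2*i+1) s hs
      have e1 : ((2*i:ℤ)+1+1) = ((2*(i+1):ℕ):ℤ) := by push_cast; ring
      have e2 : ((2*i:ℤ)+1-1) = ((2*i:ℕ):ℤ) := by push_cast; ring
      rw [e1, e2] at h1
      have h2 : ‖Ek ((2*(i+1):ℕ):ℤ) s - Ek 0 s‖ ≤ ‖Ek ((2*(i+1):ℕ):ℤ) s - Ek ((2*i:ℕ):ℤ) s‖ + ‖Ek ((2*i:ℕ):ℤ) s - Ek 0 s‖ :=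
        norm_sub_le_norm_sub_add_norm_sub _ _ _
      have h3 := h (2*i+1) s hs
      have hi : (0:ℝ) ≤ i := Nat.cast_nonneg i
      have h4 : |((2*(i:ℤ)+1:ℤ):ℝ)| = 2*(i:ℝ)+1 := by
        push_cast; rw [abs_of_nonneg (by positivity)]
      rw [h4] at h1
      push_cast at h3
      have h5 : (2*(i:ℝ)+1) * ‖Ek (2*i+1) s‖ * (3 * s)⁻¹ ≤ C * ((2*(i:ℝ)+1) * (1 + (2*(i:ℝ)+1)^2)) * s^(-(3/2):ℝ) := by
        rw [← hmul]
        have h6 : (3 * s)⁻¹ ≤ s⁻¹ := by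
          rw [mul_inv]
          have : 0 ≤ s⁻¹ := by positivity
          nlinarith
        calc (2*(i:ℝ)+1) * ‖Ek (2*i+1) s‖ * (3 * s)⁻¹
            ≤ (2*(i:ℝ)+1) * (C * (1 + (2*(i:ℝ)+1)^2) * s^(-(1/2):ℝ)) * s⁻¹ := by gcongr
          _ = _ := by ring
      have h8 : ((2*(i:ℝ)+1) * (1 + (2*(i:ℝ)+1)^2)) + (1 + 2 * (i:ℝ))^4 ≤ (1 + 2 * ((i+1:ℕ):ℝ))^4 := by
        push_cast
        have : (1 + 2 * ((i:ℝ)+1))^4 - ((2*(i:ℝ)+1) * (1 + (2*(i:ℝ)+1)^2)) - (1 + 2 * (i:ℝ))^4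
          = 78 + 56 * i^3 + 180 * i^2 + 200 * i := by ring
        nlinarith [pow_nonneg hi 3, pow_nonneg hi 2]
      have h9 := mul_le_mul_of_nonneg_right (mul_le_mul_of_nonneg_left h8 hC.le) hsp.le
      nlinarith
  intro k hk s hs
  obtain ⟨j, rfl⟩ := hk
  rcases Int.eq_nat_or_neg j with ⟨n, rfl | rfl⟩
  · have := hnat n s hs
    have e : (n:ℤ) + n = ((2*n:ℕ):ℤ) := by push_cast; ring
    rw [e]
    have e3 : |(((2*n:ℕ):ℤ):ℝ)| = 2 * n := by
      push_cast; rw [abs_of_nonneg (by positivity)]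
    rw [e3]; exact this
  · have := hnat n s hs
    have e : -(n:ℤ) + -n = -((2*n:ℕ):ℤ) := by push_cast; ring
    rw [e, Ek_neg]
    have e3 : |((-((2*n:ℕ):ℤ):ℤ):ℝ)| = 2 * n := by
      push_cast; rw [abs_neg, abs_of_nonneg]; positivity
    rw [e3]; exact this

/-- trigonometric polynomials with even frequencies -/
def TP (K A : ℝ) (g : ℝ → ℂ) : Prop :=
  ∃ (ι : Type) (_ : Fintype ι) (κ : ι → ℤ) (c : ι → ℂ), (∀ i, Even (κ i) ∧ |(κ i : ℝ)| ≤ K) ∧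
    ∑ i, ‖c i‖ ≤ A ∧ ∀ u, g u = ∑ i, c i * ex (κ i) u

lemma TP.mul {K A K' A' : ℝ} {g g' : ℝ → ℂ} (h : TP K A g) (h' : TP K' A' g') :
    TP (K + K') (A * A') (fun u => g u * g' u) := by
  obtain ⟨ι, _, κ, c, h1, h2, h3⟩ := h
  obtain ⟨ι', _, κ', c', h1', h2', h3'⟩ := h'
  refine ⟨ι × ι', inferInstance, fun p => κ p.1 + κ' p.2, fun p => c p.1 * c' p.2, ?_, ?_, ?_⟩
  · intro p
    refine ⟨(h1 _).1.add (h1' _).1, ?_⟩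
    push_cast
    exact (abs_add_le _ _).trans (add_le_add (h1 _).2 (h1' _).2)
  · simp only [norm_mul]
    rw [Fintype.sum_prod_type]
    dsimp only
    rw [← Finset.sum_mul_sum]
    exact mul_le_mul h2 h2' (Finset.sum_nonneg fun _ _ => norm_nonneg _)
      ((Finset.sum_nonneg fun _ _ => norm_nonneg _).trans h2)
  · intro u
    beta_reduce
    rw [h3, h3', Fintype.sum_prod_type, Finset.sum_mul_sum]
    refine Finset.sum_congr rfl fun i _ => Finset.sum_congr rfl fun j _ => ?_
    rw [ex_add]; ring

lemma TP.conj {K A : ℝ} {g : ℝ → ℂ} (h : TP K A g) : TP K A (fun u => (starRingEnd ℂ) (g u)) := by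
  obtain ⟨ι, _, κ, c, h1, h2, h3⟩ := h
  refine ⟨ι, inferInstance, fun i => - κ i, fun i => (starRingEnd ℂ) (c i), ?_, ?_, ?_⟩
  · intro i; refine ⟨(h1 i).1.neg, ?_⟩
    push_cast; rw [abs_neg]; exact (h1 i).2
  · simpa using h2
  · intro u
    beta_reduce
    rw [h3, map_sum]
    refine Finset.sum_congr rfl fun i _ => ?_
    rw [map_mul, ex_conj]

lemma TP.one : TP 0 1 (fun _ => 1) :=
  ⟨Unit, inferInstance, fun _ => 0, fun _ => 1, by simp, by simp, by simp [ex_zero]⟩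

lemma TP.cos_sq (v : ℝ) : TP 2 1 (fun u => ((rcos (u - v) ^ 2 : ℝ) : ℂ)) := by
  refine ⟨Fin 3, inferInstance, ![0, 2, -2], ![1/2, ex (-2) v / 4, ex 2 v / 4], ?_, ?_, ?_⟩
  · intro i; fin_cases i <;> simp
  · simp [Fin.sum_univ_three, ex_norm]; norm_num
  · intro u
    simp only [Fin.sum_univ_three, Matrix.cons_val_zero, Matrix.cons_val_one, Matrix.cons_val]
    have h1 : ex (-2) v * ex 2 u = cexp ((u - v) * I) ^ 2 := by
      unfold ex; rw [← Complex.exp_add, ← Complex.exp_nat_mul]; push_cast; ring_nf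
    have h2 : ex 2 v * ex (-2) u = cexp (-(u - v) * I) ^ 2 := by
      unfold ex; rw [← Complex.exp_add, ← Complex.exp_nat_mul]; push_cast; ring_nf
    have h3 : cexp ((u - v) * I) * cexp (-(u - v) * I) = 1 := by
      rw [← Complex.exp_add]; ring_nf; simp
    push_cast
    rw [Complex.cos, ex_zero]
    linear_combination (1/2) * h3 - h1 / 4 - h2 / 4

lemma TP.cos_pow (v : ℝ) (m : ℕ) : TP (2 * m) 1 (fun u => ((rcos (u - v) ^ (2 * m) : ℝ) : ℂ)) := by
  induction m with
  | zero => simpa using TP.one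
  | succ m ih =>
    have := ih.mul (TP.cos_sq v)
    convert this using 1
    · push_cast; ring
    · ring
    · ext u; push_cast; ring

lemma TP_conv_eq {ι : Type} [Fintype ι] (κ : ι → ℤ) (c : ι → ℂ) (ψ s : ℝ) :
    ∫ u in (-rpi)..Real.pi, (∑ i, c i * ex (κ i) (ψ + u)) * ee (s * rcos u)
      = ∑ i, c i * Ek (κ i) s * ex (κ i) ψ := by
  have : ∀ u, (∑ i, c i * ex (κ i) (ψ + u)) * ee (s * rcos u)
      = ∑ i, (c i * ex (κ i) ψ) * (ex (κ i) u * ee (s * rcos u)) := by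
    intro u
    rw [Finset.sum_mul]
    refine Finset.sum_congr rfl fun i _ => ?_
    rw [ex_add']; ring
  simp only [this]
  rw [intervalIntegral.integral_finsetSum (fun i _ => (Ek_ii _ _ _ _).const_mul _)]
  refine Finset.sum_congr rfl fun i _ => ?_
  rw [intervalIntegral.integral_const_mul]
  unfold Ek; ring

lemma TP.conv : ∃ C > (0:ℝ), ∀ K A g s, 0 < s → TP K A g →
    TP K (C * (1 + K^2) * s^(-(1/2):ℝ) * A)
      (fun ψ => ∫ u in (-rpi)..Real.pi, g (ψ + u) * ee (s * rcos u)) := by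
  obtain ⟨C, hC, h⟩ := Ek_all
  refine ⟨C, hC, fun K A g s hs ⟨ι, _, κ, c, h1, h2, h3⟩ => ?_⟩
  refine ⟨ι, inferInstance, κ, fun i => c i * Ek (κ i) s, h1, ?_, ?_⟩
  · calc ∑ i, ‖c i * Ek (κ i) s‖ ≤ ∑ i, ‖c i‖ * (C * (1 + K^2) * s^(-(1/2):ℝ)) := by
          refine Finset.sum_le_sum fun i _ => ?_
          rw [norm_mul]
          have := h (κ i) s hs
          have h5 : (κ i:ℝ)^2 ≤ K^2 := sq_le_sq' (by linarith [neg_abs_le (κ i:ℝ), (h1 i).2]) (by linarith [le_abs_self (κ i:ℝ), (h1 i).2])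
          gcongr
          refine this.trans ?_
          gcongr
      _ ≤ _ := by
          rw [← Finset.sum_mul, mul_comm]
          gcongr
  · intro ψ
    simp only [h3]
    rw [TP_conv_eq]

lemma TP.approx : ∃ C > (0:ℝ), ∀ K A g s φ, 0 < s → TP K A g →
    ‖(∫ u in (-rpi)..Real.pi, g (φ + u) * ee (s * rcos u)) - g φ * Ek 0 s‖
      ≤ C * (1 + K)^4 * s^(-(3/2):ℝ) * A := by
  obtain ⟨C, hC, h⟩ := Ek_even
  refine ⟨C, hC, fun K A g s φ hs ⟨ι, _, κ, c, h1, h2, h3⟩ => ?_⟩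
  simp only [h3]
  rw [TP_conv_eq, Finset.sum_mul, ← Finset.sum_sub_distrib]
  calc ‖∑ i, (c i * Ek (κ i) s * ex (κ i) φ - c i * ex (κ i) φ * Ek 0 s)‖
      ≤ ∑ i, ‖c i‖ * (C * (1 + K)^4 * s^(-(3/2):ℝ)) := by
        refine (norm_sum_le _ _).trans (Finset.sum_le_sum fun i _ => ?_)
        rw [show c i * Ek (κ i) s * ex (κ i) φ - c i * ex (κ i) φ * Ek 0 s
          = c i * (Ek (κ i) s - Ek 0 s) * ex (κ i) φ by ring, norm_mul, norm_mul, ex_norm, mul_one]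
        have := h (κ i) (h1 i).1 s hs
        gcongr
        refine this.trans ?_
        gcongr
        exact (h1 i).2
    _ ≤ _ := by
          rw [← Finset.sum_mul, mul_comm]
          gcongr

/-- one dimensional amplitude -/
def amp (ρ : ℝ) : ℝ := Real.smoothTransition (4 * ρ) * ((ρ^2) ^ (-(1/4):ℝ) * bb (ρ^2) ^ 2)

lemma amp_smooth : ContDiff ℝ (⊤ : ℕ∞) amp := by
  rw [contDiff_iff_contDiffAt]
  intro ρ
  unfold amp
  have h0 : ContDiff ℝ (⊤ : ℕ∞) (fun ρ : ℝ => Real.smoothTransition (4 * ρ)) :=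
    Real.smoothTransition.contDiff.comp (by fun_prop)
  have h1 : ContDiff ℝ (⊤ : ℕ∞) (fun ρ : ℝ => bb (ρ^2) ^ 2) := (bb_smooth.comp (by fun_prop)).pow 2
  refine h0.contDiffAt.mul ?_
  by_cases h : ρ = 0
  · have : (fun ρ : ℝ => (ρ^2) ^ (-(1/4):ℝ) * bb (ρ^2) ^ 2) =ᶠ[nhds ρ] fun _ => 0 := by
      have hU : Ioo (-(1/2):ℝ) (1/2) ∈ nhds ρ := Ioo_mem_nhds (by rw [h]; norm_num) (by rw [h]; norm_num)
      filter_upwards [hU] with y hy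
      rw [bb_zero (y^2) (Or.inl (by nlinarith [hy.1, hy.2]))]; simp
    exact contDiffAt_const.congr_of_eventuallyEq this
  · refine ContDiffAt.mul ?_ h1.contDiffAt
    exact ContDiffAt.rpow_const_of_ne (by fun_prop) (by positivity)

lemma amp_supp : HasCompactSupport (fun ρ => ((amp ρ : ℝ) : ℂ)) := by
  refine HasCompactSupport.intro (isCompact_closedBall (0 : ℝ) 3) fun x hx => ?_
  rw [mem_closedBall_zero_iff, not_le, norm_abs] at hx
  have : 9 ≤ x^2 := by rw [← sq_abs]; nlinarith
  unfold amp
  rw [bb_zero _ (Or.inr (by nlinarith))]; simp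

lemma amp_pos (ρ : ℝ) (h : 0 < ρ) : amp ρ = ρ ^ (-(1/2):ℝ) * bb (ρ^2)^2 := by
  unfold amp
  by_cases h1 : ρ < 1/2
  · rw [bb_zero _ (Or.inl (by nlinarith))]; simp
  · rw [Real.smoothTransition.one_of_one_le (by linarith), one_mul, ← Real.rpow_natCast, ← Real.rpow_mul h.le]
    norm_num

lemma amp_neg (ρ : ℝ) (h : ρ ≤ 0) : amp ρ = 0 := by
  unfold amp
  rw [Real.smoothTransition.zero_of_nonpos (by linarith)]; simp

/-- one dimensional decay -/
lemma decay1 : ∃ C > (0:ℝ), ∀ a : ℝ,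
    ‖∫ ρ in Ioi (0:ℝ), ((ρ ^ (-(1/2):ℝ) * bb (ρ^2)^2 : ℝ) : ℂ) * ee (ρ * a)‖ ≤ C * ((1 + |a|)^4)⁻¹ := by
  set m : ℝ → ℂ := fun ρ => ((amp ρ : ℝ) : ℂ) with hm
  let S : SchwartzMap ℝ ℂ := amp_supp.toSchwartzMap (Complex.ofRealCLM.contDiff.comp amp_smooth)
  have hS : 𝓕⁻ m = (FourierTransform.fourierInv S : SchwartzMap ℝ ℂ) := by
    rw [SchwartzMap.fourierInv_coe]; rfl
  have h := SchwartzMap.one_add_le_sup_seminorm_apply (𝕜 := ℂ) (m := (4, 0)) (k := 4) (n := 0) le_rfl le_rfl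
     (FourierTransform.fourierInv S : SchwartzMap ℝ ℂ)
  refine ⟨_, lt_add_of_le_of_pos (le_trans (by positivity) (h 0)) one_pos, fun a => ?_⟩
  have h2 := h a
  rw [norm_iteratedFDeriv_zero, ← hS, fourierInv_ee] at h2
  have e : ∫ y, ee (inner ℝ y a) * m y = ∫ ρ in Ioi (0:ℝ), ((ρ ^ (-(1/2):ℝ) * bb (ρ^2)^2 : ℝ) : ℂ) * ee (ρ * a) := by
    rw [← integral_indicator measurableSet_Ioi]
    refine integral_congr_ae (of_forall fun ρ => ?_)
    simp only [hm]
    by_cases hρ : 0 < ρ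
    · rw [indicator_of_mem (show ρ ∈ Ioi (0:ℝ) from hρ), amp_pos ρ hρ, mul_comm]
      congr 2
      simp [mul_comm]
    · rw [indicator_of_notMem (by simpa using hρ), amp_neg ρ (not_lt.1 hρ)]; simp
  rw [e, norm_abs] at h2
  rw [← div_eq_mul_inv, le_div_iff₀ (by positivity), mul_comm]
  exact h2.trans (le_add_of_nonneg_right zero_le_one)

/-- radial squared cutoff -/
def bR (N ρ : ℝ) : ℝ := bb ((N⁻¹ * ρ)^2)^2

lemma bR_cont (N : ℝ) : Continuous (bR N) := by
  unfold bR
  exact (bb_smooth.continuous.comp (by fun_prop)).pow 2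

lemma bR_nonneg (N ρ : ℝ) : 0 ≤ bR N ρ := by unfold bR; positivity

lemma bR_le_one (N ρ : ℝ) : bR N ρ ≤ 1 := by
  unfold bR; exact pow_le_one₀ (bb_nonneg _) (bb_le_one _)

lemma bR_supp (N ρ : ℝ) (hN : 0 < N) (hρ : 0 < ρ) (h : ρ ∉ Icc (N/2) (5/2*N)) : bR N ρ = 0 := by
  unfold bR
  have e : ρ = N * (N⁻¹ * ρ) := by field_simp
  have hq : 0 < N⁻¹ * ρ := by positivity
  set q := N⁻¹ * ρ
  rw [bb_zero _ _]; · simp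
  by_contra hc
  rw [not_or, not_le, not_le] at hc
  apply h
  constructor
  · have : 1/2 ≤ q := by nlinarith
    nlinarith
  · have : q ≤ 5/2 := by nlinarith
    nlinarith

lemma decayN : ∃ C > (0:ℝ), ∀ N > (0:ℝ), ∀ a : ℝ,
    ‖∫ ρ in Ioi (0:ℝ), ((ρ ^ (-(1/2):ℝ) * bR N ρ : ℝ) : ℂ) * ee (ρ * a)‖
      ≤ C * N^(1/2:ℝ) * ((1 + N * |a|)^4)⁻¹ := by
  obtain ⟨C, hC, h⟩ := decay1
  refine ⟨C, hC, fun N hN a => ?_⟩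
  have h1 := integral_comp_mul_left_Ioi (fun ρ : ℝ => ((ρ ^ (-(1/2):ℝ) * bR N ρ : ℝ) : ℂ) * ee (ρ * a)) 0 hN
  rw [mul_zero] at h1
  have h2 : ∫ ρ in Ioi (0:ℝ), (((N * ρ) ^ (-(1/2):ℝ) * bR N (N * ρ) : ℝ) : ℂ) * ee (N * ρ * a)
      = ((N ^ (-(1/2):ℝ) : ℝ) : ℂ) * ∫ ρ in Ioi (0:ℝ), ((ρ ^ (-(1/2):ℝ) * bb (ρ^2)^2 : ℝ) : ℂ) * ee (ρ * (N * a)) := by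
    rw [← integral_const_mul]
    refine setIntegral_congr_fun measurableSet_Ioi fun ρ hρ => ?_
    have hρ' : 0 < ρ := hρ
    beta_reduce
    rw [Real.mul_rpow hN.le hρ'.le]
    unfold bR
    rw [inv_mul_cancel_left₀ hN.ne']
    rw [show N * ρ * a = ρ * (N * a) by ring]
    push_cast; ring
  rw [h2] at h1
  have h3 : ∫ ρ in Ioi (0:ℝ), ((ρ ^ (-(1/2):ℝ) * bR N ρ : ℝ) : ℂ) * ee (ρ * a)
      = ((N ^ (1/2:ℝ) : ℝ) : ℂ) * ∫ ρ in Ioi (0:ℝ), ((ρ ^ (-(1/2):ℝ) * bb (ρ^2)^2 : ℝ) : ℂ) * ee (ρ * (N * a)) := by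
    have : ∀ x : ℂ, x = (N:ℝ) • ((N⁻¹:ℝ) • x) := fun x => by rw [smul_smul, mul_inv_cancel₀ hN.ne', one_smul]
    rw [this (∫ ρ in Ioi (0:ℝ), ((ρ ^ (-(1/2):ℝ) * bR N ρ : ℝ) : ℂ) * ee (ρ * a)), ← h1, Complex.real_smul,
      ← mul_assoc, ← Complex.ofReal_mul]
    congr 3
    nth_rewrite 1 [← Real.rpow_one N]
    rw [← Real.rpow_add hN]; norm_num
  rw [h3, norm_mul, Complex.norm_real, norm_abs, abs_of_pos (Real.rpow_pos_of_pos hN _)]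
  have := h (N * a)
  rw [abs_mul, abs_of_pos hN] at this
  calc _ ≤ N^(1/2:ℝ) * (C * ((1 + N * |a|)^4)⁻¹) := by gcongr
    _ = _ := by ring

/-- bounds for oscillatory integrals at all frequencies -/
def Osc (g : ℝ → ℂ) (B : ℝ → ℝ) : Prop :=
  IntegrableOn g (Ioi 0) ∧ ∀ a, ‖∫ ρ in Ioi (0:ℝ), g ρ * ee (ρ * a)‖ ≤ B a

lemma Osc.int_mul {g : ℝ → ℂ} {B : ℝ → ℝ} (h : Osc g B) (k : ℝ → ℂ) (hk : Continuous k) (D : ℝ) (hD : ∀ x, ‖k x‖ ≤ D) :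
    IntegrableOn (fun ρ => g ρ * k ρ) (Ioi 0) :=
  h.1.mul_bdd (c := D) hk.aestronglyMeasurable (of_forall hD)

lemma Osc.step {g : ℝ → ℂ} {B : ℝ → ℝ} (h : Osc g B) (ap am : ℂ) (A t : ℝ) (hp : ‖ap‖ ≤ A) (hm : ‖am‖ ≤ A) :
    Osc (fun ρ => g ρ * (ap * ee (t * ρ) + am * ee (-(t * ρ)))) (fun a => A * (B (a + t) + B (a - t))) := by
  refine ⟨h.int_mul _ (by fun_prop) (A + A) fun x => ?_, fun a => ?_⟩
  · refine (norm_add_le _ _).trans ?_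
    rw [norm_mul, norm_mul, ee_norm, ee_norm, mul_one, mul_one]
    exact add_le_add hp hm
  · have e : ∀ ρ, g ρ * (ap * ee (t * ρ) + am * ee (-(t * ρ))) * ee (ρ * a)
        = ap * (g ρ * ee (ρ * (a + t))) + am * (g ρ * ee (ρ * (a - t))) := by
      intro ρ
      rw [show ρ * (a + t) = t * ρ + ρ * a by ring, show ρ * (a - t) = -(t * ρ) + ρ * a by ring, ee_add, ee_add]
      ring
    simp only [e]
    have hi : ∀ b, IntegrableOn (fun ρ => g ρ * ee (ρ * b)) (Ioi 0) := fun b =>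
      h.int_mul _ (by fun_prop) 1 fun x => (ee_norm _).le
    rw [integral_add ((hi _).const_mul _) ((hi _).const_mul _), integral_const_mul, integral_const_mul]
    refine (norm_add_le _ _).trans ?_
    rw [norm_mul, norm_mul, mul_add]
    have hA : 0 ≤ A := (norm_nonneg _).trans hp
    exact add_le_add (mul_le_mul hp (h.2 _) (norm_nonneg _) hA) (mul_le_mul hm (h.2 _) (norm_nonneg _) hA)

lemma supp_bound (N : ℝ) (hN : 0 < N) (X : ℝ → ℂ) (D : ℝ) (hX : ∀ ρ ∈ Icc (N/2) (5/2*N), ‖X ρ‖ ≤ D) :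
    ‖∫ ρ in Ioi (0:ℝ), ((bR N ρ : ℝ):ℂ) * X ρ‖ ≤ D * (2 * N) := by
  have hD : 0 ≤ D := (norm_nonneg _).trans (hX N ⟨by linarith, by linarith⟩)
  have e : ∫ ρ in Ioi (0:ℝ), ((bR N ρ : ℝ):ℂ) * X ρ = ∫ ρ in Icc (N/2) (5/2*N), ((bR N ρ : ℝ):ℂ) * X ρ := by
    refine setIntegral_eq_of_subset_of_forall_diff_eq_zero measurableSet_Ioi
      (fun x hx => lt_of_lt_of_le (by positivity) hx.1) fun x hx => ?_
    rw [bR_supp N x hN hx.1 hx.2]; simp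
  rw [e]
  have := norm_setIntegral_le_of_norm_le_const (μ := volume) (s := Icc (N/2) (5/2*N))
    (f := fun ρ => ((bR N ρ : ℝ):ℂ) * X ρ) (C := D) (by simp) (fun x hx => by
      rw [norm_mul, Complex.norm_real, norm_abs, abs_of_nonneg (bR_nonneg _ _)]
      exact (mul_le_of_le_one_left (norm_nonneg _) (bR_le_one _ _)).trans (hX x hx))
  refine this.trans (le_of_eq ?_)
  rw [Measure.real, Real.volume_Icc, ENNReal.toReal_ofReal (by linarith)]; ring

lemma bR_integrable (N : ℝ) (hN : 0 < N) (X : ℝ → ℂ) (hX : ContinuousOn X (Ioi 0)) :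
    IntegrableOn (fun ρ => ((bR N ρ : ℝ):ℂ) * X ρ) (Ioi 0) := by
  have h1 : IntegrableOn (fun ρ => ((bR N ρ : ℝ):ℂ) * X ρ) (Icc (N/2) (5/2*N)) := by
    apply ContinuousOn.integrableOn_Icc
    have := bR_cont N
    exact ContinuousOn.mul (by fun_prop) (hX.mono fun x hx => lt_of_lt_of_le (by positivity) hx.1)
  refine h1.of_forall_diff_eq_zero measurableSet_Ioi fun x hx => ?_
  rw [bR_supp N x hN hx.1 hx.2]; simp

lemma Osc_base : ∃ C > (0:ℝ), ∀ N > (0:ℝ), Osc (fun ρ => ((ρ ^ (-(1/2):ℝ) * bR N ρ : ℝ) : ℂ))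
    (fun a => C * N^(1/2:ℝ) * ((1 + N * |a|)^4)⁻¹) := by
  obtain ⟨C, hC, h⟩ := decayN
  refine ⟨C, hC, fun N hN => ⟨?_, h N hN⟩⟩
  have := bR_integrable N hN (fun ρ => ((ρ ^ (-(1/2):ℝ) : ℝ) : ℂ)) (by
    refine Complex.continuous_ofReal.comp_continuousOn ?_
    exact continuousOn_id.rpow_const fun x hx => Or.inl (ne_of_gt hx))
  refine this.congr_fun (fun x _ => ?_) measurableSet_Ioi
  push_cast; ring

lemma Ek_cont (k : ℤ) : Continuous (Ek k) := by
  unfold Ek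
  apply intervalIntegral.continuous_parametric_intervalIntegral_of_continuous'
  have := ex_cont k
  fun_prop

lemma E0_form : ∃ (ap am : ℂ) (A : ℝ) (er : ℝ → ℂ), 0 < A ∧ ‖ap‖ ≤ A ∧ ‖am‖ ≤ A ∧ ∀ s ≥ (1:ℝ), ‖er s‖ ≤ A / s ∧
    Ek 0 s = ((s ^ (-(1/2):ℝ) : ℝ) : ℂ) * (ap * ee s + am * ee (-s) + er s) := by
  obtain ⟨ap, am, C, er, er', hC, h⟩ := Phi_asymp (d := 2) (by norm_num)
  have hpi := rpi_pos
  have n2 : ‖(2 * rpi : ℂ)‖ = 2 * rpi := by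
    rw [norm_mul, Complex.norm_real, norm_abs, abs_of_pos hpi]; simp
  refine ⟨2 * rpi * ap, 2 * rpi * am, 2 * rpi * (‖ap‖ + ‖am‖ + C), fun s => 2 * rpi * er s, by positivity, ?_, ?_, fun s hs => ⟨?_, ?_⟩⟩
  · rw [norm_mul, n2]; gcongr; linarith [norm_nonneg am]
  · rw [norm_mul, n2]; gcongr; linarith [norm_nonneg ap]
  · have := (h s hs).2.1
    beta_reduce
    rw [norm_mul, n2, mul_div_assoc]; gcongr; refine this.trans ?_; gcongr; linarith [norm_nonneg ap, norm_nonneg am]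
  · have := (h s hs).2.2.2 (s • om 0) (by rw [norm_smul, om_norm, mul_one, norm_abs, abs_of_nonneg (by linarith)])
    have h2 := Phi_Ek (s • om 0)
    rw [norm_smul, om_norm, mul_one, norm_abs, abs_of_nonneg (by linarith)] at h2
    rw [← h2, this]
    norm_num
    ring

lemma prod3_err (M1 M2 M3 e1 e2 e3 : ℂ) (A D : ℝ) (hDA : D ≤ A)
    (h1 : ‖M1‖ ≤ 2 * A) (h2 : ‖M2‖ ≤ 2 * A) (h3 : ‖M3‖ ≤ 2 * A) (k1 : ‖e1‖ ≤ D) (k2 : ‖e2‖ ≤ D) (k3 : ‖e3‖ ≤ D) :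
    ‖(M1 + e1) * (M2 + e2) * (M3 + e3) - M1 * M2 * M3‖ ≤ 19 * A^2 * D := by
  have hD : 0 ≤ D := (norm_nonneg _).trans k1
  have e : (M1 + e1) * (M2 + e2) * (M3 + e3) - M1 * M2 * M3 = e1 * (M2 + e2) * (M3 + e3) + M1 * e2 * (M3 + e3) + M1 * M2 * e3 := by ring
  have b2 : ‖M2 + e2‖ ≤ 3 * A := (norm_add_le _ _).trans (by linarith)
  have b3 : ‖M3 + e3‖ ≤ 3 * A := (norm_add_le _ _).trans (by linarith)
  rw [e]
  refine (norm_add₃_le).trans ?_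
  simp only [norm_mul]
  have hA : 0 ≤ A := hD.trans hDA
  calc _ ≤ D * (3 * A) * (3 * A) + 2 * A * D * (3 * A) + 2 * A * (2 * A) * D := by gcongr
    _ = _ := by ring

lemma rp_half (s : ℝ) (hs : 0 < s) : s ^ (-(1/2):ℝ) = (√s)⁻¹ := by
  rw [Real.rpow_neg hs.le, Real.sqrt_eq_rpow]

set_option maxHeartbeats 2000000 in
lemma radial_main : ∃ C > (0:ℝ), ∀ N ≥ (2:ℝ), ∀ t ∈ Icc (1:ℝ) 2, ∀ t' ∈ Icc (1:ℝ) 2, ∀ r0 : ℝ, 0 < r0 → r0 ≤ 1/4 →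
    ‖∫ ρ in Ioi (0:ℝ), ((bR N ρ : ℝ) : ℂ) * ((ρ:ℂ) * (Ek 0 (t * ρ) * (starRingEnd ℂ) (Ek 0 (t' * ρ)) * Ek 0 (r0 * ρ)))‖
      ≤ C * (√N * (√r0)⁻¹ * (((1 + N * |r0 - (t - t')|)^4)⁻¹ + ((1 + N * |r0 + (t - t')|)^4)⁻¹)
        + (√N)⁻¹ * (r0 * √r0)⁻¹) := by
  obtain ⟨C1, hC1, hE⟩ := E01_bound
  obtain ⟨ap, am, A, er, hA, hap, ham, hf⟩ := E0_form
  obtain ⟨C2, hC2, hO⟩ := Osc_base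
  refine ⟨100 * C1^3 + 1000 * A^3 * (1 + C2), by positivity, fun N hN t ht t' ht' r0 hr0 hr1 => ?_⟩
  have hN0 : 0 < N := by linarith
  have ht0 : 0 < t := by linarith [ht.1]
  have ht0' : 0 < t' := by linarith [ht'.1]
  set B1 := ((1 + N * |r0 - (t - t')|)^4)⁻¹ + ((1 + N * |r0 + (t - t')|)^4)⁻¹ with hB1
  have hB1' : 0 ≤ B1 := by rw [hB1]; positivity
  have hsN : 0 < √N := Real.sqrt_pos.2 hN0
  have hsr : 0 < √r0 := Real.sqrt_pos.2 hr0
  have hsN2 : √N * √N = N := Real.mul_self_sqrt hN0.le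
  have hsr2 : √r0 * √r0 = r0 := Real.mul_self_sqrt hr0.le
  have fac : ∀ ρ > (0:ℝ), ((t*ρ)^(-(1/2):ℝ)) ≤ (√ρ)⁻¹ ∧ ((t'*ρ)^(-(1/2):ℝ)) ≤ (√ρ)⁻¹ := by
    intro ρ hρ
    constructor
    · rw [rp_half _ (by positivity)]
      apply inv_anti₀ (Real.sqrt_pos.2 hρ); apply Real.sqrt_le_sqrt; nlinarith [ht.1]
    · rw [rp_half _ (by positivity)]
      apply inv_anti₀ (Real.sqrt_pos.2 hρ); apply Real.sqrt_le_sqrt; nlinarith [ht'.1]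
  have hlow : ∀ ρ ∈ Icc (N/2) (5/2*N), (√ρ)⁻¹ ≤ 2 * (√N)⁻¹ := by
    intro ρ hρ
    have : √N / 2 ≤ √ρ := by
      apply Real.le_sqrt_of_sq_le
      rw [div_pow, sq, hsN2]; linarith [hρ.1]
    calc (√ρ)⁻¹ ≤ (√N / 2)⁻¹ := inv_anti₀ (by positivity) this
      _ = _ := by field_simp
  by_cases hc : N * r0 < 2
  · have h1 := supp_bound N hN0 (fun ρ => (ρ:ℂ) * (Ek 0 (t * ρ) * (starRingEnd ℂ) (Ek 0 (t' * ρ)) * Ek 0 (r0 * ρ)))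
      (C1^3 * (√r0)⁻¹ * (2 * (√N)⁻¹)) (fun ρ hρ => by
        have hρ0 : 0 < ρ := by linarith [hρ.1]
        have hsρ : 0 < √ρ := Real.sqrt_pos.2 hρ0
        beta_reduce
        rw [norm_mul, norm_mul, norm_mul, Complex.norm_real, norm_abs, abs_of_pos hρ0, RCLike.norm_conj]
        have a1 := (hE (t*ρ) (by positivity)).1.trans (mul_le_mul_of_nonneg_left (fac ρ hρ0).1 hC1.le)
        have a2 := (hE (t'*ρ) (by positivity)).1.trans (mul_le_mul_of_nonneg_left (fac ρ hρ0).2 hC1.le)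
        have a3 := (hE (r0*ρ) (by positivity)).1
        rw [rp_half _ (by positivity), Real.sqrt_mul hr0.le] at a3
        calc _ ≤ ρ * ((C1 * (√ρ)⁻¹) * (C1 * (√ρ)⁻¹) * (C1 * (√r0 * √ρ)⁻¹)) := by gcongr
          _ = C1^3 * (√r0)⁻¹ * (√ρ)⁻¹ := by
            have : √ρ * √ρ = ρ := Real.mul_self_sqrt hρ0.le
            field_simp
            rw [sq, this]
          _ ≤ _ := by gcongr; exact hlow ρ hρ)
    refine h1.trans ?_
    have : C1^3 * (√r0)⁻¹ * (2 * (√N)⁻¹) * (2 * N) = 4 * C1^3 * (N * r0) * ((√N)⁻¹ * (r0 * √r0)⁻¹) := by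
      field_simp
      norm_num
    rw [this]
    have pos : 0 ≤ (√N)⁻¹ * (r0 * √r0)⁻¹ := by positivity
    calc _ ≤ 4 * C1^3 * 2 * ((√N)⁻¹ * (r0 * √r0)⁻¹) := by gcongr
      _ ≤ (100 * C1^3 + 1000 * A^3 * (1 + C2)) * ((√N)⁻¹ * (r0 * √r0)⁻¹) := by
        apply mul_le_mul_of_nonneg_right _ pos
        have : 0 ≤ 1000 * A^3 * (1 + C2) := by positivity
        have : 0 < C1^3 := by positivity
        linarith
      _ ≤ _ := by
        gcongr
        have : 0 ≤ √N * (√r0)⁻¹ * B1 := by positivity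
        linarith
  · push Not at hc
    set M : ℝ → ℝ → ℂ := fun τ ρ => ap * ee (τ * ρ) + am * ee (-(τ * ρ)) with hM
    set M' : ℝ → ℝ → ℂ := fun τ ρ => (starRingEnd ℂ) am * ee (τ * ρ) + (starRingEnd ℂ) ap * ee (-(τ * ρ)) with hM'
    have hMM : ∀ τ ρ, (starRingEnd ℂ) (M τ ρ) = M' τ ρ := by
      intro τ ρ
      simp only [hM, hM', map_add, map_mul, ee_conj, neg_neg]; ring
    have hMb : ∀ τ ρ, ‖M τ ρ‖ ≤ 2 * A := by
      intro τ ρ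
      refine (norm_add_le _ _).trans ?_
      rw [norm_mul, norm_mul, ee_norm, ee_norm]; linarith
    have o3 := (((hO N hN0).step ap am A t hap ham).step ((starRingEnd ℂ) am) ((starRingEnd ℂ) ap) A t'
      (by rwa [RCLike.norm_conj]) (by rwa [RCLike.norm_conj])).step ap am A r0 hap ham
    have hcst : ((t * t' * r0)^(-(1/2):ℝ)) ≤ (√r0)⁻¹ := by
      rw [rp_half _ (by positivity)]
      apply inv_anti₀ hsr; apply Real.sqrt_le_sqrt
      have : 1 ≤ t * t' := by nlinarith [ht.1, ht'.1]
      nlinarith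
    set c : ℝ := (t * t' * r0)^(-(1/2):ℝ) with hcdef
    have hc0 : 0 ≤ c := Real.rpow_nonneg (by positivity) _
    -- decomposition
    have dec : ∀ ρ ∈ Icc (N/2) (5/2*N), (ρ:ℂ) * (Ek 0 (t * ρ) * (starRingEnd ℂ) (Ek 0 (t' * ρ)) * Ek 0 (r0 * ρ))
        = (c:ℂ) * ((ρ^(-(1/2):ℝ) : ℝ) : ℂ) * ((M t ρ + er (t*ρ)) * (M' t' ρ + (starRingEnd ℂ) (er (t'*ρ))) * (M r0 ρ + er (r0*ρ))) := by
      intro ρ hρ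
      have hρ0 : 0 < ρ := by linarith [hρ.1]
      have hρ1 : 1 ≤ ρ := by linarith [hρ.1]
      rw [(hf (t*ρ) (by nlinarith [ht.1])).2, (hf (t'*ρ) (by nlinarith [ht'.1])).2, (hf (r0*ρ) (by nlinarith [hρ.1])).2,
        ← hMM]
      rw [map_mul, Complex.conj_ofReal]
      have e1 : ρ * ((t*ρ)^(-(1/2):ℝ) * (t'*ρ)^(-(1/2):ℝ) * (r0*ρ)^(-(1/2):ℝ)) = c * ρ^(-(1/2):ℝ) := by
        rw [hcdef, Real.mul_rpow ht0.le hρ0.le, Real.mul_rpow ht0'.le hρ0.le, Real.mul_rpow hr0.le hρ0.le,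
          Real.mul_rpow (by positivity) hr0.le, Real.mul_rpow ht0.le ht0'.le]
        have : ρ^(-(1/2):ℝ) * ρ^(-(1/2):ℝ) * ρ = 1 := by
          nth_rewrite 3 [← Real.rpow_one ρ]
          rw [← Real.rpow_add hρ0, ← Real.rpow_add hρ0]; norm_num
        linear_combination (t^(-(1/2):ℝ) * t'^(-(1/2):ℝ) * r0^(-(1/2):ℝ) * ρ^(-(1/2):ℝ)) * this
      rw [map_add, show (starRingEnd ℂ) (ap * ee (t'*ρ) + am * ee (-(t'*ρ))) = (starRingEnd ℂ) (M t' ρ) from rfl]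
      have e2 := congrArg (fun x : ℝ => (x:ℂ)) e1
      push_cast at e2
      simp only [hM]
      push_cast
      linear_combination ((ap * ee (t*ρ) + am * ee (-(t*ρ)) + er (t*ρ)) * ((starRingEnd ℂ) (ap * ee (t'*ρ) + am * ee (-(t'*ρ))) + (starRingEnd ℂ) (er (t'*ρ))) * (ap * ee (r0*ρ) + am * ee (-(r0*ρ)) + er (r0*ρ))) * e2
    set X : ℝ → ℂ := fun ρ => (ρ:ℂ) * (Ek 0 (t * ρ) * (starRingEnd ℂ) (Ek 0 (t' * ρ)) * Ek 0 (r0 * ρ)) with hX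
    set Y : ℝ → ℂ := fun ρ => (c:ℂ) * (((ρ^(-(1/2):ℝ) : ℝ) : ℂ) * (M t ρ * M' t' ρ * M r0 ρ)) with hY
    have hXY := supp_bound N hN0 (fun ρ => X ρ - Y ρ) ((√r0)⁻¹ * (2 * (√N)⁻¹) * (19 * A^2 * (2 * A / (N * r0)))) (fun ρ hρ => by
      have hρ0 : 0 < ρ := by linarith [hρ.1]
      have hρ1 : 1 ≤ ρ := by linarith [hρ.1]
      have hr : N * r0 / 2 ≤ r0 * ρ := by nlinarith [hρ.1]
      simp only [hX, hY]
      rw [dec ρ hρ, ← mul_assoc (c:ℂ), ← mul_sub, norm_mul, norm_mul, Complex.norm_real, Complex.norm_real,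
        norm_abs, norm_abs, abs_of_nonneg hc0, abs_of_nonneg (Real.rpow_nonneg hρ0.le _), rp_half _ hρ0]
      have key : ∀ s, N * r0 / 2 ≤ s → ‖er s‖ ≤ 2 * A / (N * r0) := by
        intro s hs
        refine (hf s (by linarith)).1.trans ?_
        calc A / s ≤ A / (N * r0 / 2) := by gcongr
          _ = _ := by field_simp
      have := prod3_err (M t ρ) (M' t' ρ) (M r0 ρ) (er (t*ρ)) ((starRingEnd ℂ) (er (t'*ρ))) (er (r0*ρ)) A (2 * A / (N * r0))
        (by rw [div_le_iff₀ (by positivity)]; nlinarith) (hMb _ _) (by rw [← hMM, RCLike.norm_conj]; exact hMb _ _) (hMb _ _)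
        (key _ (by nlinarith [ht.1])) (by rw [RCLike.norm_conj]; exact key _ (by nlinarith [ht'.1])) (key _ hr)
      have h2 := hlow ρ hρ
      gcongr)
    have hY2 : ‖∫ ρ in Ioi (0:ℝ), ((bR N ρ : ℝ) : ℂ) * Y ρ‖ ≤ (√r0)⁻¹ * (A * (A * (A * (2 * (C2 * √N * B1) + 4 * (C2 * √N * (N^4)⁻¹))))) := by
      have e0 : ∫ ρ in Ioi (0:ℝ), ((bR N ρ : ℝ) : ℂ) * Y ρ = (c:ℂ) * ∫ ρ in Ioi (0:ℝ),
          (((ρ ^ (-(1/2):ℝ) * bR N ρ : ℝ) : ℂ) * (ap * ee (t * ρ) + am * ee (-(t * ρ))) * ((starRingEnd ℂ) am * ee (t' * ρ) + (starRingEnd ℂ) ap * ee (-(t' * ρ)))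
            * (ap * ee (r0 * ρ) + am * ee (-(r0 * ρ)))) * ee (ρ * 0) := by
        rw [← integral_const_mul]
        congr 1; ext ρ
        simp only [hY, hM, hM', mul_zero, ee_zero]
        push_cast; ring
      rw [e0, norm_mul, Complex.norm_real, norm_abs, abs_of_nonneg hc0]
      refine mul_le_mul hcst ((o3.2 0).trans ?_) (norm_nonneg _) (by positivity)
      rw [← Real.sqrt_eq_rpow]
      beta_reduce
      have far : ∀ a, 1 ≤ |a| → C2 * √N * ((1 + N * |a|)^4)⁻¹ ≤ C2 * √N * (N^4)⁻¹ := by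
        intro a ha; gcongr; nlinarith
      have f1 := far (0 + r0 + t' + t) (by rw [abs_of_nonneg (by linarith)]; linarith [ht.1])
      have f2 := far (0 + r0 - t' - t) (by rw [abs_of_neg (by linarith [ht.1, ht'.1])]; linarith [ht.1, ht'.1])
      have f3 := far (0 - r0 + t' + t) (by rw [abs_of_nonneg (by linarith [ht.1, ht'.1])]; linarith [ht.1, ht'.1])
      have f4 := far (0 - r0 - t' - t) (by rw [abs_of_neg (by linarith [ht.1, ht'.1])]; linarith [ht.1, ht'.1])
      have g1 : |0 + r0 - t' + t| = |r0 + (t - t')| := by congr 1; ring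
      have g2 : |0 + r0 + t' - t| = |r0 - (t - t')| := by congr 1; ring
      have g3 : |0 - r0 - t' + t| = |r0 - (t - t')| := by rw [← abs_neg]; congr 1; ring
      have g4 : |0 - r0 + t' - t| = |r0 + (t - t')| := by rw [← abs_neg]; congr 1; ring
      rw [g1, g2, g3, g4]
      calc _ = A * (A * (A * (2 * (C2 * √N * B1) + (C2 * √N * ((1 + N * |0 + r0 + t' + t|)^4)⁻¹ + C2 * √N * ((1 + N * |0 + r0 - t' - t|)^4)⁻¹
            + C2 * √N * ((1 + N * |0 - r0 + t' + t|)^4)⁻¹ + C2 * √N * ((1 + N * |0 - r0 - t' - t|)^4)⁻¹)))) := by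
              rw [hB1]; ring
        _ ≤ _ := by gcongr; linarith
    have hcY : ContinuousOn Y (Ioi 0) := by
      have : ContinuousOn (fun ρ : ℝ => ((ρ^(-(1/2):ℝ) : ℝ) : ℂ)) (Ioi 0) := by
        refine Complex.continuous_ofReal.comp_continuousOn ?_
        exact continuousOn_id.rpow_const fun x hx => Or.inl (ne_of_gt hx)
      simp only [hY, hM, hM']
      fun_prop
    have hcX : ContinuousOn X (Ioi 0) := by
      have := Ek_cont 0
      simp only [hX]
      fun_prop
    have split : ∫ ρ in Ioi (0:ℝ), ((bR N ρ : ℝ) : ℂ) * X ρ = (∫ ρ in Ioi (0:ℝ), ((bR N ρ : ℝ) : ℂ) * (X ρ - Y ρ)) + ∫ ρ in Ioi (0:ℝ), ((bR N ρ : ℝ) : ℂ) * Y ρ := by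
      rw [← integral_add (bR_integrable N hN0 (fun ρ => X ρ - Y ρ) (hcX.sub hcY)) (bR_integrable N hN0 _ hcY)]
      congr 1; ext ρ; ring
    rw [split]
    refine (norm_add_le _ _).trans ((add_le_add hXY hY2).trans ?_)
    set P := (√N)⁻¹ * (r0 * √r0)⁻¹ with hP
    have hP0 : 0 ≤ P := by rw [hP]; positivity
    have q1 : (√r0)⁻¹ * (2 * (√N)⁻¹) * (19 * A^2 * (2 * A / (N * r0))) * (2 * N) = 152 * A^3 * P := by
      rw [hP]; field_simp; norm_num
    have q2 : (√r0)⁻¹ * (√N * (N^4)⁻¹) ≤ P := by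
      have : (√r0)⁻¹ * (√N * (N^4)⁻¹) = P * (r0 * (N^3)⁻¹) := by
        rw [hP]; field_simp; rw [sq, hsN2]
      rw [this]
      apply mul_le_of_le_one_right hP0
      have : (N^3)⁻¹ ≤ 1 := inv_le_one_of_one_le₀ (one_le_pow₀ (by linarith))
      have : 0 ≤ (N^3)⁻¹ := by positivity
      nlinarith
    rw [q1]
    have q3 : (√r0)⁻¹ * (A * (A * (A * (2 * (C2 * √N * B1) + 4 * (C2 * √N * (N^4)⁻¹)))))
       = 2 * A^3 * C2 * (√N * (√r0)⁻¹ * B1) + 4 * A^3 * C2 * ((√r0)⁻¹ * (√N * (N^4)⁻¹)) := by ring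
    rw [q3]
    have hQ : 0 ≤ √N * (√r0)⁻¹ * B1 := by positivity
    set Q := √N * (√r0)⁻¹ * B1
    have hA3 : 0 < A^3 := by positivity
    have hAC : 0 < A^3 * C2 := by positivity
    have hC13 : 0 < C1^3 := by positivity
    nlinarith [mul_nonneg hA3.le hP0, mul_nonneg hA3.le hQ, mul_nonneg hAC.le hP0, mul_nonneg hAC.le hQ, mul_nonneg hC13.le hP0, mul_nonneg hC13.le hQ, mul_le_mul_of_nonneg_left q2 hAC.le]

lemma per_shift (f : ℝ → ℂ) (hf : Function.Periodic f (2 * rpi)) (ψ : ℝ) :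
    ∫ u in (-rpi)..Real.pi, f u = ∫ u in (-rpi)..Real.pi, f (ψ + u) := by
  have h1 := hf.intervalIntegral_add_eq (-rpi) (ψ + -rpi)
  rw [intervalIntegral.integral_comp_add_left (fun u => f u) ψ]
  rw [show -rpi + 2 * rpi = rpi by ring, show ψ + -rpi + 2 * rpi = ψ + rpi by ring] at h1
  exact h1

/-- bump `cos^{2m}(u-v)` -/
def gv (m : ℕ) (v u : ℝ) : ℂ := ((rcos (u - v) ^ (2 * m) : ℝ) : ℂ)

lemma gv_cont (m : ℕ) (v : ℝ) : Continuous (gv m v) := by unfold gv; fun_prop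

lemma gv_cont2 (m : ℕ) : Continuous (fun p : ℝ × ℝ => gv m p.1 p.2) := by unfold gv; fun_prop

lemma gv_per (m : ℕ) (v : ℝ) : Function.Periodic (gv m v) (2 * rpi) := by
  intro u
  unfold gv
  rw [show u + 2 * rpi - v = u - v + 2 * rpi by ring, Real.cos_add_two_pi]

/-- arc symbol -/
def PhV (m : ℕ) (v : ℝ) (ξ : EE 2) : ℂ :=
  ((1 / (2 * rpi) : ℝ) : ℂ) * ∫ u in (-rpi)..Real.pi, gv m v u * ee (inner ℝ (om u) ξ)

def CV (g : ℝ → ℂ) (s ψ : ℝ) : ℂ := ∫ u in (-rpi)..Real.pi, g (ψ + u) * ee (s * rcos u)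

lemma PhV_polar (m : ℕ) (v ρ ψ : ℝ) :
    PhV m v (ρ • om ψ) = ((1 / (2 * rpi) : ℝ) : ℂ) * CV (gv m v) ρ ψ := by
  unfold PhV CV
  congr 1
  have hp : Function.Periodic (fun u => gv m v u * ee (inner ℝ (om u) (ρ • om ψ))) (2 * rpi) := by
    intro u
    beta_reduce
    rw [gv_per m v u, inner_smul_right, inner_smul_right, om_inner, om_inner,
      show u + 2 * rpi - ψ = u - ψ + 2 * rpi by ring, Real.cos_add_two_pi]
  rw [per_shift _ hp ψ]
  congr 1; ext u
  rw [inner_smul_right, om_inner, add_sub_cancel_left]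

lemma CV_cont (g : ℝ → ℂ) (hg : Continuous g) : Continuous (fun p : ℝ × ℝ => CV g p.1 p.2) := by
  unfold CV
  apply intervalIntegral.continuous_parametric_intervalIntegral_of_continuous'
  simp only [Function.uncurry_def]
  fun_prop

lemma PhV_cont (m : ℕ) : Continuous (fun p : ℝ × EE 2 => PhV m p.1 p.2) := by
  unfold PhV
  refine continuous_const.mul ?_
  apply intervalIntegral.continuous_parametric_intervalIntegral_of_continuous'
  have := om_cont
  have := gv_cont2 m
  simp only [Function.uncurry_def]
  unfold gv
  fun_prop

lemma norm_2pi : ‖((1 / (2 * rpi) : ℝ) : ℂ)‖ = 1 / (2 * rpi) := by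
  rw [Complex.norm_real, norm_abs, abs_of_pos (by positivity)]

lemma gv_norm (m : ℕ) (v u : ℝ) : ‖gv m v u‖ ≤ 1 := by
  unfold gv
  rw [Complex.norm_real, norm_abs, abs_pow]
  exact pow_le_one₀ (abs_nonneg _) (Real.abs_cos_le_one _)

lemma CV_bdd (m : ℕ) (v s ψ : ℝ) : ‖CV (gv m v) s ψ‖ ≤ 2 * rpi := by
  unfold CV
  refine (intervalIntegral.norm_integral_le_of_norm_le_const (C := 1) fun u _ => ?_).trans (le_of_eq ?_)
  · rw [norm_mul, ee_norm, mul_one]; exact gv_norm _ _ _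
  · rw [one_mul, abs_of_pos (by linarith [rpi_pos])]; ring

lemma PhV_bdd (m : ℕ) (v : ℝ) (ξ : EE 2) : ‖PhV m v ξ‖ ≤ 1 := by
  obtain ⟨u, hu⟩ := om_surj ξ
  rw [hu, PhV_polar, norm_mul, norm_2pi]
  have := CV_bdd m v ‖ξ‖ u
  have hp := rpi_pos
  rw [div_mul_eq_mul_div, one_mul, div_le_one (by positivity)]
  exact this

lemma bN_polar (N ρ ψ : ℝ) : bN 2 N (ρ • om ψ) ^ 2 = bR N ρ := by
  unfold bN bR
  rw [smul_smul, norm_smul, om_norm, mul_one, norm_abs, sq_abs]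

/-- TT* kernel -/
def LK (m : ℕ) (v N t t' : ℝ) (z : EE 2) : ℂ :=
  ∫ ξ, ((bN 2 N ξ ^ 2 : ℝ) : ℂ) * (PhV m v (t • ξ) * (starRingEnd ℂ) (PhV m v (t' • ξ)) * ee (inner ℝ ξ z))

/-- product of the two conv symbols -/
def GG (m : ℕ) (v t t' ρ ψ : ℝ) : ℂ := CV (gv m v) (t * ρ) ψ * (starRingEnd ℂ) (CV (gv m v) (t' * ρ) ψ)

lemma GG_cont (m : ℕ) (v t t' : ℝ) : Continuous (fun p : ℝ × ℝ => GG m v t t' p.1 p.2) := by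
  unfold GG
  have h := CV_cont (gv m v) (gv_cont m v)
  have h1 : Continuous (fun p : ℝ × ℝ => CV (gv m v) (t * p.1) p.2) := h.comp (by fun_prop : Continuous fun p : ℝ × ℝ => (t * p.1, p.2))
  have h2 : Continuous (fun p : ℝ × ℝ => CV (gv m v) (t' * p.1) p.2) := h.comp (by fun_prop : Continuous fun p : ℝ × ℝ => (t' * p.1, p.2))
  exact h1.mul (continuous_conj.comp h2)

lemma LK_polar (m : ℕ) (v N t t' : ℝ) (hN : 0 < N) (r0 φ : ℝ) :
    LK m v N t t' (r0 • om φ) = ((1 / (2 * rpi) : ℝ) : ℂ)^2 * ∫ ρ in Ioi (0:ℝ), ((bR N ρ : ℝ) : ℂ) * ((ρ:ℂ) *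
      CV (GG m v t t' ρ) (r0 * ρ) φ) := by
  unfold LK
  rw [polar2_int]
  have e1 : ∀ p : ℝ × ℝ, (p.1:ℂ) * (((bN 2 N (p.1 • om p.2) ^ 2 : ℝ) : ℂ) * (PhV m v (t • p.1 • om p.2) * (starRingEnd ℂ) (PhV m v (t' • p.1 • om p.2)) * ee (inner ℝ (p.1 • om p.2) (r0 • om φ))))
      = ((1 / (2 * rpi) : ℝ) : ℂ)^2 * (((bR N p.1 : ℝ) : ℂ) * ((p.1:ℂ) * (GG m v t t' p.1 p.2 * ee (r0 * p.1 * rcos (p.2 - φ))))) := by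
    intro p
    rw [bN_polar, smul_smul, smul_smul, PhV_polar, PhV_polar, inner_smul_left, inner_smul_right, om_inner, map_mul, Complex.conj_ofReal]
    unfold GG
    simp only [conj_trivial]
    rw [show p.1 * (r0 * rcos (p.2 - φ)) = r0 * p.1 * rcos (p.2 - φ) by ring]
    ring
  simp only [e1]
  rw [integral_const_mul]
  congr 1
  have hc : Continuous (fun p : ℝ × ℝ => ((bR N p.1 : ℝ) : ℂ) * ((p.1:ℂ) * (GG m v t t' p.1 p.2 * ee (r0 * p.1 * rcos (p.2 - φ))))) := by
    have h1 := GG_cont m v t t'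
    have h2 : Continuous (fun p : ℝ × ℝ => ((bR N p.1 : ℝ) : ℂ)) := by
      have := bR_cont N; fun_prop
    exact h2.mul (by fun_prop)
  have hi : IntegrableOn (fun p : ℝ × ℝ => ((bR N p.1 : ℝ) : ℂ) * ((p.1:ℂ) * (GG m v t t' p.1 p.2 * ee (r0 * p.1 * rcos (p.2 - φ)))))
      (Ioi (0:ℝ) ×ˢ Ioo (-rpi) rpi) (volume.prod volume) := by
    have h1 : IntegrableOn (fun p : ℝ × ℝ => ((bR N p.1 : ℝ) : ℂ) * ((p.1:ℂ) * (GG m v t t' p.1 p.2 * ee (r0 * p.1 * rcos (p.2 - φ)))))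
      (Icc (N/2) (5/2*N) ×ˢ Icc (-rpi) rpi) (volume.prod volume) :=
      hc.continuousOn.integrableOn_compact (isCompact_Icc.prod isCompact_Icc)
    refine h1.of_forall_diff_eq_zero (measurableSet_Ioi.prod measurableSet_Ioo) fun x hx => ?_
    have h3 : x.1 ∉ Icc (N/2) (5/2*N) := fun h => hx.2 ⟨h, ⟨hx.1.2.1.le, hx.1.2.2.le⟩⟩
    rw [bR_supp N x.1 hN hx.1.1 h3]; simp
  have h5 := setIntegral_prod _ hi
  rw [Measure.volume_eq_prod, h5]
  refine setIntegral_congr_fun measurableSet_Ioi fun ρ hρ => ?_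
  dsimp only
  rw [integral_const_mul, integral_const_mul]
  congr 2
  rw [← integral_Ioc_eq_integral_Ioo, ← intervalIntegral.integral_of_le (by linarith [rpi_pos])]
  unfold CV
  have hp : Function.Periodic (fun u => GG m v t t' ρ u * ee (r0 * ρ * rcos (u - φ))) (2 * rpi) := by
    intro u
    have hg : GG m v t t' ρ (u + 2 * rpi) = GG m v t t' ρ u := by
      unfold GG CV
      have : ∀ w, gv m v (u + 2 * rpi + w) = gv m v (u + w) := fun w => by
        rw [show u + 2 * rpi + w = u + w + 2 * rpi by ring]; exact gv_per m v _
      simp only [this]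
    beta_reduce
    rw [hg, show u + 2 * rpi - φ = u - φ + 2 * rpi by ring, Real.cos_add_two_pi]
  rw [per_shift _ hp φ]
  simp only [add_sub_cancel_left]

lemma rp_3half (s : ℝ) (hs : 0 < s) : s ^ (-(3/2):ℝ) = (s * √s)⁻¹ := by
  rw [Real.rpow_neg hs.le, Real.sqrt_eq_rpow, show (3/2:ℝ) = 1 + 1/2 by norm_num, Real.rpow_add hs, Real.rpow_one]

lemma GG_TP : ∃ C > (0:ℝ), ∀ (m : ℕ) (v : ℝ), ∀ t ∈ Icc (1:ℝ) 2, ∀ t' ∈ Icc (1:ℝ) 2, ∀ ρ > (0:ℝ),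
    TP (4 * m) (C * (1 + 4 * m)^4 * ρ⁻¹) (GG m v t t' ρ) := by
  obtain ⟨C, hC, h⟩ := TP.conv
  refine ⟨C^2, by positivity, fun m v t ht t' ht' ρ hρ => ?_⟩
  have h1 := h _ _ _ (t * ρ) (by nlinarith [ht.1]) (TP.cos_pow v m)
  have h2 := h _ _ _ (t' * ρ) (by nlinarith [ht'.1]) (TP.cos_pow v m)
  have h3 := h1.mul h2.conj
  have mono : ∀ {K A K' A' : ℝ} {g : ℝ → ℂ}, TP K A g → K ≤ K' → A ≤ A' → TP K' A' g := by
    rintro K A K' A' g ⟨ι, i, κ, c, a, b, d⟩ hK hA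
    exact ⟨ι, i, κ, c, fun j => ⟨(a j).1, (a j).2.trans hK⟩, b.trans hA, d⟩
  refine mono h3 (by linarith) ?_
  have hsρ : 0 < √ρ := Real.sqrt_pos.2 hρ
  have hs2 : √ρ * √ρ = ρ := Real.mul_self_sqrt hρ.le
  have f : ∀ τ ∈ Icc (1:ℝ) 2, (τ*ρ)^(-(1/2):ℝ) ≤ (√ρ)⁻¹ := by
    intro τ hτ
    rw [rp_half _ (by nlinarith [hτ.1])]
    apply inv_anti₀ hsρ; apply Real.sqrt_le_sqrt; nlinarith [hτ.1]
  have f1 := f t ht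
  have f2 := f t' ht'
  have g : (1 + (2 * (m:ℝ))^2) ≤ (1 + 4 * m)^2 := by
    have : (0:ℝ) ≤ m := Nat.cast_nonneg m
    nlinarith
  have p1 : 0 ≤ (t*ρ)^(-(1/2):ℝ) := Real.rpow_nonneg (by nlinarith [ht.1]) _
  have p2 : 0 ≤ (t'*ρ)^(-(1/2):ℝ) := Real.rpow_nonneg (by nlinarith [ht'.1]) _
  calc _ ≤ C * (1 + 4 * m)^2 * (√ρ)⁻¹ * 1 * (C * (1 + 4 * m)^2 * (√ρ)⁻¹ * 1) := by gcongr
    _ = C^2 * (1 + 4 * m)^4 * (√ρ * √ρ)⁻¹ := by field_simp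
    _ = _ := by rw [hs2]

set_option maxHeartbeats 2000000 in
lemma GG_approx : ∃ C > (0:ℝ), ∀ (m : ℕ) (v φ : ℝ), ∀ t ∈ Icc (1:ℝ) 2, ∀ t' ∈ Icc (1:ℝ) 2, ∀ ρ ≥ (1:ℝ),
    ‖GG m v t t' ρ φ - ((rcos (φ - v) ^ (4 * m) : ℝ) : ℂ) * (Ek 0 (t * ρ) * (starRingEnd ℂ) (Ek 0 (t' * ρ)))‖
      ≤ C * (1 + 4 * m)^8 * (ρ^2)⁻¹ := by
  obtain ⟨C, hC, h⟩ := TP.approx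
  obtain ⟨C1, hC1, hE⟩ := E01_bound
  refine ⟨C * C1 + C * (C + C1), by positivity, fun m v φ t ht t' ht' ρ hρ => ?_⟩
  have hρ0 : 0 < ρ := by linarith
  have hsρ : 0 < √ρ := Real.sqrt_pos.2 hρ0
  have hs2 : √ρ * √ρ = ρ := Real.mul_self_sqrt hρ0.le
  have hm0 : (0:ℝ) ≤ m := Nat.cast_nonneg m
  have key : ∀ τ ∈ Icc (1:ℝ) 2, ‖CV (gv m v) (τ * ρ) φ - gv m v φ * Ek 0 (τ * ρ)‖ ≤ C * (1 + 4 * m)^4 * (ρ * √ρ)⁻¹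
      ∧ ‖gv m v φ * Ek 0 (τ * ρ)‖ ≤ C1 * (√ρ)⁻¹ := by
    intro τ hτ
    have hτ0 : 0 < τ * ρ := by nlinarith [hτ.1]
    have hτρ : ρ ≤ τ * ρ := by nlinarith [hτ.1]
    have hq : √ρ ≤ √(τ * ρ) := Real.sqrt_le_sqrt hτρ
    constructor
    · refine (h _ _ _ (τ * ρ) φ hτ0 (TP.cos_pow v m)).trans ?_
      rw [rp_3half _ hτ0, mul_one]
      gcongr; norm_num
    · have := (hE (τ * ρ) hτ0).1
      rw [rp_half _ hτ0] at this
      rw [norm_mul]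
      calc _ ≤ 1 * (C1 * (√(τ * ρ))⁻¹) := by gcongr; exact gv_norm _ _ _
        _ ≤ _ := by rw [one_mul]; gcongr
  obtain ⟨a1, b1⟩ := key t ht
  obtain ⟨a2, b2⟩ := key t' ht'
  unfold GG
  set X := CV (gv m v) (t * ρ) φ
  set X' := CV (gv m v) (t' * ρ) φ
  have e : ((rcos (φ - v) ^ (4 * m) : ℝ) : ℂ) * (Ek 0 (t * ρ) * (starRingEnd ℂ) (Ek 0 (t' * ρ)))
      = (gv m v φ * Ek 0 (t*ρ)) * (starRingEnd ℂ) (gv m v φ * Ek 0 (t'*ρ)) := by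
    rw [map_mul]
    unfold gv
    rw [Complex.conj_ofReal, show 4 * m = 2 * m + 2 * m by ring, pow_add]
    push_cast; ring
  rw [e]
  set Y := gv m v φ * Ek 0 (t*ρ)
  set Y' := gv m v φ * Ek 0 (t'*ρ)
  have e2 : X * (starRingEnd ℂ) X' - Y * (starRingEnd ℂ) Y' = (X - Y) * (starRingEnd ℂ) (X' - Y') + (X - Y) * (starRingEnd ℂ) Y' + Y * (starRingEnd ℂ) (X' - Y') := by
    rw [map_sub]; ring
  rw [e2]
  refine norm_add₃_le.trans ?_
  simp only [norm_mul, RCLike.norm_conj]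
  set W : ℝ := (1 + 4 * m)^4 with hW
  have hW1 : 1 ≤ W := one_le_pow₀ (by linarith)
  have hW8 : (1 + 4 * (m:ℝ))^8 = W * W := by rw [hW]; ring
  rw [hW8]
  calc _ ≤ (C * W * (ρ * √ρ)⁻¹) * (C * W * (ρ * √ρ)⁻¹) + (C * W * (ρ * √ρ)⁻¹) * (C1 * (√ρ)⁻¹) + (C1 * (√ρ)⁻¹) * (C * W * (ρ * √ρ)⁻¹) := by gcongr
    _ = C * C * (W * W) * (ρ^2)⁻¹ * ρ⁻¹ + 2 * C * C1 * W * (ρ^2)⁻¹ := by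
      have : (ρ * √ρ)⁻¹ * (√ρ)⁻¹ = (ρ^2)⁻¹ := by rw [← mul_inv, mul_assoc, hs2, sq]
      have h2 : (ρ * √ρ)⁻¹ * (ρ * √ρ)⁻¹ = (ρ^2)⁻¹ * ρ⁻¹ := by
        rw [← mul_inv, ← mul_inv]; congr 1; rw [mul_mul_mul_comm, hs2]; ring
      linear_combination (2 * C * C1 * W) * this + (C * C * W * W) * h2
    _ ≤ C * C * (W * W) * (ρ^2)⁻¹ * 1 + 2 * C * C1 * (W * W) * (ρ^2)⁻¹ := by
      gcongr
      · exact inv_le_one_of_one_le₀ hρ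
      · nlinarith
    _ = _ := by ring

lemma CVGG_cont (m : ℕ) (v t t' r0 φ : ℝ) : Continuous (fun ρ : ℝ => CV (GG m v t t' ρ) (r0 * ρ) φ) := by
  have h := GG_cont m v t t'
  generalize GG m v t t' = G at h
  unfold CV
  apply intervalIntegral.continuous_parametric_intervalIntegral_of_continuous'
  simp only [Function.uncurry_def]
  have h1 : Continuous (fun p : ℝ × ℝ => G p.1 (φ + p.2)) := Continuous.comp (g := fun p : ℝ × ℝ => G p.1 p.2) (f := fun p : ℝ × ℝ => (p.1, φ + p.2)) h (by fun_prop)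
  exact h1.mul (by fun_prop)

lemma kernel_arith (x y D C1 c W B P : ℝ) (hx : x ≤ 8 * D * W * P) (hy : y ≤ C1 * (B + P)) (hD : 0 ≤ D) (hC : 0 ≤ C1)
    (hc0 : 0 ≤ c) (hcW : c ≤ W) (hB : 0 ≤ B) (hP : 0 ≤ P) :
    x + c * y ≤ (C1 + 8 * D) * (c * B + W * P) := by
  have h1 : c * y ≤ c * (C1 * (B + P)) := mul_le_mul_of_nonneg_left hy hc0
  have h2 : C1 * (c * P) ≤ C1 * (W * P) := by gcongr
  have h3 : 0 ≤ 8 * D * (c * B) := by positivity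
  linarith

set_option maxHeartbeats 2000000 in
lemma kernel_est : ∃ C > (0:ℝ), ∀ (m : ℕ) (v : ℝ), ∀ N ≥ (2:ℝ), ∀ t ∈ Icc (1:ℝ) 2, ∀ t' ∈ Icc (1:ℝ) 2,
    ∀ r0 : ℝ, 0 < r0 → r0 ≤ 1/4 → ∀ φ : ℝ,
    ‖LK m v N t t' (r0 • om φ)‖ ≤ C * (rcos (φ - v) ^ (4 * m) *
      (√N * (√r0)⁻¹ * (((1 + N * |r0 - (t - t')|)^4)⁻¹ + ((1 + N * |r0 + (t - t')|)^4)⁻¹))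
        + (1 + 4 * m)^8 * ((√N)⁻¹ * (r0 * √r0)⁻¹)) := by
  obtain ⟨C1, hC1, h1⟩ := radial_main
  obtain ⟨C2, hC2, h2⟩ := GG_TP
  obtain ⟨C3, hC3, h3⟩ := GG_approx
  obtain ⟨C4, hC4, h4⟩ := TP.approx
  obtain ⟨C5, hC5, h5⟩ := E01_bound
  refine ⟨C1 + 8 * (C4 * C2 + C3 * C5), by positivity, fun m v N hN t ht t' ht' r0 hr0 hr1 φ => ?_⟩
  have hN0 : 0 < N := by linarith
  have hsN : 0 < √N := Real.sqrt_pos.2 hN0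
  have hsr : 0 < √r0 := Real.sqrt_pos.2 hr0
  have hsN2 : √N * √N = N := Real.mul_self_sqrt hN0.le
  set P := (√N)⁻¹ * (r0 * √r0)⁻¹ with hP
  have hP0 : 0 ≤ P := by rw [hP]; positivity
  set B := √N * (√r0)⁻¹ * (((1 + N * |r0 - (t - t')|)^4)⁻¹ + ((1 + N * |r0 + (t - t')|)^4)⁻¹) with hB
  have hB0 : 0 ≤ B := by rw [hB]; positivity
  have hm0 : (0:ℝ) ≤ m := Nat.cast_nonneg m
  have hcos1 : rcos (φ - v) ^ (4 * m) ≤ 1 := by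
    rw [← Even.pow_abs (by exact ⟨2 * m, by ring⟩)]
    exact pow_le_one₀ (abs_nonneg _) (Real.abs_cos_le_one _)
  have hcos0 : 0 ≤ rcos (φ - v) ^ (4 * m) := Even.pow_nonneg (by exact ⟨2 * m, by ring⟩) _
  set c := rcos (φ - v) ^ (4 * m) with hc
  set W : ℝ := (1 + 4 * m)^8 with hW
  have hW1 : 1 ≤ W := one_le_pow₀ (by linarith)
  rw [LK_polar m v N t t' hN0, norm_mul, norm_pow, norm_2pi]
  have hpi : (1 / (2 * rpi))^2 ≤ 1 := by
    apply pow_le_one₀ (by positivity)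
    rw [div_le_one (by positivity)]; linarith [Real.pi_gt_three]
  refine (mul_le_of_le_one_left (norm_nonneg _) hpi).trans ?_
  set X : ℝ → ℂ := fun ρ => (ρ:ℂ) * CV (GG m v t t' ρ) (r0 * ρ) φ with hX
  set Y : ℝ → ℂ := fun ρ => (ρ:ℂ) * (Ek 0 (t * ρ) * (starRingEnd ℂ) (Ek 0 (t' * ρ)) * Ek 0 (r0 * ρ)) with hY
  have hYb := h1 N hN t ht t' ht' r0 hr0 hr1
  have hXY := supp_bound N hN0 (fun ρ => X ρ - (c:ℂ) * Y ρ) ((C4 * C2 + C3 * C5) * W * (4 * (N * √N)⁻¹ * (r0 * √r0)⁻¹)) (fun ρ hρ => by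
    have hρ0 : 0 < ρ := by linarith [hρ.1]
    have hρ1 : 1 ≤ ρ := by linarith [hρ.1]
    have hsρ : 0 < √ρ := Real.sqrt_pos.2 hρ0
    have hρ2 : (ρ * √ρ)⁻¹ ≤ 4 * (N * √N)⁻¹ := by
      have : √N / 2 ≤ √ρ := by
        apply Real.le_sqrt_of_sq_le
        rw [div_pow, sq, hsN2]; linarith [hρ.1]
      have h0 := hρ.1
      calc (ρ * √ρ)⁻¹ ≤ (N / 2 * (√N / 2))⁻¹ := by gcongr
        _ = _ := by field_simp; norm_num
    have i1 := h4 _ _ _ (r0 * ρ) φ (by positivity) (h2 m v t ht t' ht' ρ hρ0)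
    rw [rp_3half _ (by positivity), Real.sqrt_mul hr0.le] at i1
    have i2 := h3 m v φ t ht t' ht' ρ hρ1
    have i3 := (h5 (r0 * ρ) (by positivity)).1
    rw [rp_half _ (by positivity), Real.sqrt_mul hr0.le] at i3
    have e : X ρ - (c:ℂ) * Y ρ = (ρ:ℂ) * ((CV (GG m v t t' ρ) (r0 * ρ) φ - GG m v t t' ρ φ * Ek 0 (r0 * ρ))
        + (GG m v t t' ρ φ - (c:ℂ) * (Ek 0 (t * ρ) * (starRingEnd ℂ) (Ek 0 (t' * ρ)))) * Ek 0 (r0 * ρ)) := by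
      simp only [hX, hY]; ring
    rw [e, norm_mul, Complex.norm_real, norm_abs, abs_of_pos hρ0]
    calc _ ≤ ρ * (C4 * (1 + 4 * m)^4 * (r0 * ρ * (√r0 * √ρ))⁻¹ * (C2 * (1 + 4 * m)^4 * ρ⁻¹) + C3 * (1 + 4 * m)^8 * (ρ^2)⁻¹ * (C5 * (√r0 * √ρ)⁻¹)) := by
          gcongr
          refine (norm_add_le _ _).trans ?_
          rw [norm_mul]
          gcongr
          exact i1
      _ = W * ((ρ * √ρ)⁻¹ * (r0 * √r0)⁻¹) * (C4 * C2 + C3 * C5 * r0) := by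
          rw [hW]; field_simp
      _ ≤ W * ((4 * (N * √N)⁻¹) * (r0 * √r0)⁻¹) * (C4 * C2 + C3 * C5 * 1) := by
          gcongr; linarith
      _ = _ := by ring)
  have hcY : Continuous Y := by
    have := Ek_cont 0
    simp only [hY]
    fun_prop
  have hcX : Continuous X := by
    simp only [hX]
    exact Continuous.mul (by fun_prop) (CVGG_cont m v t t' r0 φ)
  have split : ∫ ρ in Ioi (0:ℝ), ((bR N ρ : ℝ) : ℂ) * X ρ = (∫ ρ in Ioi (0:ℝ), ((bR N ρ : ℝ) : ℂ) * (X ρ - (c:ℂ) * Y ρ)) + (c:ℂ) * ∫ ρ in Ioi (0:ℝ), ((bR N ρ : ℝ) : ℂ) * Y ρ := by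
    rw [← integral_const_mul]
    have i2 : IntegrableOn (fun ρ => (c:ℂ) * (((bR N ρ : ℝ) : ℂ) * Y ρ)) (Ioi 0) := (bR_integrable N hN0 Y hcY.continuousOn).const_mul _
    rw [← integral_add (bR_integrable N hN0 (fun ρ => X ρ - (c:ℂ) * Y ρ) (by fun_prop)) i2]
    congr 1; ext ρ; ring
  rw [split]
  refine (norm_add_le _ _).trans ?_
  rw [norm_mul, Complex.norm_real, norm_abs, abs_of_nonneg hcos0]
  have q1 : (C4 * C2 + C3 * C5) * W * (4 * (N * √N)⁻¹ * (r0 * √r0)⁻¹) * (2 * N) = 8 * (C4 * C2 + C3 * C5) * W * P := by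
    rw [hP]; field_simp; norm_num
  rw [q1] at hXY
  exact kernel_arith _ _ _ _ _ _ _ _ hXY hYb (by positivity) (by positivity) hcos0 (by linarith) hB0 hP0

lemma bNF_int (N : ℝ) (hN : 0 < N) (h : EE 2 → ℂ) (hh : Integrable h) :
    Integrable (fun ξ : EE 2 => ((bN 2 N ξ : ℝ) : ℂ) * 𝓕 h ξ) :=
  (bN_int 2 N hN).mul_bdd (c := ∫ y, ‖h y‖) (fourier_cont h hh).aestronglyMeasurable
    (of_forall (fourier_bdd h))

/-- frequency localized function -/
def gB (N : ℝ) (h : EE 2 → ℂ) : EE 2 → ℂ := Ker (fun ξ => ((bN 2 N ξ : ℝ) : ℂ) * 𝓕 h ξ)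

lemma gB_cont (N : ℝ) (hN : 0 < N) (h : EE 2 → ℂ) (hh : Integrable h) : Continuous (gB N h) :=
  Ker_cont _ (bNF_int N hN h hh)

lemma gB_bdd (N : ℝ) (hN : 0 < N) (h : EE 2 → ℂ) (hh : Integrable h) (B : ℝ≥0∞) (hB : ∀ y, ‖h y‖ₑ ≤ B) (x : EE 2) :
    ‖gB N h x‖ₑ ≤ (∫⁻ z, ‖KN 2 1 z‖ₑ) * B := by
  have e : gB N h x = Tm (fun ξ => ((bN 2 N ξ : ℝ) : ℂ)) h x := rfl
  rw [e, Tm_ker _ _ (bN_int 2 N hN) hh]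
  have hKc := KN_cont 2 N hN
  calc _ ≤ ∫⁻ y, ‖KN 2 N (x - y) * h y‖ₑ := enorm_integral_le_lintegral_enorm _
    _ ≤ ∫⁻ y, ‖KN 2 N (x - y)‖ₑ * B := by
        refine lintegral_mono fun y => ?_
        rw [enorm_mul]; exact mul_le_mul_right (hB y) _
    _ = (∫⁻ y, ‖KN 2 N (x - y)‖ₑ) * B :=
        lintegral_mul_const'' _ (by apply Continuous.aemeasurable; fun_prop)
    _ = (∫⁻ y, ‖KN 2 N y‖ₑ) * B := by
        rw [lintegral_sub_left_eq_self (fun z => ‖KN 2 N z‖ₑ) x]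
    _ = _ := by rw [KN_L1 2 N hN]

/-- arc operator (physical side) -/
def Farc (m : ℕ) (N : ℝ) (h : EE 2 → ℂ) (v t : ℝ) (x : EE 2) : ℂ :=
  ((1 / (2 * rpi) : ℝ) : ℂ) * ∫ u in (-rpi)..Real.pi, gv m v u * gB N h (x + t • om u)

lemma Farc_cont (m : ℕ) (N : ℝ) (hN : 0 < N) (h : EE 2 → ℂ) (hh : Integrable h) :
    Continuous (fun p : ℝ × ℝ × EE 2 => Farc m N h p.1 p.2.1 p.2.2) := by
  unfold Farc
  refine continuous_const.mul ?_
  apply intervalIntegral.continuous_parametric_intervalIntegral_of_continuous'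
  have := om_cont
  have := gB_cont N hN h hh
  simp only [Function.uncurry_def]
  unfold gv
  fun_prop

lemma arc_fubini (m : ℕ) (v t : ℝ) (H : EE 2 → ℂ) (hH : Integrable H) (x : EE 2) :
    ∫ ξ, ee (inner ℝ ξ x) * (PhV m v (t • ξ) * H ξ) = ((1 / (2 * rpi) : ℝ) : ℂ) * ∫ u in (-rpi)..Real.pi, gv m v u * Ker H (x + t • om u) := by
  have hle : -rpi ≤ rpi := by linarith [rpi_pos]
  have hint : Integrable (uncurry fun (ξ : EE 2) (u : ℝ) => gv m v u * (ee (inner ℝ ξ (x + t • om u)) * H ξ)) (volume.prod (volume.restrict (Ioc (-rpi) rpi))) := by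
    have h1 : Integrable (fun p : EE 2 × ℝ => H p.1 * (1:ℂ)) (volume.prod (volume.restrict (Ioc (-rpi) rpi))) :=
      hH.mul_prod (integrable_const 1)
    have hc : Continuous (fun p : EE 2 × ℝ => gv m v p.2 * ee (inner ℝ p.1 (x + t • om p.2))) := by
      have := om_cont
      unfold gv
      fun_prop
    have h2 := h1.bdd_mul (c := 1) hc.aestronglyMeasurable (of_forall fun p => by
      rw [norm_mul, ee_norm, mul_one]; exact gv_norm _ _ _)
    refine h2.congr (of_forall fun p => ?_)
    simp only [Function.uncurry_def]; ring
  have e1 : ∀ ξ : EE 2, ee (inner ℝ ξ x) * (PhV m v (t • ξ) * H ξ) =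
      ((1 / (2 * rpi) : ℝ) : ℂ) * ∫ u in Ioc (-rpi) rpi, gv m v u * (ee (inner ℝ ξ (x + t • om u)) * H ξ) := by
    intro ξ
    unfold PhV
    rw [intervalIntegral.integral_of_le hle]
    rw [show ee (inner ℝ ξ x) * (((1 / (2 * rpi) : ℝ) : ℂ) * (∫ u in Ioc (-rpi) rpi, gv m v u * ee (inner ℝ (om u) (t • ξ))) * H ξ)
      = ((1 / (2 * rpi) : ℝ) : ℂ) * ((ee (inner ℝ ξ x) * H ξ) * ∫ u in Ioc (-rpi) rpi, gv m v u * ee (inner ℝ (om u) (t • ξ))) by ring]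
    rw [← integral_const_mul]
    congr 1
    congr 1; ext u
    rw [inner_add_right, ee_add, inner_smul_right, inner_smul_right, real_inner_comm ξ (om u)]; ring
  simp only [e1]
  rw [integral_const_mul, integral_integral_swap hint, intervalIntegral.integral_of_le hle]
  congr 2; ext u
  unfold Ker
  rw [integral_const_mul]

lemma Farc_freq (m : ℕ) (N : ℝ) (hN : 0 < N) (h : EE 2 → ℂ) (hh : Integrable h) (v t : ℝ) (x : EE 2) :
    Farc m N h v t x = ∫ ξ, ee (inner ℝ ξ x) * (PhV m v (t • ξ) * (((bN 2 N ξ : ℝ) : ℂ) * 𝓕 h ξ)) := by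
  rw [arc_fubini m v t _ (bNF_int N hN h hh) x]; rfl

lemma PhV_zero (v : ℝ) (ξ : EE 2) : PhV 0 v ξ = Phi 2 ξ := by
  obtain ⟨u, hu⟩ := om_surj ξ
  have h1 := Phi_Ek ξ
  have hp : (2 * rpi : ℂ) ≠ 0 := by
    have := rpi_pos.ne'
    simp [this]
  apply mul_left_cancel₀ hp
  rw [h1]
  nth_rewrite 1 [hu]
  rw [PhV_polar]
  unfold CV gv Ek
  simp only [ex_zero, mul_zero, pow_zero]
  push_cast
  field_simp

lemma Tm_gB (N : ℝ) (hN : 0 < N) (h : EE 2 → ℂ) (hh : Integrable h) (t : ℝ) (x : EE 2) :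
    Tm (mavg 2 N t) h x = ((1 / (2 * rpi) : ℝ) : ℂ) * ∫ u in (-rpi)..Real.pi, gB N h (x + t • om u) := by
  have h1 := Farc_freq 0 N hN h hh 0 t x
  unfold Farc gv at h1
  simp only [mul_zero, pow_zero, ofReal_one, one_mul, PhV_zero] at h1
  rw [h1]
  unfold Tm mavg
  simp only [mul_assoc]

/-- mass of the bump -/
def cm (m : ℕ) : ℝ := ∫ u in (-rpi)..Real.pi, rcos u ^ (2 * m)

lemma cm_shift (m : ℕ) (v : ℝ) : ∫ u in (-rpi)..Real.pi, rcos (u - v) ^ (2 * m) = cm m := by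
  have hp : Function.Periodic (fun u : ℝ => rcos u ^ (2 * m)) (2 * rpi) := fun u => by
    beta_reduce; rw [Real.cos_add_two_pi]
  have h1 := hp.intervalIntegral_add_eq (-rpi) (-rpi - v)
  rw [intervalIntegral.integral_comp_sub_right (fun u => rcos u ^ (2 * m)) v]
  rw [show -rpi + 2 * rpi = rpi by ring, show -rpi - v + 2 * rpi = rpi - v by ring] at h1
  rw [← h1]; rfl

lemma cm_ge (m : ℕ) (hm : 1 ≤ m) : 1 / (m:ℝ) ≤ cm m := by
  have hm1 : (1:ℝ) ≤ m := by exact_mod_cast hm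
  have hpi := Real.pi_gt_three
  set b : ℝ := 1 / m with hb
  have hb0 : 0 < b := by positivity
  have hb1 : b ≤ 1 := by rw [hb, div_le_one (by positivity)]; exact hm1
  have hev : ∀ u : ℝ, 0 ≤ rcos u ^ (2 * m) := fun u => Even.pow_nonneg (by exact ⟨m, by ring⟩) _
  have hii : ∀ a b : ℝ, IntervalIntegrable (fun u => rcos u ^ (2 * m)) volume a b := fun a b => by
    apply Continuous.intervalIntegrable; fun_prop
  -- reduce to a small interval
  have h1 : ∫ u in (-b)..b, rcos u ^ (2 * m) ≤ cm m := by
    unfold cm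
    apply intervalIntegral.integral_mono_interval (by linarith) (by linarith) (by linarith) (of_forall hev) (hii _ _)
  have h2 : ∫ u in (-b)..b, (1 - m * u^2) ≤ ∫ u in (-b)..b, rcos u ^ (2 * m) := by
    apply intervalIntegral.integral_mono_on (by linarith) (by apply Continuous.intervalIntegrable; fun_prop) (hii _ _)
    intro u hu
    rw [pow_mul]
    have hs : rcos u ^ 2 = 1 + -(rsin u)^2 := by rw [Real.cos_sq']; ring
    rw [hs]
    have h3 := one_add_mul_le_pow (a := -(rsin u)^2) (by nlinarith [Real.sin_sq_le_one u]) m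
    have h4 : rsin u ^ 2 ≤ u ^ 2 := by
      rw [← sq_abs (rsin u), ← sq_abs u]
      have := Real.abs_sin_le_abs (x := u)
      gcongr
    have h5 : (m:ℝ) * rsin u ^ 2 ≤ m * u^2 := by gcongr
    linarith
  have h3 : ∫ u in (-b)..b, (1 - m * u^2) = 2 * b - 2 / 3 * (m * b^3) := by
    rw [intervalIntegral.integral_sub (by simp) (by apply Continuous.intervalIntegrable; fun_prop), intervalIntegral.integral_const_mul]
    simp only [integral_pow, intervalIntegral.integral_const, smul_eq_mul]
    push_cast
    ring
  have h4 : m * b^3 = b * b := by rw [hb]; field_simp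
  rw [h3, h4] at h2
  nlinarith

lemma Farc_bdd (m : ℕ) (N : ℝ) (h : EE 2 → ℂ) (v t : ℝ) (x : EE 2) (B : ℝ) (hB : ∀ y, ‖gB N h y‖ ≤ B) (hN : 0 < N) (hh : Integrable h) :
    ‖Farc m N h v t x‖ ≤ B * cm m := by
  have hle : -rpi ≤ rpi := by linarith [rpi_pos]
  have hB0 : 0 ≤ B := (norm_nonneg _).trans (hB 0)
  unfold Farc
  rw [norm_mul, norm_2pi]
  have h1 : ‖∫ u in (-rpi)..Real.pi, gv m v u * gB N h (x + t • om u)‖ ≤ ∫ u in (-rpi)..Real.pi, rcos (u - v) ^ (2 * m) * B := by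
    refine intervalIntegral.norm_integral_le_of_norm_le hle (of_forall fun u _ => ?_) (by apply Continuous.intervalIntegrable; fun_prop)
    rw [norm_mul]
    have : ‖gv m v u‖ = rcos (u - v) ^ (2 * m) := by
      unfold gv
      rw [Complex.norm_real, norm_abs, abs_of_nonneg (Even.pow_nonneg (by exact ⟨m, by ring⟩) _)]
    rw [this]
    have h0 : 0 ≤ rcos (u - v) ^ (2 * m) := Even.pow_nonneg (by exact ⟨m, by ring⟩) _
    gcongr
    exact hB _
  rw [intervalIntegral.integral_mul_const, cm_shift, mul_comm] at h1
  refine (mul_le_of_le_one_left (norm_nonneg _) ?_).trans h1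
  rw [div_le_one (by positivity)]; linarith [Real.pi_gt_three]

lemma Farc_int (m : ℕ) (N : ℝ) (hN : 0 < N) (h : EE 2 → ℂ) (hh : Integrable h) (t : ℝ) (x : EE 2) :
    ∫ v in (-rpi)..Real.pi, Farc m N h v t x = (cm m : ℂ) * Tm (mavg 2 N t) h x := by
  have hle : -rpi ≤ rpi := by linarith [rpi_pos]
  rw [Tm_gB N hN h hh]
  unfold Farc
  rw [intervalIntegral.integral_const_mul]
  have hc := gB_cont N hN h hh
  have := om_cont
  have hsw : ∫ v in (-rpi)..Real.pi, ∫ u in (-rpi)..Real.pi, gv m v u * gB N h (x + t • om u)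
      = ∫ u in (-rpi)..Real.pi, ∫ v in (-rpi)..Real.pi, gv m v u * gB N h (x + t • om u) := by
    apply MeasureTheory.intervalIntegral_intervalIntegral_swap
    have hcc : Continuous (uncurry fun (v u : ℝ) => gv m v u * gB N h (x + t • om u)) := by
      simp only [Function.uncurry_def]
      unfold gv
      fun_prop
    refine (hcc.continuousOn.integrableOn_compact ((isCompact_uIcc (a := -rpi) (b := rpi)).prod (isCompact_uIcc (a := -rpi) (b := rpi)))).mono_set ?_
    exact Set.prod_mono uIoc_subset_uIcc uIoc_subset_uIcc
  rw [hsw]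
  have e : ∀ u, ∫ v in (-rpi)..Real.pi, gv m v u * gB N h (x + t • om u) = (cm m : ℂ) * gB N h (x + t • om u) := by
    intro u
    rw [intervalIntegral.integral_mul_const]
    congr 1
    unfold gv
    rw [intervalIntegral.integral_ofReal, ← cm_shift m u]
    congr 1
    congr 1; ext v
    rw [← Real.cos_neg, neg_sub]
  simp only [e]
  rw [intervalIntegral.integral_const_mul]
  ring

lemma bN_rg (N : ℝ) (ξ : EE 2) : 0 ≤ bN 2 N ξ ∧ bN 2 N ξ ≤ 1 := ⟨bb_nonneg _, bb_le_one _⟩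

lemma LK_symm (m : ℕ) (v N t t' : ℝ) (z : EE 2) : ‖LK m v N t' t (-z)‖ₑ = ‖LK m v N t t' z‖ₑ := by
  have : LK m v N t' t (-z) = (starRingEnd ℂ) (LK m v N t t' z) := by
    unfold LK
    rw [← integral_conj]
    congr 1; ext ξ
    simp only [map_mul, Complex.conj_conj, ee_conj, Complex.conj_ofReal, inner_neg_right]
    ring
  rw [this, RCLike.enorm_conj]

lemma LK_cont (m : ℕ) (v N : ℝ) (hN : 0 < N) : Continuous (fun p : ℝ × ℝ × EE 2 => LK m v N p.1 p.2.1 p.2.2) := by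
  unfold LK
  have hw : Integrable (fun ξ : EE 2 => bN 2 N ξ) := by
    have := (bN_int 2 N hN).norm
    refine this.congr (of_forall fun ξ => ?_)
    simp only [Complex.norm_real, norm_abs]
    exact abs_of_nonneg (bN_rg N ξ).1
  have hP := PhV_cont m
  have hPc : ∀ t : ℝ × ℝ × EE 2 → ℝ, Continuous t → ∀ ξ : EE 2, Continuous (fun p : ℝ × ℝ × EE 2 => PhV m v (t p • ξ)) := fun t ht ξ =>
    Continuous.comp (g := fun p : ℝ × EE 2 => PhV m p.1 p.2) (f := fun p => (v, t p • ξ)) hP (by fun_prop)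
  have hPx : ∀ t : ℝ, Continuous (fun ξ : EE 2 => PhV m v (t • ξ)) := fun t =>
    Continuous.comp (g := fun p : ℝ × EE 2 => PhV m p.1 p.2) (f := fun ξ => (v, t • ξ)) hP (by fun_prop)
  refine continuous_of_dominated (bound := fun ξ => bN 2 N ξ) ?_ ?_ hw ?_
  · intro p
    apply Continuous.aestronglyMeasurable
    have h1 := hPx p.1
    have h2 := hPx p.2.1
    have h3 := bN_cont 2 N
    have h4 := ee_cont
    fun_prop
  · intro p
    refine of_forall fun ξ => ?_
    obtain ⟨h0, h1⟩ := bN_rg N ξ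
    rw [norm_mul, norm_mul, norm_mul, ee_norm, RCLike.norm_conj, Complex.norm_real, norm_abs, abs_of_nonneg (by positivity)]
    have a1 := PhV_bdd m v (p.1 • ξ)
    have a2 := PhV_bdd m v (p.2.1 • ξ)
    have : ‖PhV m v (p.1 • ξ)‖ * ‖PhV m v (p.2.1 • ξ)‖ ≤ 1 := mul_le_one₀ a1 (norm_nonneg _) a2
    nlinarith [norm_nonneg (PhV m v (p.1 • ξ)), norm_nonneg (PhV m v (p.2.1 • ξ)), mul_nonneg (norm_nonneg (PhV m v (p.1 • ξ))) (norm_nonneg (PhV m v (p.2.1 • ξ)))]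
  · refine of_forall fun ξ => ?_
    have h1 := hPc (fun p => p.1) (by fun_prop) ξ
    have h2 := hPc (fun p => p.2.1) (by fun_prop) ξ
    have h4 := ee_cont
    fun_prop

lemma swap_gen (ν : Measure (EE 2)) [IsFiniteMeasure ν] (a : EE 2 → ℂ) (ha : Integrable a) (G : EE 2 → ℂ) (hG : Integrable G ν)
    (e : EE 2 → EE 2 → ℂ) (hem : Measurable (uncurry e)) (he1 : ∀ x y, ‖e x y‖ ≤ 1) :
    ∫ ξ, a ξ * (∫ y, e ξ y * G y ∂ν) = ∫ y, (∫ ξ, a ξ * (e ξ y * G y)) ∂ν := by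
  have hint : Integrable (uncurry fun (ξ y : EE 2) => a ξ * (e ξ y * G y)) ((volume : Measure (EE 2)).prod ν) := by
    have h1 : Integrable (fun p : EE 2 × EE 2 => a p.1 * G p.2) ((volume : Measure (EE 2)).prod ν) := ha.mul_prod hG
    have h2 := h1.bdd_mul (c := 1) (f := uncurry e) hem.aestronglyMeasurable (of_forall fun p => he1 _ _)
    refine h2.congr (of_forall fun p => ?_)
    simp only [Function.uncurry_def]; ring
  have := integral_integral_swap hint
  simp only [integral_const_mul] at this
  rw [this]

set_option maxHeartbeats 1000000 in
/-- L2 estimate for a linearized arc operator. -/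
lemma arc_L2 (m : ℕ) (v N : ℝ) (hN : 0 < N) (h : EE 2 → ℂ) (hh : Integrable h) (t : EE 2 → ℝ) (ht : Measurable t)
    (H : Set (EE 2)) (hHf : volume H ≠ ⊤) (B : ℝ≥0∞)
    (hB : ∀ᵐ y ∂(volume.restrict H), ∫⁻ y' in H, ‖LK m v N (t y) (t y') (y - y')‖ₑ ≤ B) :
    (∫⁻ y in H, ‖Farc m N h v (t y) y‖ₑ) ^ 2 ≤ B * volume H * ∫⁻ y, ‖h y‖ₑ ^ 2 := by
  haveI : IsFiniteMeasure (volume.restrict H) := ⟨by rw [Measure.restrict_apply_univ]; exact hHf.lt_top⟩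
  set ν := volume.restrict H with hν
  set e : EE 2 → EE 2 → ℂ := fun ξ y => PhV m v (t y • ξ) * ee (inner ℝ ξ y) with he
  have hem : Measurable (uncurry e) := by
    have hc : Continuous (fun p : ℝ × EE 2 × EE 2 => PhV m v (p.1 • p.2.1) * ee (inner ℝ p.2.1 p.2.2)) := by
      have h1 : Continuous (fun p : ℝ × EE 2 × EE 2 => PhV m v (p.1 • p.2.1)) :=
        Continuous.comp (g := fun p : ℝ × EE 2 => PhV m p.1 p.2) (f := fun p : ℝ × EE 2 × EE 2 => (v, p.1 • p.2.1)) (PhV_cont m) (by fun_prop)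
      have h4 := ee_cont
      fun_prop
    exact hc.measurable.comp (g := fun p : ℝ × EE 2 × EE 2 => PhV m v (p.1 • p.2.1) * ee (inner ℝ p.2.1 p.2.2)) (f := fun p : EE 2 × EE 2 => (t p.2, p.1, p.2)) (by fun_prop)
  have he1 : ∀ ξ y, ‖e ξ y‖ ≤ 1 := fun ξ y => by
    rw [he]; dsimp only; rw [norm_mul, ee_norm, mul_one]; exact PhV_bdd _ _ _
  set w : EE 2 → ℝ := fun ξ => bN 2 N ξ ^ 2 with hw
  have hbi : Integrable (fun ξ : EE 2 => bN 2 N ξ) := by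
    have := (bN_int 2 N hN).norm
    refine this.congr (of_forall fun ξ => ?_)
    simp only [Complex.norm_real, norm_abs]
    exact abs_of_nonneg (bN_rg N ξ).1
  have hwi : Integrable w := by
    refine hbi.mono' ((bN_cont 2 N).pow 2).aestronglyMeasurable (of_forall fun ξ => ?_)
    obtain ⟨h0, h1⟩ := bN_rg N ξ
    rw [norm_abs, abs_of_nonneg (by positivity), hw]
    nlinarith
  set k : EE 2 → EE 2 → ℝ≥0∞ := fun y y' => ‖LK m v N (t y) (t y') (y - y')‖ₑ with hk
  have hkm : Measurable (uncurry k) := by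
    have hc := (LK_cont m v N hN).enorm.measurable
    exact hc.comp (g := fun p : ℝ × ℝ × EE 2 => ‖LK m v N p.1 p.2.1 p.2.2‖ₑ) (f := fun p : EE 2 × EE 2 => (t p.1, t p.2, p.1 - p.2)) (by fun_prop)
  -- the function and its phase
  set F : EE 2 → ℂ := fun y => Farc m N h v (t y) y with hF
  have hFm : Measurable F := by
    have hc := (Farc_cont m N hN h hh).measurable
    exact hc.comp (g := fun p : ℝ × ℝ × EE 2 => Farc m N h p.1 p.2.1 p.2.2) (f := fun y : EE 2 => (v, t y, y)) (by fun_prop)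
  set G : EE 2 → ℂ := fun y => (starRingEnd ℂ) (F y) / (‖F y‖ : ℂ) with hG
  have hGm : Measurable G := by rw [hG]; fun_prop
  have hG1 : ∀ y, ‖G y‖ ≤ 1 := fun y => by
    rw [hG]; dsimp only; rw [norm_div, RCLike.norm_conj, Complex.norm_real, norm_norm]; exact div_self_le_one _
  have hGi : Integrable G ν := (integrable_const (1:ℝ)).mono' hGm.aestronglyMeasurable (of_forall hG1)
  have hGF : ∀ y, G y * F y = (‖F y‖ : ℂ) := fun y => by
    rw [hG]; dsimp only
    by_cases h0 : F y = 0
    · simp [h0]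
    · have : (‖F y‖ : ℂ) ≠ 0 := by simpa using h0
      rw [div_mul_eq_mul_div, RCLike.conj_mul, div_eq_iff this, sq]; rfl
  have hts := ttstar_schur volume ν w (fun ξ => by positivity) hwi e hem he1 k hkm
    (fun y y' => by
      rw [hk]; dsimp only; rw [← LK_symm, neg_sub])
    (fun y y' => by
      apply le_of_eq
      rw [hk]; dsimp only
      congr 1
      unfold LK
      congr 1; ext ξ
      rw [he, hw]; dsimp only
      rw [map_mul, ee_conj, inner_sub_right, sub_eq_add_neg, ee_add]
      ring) B hB G hGi
  -- the integral of |F|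
  have hFb : Integrable F ν := by
    refine Integrable.mono' (g := fun _ => ∫ ξ, ‖((bN 2 N ξ : ℝ) : ℂ) * 𝓕 h ξ‖) (integrable_const _) hFm.aestronglyMeasurable (of_forall fun y => ?_)
    rw [hF]; dsimp only
    rw [Farc_freq m N hN h hh]
    refine norm_integral_le_of_norm_le (bNF_int N hN h hh).norm (of_forall fun ξ => ?_)
    rw [norm_mul, ee_norm, one_mul, norm_mul]
    exact mul_le_of_le_one_left (norm_nonneg _) (PhV_bdd _ _ _)
  have hsw : ∫ y, G y * F y ∂ν = ∫ ξ, (((bN 2 N ξ : ℝ) : ℂ) * 𝓕 h ξ) * ∫ y, e ξ y * G y ∂ν := by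
    rw [swap_gen ν _ (bNF_int N hN h hh) G hGi e hem he1]
    congr 1; ext y
    rw [hF]; dsimp only
    rw [Farc_freq m N hN h hh, ← integral_const_mul]
    congr 1; ext ξ
    rw [he]; dsimp only; ring
  set A : EE 2 → ℂ := fun ξ => ∫ y, e ξ y * G y ∂ν with hA
  have hAm : AEMeasurable A := by
    have : StronglyMeasurable (uncurry fun ξ y => e ξ y * G y) :=
      (hem.mul (hGm.comp measurable_snd)).stronglyMeasurable
    exact this.integral_prod_right.measurable.aemeasurable
  have h1 : ∫⁻ y, ‖F y‖ₑ ∂ν ≤ ∫⁻ ξ, ‖𝓕 h ξ‖ₑ * (eR (bN 2 N ξ) * ‖A ξ‖ₑ) := by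
    have e1 : ∫⁻ y, ‖F y‖ₑ ∂ν = ‖∫ y, G y * F y ∂ν‖ₑ := by
      simp only [hGF]
      rw [integral_complex_ofReal, ← ofReal_integral_norm_eq_lintegral_enorm hFb, ← ofReal_norm, Complex.norm_real, norm_abs, abs_of_nonneg (integral_nonneg fun _ => norm_nonneg _)]
    rw [e1, hsw]
    refine (enorm_integral_le_lintegral_enorm _).trans (le_of_eq ?_)
    congr 1; ext ξ
    rw [enorm_mul, enorm_mul, ← ofReal_norm ((bN 2 N ξ : ℝ):ℂ), Complex.norm_real, norm_abs, abs_of_nonneg (bN_rg N ξ).1]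
    ring
  have h2 := ENNReal.lintegral_mul_le_Lp_mul_Lq (volume : Measure (EE 2)) (p := 2) (q := 2) (by constructor <;> norm_num)
    (f := fun ξ => ‖𝓕 h ξ‖ₑ) (g := fun ξ => eR (bN 2 N ξ) * ‖A ξ‖ₑ)
    (fourier_cont h hh).enorm.aemeasurable ((meas_eR.comp (bN_cont 2 N).measurable).aemeasurable.mul hAm.enorm)
  have h3 := h1.trans h2
  have hbes := bessel h hh
  have e2 : ∫⁻ ξ, (eR (bN 2 N ξ) * ‖A ξ‖ₑ) ^ (2:ℝ) = ∫⁻ ξ, eR (w ξ * ‖A ξ‖ ^ 2) := by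
    congr 1; ext ξ
    have hb := (bN_rg N ξ).1
    rw [hw]; dsimp only
    rw [← mul_pow, ← ofReal_norm, ← eR_mul hb, ENNReal.rpow_two, eR_pow (by positivity)]
  have e3 : ∫⁻ ξ, ‖𝓕 h ξ‖ₑ ^ (2:ℝ) = ∫⁻ ξ, ‖𝓕 h ξ‖ₑ ^ 2 := by simp only [ENNReal.rpow_two]
  have hGl : ∫⁻ y, ‖G y‖ₑ ^ 2 ∂ν ≤ volume H := by
    calc _ ≤ ∫⁻ y, 1 ∂ν := lintegral_mono fun y => by
          apply pow_le_one₀ (zero_le)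
          rw [← ofReal_norm]; exact ENNReal.ofReal_le_one.mpr (hG1 y)
      _ = volume H := by rw [lintegral_one, hν, Measure.restrict_apply_univ]
  rw [e2, e3] at h3
  calc (∫⁻ y, ‖F y‖ₑ ∂ν) ^ 2 ≤ ((∫⁻ ξ, ‖𝓕 h ξ‖ₑ ^ 2) ^ (1/2:ℝ) * (∫⁻ ξ, eR (w ξ * ‖A ξ‖ ^ 2)) ^ (1/2:ℝ)) ^ 2 := by gcongr
    _ = (∫⁻ ξ, ‖𝓕 h ξ‖ₑ ^ 2) * (∫⁻ ξ, eR (w ξ * ‖A ξ‖ ^ 2)) := by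
        rw [mul_pow, ← ENNReal.rpow_two, ← ENNReal.rpow_two, ← ENNReal.rpow_mul, ← ENNReal.rpow_mul]; norm_num
    _ ≤ (∫⁻ y, ‖h y‖ₑ ^ 2) * (B * volume H) := by
        gcongr
        exact hts.trans (by gcongr)
    _ = _ := by ring

lemma om_det (a b c : ℝ) :
    (rcos a - rcos b) * (rsin a - rsin c) - (rsin a - rsin b) * (rcos a - rcos c)
      = 4 * rsin ((a - c) / 2) * rsin ((b - a) / 2) * rsin ((b - c) / 2) := by
  have h1 : (rcos a - rcos b) * (rsin a - rsin c) - (rsin a - rsin b) * (rcos a - rcos c)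
      = rsin (a - c) + rsin (b - a) - rsin (b - c) := by
    rw [Real.sin_sub, Real.sin_sub, Real.sin_sub]; ring
  rw [h1]
  have key : ∀ A B : ℝ, rsin (2 * A) + rsin (2 * B) - rsin (2 * (A + B)) = 4 * rsin A * rsin B * rsin (A + B) := by
    intro A B
    rw [show 2 * (A + B) = 2 * A + 2 * B by ring, Real.sin_add (2 * A), Real.sin_add A, Real.sin_two_mul, Real.sin_two_mul, Real.cos_two_mul, Real.cos_two_mul]
    have h1 := Real.sin_sq_add_cos_sq A
    have h2 := Real.sin_sq_add_cos_sq B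
    have h1' : rcos A ^ 2 = 1 - rsin A ^ 2 := by linarith
    have h2' : rcos B ^ 2 = 1 - rsin B ^ 2 := by linarith
    rw [h1', h2']; ring
  have := key ((a - c) / 2) ((b - a) / 2)
  rw [show 2 * ((a - c) / 2) = a - c by ring, show 2 * ((b - a) / 2) = b - a by ring, show (a - c) / 2 + (b - a) / 2 = (b - c) / 2 by ring, show 2 * ((b - c) / 2) = b - c by ring] at this
  exact this

lemma sin_half_ge (x s : ℝ) (h : s ≤ |rsin x|) : s / 2 ≤ |rsin (x / 2)| := by
  have h1 : rsin x = 2 * rsin (x / 2) * rcos (x / 2) := by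
    rw [← Real.sin_two_mul]; congr 1; ring
  rw [h1, abs_mul, abs_mul, abs_two] at h
  have := Real.abs_cos_le_one (x / 2)
  nlinarith [abs_nonneg (rsin (x / 2)), abs_nonneg (rcos (x / 2))]

lemma om_det_ge (a b c s : ℝ) (hs : 0 ≤ s) (h1 : s ≤ |rsin (a - b)|) (h2 : s ≤ |rsin (a - c)|) (h3 : s ≤ |rsin (b - c)|) :
    s ^ 3 / 2 ≤ |(rcos a - rcos b) * (rsin a - rsin c) - (rsin a - rsin b) * (rcos a - rcos c)| := by
  rw [om_det, abs_mul, abs_mul, abs_mul]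
  have g1 := sin_half_ge _ _ h2
  have g2 := sin_half_ge (b - a) s (by rw [← abs_neg, ← Real.sin_neg, neg_sub]; exact h1)
  have g3 := sin_half_ge _ _ h3
  have : s ^ 3 / 2 = |(4:ℝ)| * (s / 2) * (s / 2) * (s / 2) := by rw [abs_of_pos (by norm_num)]; ring
  rw [this]
  gcongr

lemma cramer2 (p1 p2 q1 q2 u1 u2 : ℝ) (hp1 : |p1| ≤ 2) (hp2 : |p2| ≤ 2) (hq1 : |q1| ≤ 2) (hq2 : |q2| ≤ 2) :
    |p1 * q2 - p2 * q1| * (|u1| + |u2|) ≤ 4 * (|p1 * u1 + p2 * u2| + |q1 * u1 + q2 * u2|) := by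
  set P := p1 * u1 + p2 * u2 with hP
  set Q := q1 * u1 + q2 * u2 with hQ
  have e1 : (p1 * q2 - p2 * q1) * u1 = P * q2 - Q * p2 := by rw [hP, hQ]; ring
  have e2 : (p1 * q2 - p2 * q1) * u2 = Q * p1 - P * q1 := by rw [hP, hQ]; ring
  rw [mul_add, ← abs_mul, ← abs_mul, e1, e2]
  have a1 := abs_sub (P * q2) (Q * p2)
  have a2 := abs_sub (Q * p1) (P * q1)
  rw [abs_mul, abs_mul] at a1 a2
  nlinarith [abs_nonneg P, abs_nonneg Q, mul_le_mul_of_nonneg_left hp1 (abs_nonneg Q), mul_le_mul_of_nonneg_left hp2 (abs_nonneg Q), mul_le_mul_of_nonneg_left hq1 (abs_nonneg P), mul_le_mul_of_nonneg_left hq2 (abs_nonneg P)]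

lemma om_sub_inner (a b : ℝ) (u : EE 2) : inner ℝ (om a - om b) u = (rcos a - rcos b) * u 0 + (rsin a - rsin b) * u 1 := by
  rw [PiLp.inner_apply, Fin.sum_univ_two]
  simp [om]
  ring

lemma norm_le_coord (u : EE 2) : ‖u‖ ≤ |u 0| + |u 1| := by
  rw [EuclideanSpace.norm_eq, Fin.sum_univ_two]
  apply Real.sqrt_le_iff.mpr
  refine ⟨by positivity, ?_⟩
  simp only [norm_abs]
  nlinarith [abs_nonneg (u 0), abs_nonneg (u 1)]

lemma geom3 (θ : Fin 3 → ℝ) (s : ℝ) (hs : 0 < s) (hsep : ∀ i j, i ≠ j → s ≤ |rsin (θ i - θ j)|)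
    (w : Fin 3 → EE 2) (η : ℝ) (hη : η ≤ s ^ 3 / 64) (hw : ∀ i, ‖w i - om (θ i)‖ ≤ η)
    (u : EE 2) (τ : ℝ) (D : ℝ) (hD : ∀ i, |inner ℝ (w i) u - τ| ≤ D) :
    ‖u‖ ≤ 64 * (s ^ 3)⁻¹ * D := by
  have hdet := om_det_ge (θ 0) (θ 1) (θ 2) s hs.le (hsep _ _ (by decide)) (hsep _ _ (by decide)) (hsep _ _ (by decide))
  have hc : ∀ a b : ℝ, |rcos a - rcos b| ≤ 2 := fun a b => by
    refine (abs_sub _ _).trans ?_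
    linarith [Real.abs_cos_le_one a, Real.abs_cos_le_one b]
  have hsn : ∀ a b : ℝ, |rsin a - rsin b| ≤ 2 := fun a b => by
    refine (abs_sub _ _).trans ?_
    linarith [Real.abs_sin_le_one a, Real.abs_sin_le_one b]
  have hcr := cramer2 (rcos (θ 0) - rcos (θ 1)) (rsin (θ 0) - rsin (θ 1)) (rcos (θ 0) - rcos (θ 2)) (rsin (θ 0) - rsin (θ 2)) (u 0) (u 1) (hc _ _) (hsn _ _) (hc _ _) (hsn _ _)
  rw [← om_sub_inner, ← om_sub_inner] at hcr
  have hpq : ∀ i j, |inner ℝ (om (θ i) - om (θ j)) u| ≤ 2 * D + 2 * (η * ‖u‖) := by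
    intro i j
    have e : inner ℝ (om (θ i) - om (θ j)) u = (inner ℝ (w i) u - τ) - (inner ℝ (w j) u - τ) - inner ℝ (w i - om (θ i)) u + inner ℝ (w j - om (θ j)) u := by
      simp only [inner_sub_left]; ring
    have b1 : ∀ i, |inner ℝ (w i - om (θ i)) u| ≤ η * ‖u‖ := fun i =>
      (abs_real_inner_le_norm _ _).trans (by gcongr; exact hw i)
    rw [e]
    have c1 := hD i
    have c2 := hD j
    have c3 := b1 i
    have c4 := b1 j
    rw [abs_le] at *
    constructor <;> linarith [c1.1, c1.2, c2.1, c2.2, c3.1, c3.2, c4.1, c4.2]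
  have h1 := hpq 0 1
  have h2 := hpq 0 2
  have hn := norm_le_coord u
  have hu := norm_nonneg u
  have h3 : s ^ 3 / 2 * ‖u‖ ≤ |(rcos (θ 0) - rcos (θ 1)) * (rsin (θ 0) - rsin (θ 2)) - (rsin (θ 0) - rsin (θ 1)) * (rcos (θ 0) - rcos (θ 2))| * (|u 0| + |u 1|) := by
    gcongr
  have h4 : η * ‖u‖ ≤ s ^ 3 / 64 * ‖u‖ := by gcongr
  have h5 : s ^ 3 / 4 * ‖u‖ ≤ 16 * D := by linarith
  have hs3 : 0 < s ^ 3 := by positivity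
  calc ‖u‖ = 4 * (s ^ 3)⁻¹ * (s ^ 3 / 4 * ‖u‖) := by field_simp
    _ ≤ 4 * (s ^ 3)⁻¹ * (16 * D) := by gcongr
    _ = _ := by ring

lemma norm_diff_dir (a b P : EE 2) (η : ℝ) (ha : a ≠ 0) (hb : b ≠ 0) (h1 : ‖‖a‖⁻¹ • a - P‖ ≤ η) (h2 : ‖‖b‖⁻¹ • b - P‖ ≤ η) :
    ∃ w : EE 2, ‖w - P‖ ≤ η ∧ inner ℝ w (a - b) = ‖a‖ - ‖b‖ := by
  have na : 0 < ‖a‖ := norm_pos_iff.mpr ha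
  have nb : 0 < ‖b‖ := norm_pos_iff.mpr hb
  have hs : 0 < ‖a‖ + ‖b‖ := by positivity
  refine ⟨(‖a‖ + ‖b‖)⁻¹ • (a + b), ?_, ?_⟩
  · have e : (‖a‖ + ‖b‖)⁻¹ • (a + b) - P = (‖a‖ + ‖b‖)⁻¹ • (‖a‖ • (‖a‖⁻¹ • a - P) + ‖b‖ • (‖b‖⁻¹ • b - P)) := by
      rw [smul_sub, smul_sub, smul_smul, smul_smul, mul_inv_cancel₀ na.ne', mul_inv_cancel₀ nb.ne', one_smul, one_smul]
      rw [show a - ‖a‖ • P + (b - ‖b‖ • P) = (a + b) - (‖a‖ + ‖b‖) • P by rw [add_smul]; abel]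
      rw [smul_sub _ (a + b), smul_smul, inv_mul_cancel₀ hs.ne', one_smul]
    rw [e, norm_smul, norm_inv, Real.norm_of_nonneg hs.le]
    rw [inv_mul_le_iff₀ hs]
    refine (norm_add_le _ _).trans ?_
    rw [norm_smul, norm_smul, norm_norm, norm_norm, add_mul]
    gcongr
  · rw [inner_smul_left, inner_sub_right, inner_add_left, inner_add_left, real_inner_comm b a, real_inner_self_eq_norm_sq, real_inner_self_eq_norm_sq]
    simp only [RCLike.conj_to_real]
    field_simp
    ring

lemma jap4 : ∃ C : ℝ≥0, ∀ N > (0:ℝ), ∀ x0 : EE 2, ∫⁻ x : EE 2, eR (((1 + N * ‖x - x0‖) ^ 4)⁻¹) ≤ C * eR ((N ^ 2)⁻¹) := by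
  have hfin : (∫⁻ x : EE 2, eR (((1 + ‖x‖) ^ 4)⁻¹)) < ⊤ := by
    have h := finite_integral_one_add_norm (E := EE 2) (μ := volume) (r := 4) (by simp; norm_num)
    refine lt_of_eq_of_lt ?_ h
    congr 1; ext x
    rw [Real.rpow_neg (by positivity)]
    norm_cast
  refine ⟨(∫⁻ x : EE 2, eR (((1 + ‖x‖) ^ 4)⁻¹)).toNNReal, fun N hN x0 => ?_⟩
  rw [ENNReal.coe_toNNReal hfin.ne]
  rw [lintegral_sub_right_eq_self (fun x : EE 2 => eR (((1 + N * ‖x‖) ^ 4)⁻¹)) x0]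
  have hm : Measurable (fun x : EE 2 => eR (((1 + ‖x‖) ^ 4)⁻¹)) := by
    apply meas_eR.comp; fun_prop
  have h := lint_scale _ hm N hN
  rw [← h]
  simp only [norm_smul, Real.norm_of_nonneg hN.le]
  rw [mul_comm, ← mul_assoc, ← eR_mul (by positivity), inv_mul_cancel₀ (by positivity), ENNReal.ofReal_one, one_mul]

/-- circle defect -/
def Dfc (t : EE 2 → ℝ) (σ : ℝ) (x y : EE 2) : ℝ := |‖x - y‖ - σ * (t x - t y)|

lemma Dfc_nonneg (t : EE 2 → ℝ) (σ : ℝ) (x y : EE 2) : 0 ≤ Dfc t σ x y := abs_nonneg _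

lemma sign_angle (ε v : ℝ) (hε : ε = 1 ∨ ε = -1) : ∃ θ, om θ = ε • om v ∧ (θ = v ∨ θ = v + rpi) := by
  rcases hε with rfl | rfl
  · exact ⟨v, by simp, Or.inl rfl⟩
  · refine ⟨v + rpi, ?_, Or.inr rfl⟩
    ext i
    fin_cases i <;> simp [om, Real.cos_add_pi, Real.sin_add_pi]

lemma sin_angle (a b a' b' : ℝ) (h : a' = a ∨ a' = a + rpi) (h2 : b' = b ∨ b' = b + rpi) : |rsin (a' - b')| = |rsin (a - b)| := by
  rcases h with rfl | rfl <;> rcases h2 with rfl | rfl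
  · rfl
  · rw [show a' - (b + rpi) = a' - b - rpi by ring, Real.sin_sub_pi, abs_neg]
  · rw [show a + rpi - b' = a - b' + rpi by ring, Real.sin_add_pi, abs_neg]
  · congr 2; ring

/-- comparision of two points in the pattern set -/
lemma two_pts (v o σ : Fin 3 → ℝ) (ho : ∀ i, o i = 1 ∨ o i = -1) (hσ : ∀ i, σ i = 1 ∨ σ i = -1) (s η : ℝ) (hs : 0 < s)
    (hsep : ∀ i j, i ≠ j → s ≤ |rsin (v i - v j)|) (hη : η ≤ s ^ 3 / 64) (t : EE 2 → ℝ) (y : Fin 3 → EE 2) (x x' : EE 2)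
    (hx : ∀ i, x - y i ≠ 0 ∧ ‖‖x - y i‖⁻¹ • (x - y i) - o i • om (v i)‖ ≤ η)
    (hx' : ∀ i, x' - y i ≠ 0 ∧ ‖‖x' - y i‖⁻¹ • (x' - y i) - o i • om (v i)‖ ≤ η) (D : ℝ)
    (hD : ∀ i, Dfc t (σ i) x (y i) + Dfc t (σ i) x' (y i) ≤ D) :
    ‖x - x'‖ ≤ 64 * (s ^ 3)⁻¹ * D := by
  have h1 : ∀ i, ∃ w : EE 2, ‖w - o i • om (v i)‖ ≤ η ∧ inner ℝ w (x - x') = ‖x - y i‖ - ‖x' - y i‖ := by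
    intro i
    obtain ⟨w, hw1, hw2⟩ := norm_diff_dir _ _ _ η (hx i).1 (hx' i).1 (hx i).2 (hx' i).2
    refine ⟨w, hw1, ?_⟩
    rw [← hw2]; congr 1; abel
  choose w hw1 hw2 using h1
  have h2 : ∀ i, ∃ θ, om θ = (σ i * o i) • om (v i) ∧ (θ = v i ∨ θ = v i + rpi) := fun i => by
    apply sign_angle
    rcases ho i with h | h <;> rcases hσ i with h' | h' <;> rw [h, h'] <;> norm_num
  choose θ hθ1 hθ2 using h2
  refine geom3 θ s hs (fun i j hij => ?_) (fun i => σ i • w i) η hη (fun i => ?_) _ (t x - t x') D (fun i => ?_)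
  · rw [sin_angle _ _ _ _ (hθ2 i) (hθ2 j)]; exact hsep i j hij
  · rw [hθ1, mul_smul, ← smul_sub, norm_smul]
    have : ‖σ i‖ = 1 := by rcases hσ i with h | h <;> rw [h] <;> simp
    rw [this, one_mul]; exact hw1 i
  · rw [inner_smul_left, hw2]
    simp only [RCLike.conj_to_real]
    refine le_trans ?_ (hD i)
    unfold Dfc
    rcases hσ i with h | h <;> rw [h]
    · refine le_trans (le_of_eq ?_) (abs_sub _ _)
      congr 1; ring
    · refine le_trans (le_of_eq ?_) (abs_sub _ _)
      rw [← abs_neg]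
      congr 1; ring

lemma main_x : ∃ C : ℝ≥0, ∀ (v o σ : Fin 3 → ℝ), (∀ i, o i = 1 ∨ o i = -1) → (∀ i, σ i = 1 ∨ σ i = -1) → ∀ (s η : ℝ), 0 < s → s ≤ 1 →
    (∀ i j, i ≠ j → s ≤ |rsin (v i - v j)|) → η ≤ s ^ 3 / 64 → ∀ (t : EE 2 → ℝ) (y : Fin 3 → EE 2), ∀ N > (0:ℝ), ∀ (S : Set (EE 2)),
    (∀ x ∈ S, ∀ i, x - y i ≠ 0 ∧ ‖‖x - y i‖⁻¹ • (x - y i) - o i • om (v i)‖ ≤ η) →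
    ∫⁻ x in S, eR (((1 + N * ∑ i, Dfc t (σ i) x (y i)) ^ 4)⁻¹) ≤ C * eR ((s ^ 12)⁻¹ * (N ^ 2)⁻¹) := by
  obtain ⟨C, hC⟩ := jap4
  refine ⟨192 ^ 4 * C, ?_⟩
  intro v o σ ho hσ s η hs hs1 hsep hη t y N hN S hS
  by_cases hne : S.Nonempty
  swap
  · rw [Set.not_nonempty_iff_eq_empty] at hne
    rw [hne]; simp
  set D : EE 2 → ℝ := fun x => ∑ i, Dfc t (σ i) x (y i) with hDdef
  have hD0 : ∀ x, 0 ≤ D x := fun x => Finset.sum_nonneg fun i _ => Dfc_nonneg _ _ _ _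
  obtain ⟨x', hx'S, hx'⟩ : ∃ x' ∈ S, ∀ x ∈ S, D x' ≤ D x + N⁻¹ := by
    have hne2 : (D '' S).Nonempty := hne.image _
    have hlt : sInf (D '' S) < sInf (D '' S) + N⁻¹ := by
      have : 0 < N⁻¹ := by positivity
      linarith
    obtain ⟨b, ⟨x', hx', rfl⟩, hb⟩ := exists_lt_of_csInf_lt hne2 hlt
    refine ⟨x', hx', fun x hx => ?_⟩
    have : sInf (D '' S) ≤ D x := csInf_le ⟨0, by rintro _ ⟨z, _, rfl⟩; exact hD0 z⟩ ⟨x, hx, rfl⟩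
    linarith
  have hpt : ∀ x ∈ S, ((1 + N * D x) ^ 4)⁻¹ ≤ (192 ^ 4 * (s ^ 12)⁻¹) * ((1 + N * ‖x - x'‖) ^ 4)⁻¹ := by
    intro x hx
    have h1 := two_pts v o σ ho hσ s η hs hsep hη t y x x' (hS x hx) (hS x' hx'S) (D x + D x') (fun i => by
      rw [hDdef]; dsimp only
      rw [← Finset.sum_add_distrib]
      exact Finset.single_le_sum (f := fun i => Dfc t (σ i) x (y i) + Dfc t (σ i) x' (y i)) (fun j _ => add_nonneg (Dfc_nonneg _ _ _ _) (Dfc_nonneg _ _ _ _)) (Finset.mem_univ i))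
    have h2 := hx' x hx
    have hd := hD0 x
    have hs3 : 0 < s ^ 3 := by positivity
    have hs31 : 1 ≤ (s ^ 3)⁻¹ := (one_le_inv₀ hs3).mpr (pow_le_one₀ hs.le hs1)
    have h3 : 1 + N * ‖x - x'‖ ≤ 192 * (s ^ 3)⁻¹ * (1 + N * D x) := by
      have : N * ‖x - x'‖ ≤ 64 * (s ^ 3)⁻¹ * (2 * (N * D x) + 1) := by
        calc N * ‖x - x'‖ ≤ N * (64 * (s ^ 3)⁻¹ * (D x + (D x + N⁻¹))) := by
              gcongr
              exact h1.trans (by gcongr)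
          _ = _ := by field_simp; ring
      have hp : 0 ≤ (s ^ 3)⁻¹ * (N * D x) := by positivity
      nlinarith
    have h4 : (1 + N * ‖x - x'‖) ^ 4 ≤ (192 ^ 4 * (s ^ 12)⁻¹) * (1 + N * D x) ^ 4 := by
      calc (1 + N * ‖x - x'‖) ^ 4 ≤ (192 * (s ^ 3)⁻¹ * (1 + N * D x)) ^ 4 := by gcongr
        _ = _ := by rw [mul_pow, mul_pow, inv_pow, ← pow_mul]
    have p1 : 0 < (1 + N * D x) ^ 4 := by positivity
    have p2 : 0 < (1 + N * ‖x - x'‖) ^ 4 := by positivity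
    rw [← div_eq_mul_inv, le_div_iff₀ p2, inv_mul_le_iff₀ p1]
    linarith
  calc ∫⁻ x in S, eR (((1 + N * D x) ^ 4)⁻¹)
      ≤ ∫⁻ x in S, eR ((192 ^ 4 * (s ^ 12)⁻¹) * ((1 + N * ‖x - x'‖) ^ 4)⁻¹) :=
        setLIntegral_mono (by apply meas_eR.comp; fun_prop) fun x hx => eR_le (hpt x hx)
    _ ≤ ∫⁻ x, eR ((192 ^ 4 * (s ^ 12)⁻¹) * ((1 + N * ‖x - x'‖) ^ 4)⁻¹) := setLIntegral_le_lintegral _ _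
    _ = eR (192 ^ 4 * (s ^ 12)⁻¹) * ∫⁻ x, eR (((1 + N * ‖x - x'‖) ^ 4)⁻¹) := by
        rw [← lintegral_const_mul' _ _ eR_ne_top]
        congr 1; ext x
        rw [← eR_mul (by positivity)]
    _ ≤ eR (192 ^ 4 * (s ^ 12)⁻¹) * (C * eR ((N ^ 2)⁻¹)) := by gcongr; exact hC N hN x'
    _ = _ := by
        rw [eR_mul (by positivity), eR_mul (p := (s ^ 12)⁻¹) (by positivity)]
        rw [show eR (192 ^ 4) = ((192 ^ 4 : ℝ≥0) : ℝ≥0∞) by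
          rw [ENNReal.ofReal_eq_coe_nnreal (by positivity)]; congr 1]
        push_cast; ring

lemma near3 (a b c ρ : ℝ) (hρ : 0 < ρ) (ha : ρ ≤ a) (hb : ρ ≤ b) (hc : ρ ≤ c) :
    (√a)⁻¹ * (√b)⁻¹ * (√c)⁻¹ ≤ 2 * (√ρ)⁻¹ * ((a + b)⁻¹ + (a + c)⁻¹ + (b + c)⁻¹) := by
  have key : ∀ x y z : ℝ, ρ ≤ x → x ≤ y → y ≤ z → (√x)⁻¹ * ((√y)⁻¹ * (√z)⁻¹) ≤ 2 * (√ρ)⁻¹ * (x + y)⁻¹ := by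
    intro x y z h1 h2 h3
    have hy : 0 < y := by linarith
    have e1 : (√x)⁻¹ ≤ (√ρ)⁻¹ := by
      gcongr
    have e2 : (√y)⁻¹ * (√z)⁻¹ ≤ (√y)⁻¹ * (√y)⁻¹ := by
      gcongr
    have e3 : (√y)⁻¹ * (√y)⁻¹ = y⁻¹ := by rw [← mul_inv, Real.mul_self_sqrt hy.le]
    have e4 : y⁻¹ ≤ 2 * (x + y)⁻¹ := by
      rw [← div_eq_mul_inv, le_div_iff₀ (by linarith), inv_mul_le_iff₀ hy]; linarith
    calc _ ≤ (√ρ)⁻¹ * (2 * (x + y)⁻¹) := by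
          rw [e3] at e2
          exact mul_le_mul e1 (e2.trans e4) (by positivity) (by positivity)
      _ = _ := by ring
  have pr : 0 < √ρ := Real.sqrt_pos.mpr hρ
  have p1 : 0 ≤ 2 * (√ρ)⁻¹ * (a + b)⁻¹ := by have : 0 ≤ a + b := by linarith
                                             positivity
  have p2 : 0 ≤ 2 * (√ρ)⁻¹ * (a + c)⁻¹ := by have : 0 ≤ a + c := by linarith
                                             positivity
  have p3 : 0 ≤ 2 * (√ρ)⁻¹ * (b + c)⁻¹ := by have : 0 ≤ b + c := by linarith
                                             positivity
  rw [mul_add, mul_add]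
  rcases le_total a b with h1 | h1 <;> rcases le_total b c with h2 | h2 <;> rcases le_total a c with h3 | h3
  · have := key a b c ha h1 h2; nlinarith
  · have := key a b c ha h1 h2; nlinarith
  · have := key a c b ha h3 h2; nlinarith
  · have := key c a b hc h3 h1; rw [add_comm c a] at this; nlinarith
  · have := key b a c hb h1 h3; rw [add_comm b a] at this; nlinarith
  · have := key b c a hb h2 h3; nlinarith
  · have := key c b a hc h2 h1; rw [add_comm c b] at this; nlinarith
  · have := key c b a hc h2 h1; rw [add_comm c b] at this; nlinarith

lemma rad2 (g : ℝ → ℝ≥0∞) (hg : Measurable g) (a : ℝ) :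
    ∫⁻ z in ball (0 : EE 2) a, g ‖z‖ = eR (2 * rpi) * ∫⁻ ρ in Ioo 0 a, eR ρ * g ρ := by
  rw [← lintegral_indicator measurableSet_ball, polar2_lint]
  have hm : Measurable (fun ρ : ℝ => (Iio a).indicator (fun ρ => eR ρ * g ρ) ρ) := by
    apply Measurable.indicator _ measurableSet_Iio
    exact meas_eR.mul hg
  have e1 : ∫⁻ p in Ioi (0:ℝ) ×ˢ Ioo (-rpi) rpi, eR p.1 * (ball (0 : EE 2) a).indicator (fun z => g ‖z‖) (p.1 • om p.2)
      = ∫⁻ p in Ioi (0:ℝ) ×ˢ Ioo (-rpi) rpi, (Iio a).indicator (fun ρ => eR ρ * g ρ) p.1 * 1 := by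
    refine setLIntegral_congr_fun (measurableSet_Ioi.prod measurableSet_Ioo) fun p hp => ?_
    have h0 : 0 < p.1 := hp.1
    have hn : ‖p.1 • om p.2‖ = p.1 := by rw [norm_smul, om_norm, mul_one, Real.norm_of_nonneg h0.le]
    by_cases h : p.1 < a
    · rw [indicator_of_mem (show p.1 • om p.2 ∈ ball (0 : EE 2) a by rw [mem_ball_zero_iff, hn]; exact h), indicator_of_mem (show p.1 ∈ Iio a from h), hn, mul_one]
    · rw [indicator_of_notMem (show p.1 • om p.2 ∉ ball (0 : EE 2) a by rw [mem_ball_zero_iff, hn]; exact h), indicator_of_notMem (show p.1 ∉ Iio a from h), mul_zero, mul_one]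
  rw [e1, Measure.volume_eq_prod, ← Measure.prod_restrict]
  rw [lintegral_prod_mul hm.aemeasurable aemeasurable_const]
  rw [lintegral_one, Measure.restrict_apply_univ, Real.volume_Ioo, lintegral_indicator measurableSet_Iio, Measure.restrict_restrict measurableSet_Iio, mul_comm]
  congr 2
  · ring
  · congr 1; ext ρ; simp [and_comm]

lemma rad_inv (a : ℝ) (ha : 0 < a) : ∫⁻ z in ball (0 : EE 2) a, (eR ‖z‖)⁻¹ ≤ eR (7 * a) := by
  rw [rad2 (fun ρ => (eR ρ)⁻¹) (by fun_prop)]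
  have : ∫⁻ ρ in Ioo 0 a, eR ρ * (eR ρ)⁻¹ = eR a := by
    rw [setLIntegral_congr_fun (g := fun _ => 1) measurableSet_Ioo fun ρ hρ => ?_]
    · simp
    · exact ENNReal.mul_inv_cancel (by simpa using hρ.1) eR_ne_top
  rw [this, ← eR_mul (by positivity)]
  apply eR_le
  have := Real.pi_lt_d2
  nlinarith

lemma rad_half (a : ℝ) (ha : 0 < a) : ∫⁻ z in ball (0 : EE 2) a, eR ((√‖z‖)⁻¹) ≤ eR (7 * (a * √a)) := by
  rw [rad2 (fun ρ => eR ((√ρ)⁻¹)) (by apply meas_eR.comp; fun_prop)]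
  have : ∫⁻ ρ in Ioo 0 a, eR ρ * eR ((√ρ)⁻¹) ≤ eR (a * √a) := by
    calc _ ≤ ∫⁻ ρ in Ioo 0 a, eR (√a) := by
          refine setLIntegral_mono measurable_const fun ρ hρ => ?_
          rw [← eR_mul hρ.1.le]
          apply eR_le
          have h1 : ρ * (√ρ)⁻¹ = √ρ := by
            have := Real.sqrt_pos.mpr hρ.1
            rw [mul_inv_eq_iff_eq_mul₀ this.ne', Real.mul_self_sqrt hρ.1.le]
          rw [h1]; exact Real.sqrt_le_sqrt hρ.2.le
      _ = _ := by simp [eR_mul ha.le, mul_comm]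
  refine (mul_le_mul_right this _).trans ?_
  rw [← eR_mul (by positivity)]
  apply eR_le
  have := Real.pi_lt_d2
  gcongr; linarith

lemma rad_3half (a : ℝ) (ha : 0 < a) : ∫⁻ z in ball (0 : EE 2) a, eR ((‖z‖ * √‖z‖)⁻¹) ≤ eR (14 * √a) := by
  rw [rad2 (fun ρ => eR ((ρ * √ρ)⁻¹)) (by apply meas_eR.comp; fun_prop)]
  have : ∫⁻ ρ in Ioo 0 a, eR ρ * eR ((ρ * √ρ)⁻¹) = eR (2 * √a) := by
    have e1 : ∫⁻ ρ in Ioo 0 a, eR ρ * eR ((ρ * √ρ)⁻¹) = ∫⁻ ρ in Ioo 0 a, eR (ρ ^ (-(1/2:ℝ))) := by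
      refine setLIntegral_congr_fun measurableSet_Ioo fun ρ hρ => ?_
      rw [← eR_mul hρ.1.le, rp_half ρ hρ.1]
      congr 1
      have := hρ.1.ne'
      rw [mul_inv, ← mul_assoc, mul_inv_cancel₀ this, one_mul]
    have hii : IntervalIntegrable (fun ρ : ℝ => ρ ^ (-(1/2:ℝ))) volume 0 a := intervalIntegral.intervalIntegrable_rpow' (by norm_num)
    rw [intervalIntegrable_iff_integrableOn_Ioo_of_le ha.le] at hii
    rw [e1, ← ofReal_integral_eq_lintegral_ofReal hii ((ae_restrict_iff' measurableSet_Ioo).mpr (of_forall fun ρ hρ => Real.rpow_nonneg hρ.1.le _))]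
    congr 1
    rw [← integral_Ioc_eq_integral_Ioo, ← intervalIntegral.integral_of_le ha.le, integral_rpow (by left; norm_num)]
    rw [Real.zero_rpow (by norm_num), Real.sqrt_eq_rpow]
    norm_num; ring
  rw [this, ← eR_mul (by positivity)]
  apply eR_le
  have := Real.pi_lt_d2
  have := Real.sqrt_nonneg a
  nlinarith

lemma rad_shift (g : ℝ → ℝ≥0∞) (hg : Measurable g) (a : ℝ) (x : EE 2) (E : Set (EE 2)) (hE : E ⊆ ball x a) :
    ∫⁻ y in E, g ‖x - y‖ ≤ ∫⁻ z in ball (0 : EE 2) a, g ‖z‖ := by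
  calc ∫⁻ y in E, g ‖x - y‖ ≤ ∫⁻ y in ball x a, g ‖x - y‖ := lintegral_mono_set hE
    _ = ∫⁻ y, (ball (0 : EE 2) a).indicator (fun z => g ‖z‖) (x - y) := by
        rw [← lintegral_indicator measurableSet_ball]
        congr 1; ext y
        by_cases h : y ∈ ball x a
        · rw [indicator_of_mem h, indicator_of_mem]
          rw [mem_ball_zero_iff, norm_sub_rev, ← dist_eq_norm]; exact h
        · rw [indicator_of_notMem h, indicator_of_notMem]
          rw [mem_ball_zero_iff, norm_sub_rev, ← dist_eq_norm]; exact h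
    _ = _ := by
        rw [lintegral_sub_left_eq_self (fun z => (ball (0 : EE 2) a).indicator (fun z => g ‖z‖) z) x, lintegral_indicator measurableSet_ball]

lemma ball_sub8 (x x0 : EE 2) (r : ℝ) (hx : x ∈ ball x0 (r / 8)) (E : Set (EE 2)) (hE : E ⊆ ball x0 (r / 8)) : E ⊆ ball x (r / 4) := by
  intro y hy
  have h1 := hE hy
  rw [mem_ball] at *
  calc dist y x ≤ dist y x0 + dist x x0 := dist_triangle_right _ _ _
    _ < r / 4 := by linarith

open Classical in
/-- main part of kernel -/
def Ain (N ρ η : ℝ) (t : EE 2 → ℝ) (v o σ : ℝ) (x y : EE 2) : ℝ≥0∞ :=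
  if ρ ≤ ‖x - y‖ ∧ ‖‖x - y‖⁻¹ • (x - y) - o • om v‖ ≤ η then
    eR (√N * (√‖x - y‖)⁻¹ * ((1 + N * Dfc t σ x y) ^ 4)⁻¹) else 0

lemma Ain_meas (N ρ η : ℝ) (t : EE 2 → ℝ) (ht : Measurable t) (v o σ : ℝ) : Measurable (uncurry (Ain N ρ η t v o σ)) := by
  unfold Ain Dfc
  simp only [Function.uncurry_def]
  apply Measurable.ite
  · have h1 : MeasurableSet {p : EE 2 × EE 2 | ρ ≤ ‖p.1 - p.2‖} := measurableSet_le (by fun_prop) (by fun_prop)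
    have h2 : MeasurableSet {p : EE 2 × EE 2 | ‖‖p.1 - p.2‖⁻¹ • (p.1 - p.2) - o • om v‖ ≤ η} := measurableSet_le (by fun_prop) (by fun_prop)
    exact h1.inter h2
  · apply meas_eR.comp
    fun_prop
  · exact measurable_const

lemma prod_Ain (N ρ η : ℝ) (hN : 0 < N) (hρ : 0 < ρ) (t : EE 2 → ℝ) (v o σ : Fin 3 → ℝ) (x y0 y1 y2 : EE 2) :
    Ain N ρ η t (v 0) (o 0) (σ 0) x y0 * (Ain N ρ η t (v 1) (o 1) (σ 1) x y1 * Ain N ρ η t (v 2) (o 2) (σ 2) x y2) ≤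
      (eR (N * √N * (2 * (√ρ)⁻¹)) * ((eR ‖y0 - y1‖)⁻¹ + (eR ‖y0 - y2‖)⁻¹ + (eR ‖y1 - y2‖)⁻¹)) *
      {x | ∀ i, x - ![y0, y1, y2] i ≠ 0 ∧ ‖‖x - ![y0, y1, y2] i‖⁻¹ • (x - ![y0, y1, y2] i) - o i • om (v i)‖ ≤ η}.indicator
        (fun x => eR (((1 + N * ∑ i, Dfc t (σ i) x (![y0, y1, y2] i)) ^ 4)⁻¹)) x := by
  unfold Ain
  by_cases h0 : ρ ≤ ‖x - y0‖ ∧ ‖‖x - y0‖⁻¹ • (x - y0) - o 0 • om (v 0)‖ ≤ η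
  swap
  · rw [if_neg h0, zero_mul]; exact zero_le
  by_cases h1 : ρ ≤ ‖x - y1‖ ∧ ‖‖x - y1‖⁻¹ • (x - y1) - o 1 • om (v 1)‖ ≤ η
  swap
  · rw [if_neg h1, zero_mul, mul_zero]; exact zero_le
  by_cases h2 : ρ ≤ ‖x - y2‖ ∧ ‖‖x - y2‖⁻¹ • (x - y2) - o 2 • om (v 2)‖ ≤ η
  swap
  · rw [if_neg h2, mul_zero, mul_zero]; exact zero_le
  rw [if_pos h0, if_pos h1, if_pos h2]
  have hne : ∀ y : EE 2, ρ ≤ ‖x - y‖ → x - y ≠ 0 := fun y hy h => by rw [h, norm_zero] at hy; linarith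
  rw [indicator_of_mem]
  swap
  · intro i
    fin_cases i
    · exact ⟨hne _ h0.1, h0.2⟩
    · exact ⟨hne _ h1.1, h1.2⟩
    · exact ⟨hne _ h2.1, h2.2⟩
  rw [Fin.sum_univ_three]
  simp only [Matrix.cons_val_zero, Matrix.cons_val_one, Matrix.cons_val_two, Matrix.cons_val]
  set a := ‖x - y0‖
  set b := ‖x - y1‖
  set c := ‖x - y2‖
  have d0 := Dfc_nonneg t (σ 0) x y0
  have d1 := Dfc_nonneg t (σ 1) x y1
  have d2 := Dfc_nonneg t (σ 2) x y2
  set D0 := Dfc t (σ 0) x y0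
  set D1 := Dfc t (σ 1) x y1
  set D2 := Dfc t (σ 2) x y2
  have n3 := near3 a b c ρ hρ h0.1 h1.1 h2.1
  have ha : 0 < a := hρ.trans_le h0.1
  have hb : 0 < b := hρ.trans_le h1.1
  have hc : 0 < c := hρ.trans_le h2.1
  have hprod : ((1 + N * D0) ^ 4)⁻¹ * ((1 + N * D1) ^ 4)⁻¹ * ((1 + N * D2) ^ 4)⁻¹ ≤ ((1 + N * (D0 + D1 + D2)) ^ 4)⁻¹ := by
    rw [← mul_inv, ← mul_inv, ← mul_pow, ← mul_pow]
    gcongr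
    have : 0 ≤ N * D0 := by positivity
    have : 0 ≤ N * D1 := by positivity
    have : 0 ≤ N * D2 := by positivity
    nlinarith [mul_nonneg ‹0 ≤ N * D0› ‹0 ≤ N * D1›, mul_nonneg ‹0 ≤ N * D0› ‹0 ≤ N * D2›, mul_nonneg ‹0 ≤ N * D1› ‹0 ≤ N * D2›, mul_nonneg (mul_nonneg ‹0 ≤ N * D0› ‹0 ≤ N * D1›) ‹0 ≤ N * D2›]
  have hreal : √N * (√a)⁻¹ * ((1 + N * D0) ^ 4)⁻¹ * (√N * (√b)⁻¹ * ((1 + N * D1) ^ 4)⁻¹ * (√N * (√c)⁻¹ * ((1 + N * D2) ^ 4)⁻¹))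
      ≤ N * √N * (2 * (√ρ)⁻¹) * ((a + b)⁻¹ + (a + c)⁻¹ + (b + c)⁻¹) * ((1 + N * (D0 + D1 + D2)) ^ 4)⁻¹ := by
    calc _ = (√N * √N) * √N * ((√a)⁻¹ * (√b)⁻¹ * (√c)⁻¹) * (((1 + N * D0) ^ 4)⁻¹ * ((1 + N * D1) ^ 4)⁻¹ * ((1 + N * D2) ^ 4)⁻¹) := by ring
      _ ≤ (√N * √N) * √N * (2 * (√ρ)⁻¹ * ((a + b)⁻¹ + (a + c)⁻¹ + (b + c)⁻¹)) * ((1 + N * (D0 + D1 + D2)) ^ 4)⁻¹ :=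
          mul_le_mul (mul_le_mul_of_nonneg_left n3 (by positivity)) hprod (by positivity) (by positivity)
      _ = _ := by rw [Real.mul_self_sqrt hN.le]; ring
  rw [← eR_mul (by positivity), ← eR_mul (by positivity)]
  refine (eR_le hreal).trans ?_
  rw [eR_mul (by positivity), eR_mul (by positivity)]
  have hinv : ∀ (A : ℝ) (u w : EE 2), 0 < A → ‖u - w‖ ≤ A → eR (A⁻¹) ≤ (eR ‖u - w‖)⁻¹ := by
    intro A u w hA h
    rw [ENNReal.ofReal_inv_of_pos hA]
    exact ENNReal.inv_le_inv.mpr (eR_le h)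
  have htri : ∀ u w : EE 2, ‖u - w‖ ≤ ‖x - u‖ + ‖x - w‖ := fun u w => by
    calc ‖u - w‖ = ‖(x - w) - (x - u)‖ := by congr 1; abel
      _ ≤ _ := (norm_sub_le _ _).trans (le_of_eq (add_comm _ _))
  rw [eR_add (by positivity) (by positivity), eR_add (by positivity) (by positivity)]
  gcongr
  · exact hinv _ _ _ (by positivity) (htri _ _)
  · exact hinv _ _ _ (by positivity) (htri _ _)
  · exact hinv _ _ _ (by positivity) (htri _ _)
  · exact le_rfl

lemma vol_ball8 (x0 : EE 2) (r : ℝ) (hr : 0 < r) : volume (ball x0 (r / 8)) ≤ eR (r ^ 2) := by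
  rw [EuclideanSpace.volume_ball_fin_two, ← eR_pow (by positivity), ← eR_mul (by positivity)]
  apply eR_le
  have := Real.pi_lt_d2
  nlinarith [sq_nonneg r]

lemma pair_int (x0 : EE 2) (r : ℝ) (hr : 0 < r) (E : Set (EE 2)) (hEm : MeasurableSet E) (hE : E ⊆ ball x0 (r / 8)) :
    ∫⁻ x in E, (∫⁻ y in E, (eR ‖x - y‖)⁻¹) ≤ eR (2 * r) * volume E := by
  calc _ ≤ ∫⁻ x in E, eR (2 * r) := by
        refine setLIntegral_mono' hEm fun x hx => ?_
        refine (rad_shift (fun ρ => (eR ρ)⁻¹) (by fun_prop) (r / 4) x E (ball_sub8 x x0 r (hE hx) E hE)).trans ?_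
        refine (rad_inv (r / 4) (by positivity)).trans (eR_le (by linarith))
    _ = _ := by rw [setLIntegral_const]

lemma triple_int (x0 : EE 2) (r : ℝ) (hr : 0 < r) (E : Set (EE 2)) (hEm : MeasurableSet E) (hE : E ⊆ ball x0 (r / 8)) :
    ∫⁻ p : EE 2 × EE 2 × EE 2, ((eR ‖p.1 - p.2.1‖)⁻¹ + (eR ‖p.1 - p.2.2‖)⁻¹ + (eR ‖p.2.1 - p.2.2‖)⁻¹)
      ∂((volume.restrict E).prod ((volume.restrict E).prod (volume.restrict E))) ≤ eR (6 * r ^ 3) * volume E := by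
  set ν := (volume : Measure (EE 2)).restrict E with hν
  have hP := pair_int x0 r hr E hEm hE
  have hv : ν univ ≤ eR (r ^ 2) := by
    rw [hν, Measure.restrict_apply_univ]; exact (measure_mono hE).trans (vol_ball8 x0 r hr)
  have m1 : Measurable (fun p : EE 2 × EE 2 × EE 2 => (eR ‖p.1 - p.2.1‖)⁻¹) := by
    apply Measurable.inv; apply meas_eR.comp; fun_prop
  have m2 : Measurable (fun p : EE 2 × EE 2 × EE 2 => (eR ‖p.1 - p.2.2‖)⁻¹) := by
    apply Measurable.inv; apply meas_eR.comp; fun_prop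
  have m3 : Measurable (fun p : EE 2 × EE 2 × EE 2 => (eR ‖p.2.1 - p.2.2‖)⁻¹) := by
    apply Measurable.inv; apply meas_eR.comp; fun_prop
  have mp : Measurable (fun p : EE 2 × EE 2 => (eR ‖p.1 - p.2‖)⁻¹) := by
    apply Measurable.inv; apply meas_eR.comp; fun_prop
  have mx : ∀ x : EE 2, Measurable (fun p : EE 2 => (eR ‖x - p‖)⁻¹) := fun x => by
    apply Measurable.inv; apply meas_eR.comp; fun_prop
  have mi : Measurable (fun x : EE 2 => ∫⁻ y, (eR ‖x - y‖)⁻¹ ∂ν) := mp.lintegral_prod_right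
  have t1 : ∫⁻ p : EE 2 × EE 2 × EE 2, (eR ‖p.1 - p.2.1‖)⁻¹ ∂(ν.prod (ν.prod ν)) = (∫⁻ x, (∫⁻ y, (eR ‖x - y‖)⁻¹ ∂ν) ∂ν) * ν univ := by
    rw [lintegral_prod _ m1.aemeasurable, ← lintegral_mul_const _ mi]
    congr 1; ext x
    have := lintegral_prod_mul (μ := ν) (ν := ν) (f := fun y => (eR ‖x - y‖)⁻¹) (g := fun _ => 1) (mx x).aemeasurable aemeasurable_const
    simpa using this
  have t2 : ∫⁻ p : EE 2 × EE 2 × EE 2, (eR ‖p.1 - p.2.2‖)⁻¹ ∂(ν.prod (ν.prod ν)) = (∫⁻ x, (∫⁻ y, (eR ‖x - y‖)⁻¹ ∂ν) ∂ν) * ν univ := by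
    rw [lintegral_prod _ m2.aemeasurable, ← lintegral_mul_const _ mi]
    congr 1; ext x
    have := lintegral_prod_mul (μ := ν) (ν := ν) (f := fun _ => 1) (g := fun y => (eR ‖x - y‖)⁻¹) aemeasurable_const (mx x).aemeasurable
    rw [mul_comm]
    simpa using this
  have t3 : ∫⁻ p : EE 2 × EE 2 × EE 2, (eR ‖p.2.1 - p.2.2‖)⁻¹ ∂(ν.prod (ν.prod ν)) = (∫⁻ x, (∫⁻ y, (eR ‖x - y‖)⁻¹ ∂ν) ∂ν) * ν univ := by
    rw [lintegral_prod _ m3.aemeasurable]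
    dsimp only
    rw [lintegral_const, lintegral_prod _ mp.aemeasurable]
  have m12 : Measurable (fun p : EE 2 × EE 2 × EE 2 => (eR ‖p.1 - p.2.1‖)⁻¹ + (eR ‖p.1 - p.2.2‖)⁻¹) := m1.add m2
  rw [lintegral_add_left m12, lintegral_add_left m1, t1, t2, t3]
  have hb : (∫⁻ x, (∫⁻ y, (eR ‖x - y‖)⁻¹ ∂ν) ∂ν) * ν univ ≤ eR (2 * r ^ 3) * volume E := by
    calc _ ≤ (eR (2 * r) * volume E) * eR (r ^ 2) := by gcongr
      _ = eR (2 * r ^ 3) * volume E := by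
        rw [mul_right_comm, ← eR_mul (by positivity)]; congr 2; ring
  calc _ ≤ eR (2 * r ^ 3) * volume E + eR (2 * r ^ 3) * volume E + eR (2 * r ^ 3) * volume E := by gcongr
    _ = _ := by
      rw [← add_mul, ← add_mul, ← eR_add (by positivity) (by positivity), ← eR_add (by positivity) (by positivity)]
      congr 2; ring

lemma trilin : ∃ C : ℝ≥0, ∀ (v o σ : Fin 3 → ℝ), (∀ i, o i = 1 ∨ o i = -1) → (∀ i, σ i = 1 ∨ σ i = -1) → ∀ (s η : ℝ), 0 < s → s ≤ 1 →
    (∀ i j, i ≠ j → s ≤ |rsin (v i - v j)|) → η ≤ s ^ 3 / 64 → ∀ (t : EE 2 → ℝ), Measurable t → ∀ N > (0:ℝ), ∀ ρ > (0:ℝ), ∀ r > (0:ℝ),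
    ∀ (x0 : EE 2) (E : Set (EE 2)), MeasurableSet E → E ⊆ ball x0 (r / 8) →
    ∫⁻ x, (∫⁻ y in E, Ain N ρ η t (v 0) (o 0) (σ 0) x y) * ((∫⁻ y in E, Ain N ρ η t (v 1) (o 1) (σ 1) x y) * (∫⁻ y in E, Ain N ρ η t (v 2) (o 2) (σ 2) x y))
      ≤ C * eR ((s ^ 12)⁻¹ * (r ^ 3 * (√N)⁻¹ * (√ρ)⁻¹)) * volume E := by
  obtain ⟨C0, hC⟩ := main_x
  obtain ⟨C, hCC⟩ : ∃ C : ℝ≥0, C = C0 + 1 := ⟨_, rfl⟩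
  refine ⟨12 * C, ?_⟩
  intro v o σ ho hσ s η hs hs1 hsep hη t ht N hN ρ hρ r hr x0 E hEm hE
  set ν := (volume : Measure (EE 2)).restrict E with hν
  have mA : ∀ i, Measurable (uncurry (Ain N ρ η t (v i) (o i) (σ i))) := fun i => Ain_meas _ _ _ t ht _ _ _
  have mAx : ∀ i x, Measurable (Ain N ρ η t (v i) (o i) (σ i) x) := fun i x => (mA i).of_uncurry_left
  have e1 : ∀ x, (∫⁻ y, Ain N ρ η t (v 0) (o 0) (σ 0) x y ∂ν) * ((∫⁻ y, Ain N ρ η t (v 1) (o 1) (σ 1) x y ∂ν) * (∫⁻ y, Ain N ρ η t (v 2) (o 2) (σ 2) x y ∂ν))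
      = ∫⁻ p : EE 2 × EE 2 × EE 2, Ain N ρ η t (v 0) (o 0) (σ 0) x p.1 * (Ain N ρ η t (v 1) (o 1) (σ 1) x p.2.1 * Ain N ρ η t (v 2) (o 2) (σ 2) x p.2.2) ∂(ν.prod (ν.prod ν)) := by
    intro x
    rw [← lintegral_prod_mul (mAx 1 x).aemeasurable (mAx 2 x).aemeasurable]
    rw [← lintegral_prod_mul (f := Ain N ρ η t (v 0) (o 0) (σ 0) x) (g := fun q : EE 2 × EE 2 => Ain N ρ η t (v 1) (o 1) (σ 1) x q.1 * Ain N ρ η t (v 2) (o 2) (σ 2) x q.2) (mAx 0 x).aemeasurable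
      (((mAx 1 x).comp measurable_fst).mul ((mAx 2 x).comp measurable_snd)).aemeasurable]
  simp only [e1]
  rw [lintegral_lintegral_swap]
  swap
  · have a0 : Measurable (fun q : EE 2 × EE 2 × EE 2 × EE 2 => Ain N ρ η t (v 0) (o 0) (σ 0) q.1 q.2.1) :=
      (mA 0).comp (g := uncurry (Ain N ρ η t (v 0) (o 0) (σ 0))) (f := fun q : EE 2 × EE 2 × EE 2 × EE 2 => (q.1, q.2.1)) (by fun_prop)
    have a1 : Measurable (fun q : EE 2 × EE 2 × EE 2 × EE 2 => Ain N ρ η t (v 1) (o 1) (σ 1) q.1 q.2.2.1) :=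
      (mA 1).comp (g := uncurry (Ain N ρ η t (v 1) (o 1) (σ 1))) (f := fun q : EE 2 × EE 2 × EE 2 × EE 2 => (q.1, q.2.2.1)) (by fun_prop)
    have a2 : Measurable (fun q : EE 2 × EE 2 × EE 2 × EE 2 => Ain N ρ η t (v 2) (o 2) (σ 2) q.1 q.2.2.2) :=
      (mA 2).comp (g := uncurry (Ain N ρ η t (v 2) (o 2) (σ 2))) (f := fun q : EE 2 × EE 2 × EE 2 × EE 2 => (q.1, q.2.2.2)) (by fun_prop)
    exact (a0.mul (a1.mul a2)).aemeasurable
  set g : EE 2 × EE 2 × EE 2 → ℝ≥0∞ := fun p => (eR ‖p.1 - p.2.1‖)⁻¹ + (eR ‖p.1 - p.2.2‖)⁻¹ + (eR ‖p.2.1 - p.2.2‖)⁻¹ with hg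
  have gm : Measurable g := by
    have m1 : Measurable (fun p : EE 2 × EE 2 × EE 2 => (eR ‖p.1 - p.2.1‖)⁻¹) := by
      apply Measurable.inv; apply meas_eR.comp; fun_prop
    have m2 : Measurable (fun p : EE 2 × EE 2 × EE 2 => (eR ‖p.1 - p.2.2‖)⁻¹) := by
      apply Measurable.inv; apply meas_eR.comp; fun_prop
    have m3 : Measurable (fun p : EE 2 × EE 2 × EE 2 => (eR ‖p.2.1 - p.2.2‖)⁻¹) := by
      apply Measurable.inv; apply meas_eR.comp; fun_prop
    exact (m1.add m2).add m3
  set c0 := eR (N * √N * (2 * (√ρ)⁻¹)) with hc0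
  set c1 := C * eR ((s ^ 12)⁻¹ * (N ^ 2)⁻¹) with hc1
  have hin : ∀ p : EE 2 × EE 2 × EE 2, ∫⁻ x, Ain N ρ η t (v 0) (o 0) (σ 0) x p.1 * (Ain N ρ η t (v 1) (o 1) (σ 1) x p.2.1 * Ain N ρ η t (v 2) (o 2) (σ 2) x p.2.2)
      ≤ (c0 * c1) * g p := by
    intro p
    by_cases hgt : g p = ⊤
    · have h0 : c0 * c1 ≠ 0 := by
        apply mul_ne_zero
        · rw [hc0]; simp only [ne_eq, ENNReal.ofReal_eq_zero, not_le]; positivity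
        · rw [hc1]; apply mul_ne_zero
          · rw [hCC]; push_cast; simp
          · simp only [ne_eq, ENNReal.ofReal_eq_zero, not_le]; positivity
      rw [hgt, ENNReal.mul_top h0]; exact le_top
    · have hpt := fun x => prod_Ain N ρ η hN hρ t v o σ x p.1 p.2.1 p.2.2
      refine (lintegral_mono hpt).trans ?_
      rw [lintegral_const_mul' _ _ (ENNReal.mul_ne_top eR_ne_top hgt)]
      have hz := hC v o σ ho hσ s η hs hs1 hsep hη t ![p.1, p.2.1, p.2.2] N hN _ (fun x hx => hx)
      have hle : (C0 : ℝ≥0∞) * eR ((s ^ 12)⁻¹ * (N ^ 2)⁻¹) ≤ c1 := by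
        rw [hc1, hCC]; apply mul_le_mul_left; push_cast; exact le_self_add
      calc _ ≤ c0 * g p * c1 := mul_le_mul_right (((lintegral_indicator_le _ _).trans hz).trans hle) _
        _ = _ := by ring
  calc _ ≤ ∫⁻ p, (c0 * c1) * g p ∂(ν.prod (ν.prod ν)) := lintegral_mono hin
    _ = (c0 * c1) * ∫⁻ p, g p ∂(ν.prod (ν.prod ν)) := lintegral_const_mul _ gm
    _ ≤ (c0 * c1) * (eR (6 * r ^ 3) * volume E) := by
        gcongr; exact triple_int x0 r hr E hEm hE
    _ = (C * (c0 * eR ((s ^ 12)⁻¹ * (N ^ 2)⁻¹) * eR (6 * r ^ 3))) * volume E := by rw [hc1]; ring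
    _ = _ := by
        congr 1
        rw [hc0, ← eR_mul (by positivity), ← eR_mul (by positivity)]
        have : N * √N * (2 * (√ρ)⁻¹) * ((s ^ 12)⁻¹ * (N ^ 2)⁻¹) * (6 * r ^ 3) = 12 * ((s ^ 12)⁻¹ * (r ^ 3 * (√N)⁻¹ * (√ρ)⁻¹)) := by
          have h1 : (N ^ 2)⁻¹ * N * √N = (√N)⁻¹ := by
            have := Real.sqrt_pos.mpr hN
            have e := Real.mul_self_sqrt hN.le
            nth_rewrite 1 2 [← e]
            field_simp
          calc _ = 12 * ((s ^ 12)⁻¹ * (r ^ 3 * ((N ^ 2)⁻¹ * N * √N) * (√ρ)⁻¹)) := by ring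
            _ = _ := by rw [h1]
        rw [this, eR_mul (by norm_num)]
        push_cast
        rw [show eR 12 = 12 by norm_num]
        ring

def sg (b : Bool) : ℝ := if b then 1 else -1

lemma sg_pm (b : Bool) : sg b = 1 ∨ sg b = -1 := by cases b <;> simp [sg]

lemma cos_small (n : ℕ) (hn : 1 ≤ n) (c : ℝ) (hc : c ^ 2 ≤ 1 - 1 / (n:ℝ) ^ 2) :
    c ^ (4 * n ^ 3) ≤ rexp (-(2 * n)) := by
  have hn0 : (0:ℝ) < n := by exact_mod_cast hn
  have e : c ^ (4 * n ^ 3) = (c ^ 2) ^ (2 * n ^ 3) := by rw [← pow_mul]; congr 1; ring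
  rw [e]
  calc _ ≤ (rexp (-(1 / (n:ℝ) ^ 2))) ^ (2 * n ^ 3) := by
        apply pow_le_pow_left₀ (sq_nonneg c)
        have := Real.add_one_le_exp (-(1 / (n:ℝ) ^ 2))
        linarith
    _ = _ := by
        rw [← Real.exp_nat_mul]; congr 1; push_cast; field_simp

lemma cos_large (n : ℕ) (hn : 1 ≤ n) (φ v : ℝ) (hc : 1 - 1 / (n:ℝ) ^ 2 < rcos (φ - v) ^ 2) :
    ∃ b : Bool, ‖om φ - sg b • om v‖ ≤ 2 / n := by
  have hn0 : (0:ℝ) < n := by exact_mod_cast hn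
  refine ⟨decide (0 ≤ rcos (φ - v)), ?_⟩
  have key : ∀ o : ℝ, (o = 1 ∨ o = -1) → o * rcos (φ - v) = |rcos (φ - v)| → ‖om φ - o • om v‖ ≤ 2 / n := by
    intro o ho h
    apply abs_le_of_sq_le_sq' _ (by positivity) |>.2
    rw [norm_sub_sq_real, om_norm, norm_smul, om_norm, real_inner_smul_right, om_inner, h]
    have ho2 : ‖o‖ = 1 := by rcases ho with rfl | rfl <;> simp
    rw [ho2]
    have h1 := Real.abs_cos_le_one (φ - v)
    have h0 := abs_nonneg (rcos (φ - v))
    rw [← sq_abs (rcos _)] at hc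
    have : (2 / (n:ℝ)) ^ 2 = 4 * (1 / (n:ℝ) ^ 2) := by field_simp; norm_num
    rw [this]
    have h3 : 0 < 1 / (n:ℝ)^2 := by positivity
    nlinarith
  apply key _ (sg_pm _)
  by_cases h : 0 ≤ rcos (φ - v)
  · simp [sg, h, abs_of_nonneg]
  · simp only [sg, h, decide_false]; push Not at h; rw [abs_of_neg h]; simp

/-- the error part of the kernel -/
def badk (n : ℕ) (N ρ s : ℝ) : ℝ≥0∞ :=
  eR (rexp (-(2 * n)) * √N * (√s)⁻¹) + (Iio ρ).indicator (fun s => eR (√N * (√s)⁻¹)) s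
    + eR ((1 + 4 * (n:ℝ) ^ 3) ^ 8 * (√N)⁻¹ * (s * √s)⁻¹)

lemma kernel_split : ∃ C : ℝ≥0, ∀ (n : ℕ), 1 ≤ n → ∀ v : ℝ, ∀ N ≥ (2:ℝ), ∀ ρ : ℝ, ∀ t : EE 2 → ℝ, (∀ x, t x ∈ Icc (1:ℝ) 2) →
    ∀ x y : EE 2, x ≠ y → ‖x - y‖ ≤ 1/4 →
    ‖LK (n ^ 3) v N (t x) (t y) (x - y)‖ₑ ≤ C * ((∑ q : Bool × Bool, Ain N ρ (2 / n) t v (sg q.1) (sg q.2) x y) + badk n N ρ ‖x - y‖) := by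
  obtain ⟨C, hC, hk⟩ := kernel_est
  refine ⟨(2 * C).toNNReal, ?_⟩
  intro n hn v N hN ρ t ht x y hxy hle
  obtain ⟨φ, hφ⟩ := om_surj (x - y)
  have hs : 0 < ‖x - y‖ := norm_pos_iff.mpr (sub_ne_zero.mpr hxy)
  have h := hk (n ^ 3) v N hN (t x) (ht x) (t y) (ht y) ‖x - y‖ hs hle φ
  rw [← hφ] at h
  have hdir : ‖x - y‖⁻¹ • (x - y) = om φ := by
    nth_rewrite 2 [hφ]; rw [smul_smul, inv_mul_cancel₀ hs.ne', one_smul]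
  set s := ‖x - y‖ with hsd
  set a := √N * (√s)⁻¹ with ha
  have ha0 : 0 ≤ a := by positivity
  set J1 := ((1 + N * |s - (t x - t y)|) ^ 4)⁻¹ with hJ1
  set J2 := ((1 + N * |s + (t x - t y)|) ^ 4)⁻¹ with hJ2
  have Jb : ∀ D : ℝ, 0 ≤ D → 0 ≤ ((1 + N * D) ^ 4)⁻¹ ∧ ((1 + N * D) ^ 4)⁻¹ ≤ 1 := by
    intro D hD
    have : 0 ≤ N * D := by positivity
    refine ⟨by positivity, inv_le_one_of_one_le₀ (one_le_pow₀ (by linarith))⟩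
  have hb1 := Jb _ (abs_nonneg (s - (t x - t y)))
  have hb2 := Jb _ (abs_nonneg (s + (t x - t y)))
  rw [← hJ1] at hb1; rw [← hJ2] at hb2
  set c := rcos (φ - v) ^ (4 * n ^ 3) with hc
  have hc0 : 0 ≤ c := by rw [hc, show 4 * n ^ 3 = 2 * (2 * n ^ 3) by ring, pow_mul]; positivity
  have hc1 : c ≤ 1 := by
    rw [hc, show 4 * n ^ 3 = 2 * (2 * n ^ 3) by ring, pow_mul]
    exact pow_le_one₀ (sq_nonneg _) (Real.cos_sq_le_one _)
  push_cast at h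
  set Q := (1 + 4 * (n:ℝ) ^ 3) ^ 8 * ((√N)⁻¹ * (s * √s)⁻¹) with hQ
  have hQ0 : 0 ≤ Q := by positivity
  -- the main bound
  have main : eR (c * (a * (J1 + J2))) ≤ 2 * ((∑ q : Bool × Bool, Ain N ρ (2 / n) t v (sg q.1) (sg q.2) x y)
      + (eR (rexp (-(2 * n)) * √N * (√s)⁻¹) + (Iio ρ).indicator (fun s => eR (√N * (√s)⁻¹)) s)) := by
    have h2a : ∀ e : ℝ, 0 ≤ e → c ≤ e → eR (c * (a * (J1 + J2))) ≤ 2 * eR (e * a) := by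
      intro e he hce
      rw [show (2:ℝ≥0∞) = eR 2 by norm_num, ← eR_mul (by norm_num)]
      apply eR_le
      calc c * (a * (J1 + J2)) ≤ e * (a * (1 + 1)) := by gcongr; exact hb1.2; exact hb2.2
        _ = _ := by ring
    by_cases h1 : s < ρ
    · refine (h2a 1 zero_le_one hc1).trans ?_
      rw [indicator_of_mem (show s ∈ Iio ρ from h1), one_mul]
      gcongr
      exact le_add_left (le_add_left le_rfl)
    · push Not at h1
      by_cases h2 : rcos (φ - v) ^ 2 ≤ 1 - 1 / (n:ℝ) ^ 2
      · refine (h2a _ (Real.exp_nonneg _) (cos_small n hn _ h2)).trans ?_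
        gcongr
        rw [ha, ← mul_assoc]
        exact le_add_left (le_add_right le_rfl)
      · push Not at h2
        obtain ⟨b, hb⟩ := cos_large n hn φ v h2
        have hA : ∀ σ : Bool, Ain N ρ (2 / n) t v (sg b) (sg σ) x y = eR (a * ((1 + N * Dfc t (sg σ) x y) ^ 4)⁻¹) := by
          intro σ
          unfold Ain
          rw [if_pos]
          rw [hdir]; exact ⟨h1, hb⟩
        have hAt := hA true
        have hAf := hA false
        have e1 : Dfc t (sg true) x y = |s - (t x - t y)| := by simp [Dfc, sg, hsd]
        have e2 : Dfc t (sg false) x y = |s + (t x - t y)| := by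
          unfold Dfc sg; rw [← hsd]; congr 1; simp only [Bool.false_eq_true, if_false]; ring
        rw [e1, ← hJ1] at hAt; rw [e2, ← hJ2] at hAf
        calc eR (c * (a * (J1 + J2))) ≤ eR (a * J1 + a * J2) := by
              apply eR_le
              have : 0 ≤ a * (J1 + J2) := mul_nonneg ha0 (add_nonneg hb1.1 hb2.1)
              nlinarith
          _ = Ain N ρ (2 / n) t v (sg b) (sg true) x y + Ain N ρ (2 / n) t v (sg b) (sg false) x y := by
              rw [hAt, hAf, eR_add (mul_nonneg ha0 hb1.1) (mul_nonneg ha0 hb2.1)]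
          _ = ∑ σ : Bool, Ain N ρ (2 / n) t v (sg b) (sg σ) x y := by simp
          _ ≤ ∑ b : Bool, ∑ σ : Bool, Ain N ρ (2 / n) t v (sg b) (sg σ) x y :=
              Finset.single_le_sum (f := fun b => ∑ σ : Bool, Ain N ρ (2 / n) t v (sg b) (sg σ) x y) (fun _ _ => zero_le) (Finset.mem_univ b)
          _ = ∑ q : Bool × Bool, Ain N ρ (2 / n) t v (sg q.1) (sg q.2) x y := by rw [Fintype.sum_prod_type]
          _ ≤ _ := by
              rw [two_mul]
              exact le_add_right le_self_add
  calc ‖LK (n ^ 3) v N (t x) (t y) (x - y)‖ₑ = eR ‖LK (n ^ 3) v N (t x) (t y) (x - y)‖ := (ofReal_norm_eq_enorm _).symm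
    _ ≤ eR (C * (c * (a * (J1 + J2)) + Q)) := eR_le h
    _ = eR C * (eR (c * (a * (J1 + J2))) + eR Q) := by
        rw [eR_mul hC.le, eR_add (mul_nonneg hc0 (mul_nonneg ha0 (add_nonneg hb1.1 hb2.1))) hQ0]
    _ ≤ eR C * (2 * ((∑ q : Bool × Bool, Ain N ρ (2 / n) t v (sg q.1) (sg q.2) x y)
      + (eR (rexp (-(2 * n)) * √N * (√s)⁻¹) + (Iio ρ).indicator (fun s => eR (√N * (√s)⁻¹)) s)) + 2 * eR Q) := by
        refine mul_le_mul_right (add_le_add main ?_) _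
        rw [two_mul]; exact le_self_add
    _ = _ := by
        unfold badk
        rw [show (((2 * C).toNNReal : ℝ≥0) : ℝ≥0∞) = eR (2 * C) from rfl, eR_mul (p := 2) (by norm_num), hQ, ← mul_assoc ((1 + 4 * (n:ℝ) ^ 3) ^ 8)]
        rw [show eR 2 = 2 by norm_num]
        ring

lemma badk_meas (n : ℕ) (N ρ : ℝ) : Measurable (badk n N ρ) := by
  have m1 : Measurable (fun s : ℝ => eR (rexp (-(2 * n)) * √N * (√s)⁻¹)) := by
    apply meas_eR.comp; fun_prop
  have m2 : Measurable (fun s : ℝ => eR (√N * (√s)⁻¹)) := by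
    apply meas_eR.comp; fun_prop
  have m3 : Measurable (fun s : ℝ => eR ((1 + 4 * (n:ℝ) ^ 3) ^ 8 * (√N)⁻¹ * (s * √s)⁻¹)) := by
    apply meas_eR.comp; fun_prop
  exact (m1.add (m2.indicator (measurableSet_Iio : MeasurableSet (Iio ρ)))).add m3

/-- `N = (w^2/b)^2`, `r = b^2`, `ρ = (b/w)^2`. -/
lemma badk_int (n : ℕ) (hn : 1 ≤ n) (b w : ℝ) (hb : 0 < b) (hw : 1 ≤ w) (he : rexp (-(2 * n)) ≤ (w ^ 4)⁻¹)
    (x x0 : EE 2) (E : Set (EE 2)) (hx : x ∈ ball x0 (b ^ 2 / 8)) (hE : E ⊆ ball x0 (b ^ 2 / 8)) :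
    ∫⁻ y in E, badk n ((w ^ 2 / b) ^ 2) ((b / w) ^ 2) ‖x - y‖ ≤ eR (10 ^ 8 * (n:ℝ) ^ 24 * b ^ 2 / w) := by
  have hw0 : 0 < w := by linarith
  have hn1 : (1:ℝ) ≤ n := by exact_mod_cast hn
  refine (rad_shift _ (badk_meas _ _ _) (b ^ 2 / 4) x E (ball_sub8 x x0 _ hx E hE)).trans ?_
  have sN : √((w ^ 2 / b) ^ 2) = w ^ 2 / b := Real.sqrt_sq (by positivity)
  have s4 : √(b ^ 2 / 4) = b / 2 := by
    rw [show b ^ 2 / 4 = (b / 2) ^ 2 by ring]; exact Real.sqrt_sq (by positivity)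
  have sρ : √((b / w) ^ 2) = b / w := Real.sqrt_sq (by positivity)
  unfold badk
  rw [sN]
  have mr : Measurable (fun z : EE 2 => eR ((√‖z‖)⁻¹)) := by apply meas_eR.comp; fun_prop
  have mr3 : Measurable (fun z : EE 2 => eR ((‖z‖ * √‖z‖)⁻¹)) := by apply meas_eR.comp; fun_prop
  have m1 : Measurable (fun z : EE 2 => eR (rexp (-(2 * n)) * (w ^ 2 / b) * (√‖z‖)⁻¹)) := by
    apply meas_eR.comp; fun_prop
  have m2 : Measurable (fun z : EE 2 => (Iio ((b / w) ^ 2)).indicator (fun s => eR ((w ^ 2 / b) * (√s)⁻¹)) ‖z‖) := by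
    refine Measurable.comp (g := (Iio ((b / w) ^ 2)).indicator (fun s => eR ((w ^ 2 / b) * (√s)⁻¹))) (Measurable.indicator ?_ measurableSet_Iio) measurable_norm
    apply meas_eR.comp; fun_prop
  have m12 : Measurable (fun z : EE 2 => eR (rexp (-(2 * n)) * (w ^ 2 / b) * (√‖z‖)⁻¹) + (Iio ((b / w) ^ 2)).indicator (fun s => eR ((w ^ 2 / b) * (√s)⁻¹)) ‖z‖) := m1.add m2
  rw [lintegral_add_left m12, lintegral_add_left m1]
  have i1 : ∫⁻ z in ball (0 : EE 2) (b ^ 2 / 4), eR (rexp (-(2 * n)) * (w ^ 2 / b) * (√‖z‖)⁻¹) ≤ eR (b ^ 2 / w) := by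
    calc _ = ∫⁻ z in ball (0 : EE 2) (b ^ 2 / 4), eR (rexp (-(2 * n)) * (w ^ 2 / b)) * eR ((√‖z‖)⁻¹) := by
          congr 1; ext z; rw [eR_mul (by positivity)]
      _ = eR (rexp (-(2 * n)) * (w ^ 2 / b)) * ∫⁻ z in ball (0 : EE 2) (b ^ 2 / 4), eR ((√‖z‖)⁻¹) := lintegral_const_mul _ mr
      _ ≤ eR (rexp (-(2 * n)) * (w ^ 2 / b)) * eR (7 * (b ^ 2 / 4 * √(b ^ 2 / 4))) := by
          gcongr; exact rad_half _ (by positivity)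
      _ ≤ _ := by
          rw [s4, ← eR_mul (by positivity)]
          apply eR_le
          calc rexp (-(2 * n)) * (w ^ 2 / b) * (7 * (b ^ 2 / 4 * (b / 2))) ≤ (w ^ 4)⁻¹ * (w ^ 2 / b) * (7 * (b ^ 2 / 4 * (b / 2))) := by gcongr
            _ = 7 / 8 * b ^ 2 / w ^ 2 := by field_simp; norm_num
            _ ≤ b ^ 2 / w := by
              rw [div_le_div_iff₀ (by positivity) hw0]
              have : b ^ 2 * w ≤ b ^ 2 * w ^ 2 := by gcongr; nlinarith
              nlinarith [show 0 ≤ b ^ 2 * w by positivity]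
  have i2 : ∫⁻ z in ball (0 : EE 2) (b ^ 2 / 4), (Iio ((b / w) ^ 2)).indicator (fun s => eR ((w ^ 2 / b) * (√s)⁻¹)) ‖z‖ ≤ eR (7 * b ^ 2 / w) := by
    calc _ ≤ ∫⁻ z : EE 2, (Iio ((b / w) ^ 2)).indicator (fun s => eR ((w ^ 2 / b) * (√s)⁻¹)) ‖z‖ := setLIntegral_le_lintegral _ _
      _ = ∫⁻ z : EE 2, (ball (0 : EE 2) ((b / w) ^ 2)).indicator (fun z => eR (w ^ 2 / b) * eR ((√‖z‖)⁻¹)) z := by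
          congr 1; ext z
          by_cases h : ‖z‖ < (b / w) ^ 2
          · rw [indicator_of_mem (show ‖z‖ ∈ Iio ((b / w) ^ 2) from h), indicator_of_mem (by simpa using h), eR_mul (by positivity)]
          · rw [indicator_of_notMem (by simpa using h), indicator_of_notMem (by simpa using h)]
      _ = eR (w ^ 2 / b) * ∫⁻ z in ball (0 : EE 2) ((b / w) ^ 2), eR ((√‖z‖)⁻¹) := by
          rw [lintegral_indicator measurableSet_ball, lintegral_const_mul _ mr]
      _ ≤ eR (w ^ 2 / b) * eR (7 * ((b / w) ^ 2 * √((b / w) ^ 2))) := by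
          gcongr; exact rad_half _ (by positivity)
      _ = _ := by
          rw [sρ, ← eR_mul (by positivity)]
          congr 1; field_simp
  have i3 : ∫⁻ z in ball (0 : EE 2) (b ^ 2 / 4), eR ((1 + 4 * (n:ℝ) ^ 3) ^ 8 * (w ^ 2 / b)⁻¹ * (‖z‖ * √‖z‖)⁻¹) ≤ eR (7 * (5 * (n:ℝ)^3) ^ 8 * b ^ 2 / w) := by
    calc _ = ∫⁻ z in ball (0 : EE 2) (b ^ 2 / 4), eR ((1 + 4 * (n:ℝ) ^ 3) ^ 8 * (w ^ 2 / b)⁻¹) * eR ((‖z‖ * √‖z‖)⁻¹) := by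
          congr 1; ext z; rw [eR_mul (by positivity)]
      _ = eR ((1 + 4 * (n:ℝ) ^ 3) ^ 8 * (w ^ 2 / b)⁻¹) * ∫⁻ z in ball (0 : EE 2) (b ^ 2 / 4), eR ((‖z‖ * √‖z‖)⁻¹) := lintegral_const_mul _ mr3
      _ ≤ eR ((1 + 4 * (n:ℝ) ^ 3) ^ 8 * (w ^ 2 / b)⁻¹) * eR (14 * √(b ^ 2 / 4)) := by
          gcongr; exact rad_3half _ (by positivity)
      _ ≤ _ := by
          rw [s4, ← eR_mul (by positivity)]
          apply eR_le
          have h3 : 1 + 4 * (n:ℝ) ^ 3 ≤ 5 * (n:ℝ) ^ 3 := by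
            have : 1 ≤ (n:ℝ) ^ 3 := one_le_pow₀ hn1
            linarith
          calc (1 + 4 * (n:ℝ) ^ 3) ^ 8 * (w ^ 2 / b)⁻¹ * (14 * (b / 2)) ≤ (5 * (n:ℝ) ^ 3) ^ 8 * (w ^ 2 / b)⁻¹ * (14 * (b / 2)) := by gcongr
            _ = 7 * (5 * (n:ℝ) ^ 3) ^ 8 * b ^ 2 / w ^ 2 := by field_simp; norm_num
            _ ≤ _ := by
              gcongr; nlinarith
  refine (add_le_add (add_le_add i1 i2) i3).trans ?_
  rw [← eR_add (by positivity) (by positivity), ← eR_add (by positivity) (by positivity)]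
  apply eR_le
  rw [← add_div, ← add_div]
  gcongr
  have h24 : 1 ≤ (n:ℝ) ^ 24 := one_le_pow₀ hn1
  have e : 7 * (5 * (n:ℝ) ^ 3) ^ 8 * b ^ 2 = 7 * 5 ^ 8 * ((n:ℝ) ^ 24 * b ^ 2) := by ring
  have hb2 : b ^ 2 ≤ (n:ℝ) ^ 24 * b ^ 2 := by nlinarith [sq_nonneg b]
  rw [e]
  nlinarith [sq_nonneg b]

lemma sum3_mul {ι : Type*} [Fintype ι] (f g h : ι → ℝ≥0∞) :
    (∑ i, f i) * ((∑ i, g i) * (∑ i, h i)) = ∑ a : ι, ∑ b : ι, ∑ c : ι, f a * (g b * h c) := by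
  rw [Finset.sum_mul_sum, Finset.sum_mul_sum]
  simp only [Finset.mul_sum]

/-- the main incidence estimate -/
lemma core : ∃ K : ℝ≥0, ∀ (n : ℕ) (s b w : ℝ) (v : Fin 3 → ℝ) (t : EE 2 → ℝ) (x0 : EE 2) (E G : Set (EE 2)) (κ : ℝ≥0∞),
    1 ≤ n → 0 < s → s ≤ 1 → 128 ≤ n * s ^ 3 → (∀ i j, i ≠ j → s ≤ |rsin (v i - v j)|) → Measurable t → (∀ x, t x ∈ Icc (1:ℝ) 2) →
    0 < b → b ≤ 1 → 1 ≤ w → 2 ≤ (w ^ 2 / b) ^ 2 → rexp (-(2 * n)) ≤ (w ^ 4)⁻¹ →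
    MeasurableSet E → MeasurableSet G → G ⊆ E → E ⊆ ball x0 (b ^ 2 / 8) → volume E ≤ 4 * volume G → volume G ≠ 0 →
    (∀ i, ∀ x ∈ G, κ ≤ ∫⁻ y in E, ‖LK (n ^ 3) (v i) ((w ^ 2 / b) ^ 2) (t x) (t y) (x - y)‖ₑ) →
    κ ^ 3 ≤ K * eR ((n:ℝ) ^ 72 * b ^ 6 / w) := by
  obtain ⟨C, hC⟩ := kernel_split
  obtain ⟨T, hT⟩ := trilin
  refine ⟨8 * C ^ 3 * 10 ^ 24 + 8 * C ^ 3 * 64 * T * 4, ?_⟩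
  intro n s b w v t x0 E G κ hn hs hs1 hns hsep ht htI hb hb1 hw hN he hEm hGm hGE hE hEG hG0 hκ
  have hw0 : 0 < w := by linarith
  have hn1 : (1:ℝ) ≤ n := by exact_mod_cast hn
  set N := (w ^ 2 / b) ^ 2 with hNd
  set ρ := (b / w) ^ 2 with hρ
  have hρ0 : 0 < ρ := by positivity
  set Bd := eR (10 ^ 8 * (n:ℝ) ^ 24 * b ^ 2 / w) with hBd
  set A : Fin 3 → Bool × Bool → EE 2 → ℝ≥0∞ := fun i q x => ∫⁻ y in E, Ain N ρ (2 / n) t (v i) (sg q.1) (sg q.2) x y with hA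
  have mAm : ∀ i q, Measurable (A i q) := fun i q => (Ain_meas N ρ (2 / n) t ht (v i) (sg q.1) (sg q.2)).lintegral_prod_right
  have step1 : ∀ i, ∀ x ∈ G, κ ≤ C * ((∑ q, A i q x) + Bd) := by
    intro i x hx
    refine (hκ i x hx).trans ?_
    have hae : ∀ᵐ y ∂(volume.restrict E), ‖LK (n ^ 3) (v i) N (t x) (t y) (x - y)‖ₑ ≤ C * ((∑ q : Bool × Bool, Ain N ρ (2 / n) t (v i) (sg q.1) (sg q.2) x y) + badk n N ρ ‖x - y‖) := by
      have h1 : ∀ᵐ y ∂(volume.restrict E), y ≠ x := by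
        apply ae_restrict_of_ae
        rw [ae_iff]; simp
      filter_upwards [h1, ae_restrict_mem hEm] with y hy hyE
      refine hC n hn (v i) N hN ρ t htI x y hy.symm ?_
      have := ball_sub8 x x0 _ (hE (hGE hx)) E hE hyE
      rw [mem_ball, dist_comm, dist_eq_norm] at this
      nlinarith
    refine (lintegral_mono_ae hae).trans ?_
    rw [lintegral_const_mul' _ _ ENNReal.coe_ne_top]
    gcongr
    have mb : Measurable (fun y : EE 2 => badk n N ρ ‖x - y‖) := (badk_meas n N ρ).comp (g := badk n N ρ) (f := fun y : EE 2 => ‖x - y‖) (by fun_prop)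
    rw [lintegral_add_right _ mb, lintegral_finset_sum]
    · gcongr
      exact badk_int n hn b w hb hw he x x0 E (hE (hGE hx)) hE
    · intro q _
      exact (Ain_meas N ρ (2 / n) t ht (v i) (sg q.1) (sg q.2)).of_uncurry_left
  have hw3 : b ^ 6 / w ^ 3 ≤ b ^ 6 / w := by
    gcongr
    calc w = w ^ 1 := (pow_one w).symm
      _ ≤ w ^ 3 := pow_le_pow_right₀ hw (by norm_num)
  by_cases hcase : κ ≤ 2 * C * Bd
  · calc κ ^ 3 ≤ (2 * C * Bd) ^ 3 := by gcongr
      _ = 8 * C ^ 3 * Bd ^ 3 := by ring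
      _ ≤ 8 * C ^ 3 * (10 ^ 24 * eR ((n:ℝ) ^ 72 * b ^ 6 / w)) := by
          gcongr
          rw [hBd, ← eR_pow (by positivity), show (10:ℝ≥0∞) ^ 24 = eR (10 ^ 24) by rw [eR_pow (by norm_num)]; norm_num, ← eR_mul (by norm_num)]
          apply eR_le
          calc (10 ^ 8 * (n:ℝ) ^ 24 * b ^ 2 / w) ^ 3 = 10 ^ 24 * ((n:ℝ) ^ 72 * (b ^ 6 / w ^ 3)) := by ring
            _ ≤ 10 ^ 24 * ((n:ℝ) ^ 72 * (b ^ 6 / w)) := by gcongr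
            _ = _ := by ring
      _ ≤ _ := by
          push_cast
          rw [← mul_assoc]
          gcongr
          exact le_self_add
  push Not at hcase
  have step2 : ∀ i, ∀ x ∈ G, κ ≤ 2 * C * ∑ q, A i q x := by
    intro i x hx
    have h := step1 i x hx
    rcases le_total (∑ q, A i q x) Bd with h1 | h1
    · exfalso
      have : κ ≤ 2 * C * Bd := h.trans (by
        calc (C:ℝ≥0∞) * ((∑ q, A i q x) + Bd) ≤ C * (Bd + Bd) := by gcongr
          _ = _ := by ring)
      exact absurd this (not_le.mpr hcase)
    · exact h.trans (by
        calc (C:ℝ≥0∞) * ((∑ q, A i q x) + Bd) ≤ C * ((∑ q, A i q x) + (∑ q, A i q x)) := by gcongr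
          _ = _ := by ring)
  set TT := T * eR ((s ^ 12)⁻¹ * (b ^ 6 / w)) with hTT
  have tri : ∀ a b' c : Bool × Bool, ∫⁻ x, A 0 a x * (A 1 b' x * A 2 c x) ≤ TT * volume E := by
    intro a b' c
    have := hT v ![sg a.1, sg b'.1, sg c.1] ![sg a.2, sg b'.2, sg c.2] (by intro i; fin_cases i <;> exact sg_pm _) (by intro i; fin_cases i <;> exact sg_pm _)
      s (2 / n) hs hs1 hsep (by
        rw [div_le_iff₀ (by positivity)]; linarith) t ht N (by positivity) ρ hρ0 (b ^ 2) (by positivity) x0 E hEm hE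
    refine this.trans (le_of_eq ?_)
    rw [hTT]
    congr 4
    rw [hNd, hρ, Real.sqrt_sq (by positivity), Real.sqrt_sq (by positivity)]
    field_simp
  have big : κ ^ 3 * volume G ≤ 8 * C ^ 3 * (64 * (TT * volume E)) := by
    calc κ ^ 3 * volume G = ∫⁻ x in G, κ ^ 3 := by rw [setLIntegral_const]
      _ ≤ ∫⁻ x in G, 8 * C ^ 3 * ((∑ q, A 0 q x) * ((∑ q, A 1 q x) * (∑ q, A 2 q x))) := by
          refine setLIntegral_mono' hGm fun x hx => ?_
          calc κ ^ 3 = κ * (κ * κ) := by ring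
            _ ≤ (2 * C * ∑ q, A 0 q x) * ((2 * C * ∑ q, A 1 q x) * (2 * C * ∑ q, A 2 q x)) :=
              mul_le_mul' (step2 0 x hx) (mul_le_mul' (step2 1 x hx) (step2 2 x hx))
            _ = _ := by ring
      _ ≤ ∫⁻ x, 8 * C ^ 3 * ((∑ q, A 0 q x) * ((∑ q, A 1 q x) * (∑ q, A 2 q x))) := setLIntegral_le_lintegral _ _
      _ = 8 * C ^ 3 * ∫⁻ x, ∑ a : Bool × Bool, ∑ b' : Bool × Bool, ∑ c : Bool × Bool, A 0 a x * (A 1 b' x * A 2 c x) := by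
          rw [lintegral_const_mul' _ _ (by finiteness)]
          simp only [sum3_mul]
      _ = 8 * C ^ 3 * ∑ a : Bool × Bool, ∑ b' : Bool × Bool, ∑ c : Bool × Bool, ∫⁻ x, A 0 a x * (A 1 b' x * A 2 c x) := by
          congr 1
          have mm : ∀ a b' c, Measurable (fun x => A 0 a x * (A 1 b' x * A 2 c x)) := fun a b' c => (mAm 0 a).mul ((mAm 1 b').mul (mAm 2 c))
          rw [lintegral_finset_sum _ (fun a _ => Finset.measurable_sum _ fun b' _ => Finset.measurable_sum _ fun c _ => mm a b' c)]
          refine Finset.sum_congr rfl fun a _ => ?_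
          rw [lintegral_finset_sum _ (fun b' _ => Finset.measurable_sum _ fun c _ => mm a b' c)]
          refine Finset.sum_congr rfl fun b' _ => ?_
          rw [lintegral_finset_sum _ (fun c _ => mm a b' c)]
      _ ≤ 8 * C ^ 3 * ∑ a : Bool × Bool, ∑ b' : Bool × Bool, ∑ c : Bool × Bool, TT * volume E := by
          refine mul_le_mul_right (Finset.sum_le_sum fun a _ => Finset.sum_le_sum fun b' _ => Finset.sum_le_sum fun c _ => tri a b' c) _
      _ = _ := by
          simp only [Finset.sum_const, Finset.card_univ, Fintype.card_prod, Fintype.card_bool, nsmul_eq_mul]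
          push_cast; ring
  have hGf : volume G ≠ ⊤ := ((measure_mono (hGE.trans hE)).trans_lt measure_ball_lt_top).ne
  have big2 : κ ^ 3 * volume G ≤ (8 * C ^ 3 * (64 * (TT * 4))) * volume G := by
    refine big.trans ?_
    calc (8:ℝ≥0∞) * C ^ 3 * (64 * (TT * volume E)) ≤ 8 * C ^ 3 * (64 * (TT * (4 * volume G))) := by gcongr
      _ = _ := by ring
  have fin := (ENNReal.mul_le_mul_iff_left hG0 hGf).mp big2
  refine fin.trans ?_
  have hs12 : (s ^ 12)⁻¹ ≤ (n:ℝ) ^ 72 := by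
    have h1 : (s ^ 3)⁻¹ ≤ n := by
      rw [inv_le_iff_one_le_mul₀ (by positivity)]; linarith
    calc (s ^ 12)⁻¹ = ((s ^ 3)⁻¹) ^ 4 := by rw [inv_pow, ← pow_mul]
      _ ≤ (n:ℝ) ^ 4 := by gcongr
      _ ≤ _ := pow_le_pow_right₀ hn1 (by norm_num)
  calc (8:ℝ≥0∞) * C ^ 3 * (64 * (TT * 4)) ≤ 8 * C ^ 3 * (64 * ((T * eR ((n:ℝ) ^ 72 * (b ^ 6 / w))) * 4)) := by
        rw [hTT]; gcongr
    _ = (8 * C ^ 3 * 64 * T * 4) * eR ((n:ℝ) ^ 72 * b ^ 6 / w) := by rw [← mul_div_assoc]; ring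
    _ ≤ _ := by
        push_cast
        gcongr
        exact le_add_self

lemma sin_set (a s : ℝ) (ha : a ∈ Ioc (-rpi) rpi) (hs : 0 ≤ s) :
    volume {v | v ∈ Ioc (-rpi) rpi ∧ |rsin (v - a)| < s} ≤ eR (20 * s) := by
  have hpi := rpi_pos
  set c := rpi / 2 * s with hc
  have hsub : {v | v ∈ Ioc (-rpi) rpi ∧ |rsin (v - a)| < s} ⊆ ⋃ k ∈ Finset.Icc (-2:ℤ) 2, Icc (a + k * rpi - c) (a + k * rpi + c) := by
    rintro v ⟨hv, hlt⟩
    set k := round ((v - a) / rpi) with hk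
    have h1 := abs_sub_round ((v - a) / rpi)
    rw [← hk] at h1
    have h1' : |v - a - k * rpi| ≤ rpi / 2 := by
      have : v - a - k * rpi = ((v - a) / rpi - k) * rpi := by field_simp
      rw [this, abs_mul, abs_of_pos hpi]; nlinarith
    have h2 := Real.mul_abs_le_abs_sin h1'
    have h3 : |rsin (v - a - k * rpi)| = |rsin (v - a)| := by
      rw [Real.sin_sub_int_mul_pi, abs_mul, abs_zpow, abs_neg, abs_one, one_zpow, one_mul]
    rw [h3] at h2
    have h4 : |v - a - k * rpi| ≤ c := by
      rw [hc]
      have : |v - a - k * rpi| = rpi / 2 * (2 / rpi * |v - a - k * rpi|) := by field_simp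
      rw [this]; gcongr; linarith
    have h5 := abs_le.mp h1'
    have hk1 : -3 < k := by
      have : (-3:ℝ) < k := by
        by_contra hcon; push Not at hcon
        have := hv.1; have := ha.2; nlinarith [h5.1, h5.2]
      exact_mod_cast this
    have hk2 : k < 3 := by
      have : (k:ℝ) < 3 := by
        by_contra hcon; push Not at hcon
        have := hv.2; have := ha.1; nlinarith [h5.1, h5.2]
      exact_mod_cast this
    simp only [mem_iUnion]
    refine ⟨k, Finset.mem_Icc.mpr ⟨by omega, by omega⟩, ?_⟩
    have h6 := abs_le.mp h4
    constructor <;> linarith [h6.1, h6.2]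
  refine (measure_mono hsub).trans ((measure_biUnion_finset_le _ _).trans ?_)
  calc ∑ k ∈ Finset.Icc (-2:ℤ) 2, volume (Icc (a + k * rpi - c) (a + k * rpi + c)) = ∑ k ∈ Finset.Icc (-2:ℤ) 2, eR (2 * c) := by
        refine Finset.sum_congr rfl fun k _ => ?_
        rw [Real.volume_Icc]; congr 1; ring
    _ = 5 * eR (2 * c) := by
        rw [Finset.sum_const]; simp
    _ = eR (5 * (2 * c)) := by rw [eR_mul (by norm_num)]; norm_num
    _ ≤ _ := by
        apply eR_le
        rw [hc]; nlinarith [Real.pi_lt_d2]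

lemma pick (g : ℝ → EE 2 → ℝ≥0∞) (hg : Measurable (uncurry g)) (hg1 : ∀ v x, g v x ≤ 1) (E : Set (EE 2)) (hE : MeasurableSet E)
    (hE0 : volume E ≠ 0) (hEf : volume E ≠ ⊤) (V : Set ℝ) (hV : MeasurableSet V) (hV7 : volume V ≤ 7) (a : ℝ≥0∞) (ha0 : a ≠ 0) (ha : a ≠ ⊤)
    (h : ∀ x ∈ E, a ≤ ∫⁻ v in V, g v x) : ∃ v ∈ V, a / 16 * volume E ≤ volume {x | x ∈ E ∧ a / 16 ≤ g v x} := by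
  by_contra hcon
  push Not at hcon
  have hgv : ∀ v, Measurable (g v) := fun v => hg.of_uncurry_left
  have hms : ∀ v, MeasurableSet {x | a / 16 ≤ g v x} := fun v => measurableSet_le measurable_const (hgv v)
  have h1 : a * volume E ≤ ∫⁻ v in V, (∫⁻ x in E, g v x) := by
    rw [lintegral_lintegral_swap hg.aemeasurable, ← setLIntegral_const]
    exact setLIntegral_mono' hE h
  have h2 : ∀ v ∈ V, ∫⁻ x in E, g v x ≤ a / 8 * volume E := by
    intro v hv
    calc ∫⁻ x in E, g v x ≤ ∫⁻ x in E, ({x | a / 16 ≤ g v x}.indicator 1 x + a / 16) := by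
          refine lintegral_mono fun x => ?_
          by_cases hx : a / 16 ≤ g v x
          · rw [indicator_of_mem (show x ∈ {x | a / 16 ≤ g v x} from hx)]
            exact (hg1 v x).trans le_self_add
          · rw [indicator_of_notMem (show x ∉ {x | a / 16 ≤ g v x} from hx), zero_add]
            exact (not_le.mp hx).le
      _ = volume {x | x ∈ E ∧ a / 16 ≤ g v x} + a / 16 * volume E := by
          rw [lintegral_add_right _ measurable_const, lintegral_indicator_one (hms v), Measure.restrict_apply (hms v), setLIntegral_const]
          congr 2; ext x; simp [and_comm]
      _ ≤ a / 16 * volume E + a / 16 * volume E := by gcongr; exact (hcon v hv).le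
      _ = a / 8 * volume E := by
          rw [← add_mul, ENNReal.div_add_div_same, ← two_mul, show (16:ℝ≥0∞) = 2 * 8 by norm_num, ENNReal.mul_div_mul_left _ _ (by norm_num) (by norm_num)]
  have h3 : a * volume E ≤ a / 8 * volume E * 7 := by
    refine h1.trans ((setLIntegral_mono' hV h2).trans ?_)
    rw [setLIntegral_const]; gcongr
  have h4 : a * volume E ≠ 0 := mul_ne_zero ha0 hE0
  have h5 : a * volume E ≠ ⊤ := ENNReal.mul_ne_top ha hEf
  have h6 : a / 8 * volume E * 7 = (a * volume E) * (7 / 8) := by simp only [div_eq_mul_inv]; ring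
  rw [h6] at h3
  have h7 : (a * volume E) * (7 / 8) < (a * volume E) * 1 := by
    refine (ENNReal.mul_lt_mul_iff_right h4 h5).mpr ?_
    rw [ENNReal.div_lt_iff (by norm_num) (by norm_num)]; norm_num
  rw [mul_one] at h7
  exact absurd h3 (not_le.mpr h7)

lemma pick2 (g : ℝ → EE 2 → ℝ≥0∞) (hg : Measurable (uncurry g)) (hg1 : ∀ v x, g v x ≤ 1) (E : Set (EE 2)) (hE : MeasurableSet E)
    (hE0 : volume E ≠ 0) (hEf : volume E ≠ ⊤) (a : ℝ) (ha0 : 0 < a)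
    (h : ∀ x ∈ E, eR a ≤ ∫⁻ v in Ioc (-rpi) rpi, g v x) (a1 a2 : ℝ) (h1 : a1 ∈ Ioc (-rpi) rpi) (h2 : a2 ∈ Ioc (-rpi) rpi) :
    ∃ v ∈ Ioc (-rpi) rpi, a / 80 ≤ |rsin (v - a1)| ∧ a / 80 ≤ |rsin (v - a2)| ∧
      eR (a / 32) * volume E ≤ volume {x | x ∈ E ∧ eR (a / 32) ≤ g v x} := by
  have hm : ∀ b : ℝ, MeasurableSet {v : ℝ | |rsin (v - b)| < a / 80} := fun b => measurableSet_lt (by fun_prop) measurable_const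
  set V := {v : ℝ | v ∈ Ioc (-rpi) rpi ∧ a / 80 ≤ |rsin (v - a1)| ∧ a / 80 ≤ |rsin (v - a2)|} with hV
  set B1 := {v : ℝ | v ∈ Ioc (-rpi) rpi ∧ |rsin (v - a1)| < a / 80} with hB1
  set B2 := {v : ℝ | v ∈ Ioc (-rpi) rpi ∧ |rsin (v - a2)| < a / 80} with hB2
  have hcov : Ioc (-rpi) rpi ⊆ V ∪ (B1 ∪ B2) := by
    intro v hv
    by_cases c1 : a / 80 ≤ |rsin (v - a1)|
    · by_cases c2 : a / 80 ≤ |rsin (v - a2)|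
      · left; exact ⟨hv, c1, c2⟩
      · right; right; exact ⟨hv, not_le.mp c2⟩
    · right; left; exact ⟨hv, not_le.mp c1⟩
  have hVm : MeasurableSet V := by
    refine measurableSet_Ioc.inter (MeasurableSet.inter ?_ ?_)
    · exact measurableSet_le (measurable_const : Measurable fun _ : ℝ => a / 80) (by fun_prop : Measurable fun v : ℝ => |rsin (v - a1)|)
    · exact measurableSet_le (measurable_const : Measurable fun _ : ℝ => a / 80) (by fun_prop : Measurable fun v : ℝ => |rsin (v - a2)|)
  have hV7 : volume V ≤ 7 := by
    calc volume V ≤ volume (Ioc (-rpi) rpi) := measure_mono fun v hv => hv.1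
      _ = eR (2 * rpi) := by rw [Real.volume_Ioc]; congr 1; ring
      _ ≤ eR 7 := eR_le (by linarith [Real.pi_lt_d2])
      _ = 7 := by norm_num
  have hlow : ∀ x ∈ E, eR (a / 2) ≤ ∫⁻ v in V, g v x := by
    intro x hx
    have hb : ∫⁻ v in B1 ∪ B2, g v x ≤ eR (a / 2) := by
      calc ∫⁻ v in B1 ∪ B2, g v x ≤ ∫⁻ v in B1 ∪ B2, 1 := lintegral_mono fun v => hg1 v x
        _ = volume (B1 ∪ B2) := by rw [setLIntegral_const, one_mul]
        _ ≤ eR (20 * (a / 80)) + eR (20 * (a / 80)) :=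
            (measure_union_le _ _).trans (add_le_add (sin_set a1 _ h1 (by positivity)) (sin_set a2 _ h2 (by positivity)))
        _ = _ := by rw [← eR_add (by positivity) (by positivity)]; congr 1; ring
    have hs : eR (a / 2) + eR (a / 2) ≤ (∫⁻ v in V, g v x) + eR (a / 2) := by
      rw [← eR_add (by positivity) (by positivity), add_halves]
      refine (h x hx).trans ((lintegral_mono_set hcov).trans ((lintegral_union_le _ _ _).trans ?_))
      gcongr
    exact (ENNReal.add_le_add_iff_right eR_ne_top).mp hs
  obtain ⟨v, hv, hvol⟩ := pick g hg hg1 E hE hE0 hEf V hVm hV7 (eR (a / 2)) (by simp; linarith) eR_ne_top hlow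
  have e : eR (a / 2) / 16 = eR (a / 32) := by
    rw [show (16:ℝ≥0∞) = eR 16 by norm_num, ← ENNReal.ofReal_div_of_pos (by norm_num)]; congr 1; ring
  rw [e] at hvol
  exact ⟨v, hv.1, hv.2.1, hv.2.2, hvol⟩

lemma triple (g : ℝ → EE 2 → ℝ≥0∞) (hg : Measurable (uncurry g)) (hg1 : ∀ v x, g v x ≤ 1) (E : Set (EE 2)) (hE : MeasurableSet E)
    (hE0 : volume E ≠ 0) (hEf : volume E ≠ ⊤) (a : ℝ) (ha0 : 0 < a)
    (h : ∀ x ∈ E, eR a ≤ ∫⁻ v in Ioc (-rpi) rpi, g v x) :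
    ∃ v : Fin 3 → ℝ, (∀ i j, i ≠ j → a / 80 ≤ |rsin (v i - v j)|) ∧ ∃ E' ⊆ E, MeasurableSet E' ∧
      eR (a / 32) ^ 3 * volume E ≤ volume E' ∧ ∀ i, ∀ x ∈ E', eR (a / 32) ≤ g (v i) x := by
  have hpi := rpi_pos
  have z : (0:ℝ) ∈ Ioc (-rpi) rpi := ⟨by linarith, by linarith⟩
  have hgv : ∀ v, Measurable (g v) := fun v => hg.of_uncurry_left
  set c := eR (a / 32) with hc
  have hc0 : c ≠ 0 := by rw [hc]; simp; linarith
  have step : ∀ F : Set (EE 2), MeasurableSet F → ∀ v, MeasurableSet {x | x ∈ F ∧ c ≤ g v x} := fun F hF v =>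
    hF.inter (measurableSet_le measurable_const (hgv v))
  obtain ⟨v1, hv1, -, -, e1⟩ := pick2 g hg hg1 E hE hE0 hEf a ha0 h 0 0 z z
  set E1 := {x | x ∈ E ∧ c ≤ g v1 x} with hE1
  have s1 : E1 ⊆ E := fun x hx => hx.1
  have n1 : volume E1 ≠ 0 := (lt_of_lt_of_le (pos_iff_ne_zero.mpr (mul_ne_zero hc0 hE0)) e1).ne'
  have f1 : volume E1 ≠ ⊤ := ((measure_mono s1).trans_lt hEf.lt_top).ne
  obtain ⟨v2, hv2, d12, -, e2⟩ := pick2 g hg hg1 E1 (step E hE v1) n1 f1 a ha0 (fun x hx => h x (s1 hx)) v1 v1 hv1 hv1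
  set E2 := {x | x ∈ E1 ∧ c ≤ g v2 x} with hE2
  have s2 : E2 ⊆ E1 := fun x hx => hx.1
  have n2 : volume E2 ≠ 0 := (lt_of_lt_of_le (pos_iff_ne_zero.mpr (mul_ne_zero hc0 n1)) e2).ne'
  have f2 : volume E2 ≠ ⊤ := ((measure_mono s2).trans_lt f1.lt_top).ne
  obtain ⟨v3, hv3, d13, d23, e3⟩ := pick2 g hg hg1 E2 (step _ (step E hE v1) v2) n2 f2 a ha0 (fun x hx => h x (s1 (s2 hx))) v1 v2 hv1 hv2
  set E3 := {x | x ∈ E2 ∧ c ≤ g v3 x} with hE3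
  have sy : ∀ u w : ℝ, |rsin (u - w)| = |rsin (w - u)| := fun u w => by
    rw [← neg_sub, Real.sin_neg, abs_neg]
  refine ⟨![v1, v2, v3], ?_, E3, fun x hx => hx.1.1.1, step _ (step _ (step E hE v1) v2) v3, ?_, ?_⟩
  · intro i j hij
    fin_cases i <;> fin_cases j <;> simp at hij ⊢
    · rw [sy]; exact d12
    · rw [sy]; exact d13
    · exact d12
    · rw [sy]; exact d23
    · exact d13
    · exact d23
  · calc c ^ 3 * volume E = c * (c * (c * volume E)) := by ring
      _ ≤ c * (c * volume E1) := by gcongr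
      _ ≤ c * volume E2 := by gcongr
      _ ≤ _ := e3
  · intro i x hx
    fin_cases i
    · exact hx.1.1.2
    · exact hx.1.2
    · exact hx.2

lemma lev2_arith (L D e e' X n K Z l : ℝ) (hL : 0 < L) (hD : 1 ≤ D * n ^ 3) (hn : 1 ≤ n) (he : 0 ≤ e) (he' : L ^ 3 * e ≤ e') (hX : 0 < X)
    (hl : l = L * K) (hK : 0 < K) (hD0 : 0 < D)
    (h : ((L * D) ^ 2 * e' / (4 * X)) ^ 3 ≤ Z) : e ^ 3 ≤ 64 * K ^ 15 * (n ^ 18 * (l ^ 15)⁻¹ * Z) * X ^ 3 := by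
  have hn0 : 0 < n := by linarith
  have h1 : (L ^ 2 * D ^ 2 * (L ^ 3 * e)) ^ 3 ≤ 64 * X ^ 3 * Z := by
    have e0 : ((L * D) ^ 2 * e' / (4 * X)) ^ 3 = ((L * D) ^ 2 * e') ^ 3 / (64 * X ^ 3) := by rw [div_pow]; ring
    rw [e0, div_le_iff₀ (by positivity)] at h
    calc (L ^ 2 * D ^ 2 * (L ^ 3 * e)) ^ 3 ≤ ((L * D) ^ 2 * e') ^ 3 := by
          rw [mul_pow L D]; gcongr
      _ ≤ _ := by linarith
  have h2 : 1 ≤ D ^ 6 * n ^ 18 := by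
    calc (1:ℝ) ≤ (D * n ^ 3) ^ 6 := one_le_pow₀ hD
      _ = _ := by ring
  have hl0 : 0 < l := by rw [hl]; positivity
  calc e ^ 3 ≤ e ^ 3 * (D ^ 6 * n ^ 18) := le_mul_of_one_le_right (by positivity) h2
    _ = (L ^ 2 * D ^ 2 * (L ^ 3 * e)) ^ 3 * (n ^ 18 * (L ^ 15)⁻¹) := by field_simp
    _ ≤ (64 * X ^ 3 * Z) * (n ^ 18 * (L ^ 15)⁻¹) := by gcongr
    _ = _ := by rw [hl]; field_simp

lemma KN_B1 : ∃ B : ℝ, 1 ≤ B ∧ ∫⁻ z, ‖KN 2 1 z‖ₑ ≤ eR B := by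
  refine ⟨(∫⁻ z, ‖KN 2 1 z‖ₑ).toReal + 1, by linarith [ENNReal.toReal_nonneg (a := ∫⁻ z, ‖KN 2 1 z‖ₑ)], ?_⟩
  calc _ = eR ((∫⁻ z, ‖KN 2 1 z‖ₑ).toReal) := (ENNReal.ofReal_toReal (KN_L1_fin 2).ne).symm
    _ ≤ _ := eR_le (by linarith)

/-- for a set where the arcs are large, the set of points with small kernel mass is small -/
lemma H_small (m : ℕ) (v N : ℝ) (hN : 0 < N) (h : EE 2 → ℂ) (hh : Integrable h) (t : EE 2 → ℝ) (ht : Measurable t)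
    (E H : Set (EE 2)) (hE : volume E ≠ ⊤) (hHm : MeasurableSet H) (hHE : H ⊆ E) (l X e' : ℝ) (hl : 0 < l) (hX : 0 < X) (he' : 0 ≤ e')
    (hhX : ∫⁻ y, ‖h y‖ₑ ^ 2 ≤ eR X)
    (hlow : ∀ x ∈ H, eR l ≤ ‖Farc m N h v (t x) x‖ₑ)
    (hk : ∀ x ∈ H, ∫⁻ y in E, ‖LK m v N (t x) (t y) (x - y)‖ₑ ≤ eR (l ^ 2 * e' / (4 * X))) :
    volume H ≤ eR (e' / 4) := by
  have hHf : volume H ≠ ⊤ := ((measure_mono hHE).trans_lt hE.lt_top).ne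
  have h1 := arc_L2 m v N hN h hh t ht H hHf (eR (l ^ 2 * e' / (4 * X))) (by
    filter_upwards [ae_restrict_mem hHm] with x hx
    exact (lintegral_mono_set hHE).trans (hk x hx))
  have h2 : eR l * volume H ≤ ∫⁻ y in H, ‖Farc m N h v (t y) y‖ₑ := by
    rw [← setLIntegral_const]; exact setLIntegral_mono' hHm hlow
  obtain ⟨c, hc⟩ : ∃ c, c = (volume H).toReal := ⟨_, rfl⟩
  have hc0 : 0 ≤ c := by rw [hc]; exact ENNReal.toReal_nonneg
  have hv : volume H = eR c := by rw [hc, ENNReal.ofReal_toReal hHf]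
  have h3 : (eR l * eR c) ^ 2 ≤ eR (l ^ 2 * e' / (4 * X)) * eR c * eR X := by
    rw [← hv]
    calc _ ≤ (∫⁻ y in H, ‖Farc m N h v (t y) y‖ₑ) ^ 2 := by gcongr
      _ ≤ _ := h1
      _ ≤ _ := by gcongr
  rw [← eR_mul hl.le, ← eR_pow (by positivity), ← eR_mul (by positivity), ← eR_mul (by positivity),
    ENNReal.ofReal_le_ofReal_iff (by positivity)] at h3
  rw [hv]
  apply eR_le
  rcases hc0.eq_or_lt with h0 | h0
  · rw [← h0]; positivity
  · have e1 : l ^ 2 * e' / (4 * X) * c * X = (l ^ 2 * c) * (e' / 4) := by field_simp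
    rw [e1] at h3
    have e2 : (l * c) ^ 2 = (l ^ 2 * c) * c := by ring
    rw [e2] at h3
    exact le_of_mul_le_mul_left h3 (by positivity)

lemma lev2 : ∃ B ≥ (1:ℝ), ∃ K ≥ (0:ℝ), ∀ (n : ℕ) (l b w X : ℝ) (h : EE 2 → ℂ) (t : EE 2 → ℝ) (x0 : EE 2) (E : Set (EE 2)),
    1 ≤ n → 0 < l → l ≤ B → 128 ≤ n * (l / B / 80) ^ 3 → Measurable t → (∀ x, t x ∈ Icc (1:ℝ) 2) →
    0 < b → b ≤ 1 → 1 ≤ w → 2 ≤ (w ^ 2 / b) ^ 2 → rexp (-(2 * n)) ≤ (w ^ 4)⁻¹ →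
    MeasurableSet E → E ⊆ ball x0 (b ^ 2 / 8) → Integrable h → (∀ y, ‖h y‖ₑ ≤ 1) → 0 < X → ∫⁻ y, ‖h y‖ₑ ^ 2 ≤ eR X →
    (∀ x ∈ E, eR l ≤ ‖Tm (mavg 2 ((w ^ 2 / b) ^ 2) (t x)) h x‖ₑ) →
    (volume E) ^ 3 ≤ eR (K * ((n:ℝ) ^ 90 * (l ^ 15)⁻¹ * (b ^ 6 / w)) * X ^ 3) := by
  obtain ⟨B, hB1, hB⟩ := KN_B1
  obtain ⟨K, hK⟩ := core
  refine ⟨B, hB1, 64 * (32 * B) ^ 15 * K, by positivity, ?_⟩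
  intro n l b w X h t x0 E hn hl hlB hn128 ht htI hb hb1 hw hN2 hexp hEm hE hh hh1 hX hhX hlow
  have hB0 : 0 < B := by linarith
  have hn1 : (1:ℝ) ≤ n := by exact_mod_cast hn
  set N := (w ^ 2 / b) ^ 2 with hNd
  have hN : 0 < N := by linarith
  have hEf : volume E ≠ ⊤ := ((measure_mono hE).trans_lt measure_ball_lt_top).ne
  by_cases hE0 : volume E = 0
  · rw [hE0]; simp
  set m := n ^ 3 with hm
  have hm1 : 1 ≤ m := Nat.one_le_pow _ _ hn
  have hcm := cm_ge m hm1
  have hcm0 : 0 < cm m := lt_of_lt_of_le (by positivity) hcm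
  set D := B * cm m with hD
  have hD0 : 0 < D := by positivity
  have hDn : 1 ≤ D * (n:ℝ) ^ 3 := by
    have h1 : 1 ≤ cm m * (n:ℝ) ^ 3 := by
      rw [div_le_iff₀ (by positivity)] at hcm
      rw [hm] at hcm ⊢
      push_cast at hcm; exact hcm
    rw [hD]; nlinarith
  have hgB : ∀ y, ‖gB N h y‖ ≤ B := by
    intro y
    have h0 := gB_bdd N hN h hh 1 hh1 y
    rw [mul_one] at h0
    have := h0.trans hB
    rw [← ofReal_norm_eq_enorm, ENNReal.ofReal_le_ofReal_iff hB0.le] at this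
    exact this
  have hFb : ∀ v t' x, ‖Farc m N h v t' x‖ₑ ≤ eR D := by
    intro v t' x
    rw [← ofReal_norm_eq_enorm]
    exact eR_le (Farc_bdd m N h v t' x B hgB hN hh)
  have hDe0 : eR D ≠ 0 := by simp; exact hD0
  set g : ℝ → EE 2 → ℝ≥0∞ := fun v x => ‖Farc m N h v (t x) x‖ₑ / eR D with hg
  have mF : Measurable (fun p : ℝ × EE 2 => Farc m N h p.1 (t p.2) p.2) :=
    (Farc_cont m N hN h hh).measurable.comp (g := fun p : ℝ × ℝ × EE 2 => Farc m N h p.1 p.2.1 p.2.2) (f := fun p : ℝ × EE 2 => (p.1, t p.2, p.2)) (by fun_prop)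
  have mg : Measurable (uncurry g) := mF.enorm.div_const _
  have hg1 : ∀ v x, g v x ≤ 1 := by
    intro v x
    exact ENNReal.div_le_of_le_mul (by rw [one_mul]; exact hFb v _ x)
  have hint : ∀ x ∈ E, eR (l / B) ≤ ∫⁻ v in Ioc (-rpi) rpi, g v x := by
    intro x hx
    have h1 := Farc_int m N hN h hh (t x) x
    have h2 : ‖(cm m : ℂ) * Tm (mavg 2 N (t x)) h x‖ₑ ≤ ∫⁻ v in Ioc (-rpi) rpi, ‖Farc m N h v (t x) x‖ₑ := by
      rw [← h1, intervalIntegral.integral_of_le (by linarith [rpi_pos])]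
      exact enorm_integral_le_lintegral_enorm _
    have mFx : Measurable (fun v : ℝ => ‖Farc m N h v (t x) x‖ₑ) := by
      exact (mF.comp (measurable_prodMk_right (y := x))).enorm
    simp only [hg, div_eq_mul_inv]
    rw [lintegral_mul_const _ mFx, ← div_eq_mul_inv, ← div_eq_mul_inv]
    rw [ENNReal.le_div_iff_mul_le (Or.inl hDe0) (Or.inl eR_ne_top)]
    refine le_trans ?_ h2
    rw [enorm_mul, ← eR_mul (by positivity)]
    have e1 : l / B * D = cm m * l := by rw [hD]; field_simp
    rw [e1, eR_mul hcm0.le]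
    refine mul_le_mul' (le_of_eq ?_) (hlow x hx)
    rw [← ofReal_norm_eq_enorm, Complex.norm_real, Real.norm_of_nonneg hcm0.le]
  have ha0 : 0 < l / B := by positivity
  obtain ⟨v, hsep, E', hE'E, hE'm, hE'vol, hE'low⟩ := triple g mg hg1 E hEm hE0 hEf (l / B) ha0 hint
  set L := l / B / 32 with hL
  have hL0 : 0 < L := by positivity
  have hE'f : volume E' ≠ ⊤ := ((measure_mono hE'E).trans_lt hEf.lt_top).ne
  obtain ⟨e', he'⟩ : ∃ e', e' = (volume E').toReal := ⟨_, rfl⟩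
  obtain ⟨e, he⟩ : ∃ e, e = (volume E).toReal := ⟨_, rfl⟩
  have ve' : volume E' = eR e' := by rw [he', ENNReal.ofReal_toReal hE'f]
  have ve : volume E = eR e := by rw [he, ENNReal.ofReal_toReal hEf]
  have he'0 : 0 ≤ e' := by rw [he']; exact ENNReal.toReal_nonneg
  have he0 : 0 < e := by rw [he]; exact ENNReal.toReal_pos hE0 hEf
  have hee' : L ^ 3 * e ≤ e' := by
    rw [ve, ve', ← eR_pow hL0.le, ← eR_mul (by positivity), ENNReal.ofReal_le_ofReal_iff he'0] at hE'vol
    exact hE'vol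
  have he'p : 0 < e' := lt_of_lt_of_le (by positivity) hee'
  have hFlow : ∀ i, ∀ x ∈ E', eR (L * D) ≤ ‖Farc m N h (v i) (t x) x‖ₑ := by
    intro i x hx
    have := hE'low i x hx
    simp only [hg] at this
    rw [ENNReal.le_div_iff_mul_le (Or.inl hDe0) (Or.inl eR_ne_top)] at this
    rw [eR_mul hL0.le]; exact this
  set κ := (L * D) ^ 2 * e' / (4 * X) with hκ
  have mI : ∀ i, Measurable (fun x => ∫⁻ y in E', ‖LK m (v i) N (t x) (t y) (x - y)‖ₑ) := by
    intro i
    have h1 : Measurable (fun p : EE 2 × EE 2 => LK m (v i) N (t p.1) (t p.2) (p.1 - p.2)) :=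
      (LK_cont m (v i) N hN).measurable.comp (g := fun p : ℝ × ℝ × EE 2 => LK m (v i) N p.1 p.2.1 p.2.2) (f := fun p : EE 2 × EE 2 => (t p.1, t p.2, p.1 - p.2)) (by fun_prop)
    exact Measurable.lintegral_prod_right (f := fun x y : EE 2 => ‖LK m (v i) N (t x) (t y) (x - y)‖ₑ) h1.enorm
  set H : Fin 3 → Set (EE 2) := fun i => E' ∩ {x | ∫⁻ y in E', ‖LK m (v i) N (t x) (t y) (x - y)‖ₑ ≤ eR κ} with hH
  have hHm : ∀ i, MeasurableSet (H i) := fun i => hE'm.inter (measurableSet_le (mI i) measurable_const)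
  have hHv : ∀ i, volume (H i) ≤ eR (e' / 4) := fun i =>
    H_small m (v i) N hN h hh t ht E' (H i) hE'f (hHm i) inter_subset_left (L * D) X e' (by positivity) hX he'0 hhX
      (fun x hx => hFlow i x hx.1) (fun x hx => hx.2)
  set G := E' \ (⋃ i, H i) with hG
  have hGm : MeasurableSet G := hE'm.diff (MeasurableSet.iUnion hHm)
  have hGv : eR (e' / 4) ≤ volume G := by
    have h1 : volume E' ≤ volume G + eR (3 * (e' / 4)) := by
      calc volume E' ≤ volume (G ∪ ⋃ i, H i) := measure_mono (by rw [hG, diff_union_self]; exact subset_union_left)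
        _ ≤ volume G + volume (⋃ i, H i) := measure_union_le _ _
        _ ≤ volume G + ∑ i, volume (H i) := by gcongr; exact measure_iUnion_fintype_le _ _
        _ ≤ volume G + ∑ i : Fin 3, eR (e' / 4) := by gcongr with i; exact hHv i
        _ = _ := by
          rw [Finset.sum_const, eR_mul (by norm_num)]; simp
    rw [ve', show e' = e' / 4 + 3 * (e' / 4) by ring, eR_add (by positivity) (by positivity)] at h1
    have e3 : eR (3 * ((e' / 4 + 3 * (e' / 4)) / 4)) = eR (3 * (e' / 4)) := by congr 1; ring
    rw [e3] at h1
    exact (ENNReal.add_le_add_iff_right eR_ne_top).mp h1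
  have hG0 : volume G ≠ 0 := by
    refine (lt_of_lt_of_le ?_ hGv).ne'
    rw [ENNReal.ofReal_pos]; positivity
  have hEG : volume E' ≤ 4 * volume G := by
    calc volume E' = 4 * eR (e' / 4) := by
          rw [ve', show (4:ℝ≥0∞) = eR 4 by norm_num, ← eR_mul (by norm_num)]; congr 1; ring
      _ ≤ _ := by gcongr
  have hs1 : l / B / 80 ≤ 1 := by
    rw [div_div, div_le_one (by positivity)]; linarith
  have fin := hK n (l / B / 80) b w v t x0 E' G (eR κ) hn (by positivity) hs1 hn128 hsep ht htI hb hb1 hw hN2 hexp hE'm hGm diff_subset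
    (hE'E.trans hE) hEG hG0 (by
      intro i x hx
      by_contra hcon
      exact hx.2 (mem_iUnion.mpr ⟨i, hx.1, (not_le.mp hcon).le⟩))
  have hκ0 : 0 ≤ κ := by positivity
  rw [← eR_pow hκ0, show (K:ℝ≥0∞) = eR (K:ℝ) from (ENNReal.ofReal_coe_nnreal).symm, ← eR_mul (p := (K:ℝ)) K.2,
    ENNReal.ofReal_le_ofReal_iff (by positivity)] at fin
  rw [ve, ← eR_pow he0.le]
  apply eR_le
  refine (lev2_arith L D e e' X n (32 * B) _ l hL0 hDn hn1 he0.le hee' hX (by rw [hL]; field_simp) (by positivity) hD0 fin).trans (le_of_eq ?_)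
  ring

lemma Tm_joint (d : ℕ) (hd : 1 ≤ d) (N : ℝ) (hN : 0 < N) (h : EE d → ℂ) (hh : Integrable h) :
    Continuous (fun p : ℝ × EE d => Tm (mavg d N p.1) h p.2) := by
  unfold Tm mavg
  have hP := Phi_cont d hd
  have hb := bN_cont d N
  have hf := fourier_cont h hh
  have he := ee_cont
  refine continuous_of_dominated (bound := fun ξ => ‖((bN d N ξ : ℝ) : ℂ)‖ * ∫ y, ‖h y‖) (fun p => ?_) (fun p => ?_) ?_ ?_
  · exact Continuous.aestronglyMeasurable (by fun_prop)
  · refine of_forall fun ξ => ?_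
    rw [norm_mul, norm_mul, norm_mul, ee_norm, one_mul]
    refine mul_le_mul ?_ (fourier_bdd h ξ) (norm_nonneg _) (norm_nonneg _)
    exact mul_le_of_le_one_left (norm_nonneg _) (Phi_bdd d hd _)
  · exact (bN_int d N hN).norm.mul_const _
  · exact of_forall fun ξ => by fun_prop

/-- the localized maximal function at frequency `N` -/
def Mx (d : ℕ) (N : ℝ) (h : EE d → ℂ) (x : EE d) : ℝ≥0∞ := ⨆ (t : ℝ) (_ : t ∈ Ioo (1:ℝ) 2), ‖Tm (mavg d N t) h x‖ₑ

lemma Mx_meas (d : ℕ) (hd : 1 ≤ d) (N : ℝ) (hN : 0 < N) (h : EE d → ℂ) (hh : Integrable h) : Measurable (Mx d N h) := by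
  have hj := Tm_joint d hd N hN h hh
  have : LowerSemicontinuous (Mx d N h) := by
    refine lowerSemicontinuous_biSup fun t _ => Continuous.lowerSemicontinuous ?_
    exact (hj.comp (g := fun p : ℝ × EE d => Tm (mavg d N p.1) h p.2) (f := fun x => (t, x)) (by fun_prop)).enorm
  exact this.measurable

lemma Mx_sup (d : ℕ) (hd : 1 ≤ d) (N : ℝ) (hN : 0 < N) (h : EE d → ℂ) (hh : Integrable h)
    (B : ℝ≥0∞) (hB : ∀ y, ‖h y‖ₑ ≤ B) (x : EE d) : Mx d N h x ≤ (∫⁻ z, ‖KN d 1 z‖ₑ) * B :=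
  iSup₂_le fun t _ => Tt_sup d hd N t hN h hh B hB x

lemma Mx_one (d : ℕ) (hd : 1 ≤ d) : ∃ C : ℝ≥0, ∀ N > (0:ℝ), ∀ h : EE d → ℂ, Integrable h → ∀ x,
    Mx d N h x ≤ C * eR N * ∫⁻ y, ‖h y‖ₑ := by
  obtain ⟨C, hC⟩ := Tt_one d hd
  exact ⟨C, fun N hN h hh x => iSup₂_le fun t ht => hC N hN t ht.1.le h hh x⟩

lemma Mx_L2 (d : ℕ) (hd : 1 ≤ d) : ∃ C : ℝ≥0, ∀ N ≥ (2:ℝ), ∀ r > (0:ℝ), 1 ≤ N * r → ∀ h : EE d → ℂ, Integrable h →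
    ∫⁻ x in ball 0 (3*r), Mx d N h x ^ 2 ≤ C * eR (r * N * N ^ (1 - (d:ℝ))) * ∫⁻ y, ‖h y‖ₑ ^ 2 := by
  obtain ⟨C, hC⟩ := L2max d hd
  refine ⟨C, fun N hN r hr hNr h hh => ?_⟩
  obtain ⟨Z, hZ, h1, h2⟩ := hC N hN r hr hNr h hh
  refine (lintegral_mono fun x => ?_).trans h2
  have h3 : Mx d N h x ≤ Z x ^ (1/2:ℝ) := iSup₂_le fun t ht => by
    have := h1 x t ht
    calc ‖Tm (mavg d N t) h x‖ₑ = (‖Tm (mavg d N t) h x‖ₑ ^ 2) ^ (1/2:ℝ) := by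
          rw [← ENNReal.rpow_natCast, ← ENNReal.rpow_mul]; norm_num
      _ ≤ _ := by gcongr
  calc Mx d N h x ^ 2 ≤ (Z x ^ (1/2:ℝ)) ^ 2 := by gcongr
    _ = Z x := by rw [← ENNReal.rpow_natCast, ← ENNReal.rpow_mul]; norm_num

lemma Tm_add (d : ℕ) (hd : 1 ≤ d) (N t : ℝ) (hN : 0 < N) (f g : EE d → ℂ) (hf : Integrable f) (hg : Integrable g) (x : EE d) :
    Tm (mavg d N t) (fun y => f y + g y) x = Tm (mavg d N t) f x + Tm (mavg d N t) g x := by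
  have hm := mavg_int d hd N t hN
  have hK := Ker_cont _ hm
  have hfg : Integrable (fun y => f y + g y) := hf.add hg
  rw [Tm_ker _ _ hm hfg, Tm_ker _ _ hm hf, Tm_ker _ _ hm hg]
  have ib : ∀ f : EE d → ℂ, Integrable f → Integrable (fun y => Ker (mavg d N t) (x - y) * f y) := by
    intro f hf
    refine hf.bdd_mul (c := ∫ ξ, ‖mavg d N t ξ‖) (Continuous.aestronglyMeasurable (by fun_prop)) (of_forall fun y => ?_)
    exact Ker_bdd _ _
  rw [← integral_add (ib f hf) (ib g hg)]
  congr 1; ext y; ring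

lemma Mx_add (d : ℕ) (hd : 1 ≤ d) (N : ℝ) (hN : 0 < N) (f g : EE d → ℂ) (hf : Integrable f) (hg : Integrable g) (x : EE d) :
    Mx d N (fun y => f y + g y) x ≤ Mx d N f x + Mx d N g x := by
  refine iSup₂_le fun t ht => ?_
  rw [Tm_add d hd N t hN f g hf hg x]
  refine (enorm_add_le _ _).trans (add_le_add ?_ ?_)
  · exact le_iSup₂ (f := fun (t : ℝ) (_ : t ∈ Ioo (1:ℝ) 2) => ‖Tm (mavg d N t) f x‖ₑ) t ht
  · exact le_iSup₂ (f := fun (t : ℝ) (_ : t ∈ Ioo (1:ℝ) 2) => ‖Tm (mavg d N t) g x‖ₑ) t ht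

lemma Mx_smul (d : ℕ) (hd : 1 ≤ d) (N : ℝ) (hN : 0 < N) (f : EE d → ℂ) (hf : Integrable f) (c : ℂ) (x : EE d) :
    Mx d N (fun y => c * f y) x = ‖c‖ₑ * Mx d N f x := by
  unfold Mx
  simp only [ENNReal.mul_iSup]
  congr 1; ext t; congr 1; ext ht
  have hm := mavg_int d hd N t hN
  rw [Tm_ker _ _ hm (hf.const_mul c), Tm_ker _ _ hm hf, ← enorm_mul, ← integral_const_mul]
  congr 2; ext y; ring

/-- measurable selection -/
lemma select (d : ℕ) (hd : 1 ≤ d) (N : ℝ) (hN : 0 < N) (h : EE d → ℂ) (hh : Integrable h) (l : ℝ≥0∞) :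
    ∃ t : EE d → ℝ, Measurable t ∧ (∀ x, t x ∈ Icc (1:ℝ) 2) ∧ ∀ x, l < Mx d N h x → l ≤ ‖Tm (mavg d N (t x)) h x‖ₑ := by
  classical
  have hj := Tm_joint d hd N hN h hh
  haveI : Nonempty (Ioo (1:ℝ) 2) := ⟨⟨3/2, by norm_num, by norm_num⟩⟩
  set e : ℕ → Ioo (1:ℝ) 2 := TopologicalSpace.denseSeq _ with he
  have hE : ∀ x, l < Mx d N h x → ∃ k, l < ‖Tm (mavg d N (e k)) h x‖ₑ := by
    intro x hx
    unfold Mx at hx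
    rw [lt_iSup_iff] at hx
    obtain ⟨t, hx⟩ := hx
    rw [lt_iSup_iff] at hx
    obtain ⟨ht, hx⟩ := hx
    have ho : IsOpen {s : Ioo (1:ℝ) 2 | l < ‖Tm (mavg d N s) h x‖ₑ} := by
      refine isOpen_lt continuous_const ?_
      exact (hj.comp (g := fun p : ℝ × EE d => Tm (mavg d N p.1) h p.2) (f := fun s : Ioo (1:ℝ) 2 => ((s:ℝ), x)) (by fun_prop)).enorm
    obtain ⟨k, hk⟩ := (TopologicalSpace.denseRange_denseSeq (Ioo (1:ℝ) 2)).exists_mem_open ho ⟨⟨t, ht⟩, hx⟩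
    exact ⟨k, hk⟩
  have hp : ∀ x, ∃ k, ¬ (l < Mx d N h x) ∨ l < ‖Tm (mavg d N (e k)) h x‖ₑ := by
    intro x
    by_cases hx : l < Mx d N h x
    · obtain ⟨k, hk⟩ := hE x hx; exact ⟨k, Or.inr hk⟩
    · exact ⟨0, Or.inl hx⟩
  refine ⟨fun x => e (Nat.find (hp x)), ?_, fun x => ⟨(e _).2.1.le, (e _).2.2.le⟩, ?_⟩
  · have hm : Measurable (fun x => Nat.find (hp x)) := by
      refine measurable_find hp fun k => ?_
      have m1 : MeasurableSet {x | ¬ (l < Mx d N h x)} := (measurableSet_lt measurable_const (Mx_meas d hd N hN h hh)).compl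
      have m2 : MeasurableSet {x | l < ‖Tm (mavg d N (e k)) h x‖ₑ} := by
        refine measurableSet_lt measurable_const ?_
        exact (hj.comp (g := fun p : ℝ × EE d => Tm (mavg d N p.1) h p.2) (f := fun x => ((e k : ℝ), x)) (by fun_prop)).measurable.enorm
      exact m1.union m2
    have : Measurable (fun k : ℕ => (e k : ℝ)) := measurable_from_nat
    exact this.comp hm
  · intro x hx
    rcases Nat.find_spec (hp x) with h1 | h1
    · exact absurd hx h1
    · exact h1.le

lemma cheb (d : ℕ) (hd : 1 ≤ d) : ∃ C : ℝ≥0, ∀ N ≥ (2:ℝ), ∀ r > (0:ℝ), 1 ≤ N * r → ∀ h : EE d → ℂ, Integrable h → ∀ l > (0:ℝ),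
    volume (ball 0 (3*r) ∩ {x | eR l < Mx d N h x}) ≤
      C * eR (r ^ ((d:ℝ)-1) * (N * r) ^ (2 - (d:ℝ)) * (l^2)⁻¹) * ∫⁻ y, ‖h y‖ₑ ^ 2 := by
  obtain ⟨C, hC⟩ := Mx_L2 d hd
  refine ⟨C, fun N hN r hr hNr h hh l hl => ?_⟩
  have h1 := hC N hN r hr hNr h hh
  have hm := Mx_meas d hd N (by linarith) h hh
  have e1 : r * N * N ^ (1 - (d:ℝ)) = r ^ ((d:ℝ)-1) * (N * r) ^ (2 - (d:ℝ)) := by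
    have hN0 : 0 < N := by linarith
    rw [Real.mul_rpow hN0.le hr.le]
    have a1 : r = r ^ ((d:ℝ)-1) * r ^ (2-(d:ℝ)) := by
      rw [← Real.rpow_add hr]; ring_nf; simp
    have a2 : N * N ^ (1-(d:ℝ)) = N ^ (2-(d:ℝ)) := by
      nth_rw 1 [← Real.rpow_one N]
      rw [← Real.rpow_add hN0]; ring_nf
    rw [mul_assoc, a2]; nth_rw 1 [a1]; ring
  have h2 := mul_meas_ge_le_lintegral₀ (μ := volume.restrict (ball (0:EE d) (3*r))) (f := fun x => Mx d N h x ^ 2) (hm.pow_const 2).aemeasurable (eR l ^ 2)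
  have h3 : volume (ball 0 (3*r) ∩ {x | eR l < Mx d N h x}) ≤ (volume.restrict (ball (0:EE d) (3*r))) {x | eR l ^ 2 ≤ Mx d N h x ^ 2} := by
    rw [Measure.restrict_apply' measurableSet_ball, inter_comm]
    refine measure_mono (inter_subset_inter_left _ fun x hx => ?_)
    have : eR l < Mx d N h x := hx
    show eR l ^ 2 ≤ Mx d N h x ^ 2
    gcongr
  have hl2 : eR l ^ 2 = eR (l^2) := by rw [eR_pow hl.le]
  have hl0 : 0 < l^2 := by positivity
  rw [e1] at h1
  obtain ⟨e, he⟩ : ∃ e, e = r ^ ((d:ℝ)-1) * (N * r) ^ (2 - (d:ℝ)) := ⟨_, rfl⟩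
  have he0 : 0 ≤ e := by rw [he]; have : 0 ≤ N := by linarith
                         positivity
  rw [← he] at h1 ⊢
  rw [hl2] at h2 h3
  rw [eR_mul (p := e) he0, ENNReal.ofReal_inv_of_pos hl0]
  have h4 := (mul_le_mul_right h3 (eR (l^2))).trans (h2.trans h1)
  have h5 := ENNReal.le_div_iff_mul_le (a := volume (ball 0 (3*r) ∩ {x | eR l < Mx d N h x})) (b := eR (l^2)) (c := C * eR e * ∫⁻ y, ‖h y‖ₑ ^ 2) (Or.inl (by simp [hl.ne']))  (Or.inl eR_ne_top)
  refine (h5.2 (by rw [mul_comm]; exact h4)).trans (le_of_eq ?_)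
  rw [ENNReal.div_eq_inv_mul]; ring

lemma lim_X (A I : ℝ≥0∞) (hI : I ≠ ⊤) (c : ℝ) (hc : 0 ≤ c)
    (h : ∀ X > (0:ℝ), I ≤ eR X → A ≤ eR (c * X)) : A ≤ eR c * I := by
  have h1 : ∀ η > (0:ℝ), A ≤ eR (c * (I.toReal + η)) := by
    intro η hη
    refine h _ (by positivity) ?_
    rw [← ENNReal.ofReal_toReal hI, ENNReal.toReal_ofReal (by positivity)]
    exact eR_le (by linarith)
  have h2 : Filter.Tendsto (fun η : ℝ => eR (c * (I.toReal + η))) (nhdsWithin 0 (Ioi 0)) (nhds (eR (c * (I.toReal + 0)))) := by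
    refine Filter.Tendsto.mono_left ?_ nhdsWithin_le_nhds
    exact (ENNReal.continuous_ofReal.comp (by fun_prop : Continuous fun η : ℝ => c * (I.toReal + η))).tendsto 0
  have h3 := ge_of_tendsto h2 (eventually_mem_nhdsWithin.mono fun η hη => h1 η hη)
  rw [add_zero, eR_mul hc, ENNReal.ofReal_toReal hI] at h3
  exact h3

lemma cover3 (d : ℕ) : ∃ S : Finset (EE d), ∀ r > (0:ℝ), ∀ x ∈ ball (0:EE d) (3*r), ∃ c ∈ S, x ∈ ball (r • c) (r/8) := by
  obtain ⟨t, -, ht, hc⟩ := (isCompact_closedBall (0:EE d) 3).finite_cover_balls (e := 1/8) (by norm_num)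
  refine ⟨ht.toFinset, fun r hr x hx => ?_⟩
  have h1 : r⁻¹ • x ∈ closedBall (0:EE d) 3 := by
    rw [mem_closedBall_zero_iff, norm_smul, Real.norm_of_nonneg (by positivity)]
    rw [mem_ball_zero_iff] at hx
    rw [inv_mul_le_iff₀ hr]; linarith
  obtain ⟨c, hct, hxc⟩ := mem_iUnion₂.1 (hc h1)
  refine ⟨c, by simpa using hct, ?_⟩
  rw [mem_ball, dist_eq_norm] at hxc ⊢
  have : x - r • c = r • (r⁻¹ • x - c) := by rw [smul_sub, smul_inv_smul₀ hr.ne']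
  rw [this, norm_smul, Real.norm_of_nonneg hr.le]
  nlinarith

lemma cube_le (V : ℝ≥0∞) (a : ℝ) (ha : 0 ≤ a) (h : V^3 ≤ eR (a^3)) : V ≤ eR a := by
  rw [eR_pow ha] at h
  exact (ENNReal.pow_le_pow_left_iff (by norm_num)).1 h

set_option maxRecDepth 8000 in
lemma weak2_arith (K K0 q n l r X : ℝ) (hK : 0 ≤ K) (hK0 : 0 ≤ K0) (hq : 1 ≤ q) (hn : 0 ≤ n) (hn2 : n ≤ 2*K0*q^3) (hl : q⁻¹ ≤ l)
    (hr : 0 ≤ r) (hX : 0 ≤ X) :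
    K*(n^90*(l^15)⁻¹*(r^3/q^600))*X^3 ≤ ((K*(2*K0)^90+1) * (r*q⁻¹) * X)^3 := by
  have hM3 : ∀ M : ℝ, 0 ≤ M → M ≤ (M+1)^3 := fun M hM0 => by nlinarith [pow_nonneg hM0 2, pow_nonneg hM0 3]
  have hq0 : 0 < q := by linarith
  have hl0 : 0 < l := lt_of_lt_of_le (by positivity) hl
  have h1 : n^90 ≤ (2*K0)^90*q^270 := by
    calc n^90 ≤ (2*K0*q^3)^90 := by gcongr
      _ = _ := by ring
  have h2 : (l^15)⁻¹ ≤ q^15 := by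
    rw [← inv_pow]; gcongr
    rw [inv_le_comm₀ hl0 hq0]; exact hl
  have h3 : (q^600)⁻¹ * (q^270*q^15) ≤ q⁻¹^3 := by
    rw [inv_mul_le_iff₀ (by positivity), inv_pow, ← div_eq_mul_inv, le_div_iff₀ (by positivity), ← pow_add, ← pow_add]
    exact pow_le_pow_right₀ hq (by norm_num)
  obtain ⟨M, hM⟩ : ∃ M, M = K*(2*K0)^90 := ⟨_, rfl⟩
  have hM0 : 0 ≤ M := by rw [hM]; positivity
  calc K*(n^90*(l^15)⁻¹*(r^3/q^600))*X^3 ≤ K*(((2*K0)^90*q^270)*q^15*(r^3/q^600))*X^3 := by gcongr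
    _ = M * r^3 * X^3 * ((q^600)⁻¹ * (q^270*q^15)) := by
          rw [hM]; generalize q^600 = Q; generalize q^270 = Q2; generalize (2*K0)^90 = Q3; rw [div_eq_mul_inv]; ring
    _ ≤ M * r^3 * X^3 * q⁻¹^3 := by gcongr
    _ ≤ (M+1)^3 * r^3 * X^3 * q⁻¹^3 := by gcongr; exact hM3 M hM0
    _ = _ := by rw [← hM]; generalize M + 1 = M1; ring

lemma fin_L2 (d : ℕ) (h : EE d → ℂ) (hh : Integrable h) (hb : ∀ y, ‖h y‖ₑ ≤ 1) : ∫⁻ y, ‖h y‖ₑ ^ 2 ≠ ⊤ := by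
  refine ne_top_of_le_ne_top hh.2.ne (lintegral_mono fun y => ?_)
  calc ‖h y‖ₑ ^ 2 = ‖h y‖ₑ * ‖h y‖ₑ := sq _
    _ ≤ ‖h y‖ₑ * 1 := by gcongr; exact hb y
    _ = _ := mul_one _

lemma weak2_big : ∃ C : ℝ≥0, ∀ q ≥ (1:ℝ), ∀ r > (0:ℝ), r ≤ 1 → 2 ≤ q^2400 / r → ∀ h : EE 2 → ℂ, Integrable h → (∀ y, ‖h y‖ₑ ≤ 1) →
    2 ≤ q^2400 → ∀ l > (0:ℝ), q⁻¹ ≤ l →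
    volume (ball 0 (3*r) ∩ {x | eR l < Mx 2 (q^2400/r) h x}) ≤ C * eR (r * q⁻¹) * ∫⁻ y, ‖h y‖ₑ ^ 2 := by
  obtain ⟨B, hB, K, hK, hlev⟩ := lev2
  obtain ⟨S, hS⟩ := cover3 2
  obtain ⟨K0, hK0⟩ : ∃ K0, K0 = 128*80^3*B^3 := ⟨_, rfl⟩
  have hB3 : 1 ≤ B^3 := one_le_pow₀ hB
  have hK1 : 1200 ≤ K0 := by rw [hK0]; nlinarith
  obtain ⟨M, hM⟩ : ∃ M, M = K*(2*K0)^90+1 := ⟨_, rfl⟩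
  have hM0 : 0 ≤ M := by rw [hM]; positivity
  refine ⟨S.card * M.toNNReal, fun q hq r hr hr1 hN h hh hb hR l0 hl0 hql0 => ?_⟩
  have hq0 : 0 < q := by linarith
  obtain ⟨l, hl⟩ : ∃ l, l = min l0 B := ⟨_, rfl⟩
  have hql : q⁻¹ ≤ l := by rw [hl]; exact le_min hql0 ((inv_le_one_of_one_le₀ hq).trans hB)
  have hlB : l ≤ B := by rw [hl]; exact min_le_right _ _
  have hll : l ≤ l0 := by rw [hl]; exact min_le_left _ _
  have hl0' : 0 < l := lt_of_lt_of_le (by positivity) hql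
  have hN0 : 0 < q^2400/r := by linarith
  obtain ⟨t, htm, ht, hsel⟩ := select 2 (by norm_num) _ hN0 h hh (eR l)
  obtain ⟨n, hn⟩ : ∃ n, n = ⌈K0*q^3⌉₊ := ⟨_, rfl⟩
  have hn1 : K0*q^3 ≤ n := by rw [hn]; exact Nat.le_ceil _
  have hq3 : 1 ≤ q^3 := one_le_pow₀ hq
  have hn2 : (n:ℝ) ≤ 2*K0*q^3 := by
    have := (Nat.ceil_lt_add_one (a := K0*q^3) (by positivity)).le
    rw [← hn] at this; nlinarith
  have hn1' : 1 ≤ n := by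
    have : (1:ℝ) ≤ n := by nlinarith
    exact_mod_cast this
  have hsq : (√r)^2 = r := Real.sq_sqrt hr.le
  have hs0 : 0 < √r := Real.sqrt_pos.2 hr
  have hNN : ((q^600)^2/√r)^2 = q^2400/r := by
    rw [div_pow, hsq, ← pow_mul, ← pow_mul]
  have hexp : rexp (-(2*n)) ≤ ((q^600)^4)⁻¹ := by
    rw [Real.exp_neg]
    refine inv_anti₀ (by positivity) ?_
    have a1 : q ≤ rexp q := by linarith [Real.add_one_le_exp q]
    calc (q^600)^4 = q^2400 := by rw [← pow_mul]
      _ ≤ (rexp q)^2400 := by gcongr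
      _ = rexp (2400*q) := by rw [← Real.exp_nat_mul]; norm_num
      _ ≤ _ := by
        refine Real.exp_le_exp.2 ?_
        have : q ≤ q^3 := le_self_pow₀ hq (by norm_num)
        nlinarith
  have h128 : 128 ≤ (n:ℝ)*(l/B/80)^3 := by
    have a1 : q⁻¹/B/80 ≤ l/B/80 := by gcongr
    have hB0 : 0 < B := by linarith
    calc (128:ℝ) = (K0*q^3)*(q⁻¹/B/80)^3 := by rw [hK0]; field_simp
      _ ≤ (n:ℝ)*(l/B/80)^3 := by gcongr
  have key : ∀ X > (0:ℝ), ∫⁻ y, ‖h y‖ₑ ^ 2 ≤ eR X → ∀ x0 : EE 2,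
      volume (ball x0 (r/8) ∩ {x | eR l < Mx 2 (q^2400/r) h x}) ≤ eR (M * (r*q⁻¹) * X) := by
    intro X hX hI x0
    have mE : MeasurableSet (ball x0 (r/8) ∩ {x | eR l < Mx 2 (q^2400/r) h x}) :=
      measurableSet_ball.inter (measurableSet_lt measurable_const (Mx_meas 2 (by norm_num) _ hN0 h hh))
    refine cube_le _ _ (by positivity) ?_
    have := hlev n l (√r) (q^600) X h t x0 _ hn1' hl0' hlB h128 htm ht hs0 (Real.sqrt_le_one.2 hr1) (one_le_pow₀ hq)
      (by rw [hNN]; exact hN) hexp mE (by rw [hsq]; exact inter_subset_left) hh hb hX hI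
      (by rw [hNN]; exact fun x hx => hsel x hx.2)
    refine this.trans (eR_le ?_)
    have e6 : √r^6 = r^3 := by rw [← hsq, ← pow_mul, Real.sqrt_sq hs0.le]
    rw [e6, hM]
    exact weak2_arith K K0 q n l r X hK (by linarith) hq (by positivity) hn2 hql hr.le hX.le
  have hfin := fin_L2 2 h hh hb
  have key2 : ∀ x0 : EE 2, volume (ball x0 (r/8) ∩ {x | eR l < Mx 2 (q^2400/r) h x}) ≤ eR (M * (r*q⁻¹)) * ∫⁻ y, ‖h y‖ₑ ^ 2 :=
    fun x0 => lim_X _ _ hfin _ (by positivity) fun X hX hI => key X hX hI x0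
  calc volume (ball 0 (3*r) ∩ {x | eR l0 < Mx 2 (q^2400/r) h x})
      ≤ volume (⋃ c ∈ S, (ball (r • c) (r/8) ∩ {x | eR l < Mx 2 (q^2400/r) h x})) := by
        refine measure_mono fun x hx => ?_
        obtain ⟨c, hc, hxc⟩ := hS r hr x hx.1
        exact mem_iUnion₂.2 ⟨c, hc, hxc, lt_of_le_of_lt (eR_le hll) hx.2⟩
    _ ≤ ∑ c ∈ S, volume (ball (r • c) (r/8) ∩ {x | eR l < Mx 2 (q^2400/r) h x}) := measure_biUnion_finset_le _ _
    _ ≤ ∑ c ∈ S, eR (M * (r*q⁻¹)) * ∫⁻ y, ‖h y‖ₑ ^ 2 := Finset.sum_le_sum fun c _ => key2 _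
    _ = _ := by
      rw [Finset.sum_const, nsmul_eq_mul, eR_mul hM0]
      push_cast
      rw [show ((M.toNNReal:ℝ≥0):ℝ≥0∞) = eR M from rfl]; ring

/-- restricted weak-type estimate with decay -/
lemma weak (d : ℕ) (hd : 2 ≤ d) : ∃ ε > (0:ℝ), ∃ C : ℝ≥0, ∀ N ≥ (2:ℝ), ∀ r > (0:ℝ), r ≤ 1 → 2 ≤ N * r → ∀ h : EE d → ℂ, Integrable h →
    (∀ y, ‖h y‖ₑ ≤ 1) → ∀ l > (0:ℝ),
    volume (ball 0 (3*r) ∩ {x | eR l < Mx d N h x}) ≤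
      C * eR (r ^ ((d:ℝ)-1) * (N * r) ^ (-ε) * (l^3)⁻¹) * ∫⁻ y, ‖h y‖ₑ ^ 2 := by
  obtain ⟨C, hC⟩ := cheb d (by omega)
  obtain ⟨B, hB⟩ : ∃ B, B = (∫⁻ z, ‖KN d 1 z‖ₑ).toReal := ⟨_, rfl⟩
  have hB0 : 0 ≤ B := by rw [hB]; exact ENNReal.toReal_nonneg
  have hBe : eR B = ∫⁻ z, ‖KN d 1 z‖ₑ := by rw [hB, ENNReal.ofReal_toReal (KN_L1_fin d).ne]
  have hemp : ∀ N > (0:ℝ), ∀ r, ∀ h : EE d → ℂ, Integrable h → (∀ y, ‖h y‖ₑ ≤ 1) → ∀ l, B ≤ l →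
      volume (ball 0 (3*r) ∩ {x | eR l < Mx d N h x}) = 0 := by
    intro N hN r h hh hb l hl
    have : ball 0 (3*r) ∩ {x | eR l < Mx d N h x} = ∅ := by
      refine eq_empty_iff_forall_notMem.2 fun x hx => ?_
      have h1 := Mx_sup d (by omega) N hN h hh 1 hb x
      rw [mul_one, ← hBe] at h1
      exact absurd (lt_of_lt_of_le hx.2 (h1.trans (eR_le hl))) (lt_irrefl _)
    rw [this, measure_empty]
  rcases eq_or_lt_of_le hd with hd2 | hd3
  · subst hd2
    obtain ⟨C2, hC2⟩ := weak2_big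
    refine ⟨1/2400, by norm_num, C + C2 * (B^3).toNNReal, fun N hN r hr hr1 hNr h hh hb l hl => ?_⟩
    rcases le_or_gt B l with hlB | hlB
    · rw [hemp N (by linarith) r h hh hb l hlB]; exact zero_le
    obtain ⟨q, hq⟩ : ∃ q, q = (N*r)^(1/2400:ℝ) := ⟨_, rfl⟩
    have hq1 : 1 ≤ q := by rw [hq]; exact Real.one_le_rpow (by linarith) (by norm_num)
    have hq0 : 0 < q := by linarith
    have hqp : q^2400 = N*r := by
      rw [hq, ← Real.rpow_natCast, ← Real.rpow_mul (by linarith)]; norm_num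
    have hqN : q^2400/r = N := by rw [hqp]; field_simp
    have hqi : (N*r)^(-(1/2400:ℝ)) = q⁻¹ := by rw [hq, Real.rpow_neg (by linarith)]
    have e1 : r ^ (((2:ℕ):ℝ)-1) = r := by norm_num
    rw [hqi, e1]
    have hl3 : 0 < l^3 := by positivity
    rcases lt_or_ge l q⁻¹ with h1 | h1
    · refine (hC N hN r hr (by linarith) h hh l hl).trans ?_
      have e2 : (N*r)^(2-((2:ℕ):ℝ)) = 1 := by norm_num
      rw [e1, e2, mul_one]
      refine mul_le_mul' (mul_le_mul' ?_ (eR_le ?_)) le_rfl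
      · exact_mod_cast le_self_add
      · rw [mul_assoc]
        refine mul_le_mul_of_nonneg_left ?_ hr.le
        rw [← div_eq_mul_inv, inv_le_comm₀ (by positivity) (by positivity), inv_div, div_le_iff₀ (by positivity)]
        calc l^3 = l^2*l := by ring
          _ ≤ l^2*q⁻¹ := by gcongr
    · have h2 := hC2 q hq1 r hr hr1 (by rw [hqN]; exact hN) h hh hb (by rw [hqp]; exact hNr) l hl h1
      rw [hqN] at h2
      refine h2.trans (mul_le_mul' ?_ le_rfl)
      calc (C2:ℝ≥0∞) * eR (r*q⁻¹) ≤ C2 * eR (B^3 * (r*q⁻¹*(l^3)⁻¹)) := by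
            refine mul_le_mul' le_rfl (eR_le ?_)
            have : 1 ≤ B^3*(l^3)⁻¹ := by
              rw [← div_eq_mul_inv, one_le_div hl3]; gcongr
            have h0 : 0 < r*q⁻¹ := by positivity
            nlinarith
        _ = ((C2 * (B^3).toNNReal : ℝ≥0):ℝ≥0∞) * eR (r*q⁻¹*(l^3)⁻¹) := by
            rw [eR_mul (by positivity)]; push_cast
            rw [show (((B^3).toNNReal:ℝ≥0):ℝ≥0∞) = eR (B^3) from rfl]; ring
        _ ≤ _ := by gcongr; exact le_add_self
  · have hdR : (3:ℝ) ≤ d := by exact_mod_cast hd3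
    refine ⟨(d:ℝ)-2, by linarith, C * B.toNNReal, fun N hN r hr hr1 hNr h hh hb l hl => ?_⟩
    rcases le_or_gt B l with hlB | hlB
    · rw [hemp N (by linarith) r h hh hb l hlB]; exact zero_le
    refine (hC N hN r hr (by linarith) h hh l hl).trans (mul_le_mul' ?_ le_rfl)
    rw [show -((d:ℝ)-2) = 2-(d:ℝ) by ring]
    obtain ⟨e, he⟩ : ∃ e, e = r ^ ((d:ℝ)-1) * (N * r) ^ (2 - (d:ℝ)) := ⟨_, rfl⟩
    have he0 : 0 ≤ e := by rw [he]; have : 0 ≤ N := by linarith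
                           positivity
    rw [← he]
    calc (C:ℝ≥0∞) * eR (e * (l^2)⁻¹) ≤ C * eR (B * (e*(l^3)⁻¹)) := by
          refine mul_le_mul' le_rfl (eR_le ?_)
          rw [show B*(e*(l^3)⁻¹) = e*(B*(l^3)⁻¹) by ring]
          gcongr
          rw [← div_eq_mul_inv, le_div_iff₀ (by positivity), inv_mul_le_iff₀ (by positivity)]
          calc l^3 = l^2*l := by ring
            _ ≤ l^2*B := by gcongr
      _ = _ := by
          rw [eR_mul hB0]; push_cast
          rw [show ((B.toNNReal:ℝ≥0):ℝ≥0∞) = eR B from rfl]; ring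

lemma layer {d : ℕ} (μ : Measure (EE d)) (F : EE d → ℝ≥0∞) (hF : Measurable F) (hfin : ∀ x, F x ≠ ⊤) (p : ℝ) (hp : 0 < p) :
    ∫⁻ x, F x ^ p ∂μ = eR p * ∫⁻ t in Ioi (0:ℝ), μ {x | eR t < F x} * eR (t ^ (p-1)) := by
  have h := lintegral_rpow_eq_lintegral_meas_lt_mul μ (f := fun x => (F x).toReal) (of_forall fun x => ENNReal.toReal_nonneg)
    hF.ennreal_toReal.aemeasurable hp
  have e1 : ∀ x, eR ((F x).toReal ^ p) = F x ^ p := fun x => by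
    rw [← ENNReal.ofReal_rpow_of_nonneg ENNReal.toReal_nonneg hp.le, ENNReal.ofReal_toReal (hfin x)]
  simp only [e1] at h
  rw [h]; congr 1
  refine setLIntegral_congr_fun measurableSet_Ioi fun t ht => ?_
  congr 2; ext x
  exact (ENNReal.ofReal_lt_iff_lt_toReal (le_of_lt ht) (hfin x)).symm

lemma ton {d : ℕ} (S : Set (ℝ × EE d)) (hS : MeasurableSet S) (G : EE d → ℝ≥0∞) (hG : Measurable G) (w : ℝ → ℝ≥0∞) (hw : Measurable w) :
    ∫⁻ t in Ioi (0:ℝ), (∫⁻ y, S.indicator (fun p => G p.2) (t, y)) * w t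
      = ∫⁻ y, G y * ∫⁻ t in Ioi (0:ℝ), S.indicator (fun p => w p.1) (t, y) := by
  have m1 : Measurable (fun p : ℝ × EE d => S.indicator (fun p => G p.2) p) := (hG.comp measurable_snd).indicator hS
  have m2 : Measurable (fun p : ℝ × EE d => S.indicator (fun p => w p.1) p) := (hw.comp measurable_fst).indicator hS
  have e1 : ∀ t, (∫⁻ y, S.indicator (fun p => G p.2) (t, y)) * w t = ∫⁻ y, S.indicator (fun p => G p.2) (t, y) * w t := fun t =>
    (lintegral_mul_const _ (m1.comp (measurable_const.prodMk measurable_id))).symm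
  simp only [e1]
  rw [lintegral_lintegral_swap (m1.mul (hw.comp measurable_fst)).aemeasurable]
  refine lintegral_congr fun y => ?_
  have m3 : Measurable (fun t : ℝ => S.indicator (fun p => w p.1) (t, y)) := m2.comp (measurable_id.prodMk measurable_const)
  rw [← lintegral_const_mul _ m3]
  refine lintegral_congr fun t => ?_
  by_cases h : (t, y) ∈ S
  · simp [indicator_of_mem h]
  · simp [indicator_of_notMem h]

lemma pow_Ioc (b q : ℝ) (hb : 0 ≤ b) (hq : 0 < q) : ∫⁻ t in Ioc 0 b, eR (t ^ (q-1)) = eR (b^q/q) := by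
  have h1 : IntervalIntegrable (fun t : ℝ => t ^ (q-1)) volume 0 b := intervalIntegral.intervalIntegrable_rpow' (by linarith)
  have h2 := integral_rpow (a := 0) (b := b) (r := q-1) (Or.inl (by linarith))
  rw [intervalIntegral.integral_of_le hb] at h2
  rw [← ofReal_integral_eq_lintegral_ofReal ((intervalIntegrable_iff_integrableOn_Ioc_of_le hb).1 h1), h2]
  · rw [sub_add_cancel, Real.zero_rpow hq.ne', sub_zero]
  · filter_upwards [ae_restrict_mem measurableSet_Ioc] with t ht
    exact Real.rpow_nonneg ht.1.le _

lemma pow_Ioi (b q : ℝ) (hb : 0 < b) (hq : q < 0) : ∫⁻ t in Ioi b, eR (t ^ (q-1)) = eR (b^q/(-q)) := by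
  rw [← ofReal_integral_eq_lintegral_ofReal (integrableOn_Ioi_rpow_of_lt (by linarith) hb), integral_Ioi_rpow_of_lt (by linarith) hb]
  · rw [sub_add_cancel, neg_div, div_neg]
  · filter_upwards [ae_restrict_mem measurableSet_Ioi] with t ht
    exact Real.rpow_nonneg (hb.trans ht).le _

lemma up_int {d : ℕ} (g : EE d → ℂ) (hg : Measurable g) (m : ℕ) (hm : 0 < m) (q a : ℝ) (hq : 0 < q) (ha : 0 < a) :
    ∫⁻ t in Ioi (0:ℝ), (∫⁻ y, {y | a * t < ‖g y‖}.indicator (fun y => ‖g y‖ₑ ^ m) y) * eR (t ^ (q-1))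
      ≤ eR (a ^ (-q) / q) * ∫⁻ y, ‖g y‖ₑ ^ ((m:ℝ) + q) := by
  have hS : MeasurableSet {p : ℝ × EE d | a * p.1 < ‖g p.2‖} :=
    measurableSet_lt (by fun_prop) (hg.comp measurable_snd).norm
  have h := ton _ hS (fun y => ‖g y‖ₑ ^ m) (by fun_prop) (fun t => eR (t ^ (q-1))) (by apply meas_eR.comp; fun_prop)
  refine (le_of_eq h).trans ?_
  rw [← lintegral_const_mul _ (by fun_prop)]
  refine lintegral_mono fun y => ?_
  dsimp only
  have h1 : ∫⁻ t in Ioi (0:ℝ), {p : ℝ × EE d | a * p.1 < ‖g p.2‖}.indicator (fun p => eR (p.1 ^ (q-1))) (t, y)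
      ≤ eR (‖g y‖^q * (a^(-q)/q)) := by
    have : ‖g y‖^q * (a^(-q)/q) = (‖g y‖/a)^q/q := by
      rw [Real.div_rpow (norm_nonneg _) ha.le, Real.rpow_neg ha.le]; field_simp
    rw [this, ← pow_Ioc _ q (by positivity) hq, ← lintegral_indicator measurableSet_Ioi, ← lintegral_indicator measurableSet_Ioc]
    refine lintegral_mono fun t => ?_
    by_cases h0 : 0 < t
    · rw [indicator_of_mem (show t ∈ Ioi (0:ℝ) from h0)]
      by_cases h1 : a * t < ‖g y‖
      · have h2 : t ∈ Ioc 0 (‖g y‖/a) := ⟨h0, by rw [le_div_iff₀ ha]; linarith⟩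
        rw [indicator_of_mem h2, indicator_of_mem (show (t, y) ∈ {p : ℝ × EE d | a * p.1 < ‖g p.2‖} from h1)]
      · rw [indicator_of_notMem (show (t, y) ∉ {p : ℝ × EE d | a * p.1 < ‖g p.2‖} from h1)]; exact zero_le
    · rw [indicator_of_notMem (show t ∉ Ioi (0:ℝ) from h0)]; exact zero_le
  refine (mul_le_mul_right h1 _).trans (le_of_eq ?_)
  rw [eR_mul (by positivity), ← ENNReal.ofReal_rpow_of_nonneg (norm_nonneg _) hq.le, ofReal_norm_eq_enorm,
    ENNReal.rpow_add_of_nonneg _ _ (by positivity) hq.le, ENNReal.rpow_natCast]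
  ring

lemma lo_int {d : ℕ} (g : EE d → ℂ) (hg : Measurable g) (q a : ℝ) (hq : q < 0) (ha : 0 < a) :
    ∫⁻ t in Ioi (0:ℝ), (∫⁻ y, {y | ‖g y‖ ≤ a * t}.indicator (fun y => ‖g y‖ₑ ^ 2) y) * eR (t ^ (q-1))
      ≤ eR (a ^ (-q) / (-q)) * ∫⁻ y, ‖g y‖ₑ ^ (2 + q) := by
  have hS : MeasurableSet {p : ℝ × EE d | ‖g p.2‖ ≤ a * p.1} :=
    measurableSet_le (hg.comp measurable_snd).norm (by fun_prop)
  have h := ton _ hS (fun y => ‖g y‖ₑ ^ 2) (by fun_prop) (fun t => eR (t ^ (q-1))) (by apply meas_eR.comp; fun_prop)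
  refine (le_of_eq h).trans ?_
  rw [← lintegral_const_mul _ (by fun_prop)]
  refine lintegral_mono fun y => ?_
  dsimp only
  by_cases hy : g y = 0
  · simp [hy]
  have hy0 : 0 < ‖g y‖ := norm_pos_iff.2 hy
  have h1 : ∫⁻ t in Ioi (0:ℝ), {p : ℝ × EE d | ‖g p.2‖ ≤ a * p.1}.indicator (fun p => eR (p.1 ^ (q-1))) (t, y)
      ≤ eR (‖g y‖^q * (a^(-q)/(-q))) := by
    have : ‖g y‖^q * (a^(-q)/(-q)) = (‖g y‖/a)^q/(-q) := by
      rw [Real.div_rpow (norm_nonneg _) ha.le, Real.rpow_neg ha.le]; field_simp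
    rw [this, ← pow_Ioi _ q (by positivity) hq, ← setLIntegral_congr (Ioi_ae_eq_Ici (μ := volume) (a := ‖g y‖/a)).symm,
      ← lintegral_indicator measurableSet_Ioi, ← lintegral_indicator measurableSet_Ici]
    refine lintegral_mono fun t => ?_
    by_cases h0 : 0 < t
    · rw [indicator_of_mem (show t ∈ Ioi (0:ℝ) from h0)]
      by_cases h1 : ‖g y‖ ≤ a * t
      · have h2 : t ∈ Ici (‖g y‖/a) := by
          rw [mem_Ici, div_le_iff₀ ha]; linarith
        rw [indicator_of_mem h2, indicator_of_mem (show (t, y) ∈ {p : ℝ × EE d | ‖g p.2‖ ≤ a * p.1} from h1)]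
      · rw [indicator_of_notMem (show (t, y) ∉ {p : ℝ × EE d | ‖g p.2‖ ≤ a * p.1} from h1)]; exact zero_le
    · rw [indicator_of_notMem (show t ∉ Ioi (0:ℝ) from h0)]; exact zero_le
  refine (mul_le_mul_right h1 _).trans (le_of_eq ?_)
  rw [eR_mul (by positivity), ← ENNReal.ofReal_rpow_of_pos hy0, ofReal_norm_eq_enorm,
    ENNReal.rpow_add _ _ (by simpa using hy) (by simp)]
  rw [show (2:ℝ) = ((2:ℕ):ℝ) by norm_num, ENNReal.rpow_natCast]
  ring

lemma enorm_ind {d : ℕ} (S : Set (EE d)) (g : EE d → ℂ) (m : ℕ) (hm : m ≠ 0) (y : EE d) :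
    ‖S.indicator g y‖ₑ ^ m = S.indicator (fun y => ‖g y‖ₑ ^ m) y := by
  by_cases h : y ∈ S
  · simp [indicator_of_mem h]
  · simp [indicator_of_notMem h, hm]

/-- distribution estimate, `p < 2` -/
lemma dist_lo (d : ℕ) (hd : 2 ≤ d) : ∃ C : ℝ≥0, ∀ N ≥ (2:ℝ), ∀ r > (0:ℝ), 2 ≤ N * r → ∀ g : EE d → ℂ, Integrable g → Measurable g →
    ∀ γ > (0:ℝ), ∀ t > (0:ℝ),
    volume (ball 0 (3*r) ∩ {x | eR t < Mx d N g x}) ≤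
      C * eR (r ^ ((d:ℝ)-1) * (N * r) ^ (2 - (d:ℝ)) * (t^2)⁻¹) * (∫⁻ y, {y | ‖g y‖ ≤ γ * t}.indicator (fun y => ‖g y‖ₑ ^ 2) y)
      + C * eR (r ^ ((d:ℝ)-1) * (N * r) * t⁻¹) * (∫⁻ y, {y | γ * t < ‖g y‖}.indicator (fun y => ‖g y‖ₑ ^ 1) y) := by
  have hd1 : 1 ≤ d := by omega
  obtain ⟨C1, hC1⟩ := cheb d hd1
  obtain ⟨C2, hC2⟩ := Mx_one d hd1
  obtain ⟨V, hV⟩ : ∃ V, V = volume (ball (0:EE d) 3) := ⟨_, rfl⟩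
  have hVf : V ≠ ⊤ := by rw [hV]; exact measure_ball_lt_top.ne
  refine ⟨4*C1 + 2*C2*V.toNNReal, fun N hN r hr hNr g hg hgm γ hγ t ht => ?_⟩
  have hN0 : 0 < N := by linarith
  have mL : MeasurableSet {y | ‖g y‖ ≤ γ * t} := measurableSet_le hgm.norm measurable_const
  have mH : MeasurableSet {y | γ * t < ‖g y‖} := measurableSet_lt measurable_const hgm.norm
  have iL : Integrable (fun y => {y | ‖g y‖ ≤ γ * t}.indicator g y) := hg.indicator mL
  have iH : Integrable (fun y => {y | γ * t < ‖g y‖}.indicator g y) := hg.indicator mH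
  have hsum : g = fun y => {y | ‖g y‖ ≤ γ * t}.indicator g y + {y | γ * t < ‖g y‖}.indicator g y := by
    funext y
    by_cases h : ‖g y‖ ≤ γ * t
    · rw [indicator_of_mem (show y ∈ {y | ‖g y‖ ≤ γ * t} from h), indicator_of_notMem (show y ∉ {y | γ * t < ‖g y‖} from not_lt.2 h), add_zero]
    · rw [indicator_of_notMem (show y ∉ {y | ‖g y‖ ≤ γ * t} from h), indicator_of_mem (show y ∈ {y | γ * t < ‖g y‖} from not_le.1 h), zero_add]
  have hadd : ∀ x, Mx d N g x ≤ _ := fun x => (le_of_eq (congrFun (congrArg (Mx d N) hsum) x)).trans (Mx_add d hd1 N hN0 _ _ iL iH x)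
  have hsub : ball 0 (3*r) ∩ {x | eR t < Mx d N g x} ⊆
      (ball 0 (3*r) ∩ {x | eR (t/2) < Mx d N (fun y => {y | ‖g y‖ ≤ γ * t}.indicator g y) x}) ∪
      (ball 0 (3*r) ∩ {x | eR (t/2) < Mx d N (fun y => {y | γ * t < ‖g y‖}.indicator g y) x}) := by
    intro x hx
    by_contra hc
    rw [← inter_union_distrib_left] at hc
    have h1 : ¬ (x ∈ _ ∪ _) := fun h => hc ⟨hx.1, h⟩
    simp only [mem_union, mem_setOf_eq, not_or] at h1
    have h2 := add_le_add (not_lt.1 h1.1) (not_lt.1 h1.2)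
    rw [← eR_add (by positivity) (by positivity), add_halves] at h2
    exact absurd (lt_of_lt_of_le hx.2 ((hadd x).trans h2)) (lt_irrefl _)
  refine (measure_mono hsub).trans ((measure_union_le _ _).trans (add_le_add ?_ ?_))
  · refine (hC1 N hN r hr (by linarith) _ iL (t/2) (by positivity)).trans ?_
    simp only [enorm_ind _ g 2 (by norm_num)]
    refine mul_le_mul' ?_ le_rfl
    rw [show r ^ ((d:ℝ)-1) * (N * r) ^ (2 - (d:ℝ)) * ((t/2)^2)⁻¹ = 4 * (r ^ ((d:ℝ)-1) * (N * r) ^ (2 - (d:ℝ)) * (t^2)⁻¹) by field_simp; norm_num,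
      eR_mul (by norm_num), ← mul_assoc]
    refine mul_le_mul' ?_ le_rfl
    push_cast
    rw [mul_comm, show eR 4 = 4 by norm_num]
    exact le_self_add
  · have e0 : ∫⁻ y, {y | γ * t < ‖g y‖}.indicator (fun y => ‖g y‖ₑ ^ 1) y = ∫⁻ y, ‖{y | γ * t < ‖g y‖}.indicator g y‖ₑ :=
      lintegral_congr fun y => by rw [← enorm_ind _ g 1 (by norm_num), pow_one]
    rw [e0]
    obtain ⟨J, hJ⟩ : ∃ J, J = ∫⁻ y, ‖{y | γ * t < ‖g y‖}.indicator g y‖ₑ := ⟨_, rfl⟩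
    rw [← hJ]
    by_cases hE : eR (t/2) ≤ C2 * eR N * J
    · have h1 : volume (ball (0:EE d) (3*r)) = eR (r^d) * V := by
        rw [hV, mul_comm 3 r, Measure.addHaar_ball_mul_of_pos _ _ hr]
        simp
      have h2 : (1:ℝ≥0∞) ≤ eR (2*t⁻¹) * (C2 * eR N * J) := by
        calc (1:ℝ≥0∞) = eR (2*t⁻¹) * eR (t/2) := by
              rw [← eR_mul (by positivity), ← ENNReal.ofReal_one]; congr 1; field_simp
          _ ≤ _ := mul_le_mul_right hE _
      calc _ ≤ volume (ball (0:EE d) (3*r)) := measure_mono inter_subset_left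
        _ = eR (r^d) * V * 1 := by rw [h1, mul_one]
        _ ≤ eR (r^d) * V * (eR (2*t⁻¹) * (C2 * eR N * J)) := mul_le_mul_right h2 _
        _ = (2 * C2 * V) * eR (r^((d:ℝ)-1) * (N*r) * t⁻¹) * J := by
          have e1 : r^((d:ℝ)-1) * (N*r) * t⁻¹ = r^d * t⁻¹ * N := by
            have : r^((d:ℝ)-1) * r = r^d := by
              nth_rw 2 [← Real.rpow_one r]
              rw [← Real.rpow_add hr, sub_add_cancel, Real.rpow_natCast]
            rw [← this]; ring
          rw [e1, eR_mul (p := r^d * t⁻¹) (by positivity), eR_mul (p := r^d) (by positivity), eR_mul (p := 2) (by positivity),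
            show eR 2 = 2 by norm_num]
          ring
        _ ≤ _ := by
          refine mul_le_mul' (mul_le_mul' ?_ le_rfl) le_rfl
          push_cast
          rw [ENNReal.coe_toNNReal hVf]
          exact le_add_self
    · have : ball 0 (3*r) ∩ {x | eR (t/2) < Mx d N (fun y => {y | γ * t < ‖g y‖}.indicator g y) x} = ∅ := by
        refine eq_empty_iff_forall_notMem.2 fun x hx => hE ?_
        rw [hJ]
        exact hx.2.le.trans (hC2 N hN0 _ iH x)
      rw [this, measure_empty]; exact zero_le

/-- rescaled form of `weak` -/
lemma weak_scaled (d : ℕ) (hd : 2 ≤ d) : ∃ ε > (0:ℝ), ∃ C : ℝ≥0, ∀ N ≥ (2:ℝ), ∀ r > (0:ℝ), r ≤ 1 → 2 ≤ N * r → ∀ h : EE d → ℂ, Integrable h →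
    ∀ t > (0:ℝ), ∀ γ > (0:ℝ), (∀ y, ‖h y‖ ≤ γ * t) →
    volume (ball 0 (3*r) ∩ {x | eR (t/3) < Mx d N h x}) ≤
      C * eR (r ^ ((d:ℝ)-1) * (N * r) ^ (-ε) * γ * (t^2)⁻¹) * ∫⁻ y, ‖h y‖ₑ ^ 2 := by
  obtain ⟨ε, hε, C, hC⟩ := weak d hd
  refine ⟨ε, hε, C * 27, fun N hN r hr hr1 hNr h hh t ht γ hγ hb => ?_⟩
  have hc0 : 0 < (γ*t)⁻¹ := by positivity
  have hce : ‖(((γ*t)⁻¹:ℝ):ℂ)‖ₑ = eR ((γ*t)⁻¹) := by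
    rw [← ofReal_norm_eq_enorm, Complex.norm_real, Real.norm_of_nonneg hc0.le]
  have h1 := hC N hN r hr hr1 hNr (fun y => (((γ*t)⁻¹:ℝ):ℂ) * h y) (hh.const_mul _) (fun y => by
    rw [enorm_mul, hce, ← ofReal_norm_eq_enorm, ← eR_mul hc0.le, ← ENNReal.ofReal_one]
    refine eR_le ?_
    rw [inv_mul_le_iff₀ (by positivity), mul_one]; exact hb y) ((3*γ)⁻¹) (by positivity)
  have h2 : volume (ball 0 (3*r) ∩ {x | eR (t/3) < Mx d N h x}) ≤
      volume (ball 0 (3*r) ∩ {x | eR ((3*γ)⁻¹) < Mx d N (fun y => (((γ*t)⁻¹:ℝ):ℂ) * h y) x}) := by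
    refine measure_mono (inter_subset_inter_right _ fun x hx => ?_)
    rw [mem_setOf_eq] at hx ⊢
    rw [Mx_smul d (by omega) N (by linarith) h hh, hce, show (3*γ)⁻¹ = (γ*t)⁻¹*(t/3) by field_simp, eR_mul hc0.le]
    exact ENNReal.mul_lt_mul_right (by simpa using hc0) eR_ne_top hx
  refine (h2.trans h1).trans (le_of_eq ?_)
  have h3 : ∀ y, ‖(((γ*t)⁻¹:ℝ):ℂ) * h y‖ₑ ^ 2 = eR ((γ*t)⁻¹^2) * ‖h y‖ₑ ^ 2 := fun y => by
    rw [enorm_mul, hce, mul_pow, ← eR_pow hc0.le]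
  simp only [h3]
  rw [lintegral_const_mul' _ _ eR_ne_top]
  obtain ⟨e, he⟩ : ∃ e, e = r ^ ((d:ℝ)-1) * (N * r) ^ (-ε) := ⟨_, rfl⟩
  have he0 : 0 ≤ e := by rw [he]; have : 0 ≤ N := by linarith
                         positivity
  rw [← he, ← mul_assoc]
  congr 1
  push_cast
  rw [mul_assoc, mul_assoc, ← eR_mul (by positivity), show (27:ℝ≥0∞) = eR 27 by norm_num,
    ← eR_mul (by norm_num)]
  congr 2
  field_simp; norm_num

/-- distribution estimate, `p > 2` -/
lemma dist_hi (d : ℕ) (hd : 2 ≤ d) : ∃ ε > (0:ℝ), ∃ c0 > (0:ℝ), ∃ C : ℝ≥0, ∀ N ≥ (2:ℝ), ∀ r > (0:ℝ), r ≤ 1 → 2 ≤ N * r →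
    ∀ g : EE d → ℂ, Integrable g → Measurable g → ∀ γ > (0:ℝ), ∀ t > (0:ℝ),
    volume (ball 0 (3*r) ∩ {x | eR t < Mx d N g x}) ≤
      C * eR (r ^ ((d:ℝ)-1) * (N * r) ^ (-ε) * γ * (t^2)⁻¹) * (∫⁻ y, {y | c0 * t < ‖g y‖}.indicator (fun y => ‖g y‖ₑ ^ 2) y)
      + C * eR (r ^ ((d:ℝ)-1) * (t^2)⁻¹) * (∫⁻ y, {y | γ * t < ‖g y‖}.indicator (fun y => ‖g y‖ₑ ^ 2) y) := by
  have hd1 : 1 ≤ d := by omega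
  obtain ⟨C1, hC1⟩ := cheb d hd1
  obtain ⟨ε, hε, C2, hC2⟩ := weak_scaled d hd
  obtain ⟨B, hB⟩ : ∃ B, B = (∫⁻ z, ‖KN d 1 z‖ₑ).toReal := ⟨_, rfl⟩
  have hB0 : 0 ≤ B := by rw [hB]; exact ENNReal.toReal_nonneg
  have hBe : eR B = ∫⁻ z, ‖KN d 1 z‖ₑ := by rw [hB, ENNReal.ofReal_toReal (KN_L1_fin d).ne]
  refine ⟨ε, hε, (3*(B+1))⁻¹, by positivity, 9*C1 + C2, fun N hN r hr hr1 hNr g hg hgm γ hγ t ht => ?_⟩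
  obtain ⟨c0, hc0⟩ : ∃ c0, c0 = (3*(B+1))⁻¹ := ⟨_, rfl⟩
  rw [← hc0]
  have hc0p : 0 < c0 := by rw [hc0]; positivity
  have hBc : B * c0 ≤ 1/3 := by rw [hc0, ← div_eq_mul_inv, div_le_iff₀ (by positivity)]; linarith
  have hN0 : 0 < N := by linarith
  obtain ⟨S1, hS1⟩ : ∃ S, S = {y | ‖g y‖ ≤ c0 * t ∧ ‖g y‖ ≤ γ * t} := ⟨_, rfl⟩
  obtain ⟨S2, hS2⟩ : ∃ S, S = {y | c0 * t < ‖g y‖ ∧ ‖g y‖ ≤ γ * t} := ⟨_, rfl⟩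
  obtain ⟨S3, hS3⟩ : ∃ S, S = {y | γ * t < ‖g y‖} := ⟨_, rfl⟩
  have ma : MeasurableSet {y | ‖g y‖ ≤ γ * t} := measurableSet_le hgm.norm measurable_const
  have m1 : MeasurableSet S1 := by rw [hS1]; exact (measurableSet_le hgm.norm measurable_const).inter ma
  have m2 : MeasurableSet S2 := by rw [hS2]; exact (measurableSet_lt measurable_const hgm.norm).inter ma
  have m3 : MeasurableSet S3 := by rw [hS3]; exact measurableSet_lt measurable_const hgm.norm
  have i1 : Integrable (fun y => S1.indicator g y) := hg.indicator m1
  have i2 : Integrable (fun y => S2.indicator g y) := hg.indicator m2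
  have i3 : Integrable (fun y => S3.indicator g y) := hg.indicator m3
  have i23 : Integrable (fun y => S2.indicator g y + S3.indicator g y) := i2.add i3
  have hsum : g = fun y => S1.indicator g y + (S2.indicator g y + S3.indicator g y) := by
    funext y
    simp only [hS1, hS2, hS3, indicator, mem_setOf_eq]
    rcases le_or_gt ‖g y‖ (γ*t) with h | h <;> rcases le_or_gt ‖g y‖ (c0*t) with h' | h'
    · simp [h, h', not_lt.2 h, not_lt.2 h']
    · simp [h, h', not_lt.2 h, not_le.2 h']
    · simp [h, not_le.2 h]
    · simp [h, not_le.2 h]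
  have hadd : ∀ x, Mx d N g x ≤ Mx d N (fun y => S1.indicator g y) x + (Mx d N (fun y => S2.indicator g y) x + Mx d N (fun y => S3.indicator g y) x) :=
    fun x => (le_of_eq (congrFun (congrArg (Mx d N) hsum) x)).trans ((Mx_add d hd1 N hN0 _ _ i1 i23 x).trans
      (add_le_add le_rfl (Mx_add d hd1 N hN0 _ _ i2 i3 x)))
  have hlow : ∀ x, Mx d N (fun y => S1.indicator g y) x ≤ eR (t/3) := fun x => by
    refine (Mx_sup d hd1 N hN0 _ i1 (eR (c0*t)) (fun y => ?_) x).trans ?_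
    · rw [← ofReal_norm_eq_enorm]
      refine eR_le ?_
      by_cases h : y ∈ S1
      · rw [indicator_of_mem h]; rw [hS1] at h; exact h.1
      · rw [indicator_of_notMem h, norm_zero]; positivity
    · rw [← hBe, ← eR_mul hB0]
      refine eR_le ?_
      nlinarith
  have hsub : ball 0 (3*r) ∩ {x | eR t < Mx d N g x} ⊆
      (ball 0 (3*r) ∩ {x | eR (t/3) < Mx d N (fun y => S2.indicator g y) x}) ∪
      (ball 0 (3*r) ∩ {x | eR (t/3) < Mx d N (fun y => S3.indicator g y) x}) := by
    intro x hx
    by_contra hc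
    rw [← inter_union_distrib_left] at hc
    have h1 : ¬ (x ∈ _ ∪ _) := fun h => hc ⟨hx.1, h⟩
    simp only [mem_union, mem_setOf_eq, not_or] at h1
    have h2 := add_le_add (hlow x) (add_le_add (not_lt.1 h1.1) (not_lt.1 h1.2))
    rw [← eR_add (by positivity) (by positivity), ← eR_add (by positivity) (by positivity),
      show t/3+(t/3+t/3) = t by ring] at h2
    exact absurd (lt_of_lt_of_le hx.2 ((hadd x).trans h2)) (lt_irrefl _)
  refine (measure_mono hsub).trans ((measure_union_le _ _).trans (add_le_add ?_ ?_))
  · refine (hC2 N hN r hr hr1 hNr _ i2 t ht γ hγ fun y => ?_).trans ?_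
    · by_cases h : y ∈ S2
      · rw [indicator_of_mem h]; rw [hS2] at h; exact h.2
      · rw [indicator_of_notMem h, norm_zero]; positivity
    refine mul_le_mul' (mul_le_mul' (by push_cast; exact le_add_self) le_rfl) (lintegral_mono fun y => ?_)
    dsimp only
    rw [enorm_ind _ g 2 (by norm_num)]
    refine indicator_le_indicator_of_subset ?_ (fun _ => zero_le) y
    rw [hS2]; exact fun y hy => hy.1
  · refine (hC1 N hN r hr (by linarith) _ i3 (t/3) (by positivity)).trans ?_
    simp only [enorm_ind _ g 2 (by norm_num)]
    rw [← hS3]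
    refine mul_le_mul' ?_ le_rfl
    have hR : (N*r)^(2-(d:ℝ)) ≤ 1 := by
      have : (2:ℝ) ≤ d := by exact_mod_cast hd
      exact Real.rpow_le_one_of_one_le_of_nonpos (by linarith) (by linarith)
    calc (C1:ℝ≥0∞) * eR (r ^ ((d:ℝ)-1) * (N * r) ^ (2 - (d:ℝ)) * ((t/3)^2)⁻¹)
        ≤ C1 * eR (9 * (r ^ ((d:ℝ)-1) * (t^2)⁻¹)) := by
          refine mul_le_mul' le_rfl (eR_le ?_)
          calc r ^ ((d:ℝ)-1) * (N * r) ^ (2 - (d:ℝ)) * ((t/3)^2)⁻¹ ≤ r ^ ((d:ℝ)-1) * 1 * ((t/3)^2)⁻¹ := by gcongr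
            _ = _ := by field_simp; norm_num
      _ = (9 * C1) * eR (r ^ ((d:ℝ)-1) * (t^2)⁻¹) := by
          rw [eR_mul (by norm_num), show eR 9 = 9 by norm_num]; ring
      _ ≤ _ := by
          refine mul_le_mul' ?_ le_rfl
          push_cast; exact le_self_add

lemma Mx_fin (d : ℕ) (hd : 1 ≤ d) (N : ℝ) (hN : 0 < N) (h : EE d → ℂ) (hh : Integrable h) (x : EE d) : Mx d N h x ≠ ⊤ := by
  obtain ⟨C, hC⟩ := Mx_one d hd
  refine ne_top_of_le_ne_top ?_ (hC N hN h hh x)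
  exact ENNReal.mul_ne_top (ENNReal.mul_ne_top ENNReal.coe_ne_top eR_ne_top) hh.2.ne

/-- integrating the weight of one piece -/
lemma piece {U : ℝ → ℝ≥0∞} (C : ℝ≥0) (s p q : ℝ) (m : ℕ) (hs : 0 ≤ s) (hq : p - 1 - m = q - 1) (I : ℝ≥0∞)
    (hI : ∫⁻ t in Ioi (0:ℝ), U t * eR (t ^ (q-1)) ≤ I) :
    ∫⁻ t in Ioi (0:ℝ), (C * eR (s * (t^m)⁻¹) * U t) * eR (t ^ (p-1)) ≤ C * eR s * I := by
  refine le_trans (le_of_eq ?_) (mul_le_mul_right hI _)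
  rw [← lintegral_const_mul' _ _ (ENNReal.mul_ne_top ENNReal.coe_ne_top eR_ne_top)]
  refine setLIntegral_congr_fun measurableSet_Ioi fun t ht => ?_
  have ht0 : (0:ℝ) < t := ht
  rw [← hq, Real.rpow_sub ht0 (p-1) m, Real.rpow_natCast, div_eq_mul_inv, eR_mul hs, eR_mul (by positivity)]
  ring

lemma meas_ind_int {d : ℕ} (g : EE d → ℂ) (hg : Measurable g) (a : ℝ) (m : ℕ) :
    Measurable fun t : ℝ => ∫⁻ y, {y | a * t < ‖g y‖}.indicator (fun y => ‖g y‖ₑ ^ m) y := by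
  have hS : MeasurableSet {p : ℝ × EE d | a * p.1 < ‖g p.2‖} :=
    measurableSet_lt (by fun_prop) (hg.comp measurable_snd).norm
  have : Measurable (fun p : ℝ × EE d => {p : ℝ × EE d | a * p.1 < ‖g p.2‖}.indicator (fun p => ‖g p.2‖ₑ ^ m) p) :=
    ((hg.comp measurable_snd).enorm.pow_const m).indicator hS
  exact this.lintegral_prod_right'

/-- combining two pieces -/
lemma two_pieces {d : ℕ} (g : EE d → ℂ) (hg : Measurable g) (F : EE d → ℝ≥0∞) (hF : Measurable F) (hfin : ∀ x, F x ≠ ⊤) (S : Set (EE d)) (hS : MeasurableSet S)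
    (p : ℝ) (hp : 0 < p) (C : ℝ≥0) (U1 : ℝ → ℝ≥0∞) (a2 : ℝ) (m1 m2 : ℕ) (s1 s2 q1 q2 : ℝ) (hs1 : 0 ≤ s1) (hs2 : 0 ≤ s2)
    (hq1 : p - 1 - m1 = q1 - 1) (hq2 : p - 1 - m2 = q2 - 1) (c1 c2 J : ℝ≥0∞)
    (h1 : ∫⁻ t in Ioi (0:ℝ), U1 t * eR (t ^ (q1-1)) ≤ c1 * J)
    (h2 : ∫⁻ t in Ioi (0:ℝ), (∫⁻ y, {y | a2 * t < ‖g y‖}.indicator (fun y => ‖g y‖ₑ ^ m2) y) * eR (t ^ (q2-1)) ≤ c2 * J)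
    (h : ∀ t > (0:ℝ), volume (S ∩ {x | eR t < F x}) ≤ C * eR (s1 * (t^m1)⁻¹) * U1 t
      + C * eR (s2 * (t^m2)⁻¹) * (∫⁻ y, {y | a2 * t < ‖g y‖}.indicator (fun y => ‖g y‖ₑ ^ m2) y)) :
    ∫⁻ x in S, F x ^ p ≤ eR p * (C * (eR s1 * c1 + eR s2 * c2)) * J := by
  rw [layer _ F hF hfin p hp, mul_assoc]
  refine mul_le_mul_right ?_ _
  calc ∫⁻ t in Ioi (0:ℝ), (volume.restrict S) {x | eR t < F x} * eR (t ^ (p-1))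
      ≤ ∫⁻ t in Ioi (0:ℝ), ((C * eR (s1 * (t^m1)⁻¹) * U1 t) * eR (t ^ (p-1))
        + (C * eR (s2 * (t^m2)⁻¹) * (∫⁻ y, {y | a2 * t < ‖g y‖}.indicator (fun y => ‖g y‖ₑ ^ m2) y)) * eR (t ^ (p-1))) := by
        refine setLIntegral_mono' measurableSet_Ioi fun t ht => ?_
        rw [Measure.restrict_apply' hS, inter_comm, ← add_mul]
        exact mul_le_mul_left (h t ht) _
    _ = _ := by
        refine lintegral_add_right _ ?_
        have e1 : Measurable (fun t : ℝ => (C:ℝ≥0∞) * eR (s2 * (t^m2)⁻¹)) := by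
          refine Measurable.const_mul (meas_eR.comp ?_) _
          exact Measurable.const_mul (Measurable.inv (by fun_prop)) _
        exact (e1.mul (meas_ind_int g hg a2 m2)).mul (meas_eR.comp (by fun_prop))
    _ ≤ C * eR s1 * (c1*J) + C * eR s2 * (c2*J) :=
        add_le_add (piece C s1 p q1 m1 hs1 hq1 _ h1) (piece C s2 p q2 m2 hs2 hq2 _ h2)
    _ = _ := by ring

lemma comb (p : ℝ) (C : ℝ≥0) (s1 s2 c1 c2 A e : ℝ) (J : ℝ≥0∞) (hs1 : 0 ≤ s1) (hs2 : 0 ≤ s2) (hc1 : 0 ≤ c1) (hc2 : 0 ≤ c2) (hA : 0 ≤ A)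
    (h : s1*c1+s2*c2 ≤ A * e) :
    eR p * (C * (eR s1 * eR c1 + eR s2 * eR c2)) * J
      ≤ ((p.toNNReal * C * A.toNNReal : ℝ≥0):ℝ≥0∞) * eR e * J := by
  refine mul_le_mul' ?_ le_rfl
  rw [← eR_mul hs1, ← eR_mul hs2, ← eR_add (by positivity) (by positivity)]
  push_cast
  rw [show ((A.toNNReal:ℝ≥0):ℝ≥0∞) = eR A from rfl, show ((p.toNNReal:ℝ≥0):ℝ≥0∞) = eR p from rfl,
    mul_assoc, ← eR_mul hA, ← mul_assoc]
  exact mul_le_mul' le_rfl (eR_le h)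

lemma strong_hi (d : ℕ) (hd : 2 ≤ d) (p : ℝ) (hp : 2 < p) : ∃ δ > (0:ℝ), ∃ C : ℝ≥0, ∀ N ≥ (2:ℝ), ∀ r > (0:ℝ), r ≤ 1 → 2 ≤ N * r →
    ∀ g : EE d → ℂ, Integrable g → Measurable g →
    ∫⁻ x in ball 0 (3*r), Mx d N g x ^ p ≤ C * eR (r ^ ((d:ℝ)-1) * (N*r)^(-δ)) * ∫⁻ y, ‖g y‖ₑ ^ p := by
  obtain ⟨ε, hε, c0, hc0, C, hC⟩ := dist_hi d hd
  have hq : 0 < p - 2 := by linarith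
  refine ⟨min (ε/2) (ε/2*(p-2)), lt_min (by positivity) (by positivity), p.toNNReal * C * (c0^(-(p-2))/(p-2) + 1/(p-2)).toNNReal,
    fun N hN r hr hr1 hNr g hg hgm => ?_⟩
  obtain ⟨δ, hδ⟩ : ∃ δ, δ = min (ε/2) (ε/2*(p-2)) := ⟨_, rfl⟩
  rw [← hδ]
  have hN0 : 0 < N := by linarith
  have hR0 : 0 < N*r := by linarith
  have hγ : 0 < (N*r)^(ε/2) := by positivity
  have hpe : ((2:ℕ):ℝ) + (p-2) = p := by push_cast; ring
  have u1 := up_int g hgm 2 (by norm_num) (p-2) c0 hq hc0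
  have u2 := up_int g hgm 2 (by norm_num) (p-2) _ hq hγ
  rw [hpe] at u1 u2
  have hs1 : 0 ≤ r ^ ((d:ℝ)-1) * (N * r) ^ (-ε) * (N*r)^(ε/2) := by positivity
  have hs2 : 0 ≤ r ^ ((d:ℝ)-1) := by positivity
  refine (two_pieces g hgm (Mx d N g) (Mx_meas d (by omega) N hN0 g hg) (Mx_fin d (by omega) N hN0 g hg) _ measurableSet_ball p (by linarith) C _ _ 2 2
    _ _ (p-2) (p-2) hs1 hs2 (by push_cast; ring) (by push_cast; ring) _ _ _ u1 u2
    (fun t ht => hC N hN r hr hr1 hNr g hg hgm _ hγ t ht)).trans ?_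
  refine comb p C _ _ _ _ _ _ _ hs1 hs2 (by positivity) (by positivity) (by positivity) ?_
  have hd1 : (N*r)^(-ε) * (N*r)^(ε/2) ≤ (N*r)^(-δ) := by
    rw [← Real.rpow_add hR0]
    refine Real.rpow_le_rpow_of_exponent_le (by linarith) ?_
    have : δ ≤ ε/2 := by rw [hδ]; exact min_le_left _ _
    linarith
  have hd2 : ((N*r)^(ε/2))^(-(p-2)) ≤ (N*r)^(-δ) := by
    rw [← Real.rpow_mul hR0.le]
    refine Real.rpow_le_rpow_of_exponent_le (by linarith) ?_
    have : δ ≤ ε/2*(p-2) := by rw [hδ]; exact min_le_right _ _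
    linarith
  calc r ^ ((d:ℝ)-1) * (N * r) ^ (-ε) * (N*r)^(ε/2) * (c0^(-(p-2))/(p-2)) + r ^ ((d:ℝ)-1) * (((N*r)^(ε/2))^(-(p-2))/(p-2))
      = r ^ ((d:ℝ)-1) * ((N * r) ^ (-ε) * (N*r)^(ε/2)) * (c0^(-(p-2))/(p-2)) + r ^ ((d:ℝ)-1) * (((N*r)^(ε/2))^(-(p-2))*(1/(p-2))) := by ring
    _ ≤ r ^ ((d:ℝ)-1) * (N*r)^(-δ) * (c0^(-(p-2))/(p-2)) + r ^ ((d:ℝ)-1) * ((N*r)^(-δ)*(1/(p-2))) := by gcongr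
    _ = _ := by ring

lemma strong_lo (d : ℕ) (hd : 2 ≤ d) (p : ℝ) (hp1 : (d:ℝ)/((d:ℝ)-1) < p) (hp : p < 2) : ∃ δ > (0:ℝ), ∃ C : ℝ≥0, ∀ N ≥ (2:ℝ), ∀ r > (0:ℝ), r ≤ 1 → 2 ≤ N * r →
    ∀ g : EE d → ℂ, Integrable g → Measurable g →
    ∫⁻ x in ball 0 (3*r), Mx d N g x ^ p ≤ C * eR (r ^ ((d:ℝ)-1) * (N*r)^(-δ)) * ∫⁻ y, ‖g y‖ₑ ^ p := by
  obtain ⟨C, hC⟩ := dist_lo d hd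
  have hdR : (2:ℝ) ≤ d := by exact_mod_cast hd
  rw [div_lt_iff₀ (by linarith)] at hp1
  have hp2 : 1 < p := by nlinarith
  have hq1 : 0 < 2 - p := by linarith
  have hq2 : 0 < p - 1 := by linarith
  refine ⟨p*((d:ℝ)-1)-d, by linarith, p.toNNReal * C * (1/(2-p) + 1/(p-1)).toNNReal,
    fun N hN r hr hr1 hNr g hg hgm => ?_⟩
  have hN0 : 0 < N := by linarith
  have hR0 : 0 < N*r := by linarith
  have hγ : 0 < (N*r)^((d:ℝ)-1) := by positivity
  have u1 := lo_int g hgm (p-2) _ (by linarith) hγ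
  have u2 := up_int g hgm 1 (by norm_num) (p-1) _ hq2 hγ
  rw [show (2:ℝ)+(p-2) = p by ring, neg_sub] at u1
  rw [show ((1:ℕ):ℝ)+(p-1) = p by push_cast; ring, neg_sub] at u2
  have hs1 : 0 ≤ r ^ ((d:ℝ)-1) * (N * r) ^ (2-(d:ℝ)) := by positivity
  have hs2 : 0 ≤ r ^ ((d:ℝ)-1) * (N * r) := by positivity
  have key : ∀ t > (0:ℝ), _ := fun t ht => hC N hN r hr hNr g hg hgm _ hγ t ht
  refine (two_pieces g hgm (Mx d N g) (Mx_meas d (by omega) N hN0 g hg) (Mx_fin d (by omega) N hN0 g hg) _ measurableSet_ball p (by linarith) C _ _ 2 1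
    _ _ (p-2) (p-1) hs1 hs2 (by push_cast; ring) (by push_cast; ring) _ _ _ u1 u2
    (fun t ht => (key t ht).trans (le_of_eq (by simp only [pow_one])))).trans ?_
  refine comb p C _ _ _ _ _ _ _ hs1 hs2 (by positivity) (by positivity) (by positivity) ?_
  have e1 : (N*r)^(2-(d:ℝ)) * ((N*r)^((d:ℝ)-1))^(2-p) = (N*r)^(-(p*((d:ℝ)-1)-d)) := by
    rw [← Real.rpow_mul hR0.le, ← Real.rpow_add hR0]; ring_nf
  have e2 : (N*r) * ((N*r)^((d:ℝ)-1))^(1-p) = (N*r)^(-(p*((d:ℝ)-1)-d)) := by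
    nth_rw 1 [← Real.rpow_one (N*r)]
    rw [← Real.rpow_mul hR0.le, ← Real.rpow_add hR0]; ring_nf
  refine le_of_eq ?_
  calc _ = r ^ ((d:ℝ)-1) * ((N*r)^(2-(d:ℝ)) * ((N*r)^((d:ℝ)-1))^(2-p)) * (1/(2-p)) + r ^ ((d:ℝ)-1) * ((N*r) * ((N*r)^((d:ℝ)-1))^(1-p)) * (1/(p-1)) := by ring
    _ = _ := by rw [e1, e2]; ring

lemma strong (d : ℕ) (hd : 2 ≤ d) (p : ℝ) (hp : (d:ℝ)/((d:ℝ)-1) < p) : ∃ δ > (0:ℝ), ∃ C : ℝ≥0, ∀ N ≥ (2:ℝ), ∀ r > (0:ℝ), r ≤ 1 → 2 ≤ N * r →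
    ∀ g : EE d → ℂ, Integrable g → Measurable g →
    ∫⁻ x in ball 0 (3*r), Mx d N g x ^ p ≤ C * eR (r ^ ((d:ℝ)-1) * (N*r)^(-δ)) * ∫⁻ y, ‖g y‖ₑ ^ p := by
  rcases lt_trichotomy p 2 with h | h | h
  · exact strong_lo d hd p hp h
  · subst h
    obtain ⟨C, hC⟩ := Mx_L2 d (by omega)
    have hdR : (2:ℝ) ≤ d := by exact_mod_cast hd
    rw [div_lt_iff₀ (by linarith)] at hp
    refine ⟨(d:ℝ)-2, by linarith, C, fun N hN r hr hr1 hNr g hg hgm => ?_⟩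
    have h1 := hC N hN r hr (by linarith) g hg
    have e : r * N * N ^ (1 - (d:ℝ)) = r ^ ((d:ℝ)-1) * (N*r)^(-((d:ℝ)-2)) := by
      have hN0 : 0 < N := by linarith
      rw [Real.mul_rpow hN0.le hr.le]
      have a1 : r = r ^ ((d:ℝ)-1) * r ^ (-((d:ℝ)-2)) := by
        rw [← Real.rpow_add hr]; ring_nf; simp
      have a2 : N * N ^ (1-(d:ℝ)) = N ^ (-((d:ℝ)-2)) := by
        nth_rw 1 [← Real.rpow_one N]
        rw [← Real.rpow_add hN0]; ring_nf
      rw [mul_assoc, a2]; nth_rw 1 [a1]; ring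
    rw [e] at h1
    simpa only [ENNReal.rpow_two] using h1
  · exact strong_hi d hd p h

lemma fourier_undef {d : ℕ} (f : EE d → ℂ) (hf : ¬ Integrable f) : 𝓕 f = fun _ => 0 := by
  funext ξ
  rw [Real.fourier_eq]
  exact integral_undef fun h => hf ((Real.fourierIntegral_convergent_iff ξ).1 h)

lemma cut_smooth (d : ℕ) (χ : ℝ → ℝ) (hχsm : ContDiff ℝ (⊤ : ℕ∞) χ) (hχsupp : Function.support χ ⊆ Ioo (1 - 1/100 : ℝ) (2 + 1/100))
    (N : ℝ) (hN : 0 < N) : ContDiff ℝ (⊤ : ℕ∞) (fun ξ : EE d => ((χ (‖ξ‖/N) : ℝ) : ℂ)) := by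
  refine Complex.ofRealCLM.contDiff.comp ?_
  refine contDiff_iff_contDiffAt.2 fun ξ => ?_
  by_cases h : ξ = 0
  · have : (fun ξ : EE d => χ (‖ξ‖/N)) =ᶠ[nhds ξ] fun _ => 0 := by
      rw [h]
      filter_upwards [ball_mem_nhds (0:EE d) (show 0 < N/2 by positivity)] with z hz
      by_contra h'
      have h1 := (hχsupp (Function.mem_support.2 h')).1
      rw [mem_ball_zero_iff] at hz
      rw [lt_div_iff₀ hN] at h1
      linarith
    exact contDiffAt_const.congr_of_eventuallyEq this
  · exact hχsm.contDiffAt.comp ξ ((contDiffAt_norm ℝ h).div_const N)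

lemma cut_supp (d : ℕ) (χ : ℝ → ℝ) (hχsupp : Function.support χ ⊆ Ioo (1 - 1/100 : ℝ) (2 + 1/100))
    (N : ℝ) (hN : 0 < N) (ξ : EE d) (h : 3*N < ‖ξ‖) : ((χ (‖ξ‖/N) : ℝ) : ℂ) = 0 := by
  by_contra h'
  have h1 := (hχsupp (Function.mem_support.2 fun h0 => h' (by rw [h0]; simp))).2
  rw [div_lt_iff₀ hN] at h1
  linarith

/-- the frequency-localised function: integrable, continuous, and its maximal function is `Mx` -/
lemma proj_facts (d : ℕ) (hd : 1 ≤ d) (χ : ℝ → ℝ) (hχsm : ContDiff ℝ (⊤ : ℕ∞) χ)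
    (hχsupp : Function.support χ ⊆ Ioo (1 - 1/100 : ℝ) (2 + 1/100)) (j : ℤ) (f : EE d → ℂ) (hf : Integrable f) :
    Integrable (proj d χ j f) ∧ Measurable (proj d χ j f) ∧ ∀ x, sphMaxLoc d (proj d χ j f) x = Mx d (2^j) (proj d χ j f) x := by
  obtain ⟨N, hNe⟩ : ∃ N : ℝ, N = 2^j := ⟨_, rfl⟩
  have hN : 0 < N := by rw [hNe]; positivity
  obtain ⟨μ, hμ⟩ : ∃ μ : EE d → ℂ, μ = fun ξ => ((χ (‖ξ‖/N) : ℝ) : ℂ) := ⟨_, rfl⟩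
  obtain ⟨M, hM⟩ : ∃ M : EE d → ℂ, M = fun ξ => μ ξ * 𝓕 f ξ := ⟨_, rfl⟩
  have hg : proj d χ j f = Ker M := by rw [Ker_eq, hM, hμ, hNe]; rfl
  have hμs : ContDiff ℝ (⊤ : ℕ∞) μ := by rw [hμ]; exact cut_smooth d χ hχsm hχsupp N hN
  have hμz : ∀ ξ, 3*N < ‖ξ‖ → μ ξ = 0 := by rw [hμ]; exact cut_supp d χ hχsupp N hN
  have hμc : HasCompactSupport μ := by
    refine HasCompactSupport.intro (isCompact_closedBall (0 : EE d) (3*N)) fun x hx => ?_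
    rw [mem_closedBall_zero_iff, not_le] at hx
    exact hμz x hx
  have hμi : Integrable μ := integrable_of_supp μ hμs.continuous _ hμz
  have hMc : Continuous M := by
    rw [hM]; exact hμs.continuous.mul (fourier_cont f hf)
  have hMi : Integrable M := integrable_of_supp M hMc (3*N) fun ξ h => by rw [hM]; simp [hμz ξ h]
  have hgi : Integrable (Ker M) := by
    have h1 := hf.integrable_convolution (ContinuousLinearMap.mul ℝ ℂ) (Ker_integrable μ hμs hμc)
    refine h1.congr (of_forall fun x => ?_)
    have h2 : Ker M x = Tm μ f x := by unfold Ker Tm; rw [hM]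
    rw [h2, Tm_ker μ f hμi hf, convolution_def]
    congr 1; funext y; simp [mul_comm]
  have hgc : Continuous (Ker M) := Ker_cont M hMi
  have hFM : Integrable (𝓕 M) := by
    have : 𝓕 M = fun ξ => Ker M (-ξ) := by
      funext ξ; rw [fourier_ee]; unfold Ker; simp [inner_neg_right]
    rw [this]; exact hgi.comp_neg
  have hFg : 𝓕 (Ker M) = M := by rw [Ker_eq]; exact hMc.fourier_fourierInv_eq hMi hFM
  rw [hg, ← hNe]
  refine ⟨hgi, hgc.measurable, fun x => ?_⟩
  unfold sphMaxLoc Mx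
  congr 1; funext t; congr 1; funext ht
  show ‖sphAvg d (Ker M) t x‖ₑ = _
  congr 1
  have h1 := avg_fourier d hd M hMi (-t) x
  rw [sphAvg_eq]
  have h2 : ∫ y, Ker M (x - t • y) ∂(sig d) = ∫ y, Ker M (x + (-t) • y) ∂(sig d) := by
    congr 1; funext y; rw [neg_smul, sub_eq_add_neg]
  rw [h2, ← h1]
  unfold Tm
  congr 1; funext ξ
  rw [hFg, Phi_radial ((-t) • ξ) (t • ξ) (by rw [neg_smul, norm_neg])]
  unfold mavg
  by_cases h3 : M ξ = 0
  · rw [h3]; simp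
  · have h4 : χ (‖ξ‖/N) ≠ 0 := fun h => h3 (by rw [hM, hμ]; simp [h])
    have h5 := hχsupp (Function.mem_support.2 h4)
    have h6 : bN d N ξ = 1 := by
      unfold bN
      rw [norm_smul, norm_inv, Real.norm_of_nonneg hN.le, inv_mul_eq_div]
      obtain ⟨h7, h8⟩ := h5
      exact bb_one _ (by nlinarith) (by nlinarith)
    rw [h6]; push_cast; ring

lemma chi_bdd (χ : ℝ → ℝ) (hχsm : ContDiff ℝ (⊤ : ℕ∞) χ)
    (hχsupp : Function.support χ ⊆ Ioo (1 - 1/100 : ℝ) (2 + 1/100)) : ∃ B : ℝ≥0, ∀ s, (‖χ s‖₊ : ℝ≥0∞) ≤ B := by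
  have hc : HasCompactSupport χ := HasCompactSupport.intro (isCompact_Icc (a := (1-1/100:ℝ)) (b := 2+1/100)) fun x hx => by
    by_contra h; exact hx (Ioo_subset_Icc_self (hχsupp (Function.mem_support.2 h)))
  obtain ⟨B, hB⟩ := hχsm.continuous.bounded_above_of_compact_support hc
  refine ⟨B.toNNReal, fun s => ?_⟩
  rw [ENNReal.coe_le_coe, ← NNReal.coe_le_coe, coe_nnnorm]
  exact (hB s).trans (Real.le_coe_toNNReal B)

lemma main_aux (d : ℕ) (hd : 2 ≤ d) (p : ℝ) (hp : (d : ℝ) / ((d : ℝ) - 1) < p)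
    (χ : ℝ → ℝ) (hχsm : ContDiff ℝ (⊤ : ℕ∞) χ)
    (hχsupp : Function.support χ ⊆ Ioo (1 - 1/100 : ℝ) (2 + 1/100)) :
    ∃ δ : ℝ, 0 < δ ∧ ∃ C : ℝ≥0, 0 < C ∧
      ∀ j k : ℕ, k < j → ∀ f : EuclideanSpace ℝ (Fin d) → ℂ, Integrable f →
        (∫⁻ x, (‖χ ((2 : ℝ) ^ (k : ℤ) * ‖x‖)‖₊ : ℝ≥0∞) ^ p *
            sphMaxLoc d (proj d χ j f) x ^ p * wt d x) ^ (1/p) ≤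
          C * (2 : ℝ≥0∞) ^ (-(δ * ((j : ℝ) - (k : ℝ)))) *
            (∫⁻ x, (‖proj d χ j f x‖₊ : ℝ≥0∞) ^ p) ^ (1/p) := by
  have hdR : (2:ℝ) ≤ d := by exact_mod_cast hd
  have hp0 : 0 < p := lt_trans (by apply div_pos <;> linarith) hp
  obtain ⟨δ, hδ, C, hC⟩ := strong d hd p hp
  obtain ⟨B, hB⟩ := chi_bdd χ hχsm hχsupp
  obtain ⟨A, hA⟩ : ∃ A : ℝ≥0, A = ((99/100:ℝ)^(1-(d:ℝ))).toNNReal := ⟨_, rfl⟩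
  refine ⟨δ/p, by positivity, (B^p*A*C)^(1/p) + 1, by positivity, fun j k hjk f hf => ?_⟩
  obtain ⟨hgi, hgm, hmx⟩ := proj_facts d (by omega) χ hχsm hχsupp j f hf
  obtain ⟨g, hg⟩ : ∃ g, g = proj d χ j f := ⟨_, rfl⟩
  rw [← hg] at hgi hgm hmx ⊢
  simp only [hmx]
  have hN2 : (2:ℝ) ≤ 2^(j:ℤ) := by
    rw [zpow_natCast]; exact le_self_pow₀ (by norm_num) (by omega)
  obtain ⟨r, hr⟩ : ∃ r : ℝ, r = ((2:ℝ)^(k:ℤ))⁻¹ := ⟨_, rfl⟩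
  have hr0 : 0 < r := by rw [hr]; positivity
  have hr1 : r ≤ 1 := by
    rw [hr]; refine inv_le_one_of_one_le₀ ?_
    rw [zpow_natCast]; exact one_le_pow₀ (by norm_num)
  have hR : (2:ℝ)^(j:ℤ) * r = 2^((j:ℝ)-(k:ℝ)) := by
    rw [hr, Real.rpow_sub (by norm_num), Real.rpow_natCast, Real.rpow_natCast, zpow_natCast, zpow_natCast, div_eq_mul_inv]
  have hR2 : 2 ≤ (2:ℝ)^(j:ℤ) * r := by
    rw [hR]
    have : (1:ℝ) ≤ (j:ℝ)-(k:ℝ) := by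
      have : (k:ℝ)+1 ≤ j := by exact_mod_cast hjk
      linarith
    calc (2:ℝ) = 2^(1:ℝ) := by norm_num
      _ ≤ _ := Real.rpow_le_rpow_of_exponent_le (by norm_num) this
  have hk : (2:ℝ)^(k:ℤ) = r⁻¹ := by rw [hr, inv_inv]
  rw [hk]
  have h1 := hC _ hN2 r hr0 hr1 hR2 g hgi hgm
  have hpt : ∀ x, (‖χ (r⁻¹ * ‖x‖)‖₊ : ℝ≥0∞) ^ p * Mx d (2^(j:ℤ)) g x ^ p * wt d x ≤
      (B^p : ℝ≥0) * (A * eR (r^(1-(d:ℝ)))) * (ball 0 (3*r)).indicator (fun x => Mx d (2^(j:ℤ)) g x ^ p) x := by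
    intro x
    by_cases hx : χ (r⁻¹ * ‖x‖) = 0
    · rw [hx]; simp [hp0]
    obtain ⟨h2, h3⟩ := hχsupp (Function.mem_support.2 hx)
    rw [inv_mul_eq_div] at h2 h3
    rw [lt_div_iff₀ hr0] at h2
    rw [div_lt_iff₀ hr0] at h3
    rw [indicator_of_mem (show x ∈ ball (0:EE d) (3*r) by rw [mem_ball_zero_iff]; linarith)]
    have hw : wt d x ≤ A * eR (r^(1-(d:ℝ))) := by
      unfold wt
      rw [hA, show ((((99/100:ℝ)^(1-(d:ℝ))).toNNReal:ℝ≥0):ℝ≥0∞) = eR ((99/100:ℝ)^(1-(d:ℝ))) from rfl, ← eR_mul (by positivity),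
        ← Real.mul_rpow (by norm_num) hr0.le]
      refine eR_le ?_
      exact Real.rpow_le_rpow_of_nonpos (by positivity) (by linarith) (by linarith)
    have hb : (‖χ (r⁻¹ * ‖x‖)‖₊ : ℝ≥0∞) ^ p ≤ (B^p : ℝ≥0) := by
      rw [ENNReal.coe_rpow_of_nonneg _ hp0.le]
      exact ENNReal.rpow_le_rpow (hB _) hp0.le
    calc _ ≤ ((B^p : ℝ≥0):ℝ≥0∞) * Mx d (2^(j:ℤ)) g x ^ p * (A * eR (r^(1-(d:ℝ)))) := mul_le_mul' (mul_le_mul' hb le_rfl) hw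
      _ = _ := by ring
  have h2 : ∫⁻ x, (‖χ (r⁻¹ * ‖x‖)‖₊ : ℝ≥0∞) ^ p * Mx d (2^(j:ℤ)) g x ^ p * wt d x ≤
      ((B^p*A*C : ℝ≥0):ℝ≥0∞) * eR ((2:ℝ)^(-(δ*((j:ℝ)-(k:ℝ))))) * ∫⁻ y, ‖g y‖ₑ ^ p := by
    refine (lintegral_mono hpt).trans ?_
    rw [lintegral_const_mul' _ _ (ENNReal.mul_ne_top ENNReal.coe_ne_top (ENNReal.mul_ne_top ENNReal.coe_ne_top eR_ne_top)),
      lintegral_indicator measurableSet_ball]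
    refine (mul_le_mul_right h1 _).trans (le_of_eq ?_)
    have e1 : (2:ℝ)^(-(δ*((j:ℝ)-(k:ℝ)))) = r^(1-(d:ℝ)) * (r^((d:ℝ)-1) * (2^(j:ℤ)*r)^(-δ)) := by
      rw [hR, ← Real.rpow_mul (by norm_num), ← mul_assoc, ← Real.rpow_add hr0]
      ring_nf; simp
    rw [e1, eR_mul (p := r^(1-(d:ℝ))) (by positivity)]
    push_cast
    ring
  refine (ENNReal.rpow_le_rpow h2 (by positivity : 0 ≤ 1/p)).trans ?_
  rw [ENNReal.mul_rpow_of_nonneg _ _ (by positivity), ENNReal.mul_rpow_of_nonneg _ _ (by positivity)]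
  refine mul_le_mul' (mul_le_mul' ?_ (le_of_eq ?_)) le_rfl
  · rw [← ENNReal.coe_rpow_of_nonneg _ (by positivity)]
    exact_mod_cast le_self_add
  · rw [← ENNReal.ofReal_rpow_of_pos (by norm_num), ← ENNReal.rpow_mul, show eR 2 = 2 by norm_num]
    congr 1; field_simp

end

/-- estimate `(j>k piece without local)`, case `j > k`. -/
theorem mj_annulus_jk' (d : ℕ) (hd : 2 ≤ d) (p : ℝ) (hp : (d : ℝ) / ((d : ℝ) - 1) < p)
    (χ : ℝ → ℝ) (hχsm : ContDiff ℝ (⊤ : ℕ∞) χ)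
    (hχsupp : Function.support χ ⊆ Ioo (1 - 1/100 : ℝ) (2 + 1/100))
    (hχsum : ∀ s : ℝ, 0 < s → HasSum (fun j : ℤ => χ (s / 2 ^ j)) 1) :
    ∃ δ : ℝ, 0 < δ ∧ ∃ C : ℝ≥0, 0 < C ∧
      ∀ j k : ℕ, k < j → ∀ f : EuclideanSpace ℝ (Fin d) → ℂ,
        (∫⁻ x, (‖χ ((2 : ℝ) ^ (k : ℤ) * ‖x‖)‖₊ : ℝ≥0∞) ^ p *
            sphMaxLoc d (proj d χ j f) x ^ p * wt d x) ^ (1/p) ≤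
          C * (2 : ℝ≥0∞) ^ (-(δ * ((j : ℝ) - (k : ℝ)))) *
            (∫⁻ x, (‖proj d χ j f x‖₊ : ℝ≥0∞) ^ p) ^ (1/p) := by
  obtain ⟨δ, hδ, C, hC0, hC⟩ := main_aux d hd p hp χ hχsm hχsupp
  refine ⟨δ, hδ, C, hC0, fun j k hjk f => ?_⟩
  by_cases hf : Integrable f
  · exact hC j k hjk f hf
  · have h0 : proj d χ j f = proj d χ j (fun _ => 0) := by
      unfold proj
      rw [fourier_undef f hf]
      congr 1; funext ξ
      rw [fourier_ee]; simp
    rw [h0]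
    exact hC j k hjk _ (integrable_zero _ _ _)

end
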